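/- There exists δ > 0 such that for every sequence (ε_k)_{k≥0} of real numbers with ε_0 = 0, ε_k ∈ (−1/2, 1/2) for all k, and sup_{k≥0} |ε_k|·(1+k)^{5/4} < δ, there exist sequences of continuous functions (θ_j)_{j≥0} and (η_j)_{j≥0} from ℝ to ℝ and constants C, C' > 0 such that |θ_j(x)| + |η_j(x)| + |θ̂_j(x)| + |η̂_j(x)| ≤ C'·(1+j)^C·(1+|x|)^{−10} for all j ≥ 0 and x ∈ ℝ, and such that for every even, real-valued Schwartz function f : ℝ → ℝ and every x ∈ ℝ, f(x) = ∑_{j≥0} ( f(√(j+ε_j))·θ_j(x) + f̂(√(j+ε_j))·η_j(x) ), the series converging absolutely. -/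

import Mathlib

open MeasureTheory FourierTransform Real

namespace PerturbedInterpolation

open Complex (I)
open scoped UpperHalfPlane BoundedContinuousFunction

/-! ### The eighth power of the eta function -/

/-- The product `∏ (1 - q ^ n) ^ 8`, which is `e ^ (-2πiτ/3) η(τ) ^ 8`. -/
noncomputable def etaProd (τ : ℂ) : ℂ := (∏' n, (1 - ModularForm.eta_q n τ)) ^ 8

/-- The absolute value of `η ^ 8`. -/
noncomputable def etaAbs (τ : ℂ) : ℝ := ‖ModularForm.eta τ‖ ^ 8

lemma etaAbs_eq (τ : ℂ) : etaAbs τ = rexp (-(2 * π / 3) * τ.im) * ‖etaProd τ‖ := by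
  unfold etaAbs etaProd ModularForm.eta
  rw [norm_mul, mul_pow, norm_pow, Function.Periodic.norm_qParam, ← Real.exp_nat_mul]
  congr 2
  push_cast
  ring

lemma etaAbs_pos {τ : ℂ} (hτ : 0 < τ.im) : 0 < etaAbs τ :=
  pow_pos (norm_pos_iff.mpr (ModularForm.eta_ne_zero hτ)) 8

lemma etaProd_ne_zero {τ : ℂ} (hτ : 0 < τ.im) : etaProd τ ≠ 0 :=
  pow_ne_zero _ (ModularForm.eta_tprod_ne_zero hτ)

lemma etaProd_differentiableAt {τ : ℂ} (hτ : 0 < τ.im) : DifferentiableAt ℂ etaProd τ :=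
  (ModularForm.differentiableAt_eta_tprod hτ).pow 8

lemma etaProd_add_one (τ : ℂ) : etaProd (τ + 1) = etaProd τ := by
  unfold etaProd ModularForm.eta_q
  congr 2
  funext n
  simp [Function.Periodic.qParam, mul_add, Complex.exp_add]

/-- The fractional linear action of an integer matrix. -/
noncomputable def moeb (a b c d : ℤ) (τ : ℂ) : ℂ := (a * τ + b) / (c * τ + d)

lemma denom_ne_zero {c d : ℤ} (h : c ≠ 0 ∨ d ≠ 0) {τ : ℂ} (hτ : 0 < τ.im) :
    (c * τ + d : ℂ) ≠ 0 := by
  intro h0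
  have him := congrArg Complex.im h0
  have hre := congrArg Complex.re h0
  simp at him hre
  have hc : c = 0 := by
    rcases him with h | h
    · exact h
    · exact absurd h hτ.ne'
  subst hc
  simp at hre
  simp_all

lemma moeb_im {a b c d : ℤ} (h : a * d - b * c = 1) (τ : ℂ) :
    (moeb a b c d τ).im = τ.im / ‖(c * τ + d : ℂ)‖ ^ 2 := by
  unfold moeb
  rw [Complex.div_im, ← Complex.normSq_eq_norm_sq]
  simp
  rw [← sub_div]
  congr 1
  have h' : (a : ℝ) * d - b * c = 1 := by exact_mod_cast h
  linear_combination τ.im * h'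

lemma moeb_im_pos {a b c d : ℤ} (h : a * d - b * c = 1) {τ : ℂ} (hτ : 0 < τ.im) :
    0 < (moeb a b c d τ).im := by
  rw [moeb_im h]
  have : (c * τ + d : ℂ) ≠ 0 := denom_ne_zero (by
    by_contra! hh
    simp [hh.1, hh.2] at h) hτ
  positivity

lemma etaAbs_moeb {a b c d : ℤ} (h : a * d - b * c = 1) {τ : ℂ} (hτ : 0 < τ.im) :
    etaAbs (moeb a b c d τ) = ‖(c * τ + d : ℂ)‖ ^ 4 * etaAbs τ := by
  let γ : Matrix.SpecialLinearGroup (Fin 2) ℤ := ⟨!![a, b; c, d], by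
    rw [Matrix.det_fin_two_of]; exact h⟩
  have hγ := congrFun (SlashInvariantForm.slash_action_generators_SL2Z
    ModularForm.discriminant_S_invariant ModularForm.discriminant_T_invariant γ) ⟨τ, hτ⟩
  rw [ModularForm.SL_slash_apply] at hγ
  have hd : UpperHalfPlane.denom (Matrix.SpecialLinearGroup.toGL
      ((Matrix.SpecialLinearGroup.map (Int.castRingHom ℝ)) γ)) τ = c * τ + d := by
    change ((c : ℝ) : ℂ) * τ + ((d : ℝ) : ℂ) = _
    simp
  have hm : ((γ • (⟨τ, hτ⟩ : ℍ) : ℍ) : ℂ) = moeb a b c d τ := by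
    rw [UpperHalfPlane.coe_specialLinearGroup_apply]
    simp [γ, moeb]
  have hne : (c * τ + d : ℂ) ≠ 0 := denom_ne_zero (by
    by_contra! hh
    simp [hh.1, hh.2] at h) hτ
  simp only [ModularForm.discriminant] at hγ
  rw [hm] at hγ
  change _ * UpperHalfPlane.denom _ τ ^ (-12 : ℤ) = ModularForm.eta τ ^ 24 at hγ
  rw [hd] at hγ
  have h2 : ModularForm.eta (moeb a b c d τ) ^ 24 = (c * τ + d : ℂ) ^ 12 * ModularForm.eta τ ^ 24 := by
    rw [← hγ, zpow_neg]
    field_simp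
  have h3 := congrArg norm h2
  simp only [norm_mul, norm_pow] at h3
  have h4 : (‖ModularForm.eta (moeb a b c d τ)‖ ^ 8) ^ 3 =
      (‖(c * τ + d : ℂ)‖ ^ 4 * ‖ModularForm.eta τ‖ ^ 8) ^ 3 := by
    ring_nf
    linarith
  unfold etaAbs
  refine (pow_left_inj₀ ?_ ?_ three_ne_zero).mp h4 <;> positivity

lemma exists_etaProd_bounds {y₀ : ℝ} (hy₀ : 0 < y₀) :
    ∃ c C : ℝ, 0 < c ∧ 0 < C ∧ ∀ τ : ℂ, y₀ ≤ τ.im → c ≤ ‖etaProd τ‖ ∧ ‖etaProd τ‖ ≤ C := by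
  set r : ℝ := rexp (-2 * π * y₀) with hr
  have hr1 : r < 1 := by rw [hr, Real.exp_lt_one_iff]; nlinarith [Real.pi_pos]
  set g : ℂ → ℝ := fun q => ‖(∏' n : ℕ, (1 - q ^ (n + 1))) ^ 8‖ with hg
  have hsub : Metric.closedBall (0 : ℂ) r ⊆ Metric.ball 0 1 := Metric.closedBall_subset_ball hr1
  have hcont : ContinuousOn g (Metric.closedBall 0 r) :=
    ((ModularForm.differentiableOn_tprod_one_sub_pow.continuousOn.mono hsub).pow 8).norm
  have hK : IsCompact (Metric.closedBall (0 : ℂ) r) := isCompact_closedBall 0 r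
  have hne : (Metric.closedBall (0 : ℂ) r).Nonempty :=
    ⟨0, Metric.mem_closedBall_self (Real.exp_pos _).le⟩
  obtain ⟨q₁, hq₁, hmin⟩ := hK.exists_isMinOn hne hcont
  obtain ⟨q₂, hq₂, hmax⟩ := hK.exists_isMaxOn hne hcont
  have hpos : 0 < g q₁ := by
    refine norm_pos_iff.mpr (pow_ne_zero _ ?_)
    have hq : ‖q₁‖ < 1 := by simpa using hsub hq₁
    refine tprod_one_add_ne_zero_of_summable (f := fun n : ℕ ↦ -q₁ ^ (n + 1)) ?_ ?_
    · intro i h0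
      have h1 : q₁ ^ (i + 1) = 1 := by linear_combination -h0
      have h2 : ‖q₁‖ ^ (i + 1) = 1 := by rw [← norm_pow, h1, norm_one]
      exact (pow_lt_one₀ (norm_nonneg _) hq (Nat.succ_ne_zero i)).ne h2
    · have := (summable_nat_add_iff 1).mpr (summable_geometric_of_lt_one (norm_nonneg q₁) hq)
      simpa using this
  refine ⟨g q₁, g q₂ + 1, hpos, by positivity, fun τ hτ => ?_⟩
  have hmem : Function.Periodic.qParam 1 τ ∈ Metric.closedBall (0 : ℂ) r := by
    rw [mem_closedBall_zero_iff, Function.Periodic.norm_qParam, hr]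
    refine Real.exp_le_exp.mpr ?_
    nlinarith [Real.pi_pos]
  exact ⟨hmin hmem, (hmax hmem).trans (by simp)⟩

/-! ### Reduction to the fundamental domain of the theta group -/

lemma neg_inv_add_im (τ : ℂ) (k : ℤ) : (-1 / τ + 2 * k).im = τ.im / ‖τ‖ ^ 2 := by
  rw [← Complex.normSq_eq_norm_sq]
  simp [neg_div]

lemma neg_inv_add_re (τ : ℂ) (k : ℤ) : (-1 / τ + 2 * k).re = -τ.re / ‖τ‖ ^ 2 + 2 * k := by
  rw [← Complex.normSq_eq_norm_sq]
  simp [neg_div]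

lemma norm_sq_eq_re_im (τ : ℂ) : ‖τ‖ ^ 2 = τ.re ^ 2 + τ.im ^ 2 := by
  rw [← Complex.normSq_eq_norm_sq, Complex.normSq_apply]
  ring

/-- If the image of `τ` under a reduction step is still inside the unit disc, then either the
translation was by `±2` and `τ` is close to `±1`, or `τ` is close to the origin. -/
lemma reduction_cases {τ : ℂ} (hτ : 0 < τ.im) (h1 : ‖τ‖ < 1) {k : ℤ}
    (hk : |(-1 / τ + 2 * k).re| ≤ 1) (h2 : ‖-1 / τ + 2 * k‖ < 1) :
    (k = 1 ∧ 3 * ‖τ‖ ^ 2 + 1 < 4 * τ.re) ∨ (k = -1 ∧ 3 * ‖τ‖ ^ 2 + 1 < -(4 * τ.re)) ∨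
      ‖τ‖ ≤ 1 / 3 := by
  have hτ0 : 0 < ‖τ‖ := norm_pos_iff.mpr (by rintro rfl; simp at hτ)
  set N := ‖τ‖ ^ 2 with hN
  have hN0 : 0 < N := by positivity
  have hNle : N < 1 := by nlinarith
  have hre := neg_inv_add_re τ k
  have him := neg_inv_add_im τ k
  have hNe : N = τ.re ^ 2 + τ.im ^ 2 := norm_sq_eq_re_im τ
  have h2' : ‖-1 / τ + 2 * k‖ ^ 2 < 1 := by nlinarith [norm_nonneg (-1 / τ + 2 * (k : ℂ))]
  rw [norm_sq_eq_re_im, hre, him] at h2'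
  rw [hre] at hk
  rw [← hN] at h2' hk
  set x := τ.re
  set y := τ.im
  have e1 : (-x / N + 2 * k) ^ 2 + (y / N) ^ 2 = (1 - 4 * k * x + 4 * k ^ 2 * N) / N := by
    field_simp
    rw [hNe]; ring
  rw [e1, div_lt_one hN0] at h2'
  have hxN : x ^ 2 ≤ N := by nlinarith [sq_nonneg y]
  rcases lt_trichotomy k 0 with h | h | h
  · by_cases hk1 : k = -1
    · right; left
      subst hk1
      refine ⟨rfl, ?_⟩
      push_cast at h2'; linarith
    · right; right
      have hk2 : (k : ℝ) ≤ -2 := by exact_mod_cast (by omega : k ≤ -2)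
      have := (abs_le.mp hk).2
      have h3 : 3 ≤ -x / N := by have := (abs_le.mp hk).1; linarith
      rw [le_div_iff₀ hN0] at h3
      have : (3 * N) ^ 2 ≤ x ^ 2 := by nlinarith
      have h9 : 9 * N ≤ 1 := by nlinarith
      nlinarith
  · subst h
    simp at h2'
    linarith
  · by_cases hk1 : k = 1
    · left
      subst hk1
      refine ⟨rfl, ?_⟩
      push_cast at h2'; linarith
    · right; right
      have hk2 : (2 : ℝ) ≤ k := by exact_mod_cast (by omega : 2 ≤ k)
      have h3 : -x / N ≤ -3 := by have := (abs_le.mp hk).2; linarith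
      rw [div_le_iff₀ hN0] at h3
      have : (3 * N) ^ 2 ≤ x ^ 2 := by nlinarith
      have h9 : 9 * N ≤ 1 := by nlinarith
      nlinarith

lemma reduction_drop {τ : ℂ} (hτ : 0 < τ.im) (h1 : ‖τ‖ < 1) {k : ℤ}
    (hk : |(-1 / τ + 2 * k).re| ≤ 1) (h2 : ‖-1 / τ + 2 * k‖ < 1) :
    1 / (-1 / τ + 2 * k).im ^ 2 + 1 ≤ 1 / τ.im ^ 2 := by
  have hτ0 : 0 < ‖τ‖ := norm_pos_iff.mpr (by rintro rfl; simp at hτ)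
  have hNe := norm_sq_eq_re_im τ
  rw [neg_inv_add_im]
  have e1 : 1 / (τ.im / ‖τ‖ ^ 2) ^ 2 = (‖τ‖ ^ 2) ^ 2 / τ.im ^ 2 := by field_simp
  have hy2 : 0 < τ.im ^ 2 := by positivity
  rw [e1, div_add_one hy2.ne', div_le_div_iff_of_pos_right hy2]
  have hN1 : ‖τ‖ ^ 2 < 1 := by nlinarith
  rcases reduction_cases hτ h1 hk h2 with ⟨-, h⟩ | ⟨-, h⟩ | h
  · nlinarith [sq_nonneg (1 - τ.re)]
  · nlinarith [sq_nonneg (1 + τ.re)]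
  · have : ‖τ‖ ^ 2 ≤ 1 / 9 := by nlinarith
    nlinarith [sq_nonneg τ.re]

lemma exists_translate (x : ℝ) : ∃ k : ℤ, |x + 2 * k| ≤ 1 := by
  refine ⟨-round (x / 2), ?_⟩
  have := abs_sub_round (x / 2)
  rw [abs_le] at this ⊢
  push_cast
  constructor <;> linarith [this.1, this.2]

/-- Induction along the reduction of a point to the fundamental domain of the theta group. -/
theorem reduction_induction {P : ℂ → Prop}
    (base : ∀ τ : ℂ, |τ.re| ≤ 1 → 0 < τ.im → 1 ≤ ‖τ‖ → P τ)
    (step : ∀ (τ : ℂ) (k : ℤ), |τ.re| ≤ 1 → 0 < τ.im → ‖τ‖ < 1 → |(-1 / τ + 2 * k).re| ≤ 1 →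
      P (-1 / τ + 2 * k) → P τ) (τ : ℂ) (hre : |τ.re| ≤ 1) (him : 0 < τ.im) : P τ := by
  have key : ∀ n : ℕ, ∀ τ : ℂ, |τ.re| ≤ 1 → 0 < τ.im → 1 / τ.im ^ 2 ≤ n → P τ := by
    intro n
    induction n with
    | zero =>
      intro τ _ h2 h3
      have : 0 < 1 / τ.im ^ 2 := by positivity
      simp at h3
      nlinarith
    | succ n ih =>
      intro τ h1 h2 h3
      rcases le_or_gt 1 ‖τ‖ with h | h
      · exact base τ h1 h2 h
      · obtain ⟨k, hk⟩ := exists_translate (-τ.re / ‖τ‖ ^ 2)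
        rw [← neg_inv_add_re] at hk
        have hτ0 : 0 < ‖τ‖ := norm_pos_iff.mpr (by rintro rfl; simp at h2)
        have him' : 0 < (-1 / τ + 2 * k).im := by rw [neg_inv_add_im]; positivity
        refine step τ k h1 h2 h hk ?_
        rcases le_or_gt 1 ‖-1 / τ + 2 * k‖ with h' | h'
        · exact base _ hk him' h'
        · refine ih _ hk him' ?_
          have := reduction_drop h2 h hk h'
          push_cast at h3
          linarith
  obtain ⟨n, hn⟩ := exists_nat_ge (1 / τ.im ^ 2)
  exact key n τ hre him hn

/-! ### The theta function -/

lemma jacobiTheta_add_two_mul_int (τ : ℂ) (k : ℤ) : jacobiTheta (τ + 2 * k) = jacobiTheta τ := by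
  have h : Function.Periodic jacobiTheta 2 := fun z => by rw [add_comm, jacobiTheta_two_add]
  have := h.int_mul k τ
  rwa [mul_comm] at this

lemma jacobiTheta_neg_inv {τ : ℂ} (hτ : 0 < τ.im) :
    jacobiTheta (-1 / τ) = (-I * τ) ^ (1 / 2 : ℂ) * jacobiTheta τ := by
  have := jacobiTheta_S_smul ⟨τ, hτ⟩
  rw [UpperHalfPlane.modular_S_smul] at this
  have h2 : ((UpperHalfPlane.mk (-(⟨τ, hτ⟩ : UpperHalfPlane) : ℂ)⁻¹
      (⟨τ, hτ⟩ : UpperHalfPlane).im_inv_neg_coe_pos : UpperHalfPlane) : ℂ) = -1 / τ := by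
    change (-τ)⁻¹ = -1 / τ
    rw [inv_neg, neg_div, one_div]
  rw [h2] at this
  exact this

lemma norm_neg_I_mul_cpow (τ : ℂ) (r : ℝ) : ‖(-I * τ) ^ (r : ℂ)‖ = ‖τ‖ ^ r := by
  rw [Complex.norm_cpow_real]
  simp

lemma norm_jacobiTheta_neg_inv {τ : ℂ} (hτ : 0 < τ.im) :
    ‖jacobiTheta (-1 / τ)‖ = ‖τ‖ ^ (1 / 2 : ℝ) * ‖jacobiTheta τ‖ := by
  rw [jacobiTheta_neg_inv hτ, norm_mul]
  congr 1
  have := norm_neg_I_mul_cpow τ (1 / 2)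
  push_cast at this
  exact this

/-- The expansion of the theta function at the cusp `1`. -/
lemma norm_jacobiTheta_cusp {w : ℂ} (hw : 0 < w.im) :
    ‖jacobiTheta (1 - 1 / w)‖ =
      ‖w‖ ^ (1 / 2 : ℝ) * rexp (-(π / 4) * w.im) * ‖jacobiTheta₂ (w / 2) w‖ := by
  have hw0 : w ≠ 0 := by rintro rfl; simp at hw
  have h1 : jacobiTheta (1 - 1 / w) = jacobiTheta₂ (1 / 2) (-1 / w) := by
    rw [jacobiTheta_eq_jacobiTheta₂]
    refine tsum_congr fun n => ?_
    unfold jacobiTheta₂_term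
    have : (2 * π * I * n * 0 + π * I * n ^ 2 * (1 - 1 / w) : ℂ) =
        (2 * π * I * n * (1 / 2) + π * I * n ^ 2 * (-1 / w)) +
          ((n * (n - 1) / 2 : ℤ) : ℂ) * (2 * π * I) := by
      have he : (2 : ℤ) ∣ n * (n - 1) := by
        rcases Int.even_or_odd n with h | h
        · exact (even_iff_two_dvd.mp h).mul_right _
        · exact (even_iff_two_dvd.mp (h.sub_odd odd_one)).mul_left _
      rw [Int.cast_div he (by norm_num)]
      push_cast
      field_simp
      ring
    rw [this, Complex.exp_add, Complex.exp_int_mul_two_pi_mul_I, mul_one]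
  rw [h1, jacobiTheta₂_functional_equation]
  have e1 : (1 / 2 : ℂ) / (-1 / w) = -(w / 2) := by field_simp
  have e2 : -1 / (-1 / w) = w := by field_simp
  have e3 : (-π * I * (1 / 2) ^ 2 / (-1 / w) : ℂ) = π / 4 * I * w := by field_simp; ring
  rw [e1, e2, e3, jacobiTheta₂_neg_left, norm_mul, norm_mul, norm_div, norm_one]
  have h4 := norm_neg_I_mul_cpow (-1 / w) (1 / 2)
  push_cast at h4
  rw [h4, Complex.norm_exp]
  congr 2
  · rw [norm_div, norm_neg, norm_one, Real.div_rpow zero_le_one (norm_nonneg _), Real.one_rpow,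
      one_div_one_div]
  · congr 1
    simp

lemma norm_jacobiTheta₂_half_sub_two_le {w : ℂ} (hw : 1 ≤ w.im) :
    ‖jacobiTheta₂ (w / 2) w - 2‖ ≤ 1 := by
  have hw0 : 0 < w.im := by linarith
  have hs := (hasSum_jacobiTheta₂_term (w / 2) hw0).nat_add_neg_add_one
  have hterm : ∀ n : ℕ, jacobiTheta₂_term n (w / 2) w + jacobiTheta₂_term (-(n + 1)) (w / 2) w =
      2 * Complex.exp (π * I * (n * (n + 1)) * w) := by
    intro n
    unfold jacobiTheta₂_term
    rw [two_mul]
    push_cast; ring_nf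
  simp_rw [hterm] at hs
  have h0 : (2 : ℂ) * Complex.exp (π * I * ((0 : ℕ) * ((0 : ℕ) + 1)) * w) = 2 := by simp
  have hs' := (hasSum_nat_add_iff' 1).mpr hs
  rw [Finset.sum_range_one, h0] at hs'
  set r : ℝ := rexp (-(2 * π)) with hr
  have hr6 : r ≤ 1 / 7 := by
    rw [hr, Real.exp_neg, ← one_div]
    refine one_div_le_one_div_of_le (by norm_num) ?_
    have := Real.add_one_le_exp (2 * π)
    linarith [Real.pi_gt_three]
  have hr0 : 0 < r := Real.exp_pos _
  have hgeo : HasSum (fun n : ℕ => 2 * r * r ^ n) (2 * r * (1 - r)⁻¹) :=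
    (hasSum_geometric_of_lt_one hr0.le (by linarith)).mul_left _
  have hbound : ∀ n : ℕ, ‖2 * Complex.exp (π * I * (((n + 1 : ℕ) : ℂ) * (((n + 1 : ℕ) : ℂ) + 1)) * w)‖
      ≤ 2 * r * r ^ n := by
    intro n
    rw [norm_mul, Complex.norm_exp]
    simp only [Complex.norm_ofNat]
    rw [mul_assoc 2 r]
    refine mul_le_mul_of_nonneg_left ?_ zero_le_two
    rw [← pow_succ', hr, ← Real.exp_nat_mul]
    refine Real.exp_le_exp.mpr ?_
    have : (π * I * (((n + 1 : ℕ) : ℂ) * (((n + 1 : ℕ) : ℂ) + 1)) * w).re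
        = -(π * ((n + 1) * (n + 2)) * w.im) := by
      have : (π * I * (((n + 1 : ℕ) : ℂ) * (((n + 1 : ℕ) : ℂ) + 1)) * w) =
        ((π * ((n + 1) * (n + 2)) : ℝ) : ℂ) * (I * w) := by push_cast; ring
      rw [this, Complex.re_ofReal_mul]
      simp
    rw [this]
    push_cast
    have h1 : (2 : ℝ) * ((n : ℝ) + 1) ≤ (n + 1) * (n + 2) := by nlinarith [n.cast_nonneg (α := ℝ)]
    have h2 : (n + 1 : ℝ) * (n + 2) ≤ (n + 1) * (n + 2) * w.im := by
      have : (0 : ℝ) ≤ (n + 1) * (n + 2) := by positivity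
      nlinarith
    nlinarith [Real.pi_pos]
  refine (hs'.norm_le_of_bounded hgeo hbound).trans ?_
  have : (1 - r)⁻¹ ≤ 7 / 6 := by
    rw [← one_div, div_le_div_iff₀ (by linarith) (by norm_num)]
    linarith
  nlinarith

lemma norm_jacobiTheta₂_half_bounds {w : ℂ} (hw : 1 ≤ w.im) :
    1 ≤ ‖jacobiTheta₂ (w / 2) w‖ ∧ ‖jacobiTheta₂ (w / 2) w‖ ≤ 3 := by
  have h := norm_jacobiTheta₂_half_sub_two_le hw
  have h1 := norm_sub_norm_le (2 : ℂ) (2 - jacobiTheta₂ (w / 2) w)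
  have h2 := norm_add_le (jacobiTheta₂ (w / 2) w - 2) 2
  rw [sub_sub_cancel, norm_sub_rev] at h1
  simp only [Complex.norm_ofNat, sub_add_cancel] at h1 h2
  constructor <;> linarith

lemma norm_jacobiTheta_cusp_le {w : ℂ} (hw : 1 ≤ w.im) :
    ‖jacobiTheta (1 - 1 / w)‖ ≤ 3 * ‖w‖ ^ (1 / 2 : ℝ) * rexp (-(π / 4) * w.im) := by
  rw [norm_jacobiTheta_cusp (by linarith)]
  have := (norm_jacobiTheta₂_half_bounds hw).2
  have h2 : 0 ≤ ‖w‖ ^ (1 / 2 : ℝ) * rexp (-(π / 4) * w.im) := by positivity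
  nlinarith

lemma le_norm_jacobiTheta_cusp {w : ℂ} (hw : 1 ≤ w.im) :
    ‖w‖ ^ (1 / 2 : ℝ) * rexp (-(π / 4) * w.im) ≤ ‖jacobiTheta (1 - 1 / w)‖ := by
  rw [norm_jacobiTheta_cusp (by linarith)]
  exact le_mul_of_one_le_right (by positivity) (norm_jacobiTheta₂_half_bounds hw).1

lemma norm_jacobiTheta_sub_one_le_of_half_le {τ : ℂ} (hτ : 1 / 2 ≤ τ.im) :
    ‖jacobiTheta τ - 1‖ ≤ 9 / 10 := by
  have h := norm_jacobiTheta_sub_one_le (τ := τ) (by linarith)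
  set r := rexp (-π * τ.im) with hr
  have hr1 : r ≤ 3 / 10 := by
    have h1 : r ≤ rexp (-(3 / 2)) := Real.exp_le_exp.mpr (by nlinarith [Real.pi_gt_three])
    have h2 : rexp (-(3 / 2)) ≤ 3 / 10 := by
      rw [Real.exp_neg, inv_le_comm₀ (Real.exp_pos _) (by norm_num)]
      have := Real.quadratic_le_exp_of_nonneg (x := 3 / 2) (by norm_num)
      linarith
    linarith
  have hr0 : 0 < r := Real.exp_pos _
  refine h.trans ?_
  rw [div_mul_eq_mul_div, div_le_iff₀ (by linarith)]
  linarith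

/-- A point of the fundamental domain of the theta group lies high up, or near a cusp `±1`. -/
lemma exists_cusp_coordinate {τ : ℂ} (hre : |τ.re| ≤ 1) (him : 0 < τ.im) (h1 : 1 ≤ ‖τ‖)
    (h2 : τ.im < 1 / 2) : ∃ (w : ℂ) (k : ℤ), |w.re| ≤ 1 / 2 ∧ 1 ≤ w.im ∧
      τ = 1 - 1 / w + 2 * k ∧ w.im ≤ 1 / τ.im := by
  have aux : ∀ σ : ℂ, 0 ≤ σ.re → |σ.re| ≤ 1 → 0 < σ.im → 1 ≤ ‖σ‖ → |σ.re - 2| ≥ 1 ∧ σ.im < 1 / 2 →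
      |(1 / (1 - σ)).re| ≤ 1 / 2 ∧ 1 ≤ (1 / (1 - σ)).im ∧ (1 / (1 - σ)).im ≤ 1 / σ.im := by
    intro σ h0 hre him h1 h2
    have hN := norm_sq_eq_re_im σ
    have hN1 : 1 ≤ ‖σ‖ ^ 2 := by nlinarith
    have hx := (abs_le.mp hre).2
    set D := Complex.normSq (1 - σ) with hD
    have hDe : D = (1 - σ.re) ^ 2 + σ.im ^ 2 := by
      rw [hD, Complex.normSq_apply]; simp; ring
    have hD0 : 0 < D := by rw [hDe]; positivity
    have hr : (1 / (1 - σ)).re = (1 - σ.re) / D := by simp [hD]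
    have hi : (1 / (1 - σ)).im = σ.im / D := by simp [hD]
    have hx1 : 1 - σ.re ≤ σ.im ^ 2 := by nlinarith
    rw [hr, hi]
    refine ⟨?_, ?_, ?_⟩
    · rw [abs_of_nonneg (div_nonneg (by linarith) hD0.le), div_le_iff₀ hD0, hDe]
      nlinarith
    · rw [le_div_iff₀ hD0, hDe]
      nlinarith [sq_nonneg (1 - σ.re), h2.2]
    · rw [div_le_div_iff₀ hD0 him, hDe]
      nlinarith [sq_nonneg (1 - σ.re)]
  have hrr := abs_le.mp hre
  rcases le_or_gt 0 τ.re with h | h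
  · have h3 := aux τ h hre him h1 ⟨by rw [abs_of_nonpos] <;> linarith, h2⟩
    have : (1 - τ) ≠ 0 := fun h0 => by
      have := congrArg Complex.im h0; simp at this; linarith
    exact ⟨1 / (1 - τ), 0, h3.1, h3.2.1, by field_simp; simp, h3.2.2⟩
  · have hN := norm_sq_eq_re_im τ
    have hN1 : 1 ≤ ‖τ‖ ^ 2 := by nlinarith
    have hDe : Complex.normSq (-1 - τ) = (1 + τ.re) ^ 2 + τ.im ^ 2 := by
      rw [Complex.normSq_apply]; simp; ring
    have hD0 : 0 < Complex.normSq (-1 - τ) := by rw [hDe]; positivity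
    have hr : (1 / (-1 - τ)).re = (-1 - τ.re) / Complex.normSq (-1 - τ) := by simp
    have hi : (1 / (-1 - τ)).im = τ.im / Complex.normSq (-1 - τ) := by simp
    have hx1 : 1 + τ.re ≤ τ.im ^ 2 := by nlinarith
    have : (-1 - τ) ≠ 0 := fun h0 => by
      have := congrArg Complex.im h0; simp at this; linarith
    refine ⟨1 / (-1 - τ), -1, ?_, ?_, by push_cast; field_simp; ring, ?_⟩
    · rw [hr, abs_of_nonpos (div_nonpos_of_nonpos_of_nonneg (by linarith) hD0.le), ← neg_div,
        div_le_iff₀ hD0, hDe]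
      nlinarith
    · rw [hi, le_div_iff₀ hD0, hDe]
      nlinarith [sq_nonneg (1 + τ.re)]
    · rw [hi, div_le_div_iff₀ hD0 him, hDe]
      nlinarith [sq_nonneg (1 + τ.re)]

theorem jacobiTheta_ne_zero {τ : ℂ} (hτ : 0 < τ.im) : jacobiTheta τ ≠ 0 := by
  have key : ∀ τ : ℂ, |τ.re| ≤ 1 → 0 < τ.im → jacobiTheta τ ≠ 0 := by
    refine reduction_induction (fun τ hre him h1 => ?_) (fun τ k _ him _ _ ih => ?_)
    · rcases le_or_gt (1 / 2) τ.im with h | h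
      · intro h0
        have := norm_jacobiTheta_sub_one_le_of_half_le h
        rw [h0] at this
        norm_num at this
      · obtain ⟨w, k, -, hw, rfl, -⟩ := exists_cusp_coordinate hre him h1 h
        rw [jacobiTheta_add_two_mul_int, ← norm_pos_iff]
        have hw0 : 0 < ‖w‖ := norm_pos_iff.mpr (by rintro rfl; simp at hw; linarith)
        exact lt_of_lt_of_le (by positivity) (le_norm_jacobiTheta_cusp hw)
    · rw [jacobiTheta_add_two_mul_int, jacobiTheta_neg_inv him] at ih
      exact right_ne_zero_of_mul ih
  obtain ⟨k, hk⟩ := exists_translate τ.re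
  have := key (τ + 2 * k) (by simpa using hk) (by simpa using hτ)
  rwa [jacobiTheta_add_two_mul_int] at this

/-! ### The residue theorem on a rectangle -/

lemma log_I_mul {v : ℂ} (h1 : 0 < v.re) (h2 : v.im < 0) :
    Complex.log (I * v) = Complex.log v + π / 2 * I := by
  have hv : v ≠ 0 := by rintro rfl; simp at h1
  have harg : Complex.arg v ≤ 0 := (Complex.arg_neg_iff.mpr h2).le
  have harg2 := Complex.neg_pi_lt_arg v
  rw [Complex.log_mul Complex.I_ne_zero hv, Complex.log_I, add_comm]
  rw [Complex.arg_I]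
  constructor <;> linarith [Real.pi_pos]

lemma integral_inv_segment {u v c : ℂ} (hc : c ≠ 0) {a b : ℝ}
    (h : ∀ t ∈ Set.uIcc a b, c * (u + t * v) ∈ Complex.slitPlane) :
    ∫ t in a..b, v * (u + t * v)⁻¹ =
      Complex.log (c * (u + b * v)) - Complex.log (c * (u + a * v)) := by
  have hd : ∀ t ∈ Set.uIcc a b, HasDerivAt (fun t : ℝ => Complex.log (c * (u + t * v)))
      (v * (u + t * v)⁻¹) t := by
    intro t ht
    have h1 : HasDerivAt (fun t : ℝ => c * (u + t * v)) (c * v) t := by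
      have := (((Complex.ofRealCLM.hasDerivAt (x := t)).mul_const v).const_add u).const_mul c
      simpa using this
    have h2 := h1.clog_real (h t ht)
    have h3 : u + t * v ≠ 0 := fun h0 => by
      have := Complex.slitPlane_ne_zero (h t ht)
      rw [h0, mul_zero] at this
      exact this rfl
    convert h2 using 1
    field_simp
  have hcont : ContinuousOn (fun t : ℝ => v * (u + t * v)⁻¹) (Set.uIcc a b) := by
    refine continuousOn_const.mul (ContinuousOn.inv₀ (by fun_prop) fun t ht h0 => ?_)
    have := Complex.slitPlane_ne_zero (h t ht)
    rw [h0, mul_zero] at this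
    exact this rfl
  exact intervalIntegral.integral_eq_sub_of_hasDerivAt hd hcont.intervalIntegrable

/-- The integral of `f` along the boundary of the rectangle `[a, b] × [c, d]`. -/
noncomputable def rectIntegral (f : ℂ → ℂ) (a b c d : ℝ) : ℂ :=
  (∫ x in a..b, f (x + c * I)) - (∫ x in a..b, f (x + d * I)) +
    (I * ∫ y in c..d, f (b + y * I)) - I * ∫ y in c..d, f (a + y * I)

lemma rectIntegral_inv {w : ℂ} {a b c d : ℝ} (ha : a < w.re) (hb : w.re < b) (hc : c < w.im)
    (hd : w.im < d) : rectIntegral (fun s => (s - w)⁻¹) a b c d = 2 * π * I := by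
  have e1 : ∫ x in a..b, ((x + c * I : ℂ) - w)⁻¹ =
      Complex.log (I * (b + c * I - w)) - Complex.log (I * (a + c * I - w)) := by
    have := integral_inv_segment (u := c * I - w) (v := 1) (c := I) Complex.I_ne_zero
      (a := a) (b := b) (fun t _ => by left; simp; linarith)
    simp only [mul_one, one_mul] at this
    convert this using 3 <;> ring_nf
  have e2 : ∫ x in a..b, ((x + d * I : ℂ) - w)⁻¹ =
      Complex.log (-I * (b + d * I - w)) - Complex.log (-I * (a + d * I - w)) := by
    have := integral_inv_segment (u := d * I - w) (v := 1) (c := -I) (by simp)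
      (a := a) (b := b) (fun t _ => by left; simp; linarith)
    simp only [mul_one, one_mul] at this
    convert this using 3 <;> ring_nf
  have e3 : I * ∫ y in c..d, ((b + y * I : ℂ) - w)⁻¹ =
      Complex.log (1 * (b + d * I - w)) - Complex.log (1 * (b + c * I - w)) := by
    have := integral_inv_segment (u := b - w) (v := I) (c := 1) one_ne_zero
      (a := c) (b := d) (fun t _ => by left; simp; linarith)
    simp_rw [intervalIntegral.integral_const_mul, sub_add_eq_add_sub] at this
    exact this
  have e4 : I * ∫ y in c..d, ((a + y * I : ℂ) - w)⁻¹ =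
      Complex.log (-1 * (a + d * I - w)) - Complex.log (-1 * (a + c * I - w)) := by
    have := integral_inv_segment (u := a - w) (v := I) (c := -1) (by simp)
      (a := c) (b := d) (fun t _ => by left; simp; linarith)
    simp_rw [intervalIntegral.integral_const_mul, sub_add_eq_add_sub] at this
    exact this
  have l1 := log_I_mul (v := b + c * I - w) (by simp; linarith) (by simp; linarith)
  have l2 := log_I_mul (v := -I * (b + d * I - w)) (by simp; linarith) (by simp; linarith)
  have l3 := log_I_mul (v := -1 * (a + d * I - w)) (by simp; linarith) (by simp; linarith)
  have l4 := log_I_mul (v := I * (a + c * I - w)) (by simp; linarith) (by simp; linarith)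
  have m2 : I * (-I * (b + d * I - w)) = 1 * (b + d * I - w) := by
    rw [← mul_assoc]; simp
  have m3 : I * (-1 * (a + d * I - w)) = -I * (a + d * I - w) := by ring
  have m4 : I * (I * (a + c * I - w)) = -1 * (a + c * I - w) := by
    rw [← mul_assoc, Complex.I_mul_I]
  rw [m2] at l2
  rw [m3] at l3
  rw [m4] at l4
  rw [rectIntegral, e1, e2, e3, e4, l1, l2, l3, l4, one_mul]
  ring

lemma rectIntegral_eq_zero {f : ℂ → ℂ} {a b c d : ℝ} (hab : a ≤ b) (hcd : c ≤ d)
    (hf : DifferentiableOn ℂ f (Set.Icc a b ×ℂ Set.Icc c d)) : rectIntegral f a b c d = 0 := by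
  have := Complex.integral_boundary_rect_eq_zero_of_differentiableOn f (a + c * I) (b + d * I)
    (by simpa [Set.uIcc_of_le hab, Set.uIcc_of_le hcd] using hf)
  simpa [rectIntegral] using this

/-- Cauchy's formula on a rectangle. -/
theorem rectIntegral_cauchy {f : ℂ → ℂ} {U : Set ℂ} (hU : IsOpen U) (hf : DifferentiableOn ℂ f U)
    {a b c d : ℝ} (hsub : Set.Icc a b ×ℂ Set.Icc c d ⊆ U) {w : ℂ} (ha : a < w.re) (hb : w.re < b)
    (hc : c < w.im) (hd : w.im < d) :
    rectIntegral (fun s => f s / (s - w)) a b c d = 2 * π * I * f w := by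
  have hab : a ≤ b := by linarith
  have hcd : c ≤ d := by linarith
  have hw : w ∈ U := hsub ⟨⟨ha.le, hb.le⟩, hc.le, hd.le⟩
  have h0 : rectIntegral (dslope f w) a b c d = 0 := rectIntegral_eq_zero hab hcd
    (((Complex.differentiableOn_dslope (hU.mem_nhds hw)).mpr hf).mono hsub)
  have hfc : ContinuousOn f U := hf.continuousOn
  have hds : ∀ s, s ≠ w → dslope f w s = f s / (s - w) - f w * (s - w)⁻¹ := by
    intro s hs
    have : s - w ≠ 0 := sub_ne_zero.mpr hs
    rw [dslope_of_ne _ hs, slope_def_field]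
    field_simp
  have hI : ∀ (p q : ℝ) (g : ℝ → ℂ), p ≤ q → Continuous g → (∀ t ∈ Set.Icc p q, g t ∈ U ∧ g t ≠ w) →
      ∫ t in p..q, dslope f w (g t) =
        (∫ t in p..q, f (g t) / (g t - w)) - f w * ∫ t in p..q, (g t - w)⁻¹ := by
    intro p q g hpq hg h
    rw [← Set.uIcc_of_le hpq] at h
    have i1 : ContinuousOn (fun t => (g t - w)⁻¹) (Set.uIcc p q) :=
      ContinuousOn.inv₀ (by fun_prop) fun t ht => sub_ne_zero.mpr (h t ht).2
    have i2 : ContinuousOn (fun t => f (g t) / (g t - w)) (Set.uIcc p q) := by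
      simp_rw [div_eq_mul_inv]
      exact (hfc.comp hg.continuousOn fun t ht => (h t ht).1).mul i1
    rw [← intervalIntegral.integral_const_mul, ← intervalIntegral.integral_sub
      i2.intervalIntegrable (i1.intervalIntegrable.const_mul _)]
    exact intervalIntegral.integral_congr fun t ht => hds _ (h t ht).2
  have hinv := rectIntegral_inv ha hb hc hd
  rw [rectIntegral] at h0 hinv ⊢
  rw [hI a b (fun x => x + c * I) hab (by fun_prop) fun t ht => ⟨hsub ⟨by simpa using ht, by simpa using hcd⟩, fun h => by simp [← h] at hc⟩,
    hI a b (fun x => x + d * I) hab (by fun_prop) fun t ht => ⟨hsub ⟨by simpa using ht, by simpa using hcd⟩, fun h => by simp [← h] at hd⟩,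
    hI c d (fun y => b + y * I) hcd (by fun_prop) fun t ht => ⟨hsub ⟨by simpa using hab, by simpa using ht⟩, fun h => by simp [← h] at hb⟩,
    hI c d (fun y => a + y * I) hcd (by fun_prop) fun t ht => ⟨hsub ⟨by simpa using hab, by simpa using ht⟩, fun h => by simp [← h] at ha⟩] at h0
  linear_combination h0 + f w * hinv

lemma rectIntegral_congr {f g : ℂ → ℂ} {w : ℂ} (h : ∀ s, s ≠ w → f s = g s) {a b c d : ℝ}
    (ha : a < w.re) (hb : w.re < b) (hc : c < w.im) (hd : w.im < d) :
    rectIntegral f a b c d = rectIntegral g a b c d := by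
  rw [rectIntegral, rectIntegral]
  congr 1
  · congr 1
    · congr 1
      · exact intervalIntegral.integral_congr fun t _ => h _ fun h => by simp [← h] at hc
      · exact intervalIntegral.integral_congr fun t _ => h _ fun h => by simp [← h] at hd
    · congr 1
      exact intervalIntegral.integral_congr fun t _ => h _ fun h => by simp [← h] at hb
  · congr 1
    exact intervalIntegral.integral_congr fun t _ => h _ fun h => by simp [← h] at ha

/-- The residue theorem on a rectangle, for a quotient with a single simple pole. -/
theorem rectIntegral_div {f g : ℂ → ℂ} {U : Set ℂ} (hU : IsOpen U) (hf : DifferentiableOn ℂ f U)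
    (hg : DifferentiableOn ℂ g U) {a b c d : ℝ} (hsub : Set.Icc a b ×ℂ Set.Icc c d ⊆ U) {w : ℂ}
    (ha : a < w.re) (hb : w.re < b) (hc : c < w.im) (hd : w.im < d) (hgw : g w = 0)
    (hg' : deriv g w ≠ 0) (hne : ∀ s ∈ U, s ≠ w → g s ≠ 0) :
    rectIntegral (fun s => f s / g s) a b c d = 2 * π * I * (f w / deriv g w) := by
  have hw : w ∈ U := hsub ⟨⟨ha.le, hb.le⟩, hc.le, hd.le⟩
  have hG := (Complex.differentiableOn_dslope (hU.mem_nhds hw)).mpr hg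
  have hGs : ∀ s, s ≠ w → dslope g w s = g s / (s - w) := fun s hs => by
    rw [dslope_of_ne _ hs, slope_def_field, hgw, sub_zero]
  have hG0 : ∀ s ∈ U, dslope g w s ≠ 0 := by
    intro s hs
    by_cases h : s = w
    · rwa [h, dslope_same]
    · rw [hGs s h]
      exact div_ne_zero (hne s hs h) (sub_ne_zero.mpr h)
  rw [← dslope_same, ← rectIntegral_cauchy (f := fun s => f s / dslope g w s) hU (hf.div hG hG0)
    hsub ha hb hc hd]
  refine rectIntegral_congr (fun s hs => ?_) ha hb hc hd
  rw [hGs s hs]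
  have : s - w ≠ 0 := sub_ne_zero.mpr hs
  field_simp

/-! ### Growth at a cusp of solutions of a difference equation -/

/-- A kernel with a simple pole at the origin, multiplied by `exp (2πip)` under translation. -/
noncomputable def cuspKernel (p : ℝ) (ξ : ℂ) : ℂ :=
  Complex.exp (2 * π * I * p * ξ) / (1 - Complex.exp (2 * π * I * ξ))

lemma cuspKernel_sub_one (p : ℝ) (ξ : ℂ) :
    cuspKernel p (ξ - 1) = Complex.exp (-(2 * π * I * p)) * cuspKernel p ξ := by
  have h : Complex.exp (2 * π * I * (ξ - 1)) = Complex.exp (2 * π * I * ξ) := by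
    rw [mul_sub, mul_one, Complex.exp_sub, Complex.exp_two_pi_mul_I, div_one]
  rw [cuspKernel, cuspKernel, h, mul_div_assoc', ← Complex.exp_add]
  ring_nf

lemma norm_exp_two_pi_I_mul (p : ℝ) (ξ : ℂ) :
    ‖Complex.exp (2 * π * I * p * ξ)‖ = rexp (-(2 * π * p * ξ.im)) := by
  have : (2 * π * I * p * ξ : ℂ) = ((2 * π * p : ℝ) : ℂ) * (I * ξ) := by push_cast; ring
  rw [Complex.norm_exp, this, Complex.re_ofReal_mul]
  simp

lemma norm_exp_two_pi_I (ξ : ℂ) : ‖Complex.exp (2 * π * I * ξ)‖ = rexp (-(2 * π * ξ.im)) := by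
  simpa using norm_exp_two_pi_I_mul 1 ξ

lemma norm_cuspKernel_of_im_le {p : ℝ} (hp : p ≤ 1) {ξ : ℂ} (hξ : ξ.im ≤ -(1 / 4)) :
    ‖cuspKernel p ξ‖ ≤ 2 := by
  have hX : 2 ≤ rexp (-(2 * π * ξ.im)) := by
    have := Real.add_one_le_exp (-(2 * π * ξ.im))
    nlinarith [Real.pi_gt_three]
  have h1 : rexp (-(2 * π * ξ.im)) - 1 ≤ ‖1 - Complex.exp (2 * π * I * ξ)‖ := by
    have := norm_sub_norm_le (Complex.exp (2 * π * I * ξ)) 1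
    rwa [norm_exp_two_pi_I, norm_one, norm_sub_rev] at this
  have h2 : rexp (-(2 * π * p * ξ.im)) ≤ rexp (-(2 * π * ξ.im)) := by
    refine Real.exp_le_exp.mpr ?_
    have : 0 ≤ 2 * π * -ξ.im * (1 - p) :=
      mul_nonneg (mul_nonneg (by positivity) (by linarith)) (by linarith)
    linarith
  rw [cuspKernel, norm_div, norm_exp_two_pi_I_mul, div_le_iff₀ (by linarith)]
  linarith

lemma norm_cuspKernel_of_le_im {p : ℝ} (hp : 1 / 2 ≤ p) {ξ : ℂ} (hξ : 1 ≤ ξ.im) :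
    ‖cuspKernel p ξ‖ ≤ 2 * rexp (-(π * ξ.im)) := by
  have hX : rexp (-(2 * π * ξ.im)) ≤ 1 / 2 := by
    rw [Real.exp_neg, ← one_div]
    refine one_div_le_one_div_of_le two_pos ?_
    have := Real.add_one_le_exp (2 * π * ξ.im)
    nlinarith [Real.pi_gt_three]
  have h1 : 1 / 2 ≤ ‖1 - Complex.exp (2 * π * I * ξ)‖ := by
    have := norm_sub_norm_le 1 (Complex.exp (2 * π * I * ξ))
    rw [norm_exp_two_pi_I, norm_one] at this
    linarith
  have h2 : rexp (-(2 * π * p * ξ.im)) ≤ rexp (-(π * ξ.im)) := by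
    refine Real.exp_le_exp.mpr ?_
    have : 0 ≤ π * ξ.im * (2 * p - 1) :=
      mul_nonneg (mul_nonneg (by positivity) (by linarith)) (by linarith)
    linarith
  rw [cuspKernel, norm_div, norm_exp_two_pi_I_mul, div_le_iff₀ (by linarith)]
  nlinarith [Real.exp_pos (-(π * ξ.im))]

lemma norm_cuspKernel_of_re_eq_half {p : ℝ} (hp : 1 / 2 ≤ p) (hp' : p ≤ 1) {ξ : ℂ}
    (hξ : ξ.re = 1 / 2) : ‖cuspKernel p ξ‖ ≤ min 1 (rexp (-(π * ξ.im))) := by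
  have he : Complex.exp (2 * π * I * ξ) = -(rexp (-(2 * π * ξ.im)) : ℂ) := by
    have : (2 * π * I * ξ : ℂ) = ((-(2 * π * ξ.im) : ℝ) : ℂ) + π * I := by
      rw [← Complex.re_add_im ξ, hξ]
      simp only [Complex.add_im, Complex.ofReal_im, Complex.mul_im, Complex.I_im, Complex.ofReal_re,
        Complex.I_re]
      push_cast
      linear_combination 2 * π * ξ.im * Complex.I_mul_I
    rw [this, Complex.exp_add, Complex.exp_pi_mul_I]
    push_cast
    ring
  have hX := Real.exp_pos (-(2 * π * ξ.im))
  have hn : ‖1 - Complex.exp (2 * π * I * ξ)‖ = 1 + rexp (-(2 * π * ξ.im)) := by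
    rw [he, sub_neg_eq_add, ← Complex.ofReal_one, ← Complex.ofReal_add, Complex.norm_real,
      Real.norm_of_nonneg (by positivity)]
  have hpow : rexp (-(2 * π * p * ξ.im)) ≤ max 1 (rexp (-(2 * π * ξ.im))) := by
    rcases le_total 0 ξ.im with h | h
    · refine le_max_of_le_left (Real.exp_le_one_iff.mpr ?_)
      have : 0 ≤ 2 * π * p * ξ.im := mul_nonneg (mul_nonneg (by positivity) (by linarith)) h
      linarith
    · refine le_max_of_le_right (Real.exp_le_exp.mpr ?_)
      have : 0 ≤ 2 * π * -ξ.im * (1 - p) :=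
        mul_nonneg (mul_nonneg (by positivity) (by linarith)) (by linarith)
      linarith
  rw [cuspKernel, norm_div, norm_exp_two_pi_I_mul, hn, div_le_iff₀ (by linarith)]
  rcases le_total 0 ξ.im with h | h
  · have h1 : rexp (-(π * ξ.im)) ≤ 1 := Real.exp_le_one_iff.mpr (by nlinarith [Real.pi_pos])
    rw [min_eq_right h1]
    have h2 : rexp (-(2 * π * p * ξ.im)) ≤ rexp (-(π * ξ.im)) := by
      refine Real.exp_le_exp.mpr ?_
      have : 0 ≤ π * ξ.im * (2 * p - 1) :=
        mul_nonneg (mul_nonneg (by positivity) h) (by linarith)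
      linarith
    nlinarith [Real.exp_pos (-(π * ξ.im))]
  · have h1 : 1 ≤ rexp (-(π * ξ.im)) := Real.one_le_exp (by nlinarith [Real.pi_pos])
    rw [min_eq_left h1, one_mul]
    exact hpow.trans (max_le (by linarith) (by linarith))

lemma exp_two_pi_I_mul_ne_one {ξ : ℂ} (h0 : ξ ≠ 0) (h : |ξ.re| < 1) :
    1 - Complex.exp (2 * π * I * ξ) ≠ 0 := by
  intro h1
  obtain ⟨n, hn⟩ := Complex.exp_eq_one_iff.mp (sub_eq_zero.mp h1).symm
  have hξ : ξ = n := by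
    have : (2 * π * I : ℂ) ≠ 0 := Complex.two_pi_I_ne_zero
    apply mul_left_cancel₀ this
    rw [hn]; ring
  rw [hξ, Complex.intCast_re] at h
  have : |n| < 1 := by exact_mod_cast h
  rw [Int.abs_lt_one_iff] at this
  rw [this] at hξ
  exact h0 (by simpa using hξ)

lemma rectIntegral_mul_cuspKernel {Y : ℂ → ℂ} (hY : DifferentiableOn ℂ Y {s | 0 < s.im}) (p : ℝ)
    {w : ℂ} {T : ℝ} (h1 : 1 < w.im) (hT : w.im < T) :
    rectIntegral (fun s => Y s * cuspKernel p (s - w)) (w.re - 1 / 2) (w.re + 1 / 2) 1 T =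
      -Y w := by
  have hU : IsOpen {s : ℂ | |(s - w).re| < 1 ∧ 0 < s.im} :=
    IsOpen.inter (s := {s : ℂ | |(s - w).re| < 1}) (t := {s | 0 < s.im})
      (isOpen_lt (by fun_prop) (by fun_prop)) (isOpen_lt (by fun_prop) (by fun_prop))
  have hg : ∀ s, HasDerivAt (fun s => 1 - Complex.exp (2 * π * I * (s - w)))
      (-(Complex.exp (2 * π * I * (s - w)) * (2 * π * I))) s := by
    intro s
    have := ((((hasDerivAt_id s).sub_const w).const_mul (2 * π * I)).cexp).const_sub 1
    simpa using this
  have hgw := (hg w).deriv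
  rw [sub_self, mul_zero, Complex.exp_zero, one_mul] at hgw
  have := rectIntegral_div (f := fun s => Y s * Complex.exp (2 * π * I * p * (s - w)))
    (g := fun s => 1 - Complex.exp (2 * π * I * (s - w))) (w := w) hU
    (a := w.re - 1 / 2) (b := w.re + 1 / 2) (c := 1) (d := T)
    ((hY.mono fun s hs => hs.2).mul (by fun_prop))
    (fun s _ => (hg s).differentiableAt.differentiableWithinAt)
    (fun s hs => by
      obtain ⟨⟨h2, h3⟩, h4, h5⟩ := hs
      refine ⟨?_, by linarith⟩
      rw [Complex.sub_re, abs_lt]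
      constructor <;> linarith)
    (by linarith) (by linarith) h1 hT (by simp)
    (by rw [hgw]; exact neg_ne_zero.mpr Complex.two_pi_I_ne_zero)
    (fun s hs hsw => exp_two_pi_I_mul_ne_one (sub_ne_zero.mpr hsw) hs.1)
  simp only [cuspKernel, mul_div_assoc'] at this ⊢
  rw [this, hgw, sub_self, mul_zero, Complex.exp_zero]
  field_simp [Complex.two_pi_I_ne_zero]

lemma exp_neg_quarter_pi_mul_abs_le (x : ℝ) : rexp (-(π / 4) * |x|) ≤ 4 * (1 + x ^ 2)⁻¹ := by
  rw [neg_mul, Real.exp_neg, ← div_eq_mul_inv, ← one_div,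
    div_le_div_iff₀ (Real.exp_pos _) (by positivity)]
  have := Real.quadratic_le_exp_of_nonneg (x := π / 4 * |x|) (by positivity)
  have h2 : (3 / 4 * |x|) ^ 2 ≤ (π / 4 * |x|) ^ 2 := by
    gcongr
    exact Real.pi_gt_three.le
  have h3 : |x| ^ 2 = x ^ 2 := sq_abs x
  have h4 : 0 ≤ π / 4 * |x| := by positivity
  nlinarith

lemma exists_cusp_side_bound (K : ℕ) : ∃ C : ℝ, 0 < C ∧ ∀ t v : ℝ, 1 ≤ t → 1 ≤ v →
    t ^ K * rexp (π / 4 * t) * min 1 (rexp (-(π * (t - v)))) ≤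
      C * (v ^ K * rexp (π / 4 * v)) * (1 + (t - v) ^ 2)⁻¹ := by
  refine ⟨4 * (K.factorial * rexp 1), by positivity, fun t v ht hv => ?_⟩
  have hE := exp_neg_quarter_pi_mul_abs_le (t - v)
  have hfac : (1 : ℝ) ≤ K.factorial * rexp 1 := by
    have h1 : (1 : ℝ) ≤ K.factorial := by exact_mod_cast K.factorial_pos
    have h2 : (1 : ℝ) ≤ rexp 1 := Real.one_le_exp zero_le_one
    nlinarith
  suffices h : t ^ K * rexp (π / 4 * t) * min 1 (rexp (-(π * (t - v)))) ≤
      (K.factorial * rexp 1) * (v ^ K * rexp (π / 4 * v)) * rexp (-(π / 4) * |t - v|) by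
    refine h.trans ((mul_le_mul_of_nonneg_left hE (by positivity)).trans (le_of_eq (by ring)))
  rcases le_total t v with h | h
  · have e1 : rexp (π / 4 * t) = rexp (π / 4 * v) * rexp (-(π / 4) * |t - v|) := by
      rw [← Real.exp_add, abs_of_nonpos (by linarith)]
      ring_nf
    have h3 : t ^ K ≤ v ^ K := pow_le_pow_left₀ (by linarith) h K
    calc _ ≤ v ^ K * rexp (π / 4 * t) * 1 := by gcongr; exact min_le_left _ _
      _ = 1 * (v ^ K * rexp (π / 4 * v)) * rexp (-(π / 4) * |t - v|) := by rw [e1]; ring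
      _ ≤ _ := by gcongr
  · have h3 : t ^ K ≤ v ^ K * (K.factorial * rexp 1 * rexp (π / 2 * (t - v))) := by
      have h4 : t ≤ v * (1 + (t - v)) := by nlinarith
      have h5 : (1 + (t - v)) ^ K ≤ K.factorial * rexp (1 + (t - v)) := by
        have := Real.pow_div_factorial_le_exp (x := 1 + (t - v)) (by linarith) K
        rwa [div_le_iff₀ (by positivity), mul_comm] at this
      have h6 : rexp (1 + (t - v)) ≤ rexp 1 * rexp (π / 2 * (t - v)) := by
        rw [← Real.exp_add]
        refine Real.exp_le_exp.mpr ?_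
        nlinarith [Real.pi_gt_three]
      calc t ^ K ≤ (v * (1 + (t - v))) ^ K := pow_le_pow_left₀ (by linarith) h4 K
        _ = v ^ K * (1 + (t - v)) ^ K := mul_pow _ _ _
        _ ≤ v ^ K * (K.factorial * (rexp 1 * rexp (π / 2 * (t - v)))) := by
          gcongr
          exact h5.trans (by gcongr)
        _ = _ := by ring
    have e1 : rexp (π / 2 * (t - v)) * rexp (π / 4 * t) * rexp (-(π * (t - v))) =
        rexp (π / 4 * v) * rexp (-(π / 4) * |t - v|) := by
      rw [← Real.exp_add, ← Real.exp_add, ← Real.exp_add, abs_of_nonneg (by linarith)]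
      ring_nf
    calc _ ≤ v ^ K * (K.factorial * rexp 1 * rexp (π / 2 * (t - v))) * rexp (π / 4 * t) *
          rexp (-(π * (t - v))) := by gcongr; exact min_le_right _ _
      _ = v ^ K * (K.factorial * rexp 1) * (rexp (π / 2 * (t - v)) * rexp (π / 4 * t) *
          rexp (-(π * (t - v)))) := by ring
      _ ≤ _ := by rw [e1]; exact le_of_eq (by ring)

lemma tendsto_cusp_top (M H v : ℝ) (K : ℕ) : Filter.Tendsto (fun T : ℝ =>
    (M * rexp (2 * π / 3 * T) + H * (T ^ K * rexp (π / 4 * T))) * (2 * rexp (-(π * (T - v)))))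
      Filter.atTop (nhds 0) := by
  have h1 : Filter.Tendsto (fun T : ℝ => T ^ K * rexp (-(π / 3) * T)) Filter.atTop (nhds 0) := by
    refine squeeze_zero' (Filter.eventually_atTop.mpr ⟨0, fun T hT => by positivity⟩)
      (Filter.eventually_atTop.mpr ⟨0, fun T hT => ?_⟩)
      (Real.tendsto_pow_mul_exp_neg_atTop_nhds_zero K)
    gcongr
    nlinarith [Real.pi_gt_three]
  have h2 : Filter.Tendsto (fun T : ℝ => rexp (-(π / 3) * T)) Filter.atTop (nhds 0) :=
    Real.tendsto_exp_atBot.comp (Filter.tendsto_id.const_mul_atTop_of_neg (by linarith [Real.pi_pos]))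
  rw [tendsto_zero_iff_norm_tendsto_zero]
  have h3 := ((h2.const_mul (2 * |M| * rexp (π * v))).add (h1.const_mul (2 * |H| * rexp (π * v))))
  rw [mul_zero, mul_zero, add_zero] at h3
  refine squeeze_zero' (Filter.Eventually.of_forall fun T => norm_nonneg _)
    (Filter.eventually_atTop.mpr ⟨0, fun T hT => ?_⟩) h3
  have e1 : rexp (2 * π / 3 * T) * rexp (-(π * (T - v))) = rexp (π * v) * rexp (-(π / 3) * T) := by
    rw [← Real.exp_add, ← Real.exp_add]; ring_nf
  have e2 : rexp (π / 4 * T) * rexp (-(π * (T - v))) ≤ rexp (π * v) * rexp (-(π / 3) * T) := by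
    rw [← Real.exp_add, ← Real.exp_add]
    exact Real.exp_le_exp.mpr (by nlinarith [Real.pi_pos])
  rw [norm_mul, Real.norm_eq_abs, Real.norm_of_nonneg (by positivity)]
  calc _ ≤ (|M| * rexp (2 * π / 3 * T) + |H| * (T ^ K * rexp (π / 4 * T))) *
        (2 * rexp (-(π * (T - v)))) := by
        gcongr
        refine (abs_add_le _ _).trans (le_of_eq ?_)
        rw [abs_mul, abs_mul, abs_of_pos (Real.exp_pos _),
          abs_of_nonneg (a := T ^ K * rexp (π / 4 * T)) (by positivity)]
    _ = 2 * |M| * (rexp (2 * π / 3 * T) * rexp (-(π * (T - v)))) +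
        2 * |H| * T ^ K * (rexp (π / 4 * T) * rexp (-(π * (T - v)))) := by ring
    _ ≤ 2 * |M| * (rexp (π * v) * rexp (-(π / 3) * T)) +
        2 * |H| * T ^ K * (rexp (π * v) * rexp (-(π / 3) * T)) := by
        rw [e1]; gcongr
    _ = _ := by ring

/-- A solution of a difference equation near a cusp which does not grow too fast is bounded in
terms of the inhomogeneity. -/
theorem exists_cusp_bound (K : ℕ) : ∃ C : ℝ, 0 < C ∧ ∀ (p : ℝ) (σ : ℂ) (Y h : ℂ → ℂ) (M H : ℝ),
    1 / 2 ≤ p → p ≤ 1 → ‖σ‖ = 1 → Complex.exp (-(2 * π * I * p)) * σ = 1 →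
    DifferentiableOn ℂ Y {s | 0 < s.im} →
    (∀ s : ℂ, 0 < s.im → Y (s - 1) = σ * Y s + h s) → 0 ≤ M → 0 ≤ H →
    (∀ s : ℂ, |s.re| ≤ 1 / 2 → 1 ≤ s.im → ‖Y s‖ ≤ M * rexp (2 * π / 3 * s.im)) →
    (∀ s : ℂ, |s.re| ≤ 3 / 2 → 1 ≤ s.im → ‖h s‖ ≤ H * (s.im ^ K * rexp (π / 4 * s.im))) →
    ∀ s : ℂ, |s.re| ≤ 1 / 2 → 1 ≤ s.im →
      ‖Y s‖ ≤ C * (M + H * (s.im ^ K * rexp (π / 4 * s.im))) := by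
  obtain ⟨C₁, hC₁, hside⟩ := exists_cusp_side_bound K
  refine ⟨rexp (2 * π) + 2 * rexp (2 * π) + C₁ * π, by positivity, ?_⟩
  intro p σ Y h M H hp hp' hσ hpσ hY hrel hM hH hYb hhb w hwre hwim
  set v := w.im with hv
  set Q := v ^ K * rexp (π / 4 * v) with hQ
  have hQ0 : 1 ≤ v ^ K * rexp (π / 4 * v) :=
    one_le_mul_of_one_le_of_one_le (one_le_pow₀ hwim) (Real.one_le_exp (by positivity))
  have hMQ : 0 ≤ M + H * Q := by positivity
  rcases le_or_gt v (5 / 4) with hv5 | hv5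
  · calc ‖Y w‖ ≤ M * rexp (2 * π / 3 * v) := hYb w hwre hwim
      _ ≤ (M + H * Q) * rexp (2 * π) := by
        have h1 : rexp (2 * π / 3 * v) ≤ rexp (2 * π) :=
          Real.exp_le_exp.mpr (by nlinarith [Real.pi_pos])
        have h2 : M ≤ M + H * Q := le_add_of_nonneg_right (by positivity)
        gcongr
      _ ≤ _ := by
        rw [mul_comm]
        gcongr
        have : 0 < C₁ * π := by positivity
        linarith [Real.exp_pos (2 * π)]
  have hwabs := abs_le.mp hwre
  have hYb' : ∀ s : ℂ, |s.re| ≤ 1 → 1 ≤ s.im →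
      ‖Y s‖ ≤ M * rexp (2 * π / 3 * s.im) + H * (s.im ^ K * rexp (π / 4 * s.im)) := by
    intro s hs hs1
    have hsa := abs_le.mp hs
    have hpos : 0 ≤ H * (s.im ^ K * rexp (π / 4 * s.im)) := by positivity
    rcases le_or_gt |s.re| (1 / 2) with h1 | h1
    · linarith [hYb s h1 hs1]
    · rcases le_or_gt 0 s.re with h0 | h0
      · rw [abs_of_nonneg h0] at h1
        have hr := hrel s (by linarith)
        have h2 : ‖Y s‖ = ‖Y (s - 1) - h s‖ := by rw [hr]; simp [hσ]
        have h3 := hYb (s - 1) (by rw [abs_le]; simp; constructor <;> linarith) (by simpa using hs1)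
        rw [Complex.sub_im, Complex.one_im, sub_zero] at h3
        have h4 := hhb s (by linarith) hs1
        rw [h2]
        exact (norm_sub_le _ _).trans (add_le_add h3 h4)
      · rw [abs_of_neg h0] at h1
        have hr := hrel (s + 1) (by simp; linarith)
        rw [add_sub_cancel_right] at hr
        have h3 := hYb (s + 1) (by rw [abs_le]; simp; constructor <;> linarith) (by simpa using hs1)
        have h4 := hhb (s + 1) (by rw [abs_le]; simp; constructor <;> linarith) (by simpa using hs1)
        rw [Complex.add_im, Complex.one_im, add_zero] at h3 h4
        rw [hr]
        refine (norm_add_le _ _).trans (add_le_add ?_ h4)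
        rwa [norm_mul, hσ, one_mul]
  have hmain : ∀ T : ℝ, v + 1 ≤ T → ‖Y w‖ ≤ 2 * rexp (2 * π) * (M + H * Q) +
      C₁ * π * (M + H * Q) +
      (M * rexp (2 * π / 3 * T) + H * (T ^ K * rexp (π / 4 * T))) * (2 * rexp (-(π * (T - v)))) := by
    intro T hT
    have hres := rectIntegral_mul_cuspKernel hY p (w := w) (T := T) (by linarith) (by linarith)
    rw [rectIntegral] at hres
    have hlen : |w.re + 1 / 2 - (w.re - 1 / 2)| = 1 := by norm_num
    have hbot : ‖∫ x in (w.re - 1 / 2)..(w.re + 1 / 2),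
        Y (x + (1 : ℝ) * I) * cuspKernel p (x + (1 : ℝ) * I - w)‖ ≤ 2 * rexp (2 * π) * (M + H * Q) := by
      have := intervalIntegral.norm_integral_le_of_norm_le_const
        (a := w.re - 1 / 2) (b := w.re + 1 / 2)
        (f := fun x : ℝ => Y (x + (1 : ℝ) * I) * cuspKernel p (x + (1 : ℝ) * I - w))
        (C := 2 * rexp (2 * π) * (M + H * Q)) (fun x hx => by
          rw [Set.uIoc_of_le (by linarith)] at hx
          rw [norm_mul]
          have h1 := hYb' (x + (1 : ℝ) * I) (by
            rw [abs_le]; simp; constructor <;> linarith [hx.1, hx.2]) (by simp)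
          have h2 := norm_cuspKernel_of_im_le hp' (ξ := x + (1 : ℝ) * I - w) (by
            simp; linarith)
          have him : ((x : ℂ) + (1 : ℝ) * I).im = 1 := by simp
          rw [him, one_pow, one_mul] at h1
          have h3 : ‖Y (x + (1 : ℝ) * I)‖ ≤ rexp (2 * π) * (M + H * Q) := by
            refine h1.trans ?_
            have e1 : rexp (2 * π / 3 * 1) ≤ rexp (2 * π) :=
              Real.exp_le_exp.mpr (by linarith [Real.pi_pos])
            have e2 : rexp (π / 4 * 1) ≤ rexp (2 * π) * Q := by
              have : rexp (π / 4 * 1) ≤ rexp (2 * π) :=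
                Real.exp_le_exp.mpr (by linarith [Real.pi_pos])
              nlinarith [Real.exp_pos (2 * π)]
            nlinarith
          calc _ ≤ rexp (2 * π) * (M + H * Q) * 2 := by gcongr
            _ = _ := by ring)
      rwa [hlen, mul_one] at this
    have htop : ‖∫ x in (w.re - 1 / 2)..(w.re + 1 / 2),
        Y (x + T * I) * cuspKernel p (x + T * I - w)‖ ≤
        (M * rexp (2 * π / 3 * T) + H * (T ^ K * rexp (π / 4 * T))) *
          (2 * rexp (-(π * (T - v)))) := by
      have := intervalIntegral.norm_integral_le_of_norm_le_const
        (a := w.re - 1 / 2) (b := w.re + 1 / 2)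
        (f := fun x : ℝ => Y (x + T * I) * cuspKernel p (x + T * I - w))
        (C := (M * rexp (2 * π / 3 * T) + H * (T ^ K * rexp (π / 4 * T))) *
          (2 * rexp (-(π * (T - v))))) (fun x hx => by
          rw [Set.uIoc_of_le (by linarith)] at hx
          rw [norm_mul]
          have him : ((x : ℂ) + T * I).im = T := by simp
          have h1 := hYb' (x + T * I) (by
            rw [abs_le]; simp; constructor <;> linarith [hx.1, hx.2]) (by rw [him]; linarith)
          have h2 := norm_cuspKernel_of_le_im hp (ξ := x + T * I - w) (by
            simp; linarith)
          rw [Complex.sub_im, him] at h2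
          rw [him] at h1
          have hT0 : 0 ≤ T := by linarith
          gcongr)
      rwa [hlen, mul_one] at this
    have hsides : ‖(I * ∫ y in (1 : ℝ)..T, Y ((w.re + 1 / 2 : ℝ) + y * I) *
          cuspKernel p ((w.re + 1 / 2 : ℝ) + y * I - w)) -
        I * ∫ y in (1 : ℝ)..T, Y ((w.re - 1 / 2 : ℝ) + y * I) *
          cuspKernel p ((w.re - 1 / 2 : ℝ) + y * I - w)‖ ≤ C₁ * π * (M + H * Q) := by
      have hcont : ∀ u : ℝ, u = w.re + 1 / 2 ∨ u = w.re - 1 / 2 → ContinuousOn (fun y : ℝ =>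
          Y (u + y * I) * cuspKernel p (u + y * I - w)) (Set.uIcc 1 T) := by
        intro u hu
        have hU : |u - w.re| = 1 / 2 := by
          rcases hu with rfl | rfl
          · rw [add_sub_cancel_left, abs_of_pos (by norm_num)]
          · rw [sub_sub_cancel_left, abs_neg, abs_of_pos (by norm_num)]
        refine ContinuousOn.mul ?_ ?_
        · refine hY.continuousOn.comp (by fun_prop) fun y hy => ?_
          rw [Set.uIcc_of_le (by linarith)] at hy
          simp only [Set.mem_ofPred_eq]
          simp; linarith [hy.1]
        · unfold cuspKernel
          refine ContinuousOn.div (by fun_prop) (by fun_prop) fun y _ => ?_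
          refine exp_two_pi_I_mul_ne_one (fun h0 => ?_) ?_
          · have := congrArg Complex.re h0
            simp at this
            rw [this] at hU
            norm_num at hU
          · simp only [Complex.sub_re, Complex.add_re, Complex.ofReal_re, Complex.mul_re,
              Complex.I_re, mul_zero, Complex.ofReal_im, Complex.I_im, zero_mul, sub_zero, add_zero]
            rw [hU]; norm_num
      rw [← mul_sub, ← intervalIntegral.integral_sub (hcont _ (Or.inl rfl)).intervalIntegrable
        (hcont _ (Or.inr rfl)).intervalIntegrable, norm_mul, Complex.norm_I, one_mul]
      have hpt : ∀ y ∈ Set.Ioc 1 T, ‖Y ((w.re + 1 / 2 : ℝ) + y * I) *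
          cuspKernel p ((w.re + 1 / 2 : ℝ) + y * I - w) - Y ((w.re - 1 / 2 : ℝ) + y * I) *
          cuspKernel p ((w.re - 1 / 2 : ℝ) + y * I - w)‖ ≤
          H * (C₁ * Q) * (1 + (y - v) ^ 2)⁻¹ := by
        intro y hy
        set s : ℂ := (w.re + 1 / 2 : ℝ) + y * I with hs
        have hs1 : ((w.re - 1 / 2 : ℝ) + y * I : ℂ) = s - 1 := by rw [hs]; push_cast; ring
        have him : s.im = y := by simp [hs]
        have hre : s.re = w.re + 1 / 2 := by simp [hs]
        have e1 : s - 1 - w = s - w - 1 := by ring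
        rw [hs1, e1, cuspKernel_sub_one, hrel s (by rw [him]; linarith [hy.1])]
        have e2 : Y s * cuspKernel p (s - w) - (σ * Y s + h s) *
            (Complex.exp (-(2 * π * I * p)) * cuspKernel p (s - w)) =
            -(h s * Complex.exp (-(2 * π * I * p)) * cuspKernel p (s - w)) := by
          linear_combination (-Y s * cuspKernel p (s - w)) * hpσ
        have e3 : ‖Complex.exp (-(2 * π * I * p))‖ = 1 := by
          have := congrArg norm hpσ
          rwa [norm_mul, hσ, mul_one, norm_one] at this
        rw [e2, norm_neg, norm_mul, norm_mul, e3, mul_one]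
        have h1 := hhb s (by rw [hre, abs_le]; constructor <;> linarith) (by rw [him]; exact hy.1.le)
        have h2 := norm_cuspKernel_of_re_eq_half hp hp' (ξ := s - w) (by simp [hre])
        rw [Complex.sub_im, him] at h2
        rw [him] at h1
        calc _ ≤ H * (y ^ K * rexp (π / 4 * y)) * min 1 (rexp (-(π * (y - v)))) := by
              have : 0 ≤ y := by linarith [hy.1]
              gcongr
          _ = H * (y ^ K * rexp (π / 4 * y) * min 1 (rexp (-(π * (y - v))))) := by ring
          _ ≤ H * (C₁ * Q * (1 + (y - v) ^ 2)⁻¹) :=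
              mul_le_mul_of_nonneg_left (hside y v hy.1.le hwim) hH
          _ = _ := by ring
      have hint : Integrable fun y : ℝ => H * (C₁ * Q) * (1 + (y - v) ^ 2)⁻¹ :=
        (integrable_inv_one_add_sq.comp_sub_right v).const_mul _
      refine (intervalIntegral.norm_integral_le_of_norm_le (by linarith)
        (Filter.Eventually.of_forall fun y hy => hpt y hy) hint.intervalIntegrable).trans ?_
      rw [intervalIntegral.integral_of_le (by linarith)]
      refine (setIntegral_le_integral hint (Filter.Eventually.of_forall fun y => by
        change 0 ≤ H * (C₁ * Q) * (1 + (y - v) ^ 2)⁻¹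
        positivity)).trans ?_
      rw [integral_const_mul, integral_sub_right_eq_self (fun y : ℝ => (1 + y ^ 2)⁻¹) v,
        integral_univ_inv_one_add_sq]
      have : H * Q * (C₁ * π) ≤ (M + H * Q) * (C₁ * π) := by gcongr; linarith
      linarith
    have hY' : Y w = -((∫ x in (w.re - 1 / 2)..(w.re + 1 / 2),
        Y (x + (1 : ℝ) * I) * cuspKernel p (x + (1 : ℝ) * I - w)) -
        (∫ x in (w.re - 1 / 2)..(w.re + 1 / 2), Y (x + T * I) * cuspKernel p (x + T * I - w)) +
        ((I * ∫ y in (1 : ℝ)..T, Y ((w.re + 1 / 2 : ℝ) + y * I) *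
          cuspKernel p ((w.re + 1 / 2 : ℝ) + y * I - w)) -
        I * ∫ y in (1 : ℝ)..T, Y ((w.re - 1 / 2 : ℝ) + y * I) *
          cuspKernel p ((w.re - 1 / 2 : ℝ) + y * I - w))) := by
      linear_combination hres
    rw [hY', norm_neg]
    refine (norm_add_le _ _).trans ?_
    have := norm_sub_le (∫ x in (w.re - 1 / 2)..(w.re + 1 / 2),
        Y (x + (1 : ℝ) * I) * cuspKernel p (x + (1 : ℝ) * I - w))
        (∫ x in (w.re - 1 / 2)..(w.re + 1 / 2), Y (x + T * I) * cuspKernel p (x + T * I - w))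
    linarith
  have hlim := (tendsto_cusp_top M H v K).const_add
    (2 * rexp (2 * π) * (M + H * Q) + C₁ * π * (M + H * Q))
  rw [add_zero] at hlim
  refine (ge_of_tendsto hlim (Filter.eventually_atTop.mpr ⟨v + 1, hmain⟩)).trans ?_
  have : 0 ≤ rexp (2 * π) * (M + H * Q) := by positivity
  linarith

/-! ### The geometry of circular arcs through `±1` -/

/-- A conformal map from the strip `0 < im < π` to the upper half plane, sending horizontal lines to
circular arcs from `-1` to `1`. -/
noncomputable def arc (ζ : ℂ) : ℂ := (Complex.exp ζ - 1) / (Complex.exp ζ + 1)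

noncomputable def arcDeriv (ζ : ℂ) : ℂ := 2 * Complex.exp ζ / (Complex.exp ζ + 1) ^ 2

noncomputable def arcDenom (ζ : ℂ) : ℝ := Real.cosh ζ.re + Real.cos ζ.im

section Arc

variable {ζ : ℂ}

lemma exp_add_one_ne_zero (h0 : 0 < ζ.im) (h1 : ζ.im < π) : Complex.exp ζ + 1 ≠ 0 := by
  intro h
  have h2 := congrArg Complex.im h
  rw [Complex.add_im, Complex.exp_im, Complex.one_im, add_zero, Complex.zero_im] at h2
  have h3 := mul_pos (Real.exp_pos ζ.re) (Real.sin_pos_of_pos_of_lt_pi h0 h1)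
  linarith

lemma arcDenom_pos (h0 : 0 < ζ.im) (h1 : ζ.im < π) : 0 < arcDenom ζ := by
  have h2 := Real.one_le_cosh ζ.re
  have h3 := Real.cos_lt_cos_of_nonneg_of_le_pi h0.le le_rfl h1
  rw [Real.cos_pi] at h3
  rw [arcDenom]; linarith

lemma normSq_exp_add_one : Complex.normSq (Complex.exp ζ + 1) = 2 * rexp ζ.re * arcDenom ζ := by
  rw [Complex.normSq_apply, Complex.add_re, Complex.add_im, Complex.exp_re, Complex.exp_im,
    arcDenom, Real.cosh_eq, Complex.one_re, Complex.one_im]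
  have h1 := Real.sin_sq_add_cos_sq ζ.im
  have h2 : rexp ζ.re * rexp (-ζ.re) = 1 := by rw [← Real.exp_add]; simp
  linear_combination rexp ζ.re ^ 2 * h1 - h2

lemma normSq_exp_sub_one : Complex.normSq (Complex.exp ζ - 1) =
    2 * rexp ζ.re * (Real.cosh ζ.re - Real.cos ζ.im) := by
  rw [Complex.normSq_apply, Complex.sub_re, Complex.sub_im, Complex.exp_re, Complex.exp_im,
    Real.cosh_eq, Complex.one_re, Complex.one_im]
  have h1 := Real.sin_sq_add_cos_sq ζ.im
  have h2 : rexp ζ.re * rexp (-ζ.re) = 1 := by rw [← Real.exp_add]; simp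
  linear_combination rexp ζ.re ^ 2 * h1 - h2

lemma arc_im (h0 : 0 < ζ.im) (h1 : ζ.im < π) : (arc ζ).im = Real.sin ζ.im / arcDenom ζ := by
  have hD := arcDenom_pos h0 h1
  rw [arc, Complex.div_im, normSq_exp_add_one]
  simp only [Complex.add_re, Complex.add_im, Complex.sub_re, Complex.sub_im, Complex.one_re,
    Complex.one_im, Complex.exp_im, Complex.exp_re]
  have := Real.exp_pos ζ.re
  field_simp
  ring

lemma arc_im_pos (h0 : 0 < ζ.im) (h1 : ζ.im < π) : 0 < (arc ζ).im := by
  rw [arc_im h0 h1]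
  exact div_pos (Real.sin_pos_of_pos_of_lt_pi h0 h1) (arcDenom_pos h0 h1)

lemma norm_arcDeriv (h0 : 0 < ζ.im) (h1 : ζ.im < π) : ‖arcDeriv ζ‖ = 1 / arcDenom ζ := by
  have hD := arcDenom_pos h0 h1
  rw [arcDeriv, norm_div, norm_pow, ← Complex.normSq_eq_norm_sq, normSq_exp_add_one, norm_mul,
    Complex.norm_exp]
  have := Real.exp_pos ζ.re
  simp only [Complex.norm_ofNat]
  field_simp

lemma norm_sq_arc (h0 : 0 < ζ.im) (h1 : ζ.im < π) :
    ‖arc ζ‖ ^ 2 = 1 - 2 * Real.cos ζ.im / arcDenom ζ := by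
  have hD := arcDenom_pos h0 h1
  rw [← Complex.normSq_eq_norm_sq, arc, Complex.normSq_div, normSq_exp_add_one, normSq_exp_sub_one]
  have := Real.exp_pos ζ.re
  field_simp
  rw [arcDenom]; ring

lemma hasDerivAt_arc (h0 : 0 < ζ.im) (h1 : ζ.im < π) : HasDerivAt arc (arcDeriv ζ) ζ := by
  have hE := Complex.hasDerivAt_exp ζ
  have := (hE.sub_const 1).fun_div (hE.add_const 1) (exp_add_one_ne_zero h0 h1)
  refine this.congr_deriv ?_
  unfold arcDeriv
  ring

lemma arc_log {τ : ℂ} (hτ : 0 < τ.im) : ∃ ζ : ℂ, 0 < ζ.im ∧ ζ.im < π ∧ arc ζ = τ := by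
  have h1 : 1 - τ ≠ 0 := fun h => by
    have := congrArg Complex.im h; simp at this; linarith
  have h2 : 1 + τ ≠ 0 := fun h => by
    have := congrArg Complex.im h; simp at this; linarith
  have hE : Complex.exp (Complex.log ((1 + τ) / (1 - τ))) = (1 + τ) / (1 - τ) :=
    Complex.exp_log (div_ne_zero h2 h1)
  have him : 0 < ((1 + τ) / (1 - τ)).im := by
    have hn : 0 < Complex.normSq (1 - τ) := Complex.normSq_pos.mpr h1
    rw [Complex.div_im, ← sub_div]
    refine div_pos ?_ hn
    simp
    nlinarith
  refine ⟨Complex.log ((1 + τ) / (1 - τ)), ?_, ?_, ?_⟩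
  · rw [Complex.log_im]
    refine lt_of_le_of_ne (Complex.arg_nonneg_iff.mpr him.le) fun h => ?_
    rw [eq_comm, Complex.arg_eq_zero_iff] at h
    linarith [h.2]
  · rw [Complex.log_im]
    refine lt_of_le_of_ne (Complex.arg_le_pi _) fun h => ?_
    rw [Complex.arg_eq_pi_iff] at h
    linarith [h.2]
  · rw [arc, hE]
    field_simp
    ring

lemma arc_injective {ξ : ℂ} (h0 : 0 < ζ.im) (h1 : ζ.im < π) (h0' : 0 < ξ.im) (h1' : ξ.im < π)
    (h : arc ζ = arc ξ) : ζ = ξ := by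
  have hE : Complex.exp ζ = Complex.exp ξ := by
    rw [arc, arc, div_eq_div_iff (exp_add_one_ne_zero h0 h1) (exp_add_one_ne_zero h0' h1')] at h
    linear_combination h / 2
  rw [← Complex.log_exp (by linarith [Real.pi_pos]) h1.le, hE,
    Complex.log_exp (by linarith [Real.pi_pos]) h1'.le]

end Arc

/-- The lens between the unit circle and the circle `‖z‖ ^ 2 + 2 * im z = 1`. -/
def lens : Set ℂ := {z | 0 < z.im ∧ ‖z‖ ≤ 1 ∧ 1 ≤ ‖z‖ ^ 2 + 2 * z.im}

lemma sin_cos_arc {α : ℝ} (h0 : π / 4 ≤ α) (h1 : α ≤ π / 2) :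
    0 ≤ Real.cos α ∧ Real.cos α ≤ Real.sin α ∧ 1 / 2 ≤ Real.sin α := by
  have hπ := Real.pi_pos
  have h2 : Real.cos α ≤ Real.cos (π / 4) :=
    Real.cos_le_cos_of_nonneg_of_le_pi (by linarith) (by linarith) h0
  have h3 : Real.sin (π / 4) ≤ Real.sin α :=
    Real.sin_le_sin_of_le_of_le_pi_div_two (by linarith) h1 h0
  have h4 : (1 : ℝ) ≤ √2 := by rw [Real.one_le_sqrt]; norm_num
  refine ⟨Real.cos_nonneg_of_neg_pi_div_two_le_of_le (by linarith) h1, ?_, ?_⟩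
  · refine h2.trans (le_trans (le_of_eq ?_) h3)
    rw [Real.cos_pi_div_four, Real.sin_pi_div_four]
  · rw [Real.sin_pi_div_four] at h3; linarith

lemma arc_mem_lens {ζ : ℂ} (h0 : π / 4 ≤ ζ.im) (h1 : ζ.im ≤ π / 2) :
    arc ζ ∈ lens ∧ ‖arcDeriv ζ‖ ≤ 2 * (arc ζ).im ∧ (arc ζ).im ≤ 1 ∧
      (arc ζ).im ≤ 2 * (1 + ζ.re ^ 2)⁻¹ := by
  have hπ := Real.pi_pos
  have a0 : 0 < ζ.im := by linarith
  have a1 : ζ.im < π := by linarith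
  obtain ⟨c0, c1, c2⟩ := sin_cos_arc h0 h1
  have hD := arcDenom_pos a0 a1
  have hN := norm_sq_arc a0 a1
  have hI := arc_im a0 a1
  have hch : 1 + ζ.re ^ 2 / 2 ≤ Real.cosh ζ.re := by
    rw [← Real.cosh_abs, ← sq_abs]
    have e4 : Real.cosh |ζ.re| = 2 * Real.sinh (|ζ.re| / 2) ^ 2 + 1 := by
      have := Real.cosh_two_mul (|ζ.re| / 2)
      rw [mul_div_cancel₀ _ two_ne_zero] at this
      rw [this, Real.cosh_sq]; ring
    have e5 : |ζ.re| / 2 ≤ Real.sinh (|ζ.re| / 2) := Real.self_le_sinh_iff.mpr (by positivity)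
    have e6 : (|ζ.re| / 2) ^ 2 ≤ Real.sinh (|ζ.re| / 2) ^ 2 := by gcongr
    rw [e4]
    linarith
  have hDge : 1 + ζ.re ^ 2 / 2 ≤ arcDenom ζ := by rw [arcDenom]; linarith
  have hle : (arc ζ).im ≤ 1 / arcDenom ζ := by
    rw [hI]; gcongr; exact Real.sin_le_one _
  refine ⟨⟨arc_im_pos a0 a1, ?_, ?_⟩, ?_, ?_, ?_⟩
  · have : ‖arc ζ‖ ^ 2 ≤ 1 := by
      rw [hN]
      have : 0 ≤ 2 * Real.cos ζ.im / arcDenom ζ := by positivity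
      linarith
    nlinarith [norm_nonneg (arc ζ)]
  · rw [hN, hI]
    have : Real.cos ζ.im / arcDenom ζ ≤ Real.sin ζ.im / arcDenom ζ := by gcongr
    rw [mul_div_assoc]
    linarith
  · rw [norm_arcDeriv a0 a1, hI, ← mul_div_assoc]
    gcongr
    linarith
  · refine hle.trans ?_
    rw [div_le_one hD]; nlinarith [sq_nonneg ζ.re]
  · refine hle.trans ?_
    rw [← div_eq_mul_inv, div_le_div_iff₀ hD (by positivity)]
    linarith

lemma norm_sq_arc_quarter {ζ : ℂ} (h : ζ.im = π / 4) : ‖arc ζ‖ ^ 2 + 2 * (arc ζ).im = 1 := by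
  have hπ := Real.pi_pos
  rw [norm_sq_arc (by linarith) (by linarith), arc_im (by linarith) (by linarith), h,
    Real.cos_pi_div_four, Real.sin_pi_div_four]
  ring

lemma norm_arc_half {ζ : ℂ} (h : ζ.im = π / 2) : ‖arc ζ‖ = 1 := by
  have hπ := Real.pi_pos
  have := norm_sq_arc (ζ := ζ) (by linarith) (by linarith)
  rw [h, Real.cos_pi_div_two, mul_zero, zero_div, sub_zero] at this
  nlinarith [norm_nonneg (arc ζ)]

/-! ### Lower bounds for the periodic Cauchy kernel -/

lemma le_norm_one_sub_exp {s : ℂ} {d : ℝ} (hd : d ≤ 1) (h : ∀ k : ℤ, d ≤ ‖s + 2 * k‖) :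
    d / 2 ≤ ‖1 - Complex.exp (π * I * s)‖ := by
  obtain ⟨k, hk⟩ := exists_translate s.re
  have he : Complex.exp (π * I * s) = Complex.exp (π * I * (s + 2 * k)) := by
    rw [mul_add, show (π * I * (2 * k) : ℂ) = k * (2 * π * I) by ring, Complex.exp_add,
      Complex.exp_int_mul_two_pi_mul_I, mul_one]
  have hd' := h k
  rw [he]
  set t := s + 2 * k with ht
  have hre : |t.re| ≤ 1 := by simpa [ht] using hk
  have hn : ‖Complex.exp (π * I * t)‖ = rexp (-(π * t.im)) := by
    rw [Complex.norm_exp, mul_assoc, Complex.re_ofReal_mul]; simp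
  rcases le_or_gt (1 / 2) t.im with h1 | h1
  · have h2 := norm_sub_norm_le 1 (Complex.exp (π * I * t))
    rw [hn, norm_one] at h2
    have h3 : rexp (-(π * t.im)) ≤ 1 / 2 := by
      rw [Real.exp_neg, ← one_div]
      refine one_div_le_one_div_of_le two_pos ?_
      have := Real.add_one_le_exp (π * t.im)
      nlinarith [Real.pi_gt_three]
    linarith
  · have e1 : ‖1 - Complex.exp (π * I * t)‖ ^ 2 = 4 * rexp (-(π * t.im)) *
        (Real.sinh (π * t.im / 2) ^ 2 + Real.sin (π * t.re / 2) ^ 2) := by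
      rw [← Complex.normSq_eq_norm_sq, Complex.normSq_apply, Complex.sub_re, Complex.sub_im,
        Complex.exp_re, Complex.exp_im]
      have a1 : (π * I * t : ℂ).re = -(π * t.im) := by
        rw [mul_assoc, Complex.re_ofReal_mul]; simp
      have a2 : (π * I * t : ℂ).im = 2 * (π * t.re / 2) := by
        rw [mul_assoc, Complex.im_ofReal_mul]; simp; ring
      rw [a1, a2, Real.cos_two_mul, Real.sinh_eq]
      have a3 : rexp (-(π * t.im)) = rexp (-(π * t.im / 2)) ^ 2 := by
        rw [← Real.exp_nat_mul]; ring_nf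
      have a4 : rexp (π * t.im / 2) * rexp (-(π * t.im / 2)) = 1 := by rw [← Real.exp_add]; simp
      have a5 := Real.sin_sq_add_cos_sq (π * t.re / 2)
      have a6 := Real.sin_sq_add_cos_sq (2 * (π * t.re / 2))
      rw [Real.cos_two_mul] at a6
      rw [a3]
      set q := rexp (-(π * t.im / 2))
      set Q := rexp (π * t.im / 2)
      set c := Real.cos (π * t.re / 2)
      simp only [Complex.one_re, Complex.one_im]
      linear_combination q ^ 4 * a6 - 4 * q ^ 2 * a5 - (Q * q + 1 - 2 * q ^ 2) * a4
    have e2 : t.im ^ 2 ≤ Real.sinh (π * t.im / 2) ^ 2 := by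
      have b1 : |t.im| ≤ |Real.sinh (π * t.im / 2)| := by
        rw [Real.abs_sinh]
        have : |t.im| ≤ |π * t.im / 2| := by
          rw [abs_div, abs_mul, abs_of_pos Real.pi_pos, abs_of_pos (two_pos (α := ℝ))]
          nlinarith [abs_nonneg t.im, Real.pi_gt_three]
        exact this.trans (Real.self_le_sinh_iff.mpr (abs_nonneg _))
      exact sq_le_sq.mpr b1
    have e3 : t.re ^ 2 ≤ Real.sin (π * t.re / 2) ^ 2 := by
      have b1 : |t.re| ≤ |Real.sin (π * t.re / 2)| := by
        have hj := Real.mul_le_sin (x := π * |t.re| / 2) (by positivity)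
          (by nlinarith [Real.pi_pos])
        have : 2 / π * (π * |t.re| / 2) = |t.re| := by field_simp
        rw [this] at hj
        refine hj.trans ?_
        rcases abs_cases t.re with ⟨h, -⟩ | ⟨h, -⟩
        · rw [h]; exact le_abs_self _
        · rw [h, mul_neg, neg_div, Real.sin_neg]; exact neg_le_abs _
      exact sq_le_sq.mpr b1
    have e4 : 1 / 16 ≤ rexp (-(π * t.im)) := by
      have : rexp (-2) ≤ rexp (-(π * t.im)) :=
        Real.exp_le_exp.mpr (by nlinarith [Real.pi_lt_four, Real.pi_pos])
      refine le_trans ?_ this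
      rw [Real.exp_neg, ← one_div]
      refine one_div_le_one_div_of_le (Real.exp_pos _) ?_
      have h4 : rexp 2 = rexp 1 ^ 2 := by rw [← Real.exp_nat_mul]; norm_num
      rw [h4]
      nlinarith [Real.exp_one_lt_d9, Real.exp_pos 1]
    have e5 := norm_sq_eq_re_im t
    have e6 : ‖t‖ ^ 2 / 4 ≤ ‖1 - Complex.exp (π * I * t)‖ ^ 2 := by
      rw [e1, e5]
      have : 0 ≤ t.re ^ 2 + t.im ^ 2 := by positivity
      nlinarith
    have e7 : ‖t‖ / 2 ≤ ‖1 - Complex.exp (π * I * t)‖ := by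
      refine le_of_sq_le_sq ?_ (norm_nonneg _)
      rw [div_pow]; linarith
    linarith

/-! ### Periodic Cauchy integrals along circular arcs -/

/-- A holomorphic function on the upper half plane, vanishing to second order at the cusps of the
lens. -/
structure LensBound (ω : ℂ → ℂ) (B : ℝ) : Prop where
  diff : DifferentiableOn ℂ ω {s | 0 < s.im}
  bound : ∀ z ∈ lens, ‖ω z‖ ≤ B * z.im ^ 2

noncomputable def cauchyIntegrand (ω : ℂ → ℂ) (τ ζ : ℂ) : ℂ :=
  ω (arc ζ) * arcDeriv ζ / 2 / (1 - Complex.exp (π * I * (τ - arc ζ)))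

noncomputable def cauchyInt (ω : ℂ → ℂ) (α : ℝ) (τ : ℂ) : ℂ :=
  ∫ s : ℝ, cauchyIntegrand ω τ (s + α * I)

lemma I_mem_lens : I ∈ lens := by
  refine ⟨by simp, by simp, by simp⟩

lemma LensBound.nonneg {ω : ℂ → ℂ} {B : ℝ} (h : LensBound ω B) : 0 ≤ B := by
  have := h.bound I I_mem_lens
  simp only [Complex.I_im, one_pow, mul_one] at this
  exact (norm_nonneg _).trans this

lemma norm_numerator_le {ω : ℂ → ℂ} {B : ℝ} (h : LensBound ω B) {ζ : ℂ} (h0 : π / 4 ≤ ζ.im)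
    (h1 : ζ.im ≤ π / 2) : ‖ω (arc ζ) * arcDeriv ζ / 2‖ ≤ B * (arc ζ).im ^ 3 := by
  obtain ⟨hl, hd, -, -⟩ := arc_mem_lens h0 h1
  have h2 := h.bound _ hl
  have hB := h.nonneg
  rw [norm_div, norm_mul, Complex.norm_ofNat, div_le_iff₀ two_pos]
  calc _ ≤ B * (arc ζ).im ^ 2 * (2 * (arc ζ).im) := by gcongr
    _ = _ := by ring

section Horizontal

variable {α : ℝ}

lemma horizontal_re (s : ℝ) : ((s : ℂ) + α * I).re = s := by simp

lemma horizontal_im (s : ℝ) : ((s : ℂ) + α * I).im = α := by simp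

lemma differentiableOn_arc : DifferentiableOn ℂ arc {ζ | 0 < ζ.im ∧ ζ.im < π} := fun _ h =>
  (hasDerivAt_arc h.1 h.2).differentiableAt.differentiableWithinAt

lemma differentiableOn_numerator {ω : ℂ → ℂ} {B : ℝ} (h : LensBound ω B) :
    DifferentiableOn ℂ (fun ζ => ω (arc ζ) * arcDeriv ζ / 2) {ζ | 0 < ζ.im ∧ ζ.im < π} := by
  refine ((h.diff.comp differentiableOn_arc fun ζ hζ => arc_im_pos hζ.1 hζ.2).mul ?_).div_const 2
  unfold arcDeriv
  exact DifferentiableOn.div (by fun_prop) (by fun_prop)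
    fun ζ hζ => pow_ne_zero 2 (exp_add_one_ne_zero hζ.1 hζ.2)

lemma continuous_numerator {ω : ℂ → ℂ} {B : ℝ} (h : LensBound ω B) (h0 : 0 < α) (h1 : α < π) :
    Continuous fun s : ℝ => ω (arc (s + α * I)) * arcDeriv (s + α * I) / 2 :=
  (differentiableOn_numerator h).continuousOn.comp_continuous (by fun_prop) fun s => by
    simpa using ⟨h0, h1⟩

lemma continuous_arc_horizontal (h0 : 0 < α) (h1 : α < π) :
    Continuous fun s : ℝ => arc (s + α * I) :=
  differentiableOn_arc.continuousOn.comp_continuous (by fun_prop) fun s => by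
    simpa using ⟨h0, h1⟩

lemma cauchyInt_bound {ω : ℂ → ℂ} {B c : ℝ} (h : LensBound ω B) (h0 : π / 4 ≤ α) (h1 : α ≤ π / 2)
    (hc : 0 < c) {τ : ℂ} (hk : ∀ s : ℝ, c * (arc (s + α * I)).im ≤
      ‖1 - Complex.exp (π * I * (τ - arc (s + α * I)))‖) :
    Integrable (fun s : ℝ => cauchyIntegrand ω τ (s + α * I)) ∧
      ‖cauchyInt ω α τ‖ ≤ 2 * B / c * π := by
  have hπ := Real.pi_pos
  have hB := h.nonneg
  have hpos : ∀ s : ℝ, 0 < (arc (s + α * I)).im := fun s =>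
    arc_im_pos (by rw [horizontal_im]; linarith) (by rw [horizontal_im]; linarith)
  have hb : ∀ s : ℝ, ‖cauchyIntegrand ω τ (s + α * I)‖ ≤ 2 * B / c * (1 + s ^ 2)⁻¹ := by
    intro s
    have hn := norm_numerator_le h (ζ := s + α * I) (by rwa [horizontal_im]) (by rwa [horizontal_im])
    obtain ⟨-, -, b1, b2⟩ := arc_mem_lens (ζ := s + α * I) (by rwa [horizontal_im])
      (by rwa [horizontal_im])
    rw [horizontal_re] at b2
    have hp := hpos s
    set b := (arc (s + α * I)).im
    rw [cauchyIntegrand, norm_div]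
    calc _ ≤ B * b ^ 3 / (c * b) := by gcongr; exact hk s
      _ = B / c * (b * b) := by field_simp
      _ ≤ B / c * (1 * (2 * (1 + s ^ 2)⁻¹)) := by gcongr
      _ = _ := by ring
  have hcont : Continuous fun s : ℝ => cauchyIntegrand ω τ (s + α * I) := by
    refine (continuous_numerator h (by linarith) (by linarith)).div ?_ fun s hs => ?_
    · have := continuous_arc_horizontal (α := α) (by linarith) (by linarith)
      fun_prop
    · have h3 := hk s
      rw [hs, norm_zero] at h3
      have := mul_pos hc (hpos s)
      linarith
  have hint : Integrable fun s : ℝ => 2 * B / c * (1 + s ^ 2)⁻¹ :=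
    integrable_inv_one_add_sq.const_mul _
  refine ⟨hint.mono' hcont.aestronglyMeasurable (Filter.Eventually.of_forall hb), ?_⟩
  refine (norm_integral_le_of_norm_le hint (Filter.Eventually.of_forall hb)).trans (le_of_eq ?_)
  rw [integral_const_mul, integral_univ_inv_one_add_sq]

lemma differentiableAt_cauchyInt {ω : ℂ → ℂ} {B d : ℝ} (h : LensBound ω B) (h0 : π / 4 ≤ α)
    (h1 : α ≤ π / 2) (hd : 0 < d) (hd1 : d ≤ 1) {τ : ℂ} (hτ : 0 < τ.im)
    (hk : ∀ (s : ℝ) (k : ℤ), 2 * d ≤ ‖τ - arc (s + α * I) + 2 * k‖) :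
    DifferentiableAt ℂ (cauchyInt ω α) τ := by
  have hπ := Real.pi_pos
  have hB := h.nonneg
  have hker : ∀ σ ∈ Metric.ball τ d, ∀ s : ℝ,
      d / 2 ≤ ‖1 - Complex.exp (π * I * (σ - arc (s + α * I)))‖ := by
    intro σ hσ s
    refine le_norm_one_sub_exp hd1 fun k => ?_
    have h2 := hk s k
    have h3 : ‖τ - σ‖ < d := by rwa [Metric.mem_ball, dist_comm, dist_eq_norm] at hσ
    have h4 := norm_add_le (σ - arc (s + α * I) + 2 * k) (τ - σ)
    rw [show σ - arc (s + α * I) + 2 * k + (τ - σ) = τ - arc (s + α * I) + 2 * k by ring] at h4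
    linarith
  have hpos : ∀ s : ℝ, 0 < (arc (s + α * I)).im ∧ (arc (s + α * I)).im ≤ 1 := fun s =>
    ⟨arc_im_pos (by rw [horizontal_im]; linarith) (by rw [horizontal_im]; linarith),
      (arc_mem_lens (by rwa [horizontal_im]) (by rwa [horizontal_im])).2.2.1⟩
  have hint : ∀ σ ∈ Metric.ball τ d,
      Integrable fun s : ℝ => cauchyIntegrand ω σ (s + α * I) := fun σ hσ =>
    (cauchyInt_bound h h0 h1 (half_pos hd) fun s => (mul_le_of_le_one_right (by positivity)
      (hpos s).2).trans (hker σ hσ s)).1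
  have hne : ∀ σ ∈ Metric.ball τ d, ∀ s : ℝ,
      1 - Complex.exp (π * I * (σ - arc (s + α * I))) ≠ 0 := fun σ hσ s h0 => by
    have := hker σ hσ s
    rw [h0, norm_zero] at this
    linarith
  have hc := continuous_arc_horizontal (α := α) (by linarith) (by linarith)
  have hcn := continuous_numerator h (α := α) (by linarith) (by linarith)
  have hball : Metric.ball τ d ∈ nhds τ := Metric.ball_mem_nhds _ hd
  refine (hasDerivAt_integral_of_dominated_loc_of_deriv_le
    (F' := fun σ s => ω (arc (s + α * I)) * arcDeriv (s + α * I) / 2 *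
      (Complex.exp (π * I * (σ - arc (s + α * I))) * (π * I)) /
        (1 - Complex.exp (π * I * (σ - arc (s + α * I)))) ^ 2)
    (bound := fun s => 2 * B * (1 + s ^ 2)⁻¹ * (rexp (2 * π) * π / (d / 2) ^ 2))
    hball (Filter.eventually_of_mem hball fun σ hσ => (hint σ hσ).aestronglyMeasurable)
    (hint τ (Metric.mem_ball_self hd)) ?_ ?_ ?_ ?_).2.differentiableAt
  · refine Continuous.aestronglyMeasurable ?_
    refine (hcn.mul (by fun_prop)).div (by fun_prop) fun s =>
      pow_ne_zero 2 (hne τ (Metric.mem_ball_self hd) s)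
  · refine Filter.Eventually.of_forall fun s σ hσ => ?_
    have hn := norm_numerator_le h (ζ := s + α * I) (by rwa [horizontal_im]) (by rwa [horizontal_im])
    obtain ⟨-, -, -, b2⟩ := arc_mem_lens (ζ := s + α * I) (by rwa [horizontal_im])
      (by rwa [horizontal_im])
    rw [horizontal_re] at b2
    obtain ⟨b0, b1⟩ := hpos s
    have hk2 := hker σ hσ s
    have hσim : -1 < σ.im := by
      have h3 : ‖τ - σ‖ < d := by rwa [Metric.mem_ball, dist_comm, dist_eq_norm] at hσ
      have := (abs_le.mp (Complex.abs_im_le_norm (τ - σ))).2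
      rw [Complex.sub_im] at this
      linarith
    have he : ‖Complex.exp (π * I * (σ - arc (s + α * I)))‖ ≤ rexp (2 * π) := by
      rw [Complex.norm_exp, mul_assoc, Complex.re_ofReal_mul]
      refine Real.exp_le_exp.mpr ?_
      simp only [Complex.mul_re, Complex.I_re, zero_mul, Complex.I_im, one_mul, zero_sub,
        Complex.sub_im]
      nlinarith
    rw [norm_div, norm_mul, norm_mul (Complex.exp _), norm_pow, norm_mul, Complex.norm_I, mul_one,
      Complex.norm_real, Real.norm_of_nonneg hπ.le]
    set b := (arc (s + α * I)).im
    have hb3 : B * b ^ 3 ≤ 2 * B * (1 + s ^ 2)⁻¹ := by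
      have : b ^ 3 ≤ 2 * (1 + s ^ 2)⁻¹ := le_trans (by nlinarith [sq_nonneg b]) b2
      nlinarith
    rw [mul_div_assoc]
    exact mul_le_mul (hn.trans hb3) (div_le_div₀ (by positivity)
      (mul_le_mul_of_nonneg_right he hπ.le) (by positivity)
      (pow_le_pow_left₀ (by positivity) hk2 2)) (by positivity) (by positivity)
  · exact (integrable_inv_one_add_sq.const_mul _).mul_const _
  · refine Filter.Eventually.of_forall fun s σ hσ => ?_
    have h3 : HasDerivAt (fun σ => 1 - Complex.exp (π * I * (σ - arc (s + α * I))))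
        (-(Complex.exp (π * I * (σ - arc (s + α * I))) * (π * I))) σ := by
      have := ((((hasDerivAt_id σ).sub_const (arc (s + α * I))).const_mul (π * I)).cexp).const_sub 1
      simpa using this
    have h4 := (hasDerivAt_const σ (ω (arc (s + α * I)) * arcDeriv (s + α * I) / 2)).fun_div h3
      (hne σ hσ s)
    refine h4.congr_deriv ?_
    ring

end Horizontal

lemma quarter_dist {z σ : ℂ} (hz : z ∈ lens) (hz1 : ‖z‖ ^ 2 + 2 * z.im = 1) (_ : z.im ≤ 1)
    (hσ : 1 ≤ ‖σ‖ ^ 2 + σ.im) : z.im / 4 ≤ ‖σ - z‖ := by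
  by_contra! hlt
  have h1 : ‖σ‖ ≤ ‖σ - z‖ + ‖z‖ := by simpa using norm_add_le (σ - z) z
  have h2 := (abs_le.mp (Complex.abs_im_le_norm (σ - z))).2
  rw [Complex.sub_im] at h2
  have h3 : ‖σ‖ ≤ ‖z‖ + z.im / 4 := by linarith
  have h4 : ‖σ‖ ^ 2 ≤ (‖z‖ + z.im / 4) ^ 2 := by gcongr
  nlinarith [hz.1, hz.2.1, norm_nonneg z]

lemma half_norm_translate {z : ℂ} (hz : ‖z‖ = 1) (k : ℤ) : 1 ≤ ‖z + 2 * k‖ := by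
  by_cases hk : k = 0
  · simp [hk, hz]
  · have h1 : (1 : ℝ) ≤ |(k : ℝ)| := by exact_mod_cast Int.one_le_abs hk
    have h2 : ‖(2 * k : ℂ)‖ ≤ ‖z + 2 * k‖ + ‖z‖ := by
      simpa using norm_sub_le (z + 2 * k) z
    rw [norm_mul, Complex.norm_ofNat, Complex.norm_intCast] at h2
    linarith

lemma half_dist {z τ : ℂ} (hz : 0 < z.im) (hz1 : ‖z‖ = 1) (hτ : ‖τ‖ ^ 2 + τ.im ≤ 1) (k : ℤ) :
    z.im / 4 ≤ ‖τ - z + 2 * k‖ := by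
  by_contra! hlt
  have h0 := half_norm_translate hz1 (-k)
  have h1 : ‖z + 2 * (-k : ℤ)‖ ≤ ‖τ‖ + ‖τ - z + 2 * k‖ := by
    have := norm_sub_le τ (τ - z + 2 * k)
    rwa [show τ - (τ - z + 2 * k) = z + 2 * (-k : ℤ) by push_cast; ring] at this
  have h2 := (abs_le.mp (Complex.abs_im_le_norm (τ - z + 2 * k))).1
  simp at h2
  have hz2 : z.im ≤ 1 := by
    have := (abs_le.mp (Complex.abs_im_le_norm z)).2
    linarith
  have h3 : 1 - z.im / 4 ≤ ‖τ‖ := by linarith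
  nlinarith

section Bounds

variable {ω : ℂ → ℂ} {B : ℝ} {τ : ℂ}

lemma cauchyInt_quarter_bound (h : LensBound ω B)
    (hτ : ∀ k : ℤ, 1 ≤ ‖τ + 2 * k‖ ^ 2 + τ.im) :
    Integrable (fun s : ℝ => cauchyIntegrand ω τ (s + (π / 4 : ℝ) * I)) ∧
      ‖cauchyInt ω (π / 4) τ‖ ≤ 16 * B * π := by
  have := cauchyInt_bound h (α := π / 4) (c := 1 / 8) (τ := τ) le_rfl (by linarith [Real.pi_pos])
    (by norm_num) fun s => by
      obtain ⟨hl, -, h1, -⟩ := arc_mem_lens (ζ := s + (π / 4 : ℝ) * I) (by rw [horizontal_im])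
        (by rw [horizontal_im]; linarith [Real.pi_pos])
      have h3 := norm_sq_arc_quarter (ζ := s + (π / 4 : ℝ) * I) (horizontal_im s)
      have := le_norm_one_sub_exp (s := τ - arc (s + (π / 4 : ℝ) * I))
        (d := (arc (s + (π / 4 : ℝ) * I)).im / 4) (by linarith) fun k => by
          rw [show τ - arc (s + (π / 4 : ℝ) * I) + 2 * k = τ + 2 * k - arc (s + (π / 4 : ℝ) * I) by
            ring]
          exact quarter_dist hl h3 h1 (by simpa using hτ k)
      linarith
  refine ⟨this.1, this.2.trans (le_of_eq ?_)⟩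
  ring

lemma cauchyInt_half_bound (h : LensBound ω B) (hτ : ‖τ‖ ^ 2 + τ.im ≤ 1) :
    ‖cauchyInt ω (π / 2) τ‖ ≤ 16 * B * π := by
  have := (cauchyInt_bound h (α := π / 2) (c := 1 / 8) (τ := τ) (by linarith [Real.pi_pos]) le_rfl
    (by norm_num) fun s => by
      obtain ⟨hl, -, h1, -⟩ := arc_mem_lens (ζ := s + (π / 2 : ℝ) * I)
        (by rw [horizontal_im]; linarith [Real.pi_pos]) (by rw [horizontal_im])
      have h3 := norm_arc_half (ζ := s + (π / 2 : ℝ) * I) (horizontal_im s)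
      have := le_norm_one_sub_exp (s := τ - arc (s + (π / 2 : ℝ) * I))
        (d := (arc (s + (π / 2 : ℝ) * I)).im / 4) (by linarith) (half_dist hl.1 h3 hτ)
      linarith).2
  refine this.trans (le_of_eq ?_)
  ring

lemma half_kernel_dist {n : ℤ} (s : ℝ) (k : ℤ) :
    1 - ‖τ - 2 * n‖ ≤ ‖τ - arc (s + (π / 2 : ℝ) * I) + 2 * k‖ := by
  have h3 := norm_arc_half (ζ := s + (π / 2 : ℝ) * I) (horizontal_im s)
  have h0 := half_norm_translate h3 (-(k + n))
  have := norm_sub_le (τ - 2 * n) (τ - arc (s + (π / 2 : ℝ) * I) + 2 * k)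
  rw [show τ - 2 * n - (τ - arc (s + (π / 2 : ℝ) * I) + 2 * k) =
    arc (s + (π / 2 : ℝ) * I) + 2 * (-(k + n) : ℤ) by push_cast; ring] at this
  linarith

lemma differentiableAt_cauchyInt_half (h : LensBound ω B) (hτ : 0 < τ.im) {n : ℤ}
    (hn : ‖τ - 2 * n‖ < 1) : DifferentiableAt ℂ (cauchyInt ω (π / 2)) τ := by
  refine differentiableAt_cauchyInt h (by linarith [Real.pi_pos]) le_rfl
    (d := (1 - ‖τ - 2 * n‖) / 2) (by linarith) (by linarith [norm_nonneg (τ - 2 * n)]) hτ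
    fun s k => ?_
  rw [mul_div_cancel₀ _ two_ne_zero]
  exact half_kernel_dist s k

lemma integrable_cauchyIntegrand_half (h : LensBound ω B) {n : ℤ} (hn : ‖τ - 2 * n‖ < 1) :
    Integrable fun s : ℝ => cauchyIntegrand ω τ (s + (π / 2 : ℝ) * I) := by
  refine (cauchyInt_bound h (α := π / 2) (c := (1 - ‖τ - 2 * n‖) / 2) (by linarith [Real.pi_pos])
    le_rfl (by linarith) fun s => ?_).1
  have h1 := (arc_mem_lens (ζ := s + (π / 2 : ℝ) * I)
        (by rw [horizontal_im]; linarith [Real.pi_pos]) (by rw [horizontal_im])).2.2.1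
  refine (mul_le_of_le_one_right (by linarith) h1).trans (le_norm_one_sub_exp ?_ fun k =>
    half_kernel_dist s k)
  linarith [norm_nonneg (τ - 2 * n)]

lemma differentiableAt_cauchyInt_quarter (h : LensBound ω B) (hτ : 0 < τ.im)
    (hk : ∀ k : ℤ, 1 ≤ ‖τ + 2 * k‖) : DifferentiableAt ℂ (cauchyInt ω (π / 4)) τ := by
  refine differentiableAt_cauchyInt h le_rfl (by linarith [Real.pi_pos])
    (d := min (1 / 10) (τ.im / 10)) (by positivity) ((min_le_left _ _).trans (by norm_num)) hτ
    fun s k => ?_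
  by_contra! hlt
  obtain ⟨hl, -, h1, -⟩ := arc_mem_lens (ζ := s + (π / 4 : ℝ) * I) (by rw [horizontal_im])
    (by rw [horizontal_im]; linarith [Real.pi_pos])
  have h3 := norm_sq_arc_quarter (ζ := s + (π / 4 : ℝ) * I) (horizontal_im s)
  set z := arc (s + (π / 4 : ℝ) * I)
  have d1 := min_le_left (1 / 10) (τ.im / 10)
  have d2 := min_le_right (1 / 10) (τ.im / 10)
  have d0 : 0 < min (1 / 10) (τ.im / 10) := by positivity
  set d := min (1 / 10) (τ.im / 10)
  have h4 : ‖τ + 2 * k‖ ≤ ‖z‖ + 2 * d := by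
    have := norm_add_le (τ - z + 2 * k) z
    rw [show τ - z + 2 * k + z = τ + 2 * k by ring] at this
    linarith
  have h5 := (abs_le.mp (Complex.abs_im_le_norm (τ - z + 2 * k))).2
  simp at h5
  nlinarith [hk k, hl.2.1, norm_nonneg z]

end Bounds

/-! ### The jump across the arc and the periodic Cauchy transform -/

section Jump

variable {ω : ℂ → ℂ} {B : ℝ} {τ : ℂ}

lemma one_le_norm_add_two_mul_int (hτ : ‖τ‖ < 1) {k : ℤ} (hk : k ≠ 0) :
    2 - ‖τ‖ ≤ ‖τ + 2 * k‖ ∧ 1 ≤ ‖τ + 2 * k‖ := by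
  have h1 : (1 : ℝ) ≤ |(k : ℝ)| := by exact_mod_cast Int.one_le_abs hk
  have h2 : ‖(2 * k : ℂ)‖ ≤ ‖τ + 2 * k‖ + ‖τ‖ := by
    simpa using norm_sub_le (τ + 2 * k) τ
  rw [norm_mul, Complex.norm_ofNat, Complex.norm_intCast] at h2
  constructor <;> linarith

lemma integrable_cauchyIntegrand_quarter (h : LensBound ω B) (hτ : 0 < τ.im) (h1 : ‖τ‖ < 1)
    (h2 : 1 < ‖τ‖ ^ 2 + 2 * τ.im) :
    Integrable fun s : ℝ => cauchyIntegrand ω τ (s + (π / 4 : ℝ) * I) := by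
  have hπ := Real.pi_pos
  set g := min (min (‖τ‖ ^ 2 + 2 * τ.im - 1) τ.im) 1 with hg
  have g0 : 0 < g := lt_min (lt_min (by linarith) hτ) one_pos
  have g1 : g ≤ ‖τ‖ ^ 2 + 2 * τ.im - 1 := (min_le_left _ _).trans (min_le_left _ _)
  have g2 : g ≤ τ.im := (min_le_left _ _).trans (min_le_right _ _)
  have g3 : g ≤ 1 := min_le_right _ _
  refine (cauchyInt_bound h (α := π / 4) (c := g / 20) le_rfl (by linarith) (by positivity)
    fun s => ?_).1
  obtain ⟨hl, -, hz1, -⟩ := arc_mem_lens (ζ := s + (π / 4 : ℝ) * I) (by rw [horizontal_im])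
    (by rw [horizontal_im]; linarith)
  have h3 := norm_sq_arc_quarter (ζ := s + (π / 4 : ℝ) * I) (horizontal_im s)
  set z := arc (s + (π / 4 : ℝ) * I)
  refine (mul_le_of_le_one_right (by positivity) hz1).trans ?_
  have := le_norm_one_sub_exp (s := τ - z) (d := g / 10) (by linarith) fun k => ?_
  · linarith
  by_contra! hlt
  have h4 : ‖τ + 2 * k‖ ≤ ‖z‖ + g / 10 := by
    have := norm_add_le (τ - z + 2 * k) z
    rw [show τ - z + 2 * k + z = τ + 2 * k by ring] at this
    linarith
  have h5 := (abs_le.mp (Complex.abs_im_le_norm (τ - z + 2 * k))).2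
  simp at h5
  have h6 : 1 + g ≤ ‖τ + 2 * k‖ ^ 2 + 2 * τ.im := by
    by_cases hk : k = 0
    · simp only [hk, Int.cast_zero, mul_zero, add_zero]; linarith
    · nlinarith [(one_le_norm_add_two_mul_int h1 hk).2]
  have h7 : ‖τ + 2 * k‖ ^ 2 ≤ (‖z‖ + g / 10) ^ 2 := by gcongr
  nlinarith [hl.2.1, norm_nonneg z]

lemma exp_sub_eq_one {s : ℂ} (h : 1 - Complex.exp (π * I * s) = 0) : ∃ k : ℤ, s = 2 * k := by
  obtain ⟨n, hn⟩ := Complex.exp_eq_one_iff.mp (sub_eq_zero.mp h).symm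
  refine ⟨n, ?_⟩
  have : (π * I : ℂ) ≠ 0 := mul_ne_zero (by exact_mod_cast Real.pi_ne_zero) Complex.I_ne_zero
  refine mul_left_cancel₀ this ?_
  rw [hn]; ring

lemma tendsto_side {h : LensBound ω B} (hτ : 0 < τ.im) {c : ℝ} (hc : |c| = 1) :
    Filter.Tendsto (fun T : ℝ => I * ∫ y in (π / 4)..(π / 2),
      cauchyIntegrand ω τ (((c * T : ℝ) : ℂ) + y * I)) Filter.atTop (nhds 0) := by
  have hπ := Real.pi_pos
  have hB := h.nonneg
  rw [tendsto_zero_iff_norm_tendsto_zero]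
  set d := min 1 (τ.im / 2)
  have d0 : 0 < d := lt_min one_pos (by linarith)
  have hlim : Filter.Tendsto (fun T : ℝ => 4 * B / d * (1 + T ^ 2)⁻¹ * |π / 2 - π / 4|)
      Filter.atTop (nhds 0) := by
    rw [show (0 : ℝ) = 4 * B / d * 0 * |π / 2 - π / 4| by ring]
    refine (Filter.Tendsto.const_mul _ ?_).mul_const _
    exact (Filter.tendsto_atTop_add_const_left _ _
      (Filter.tendsto_pow_atTop two_ne_zero)).inv_tendsto_atTop
  have hev : ∀ᶠ T : ℝ in Filter.atTop, 2 * (1 + T ^ 2)⁻¹ < τ.im / 2 := by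
    have : Filter.Tendsto (fun T : ℝ => 2 * (1 + T ^ 2)⁻¹) Filter.atTop (nhds (2 * 0)) :=
      ((Filter.tendsto_atTop_add_const_left _ _
        (Filter.tendsto_pow_atTop two_ne_zero)).inv_tendsto_atTop).const_mul _
    rw [mul_zero] at this
    exact this.eventually_lt_const (by linarith)
  refine squeeze_zero' (Filter.Eventually.of_forall fun _ => norm_nonneg _) ?_ hlim
  filter_upwards [hev] with T hT
  rw [norm_mul, Complex.norm_I, one_mul]
  refine intervalIntegral.norm_integral_le_of_norm_le_const fun y hy => ?_
  rw [Set.uIoc_of_le (by linarith)] at hy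
  have e1 := horizontal_im (α := y) (c * T)
  have hn := norm_numerator_le h (ζ := ((c * T : ℝ) : ℂ) + y * I) (by rw [e1]; exact hy.1.le)
    (by rw [e1]; exact hy.2)
  obtain ⟨hl, -, b1, b2⟩ := arc_mem_lens (ζ := ((c * T : ℝ) : ℂ) + y * I)
    (by rw [e1]; exact hy.1.le) (by rw [e1]; exact hy.2)
  rw [horizontal_re, mul_pow, ← sq_abs c, hc, one_pow, one_mul] at b2
  set z := arc (((c * T : ℝ) : ℂ) + y * I)
  have hk := le_norm_one_sub_exp (s := τ - z) (d := d) (min_le_left _ _) fun k => by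
    have h5 := (abs_le.mp (Complex.abs_im_le_norm (τ - z + 2 * k))).2
    simp at h5
    have := min_le_right 1 (τ.im / 2)
    linarith
  have hz := hl.1
  rw [cauchyIntegrand, norm_div]
  calc _ ≤ B * z.im ^ 3 / (d / 2) := by gcongr
    _ = 2 * B / d * (z.im ^ 2 * z.im) := by field_simp
    _ ≤ 2 * B / d * (1 * (2 * (1 + T ^ 2)⁻¹)) := by
        gcongr
        exact pow_le_one₀ hz.le b1
    _ = _ := by ring

/-- The jump of the Cauchy integral when the pole is crossed. -/
lemma cauchyInt_jump (h : LensBound ω B) (hτ : 0 < τ.im) (h1 : ‖τ‖ < 1)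
    (h2 : 1 < ‖τ‖ ^ 2 + 2 * τ.im) :
    cauchyInt ω (π / 4) τ = cauchyInt ω (π / 2) τ + ω τ := by
  have hπ := Real.pi_pos
  obtain ⟨w, w0, w1, hw⟩ := arc_log hτ
  have hD := arcDenom_pos w0 w1
  have hcos : 0 < Real.cos w.im := by
    have := norm_sq_arc w0 w1
    rw [hw] at this
    have h3 : ‖τ‖ ^ 2 < 1 := by nlinarith [norm_nonneg τ]
    by_contra! hc
    have : 2 * Real.cos w.im / arcDenom w ≤ 0 := div_nonpos_of_nonpos_of_nonneg (by linarith) hD.le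
    linarith
  have hw2 : w.im < π / 2 := by
    by_contra! hc
    have := Real.cos_nonpos_of_pi_div_two_le_of_le hc (by linarith)
    linarith
  have hsc : Real.cos w.im < Real.sin w.im := by
    have e1 := norm_sq_arc w0 w1
    have e2 := arc_im w0 w1
    rw [hw] at e1 e2
    rw [e1, e2] at h2
    have : Real.cos w.im / arcDenom w < Real.sin w.im / arcDenom w := by
      have e3 : 2 * Real.cos w.im / arcDenom w = 2 * (Real.cos w.im / arcDenom w) := by ring
      linarith
    rwa [div_lt_div_iff_of_pos_right hD] at this
  have hw4 : π / 4 < w.im := by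
    by_contra! hc
    have c1 : Real.sin w.im ≤ Real.sin (π / 4) :=
      Real.sin_le_sin_of_le_of_le_pi_div_two (by linarith) (by linarith) hc
    have c2 : Real.cos (π / 4) ≤ Real.cos w.im :=
      Real.cos_le_cos_of_nonneg_of_le_pi w0.le (by linarith) hc
    rw [Real.sin_pi_div_four] at c1
    rw [Real.cos_pi_div_four] at c2
    linarith
  set f : ℂ → ℂ := fun ζ => ω (arc ζ) * arcDeriv ζ / 2 with hf
  set g : ℂ → ℂ := fun ζ => 1 - Complex.exp (π * I * (τ - arc ζ)) with hg
  set S : Set ℂ := {ζ | 0 < ζ.im ∧ ζ.im < π} with hS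
  have hSo : IsOpen S := by
    have a : IsOpen {ζ : ℂ | 0 < ζ.im} := isOpen_lt continuous_const Complex.continuous_im
    have b : IsOpen {ζ : ℂ | ζ.im < π} := isOpen_lt Complex.continuous_im continuous_const
    exact a.inter b
  set U : Set ℂ := S ∩ (fun ζ => ‖arc ζ‖) ⁻¹' Set.Iio (2 - ‖τ‖) with hU
  have hUo : IsOpen U :=
    differentiableOn_arc.continuousOn.norm.isOpen_inter_preimage hSo isOpen_Iio
  have hgd : ∀ ζ ∈ S, HasDerivAt g (π * I * arcDeriv ζ * Complex.exp (π * I * (τ - arc ζ))) ζ := by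
    intro ζ hζ
    have := ((((hasDerivAt_arc hζ.1 hζ.2).const_sub τ).const_mul (π * I)).cexp).const_sub 1
    refine this.congr_deriv ?_
    ring
  have hwS : w ∈ S := ⟨w0, w1⟩
  have hd := (hgd w hwS).deriv
  rw [hw, sub_self, mul_zero, Complex.exp_zero, mul_one] at hd
  have hne0 : (π * I : ℂ) ≠ 0 := mul_ne_zero (by exact_mod_cast Real.pi_ne_zero) Complex.I_ne_zero
  have hA : arcDeriv w ≠ 0 := by
    rw [← norm_pos_iff, norm_arcDeriv w0 w1]; positivity
  have hrect : ∀ T : ℝ, |w.re| < T → rectIntegral (cauchyIntegrand ω τ) (-T) T (π / 4) (π / 2) =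
      ω τ := by
    intro T hT
    have := rectIntegral_div (f := f) (g := g) (w := w) (a := -T) (b := T) (c := π / 4) (d := π / 2)
      hUo ((differentiableOn_numerator h).mono Set.inter_subset_left)
      (fun ζ hζ => (hgd ζ hζ.1).differentiableAt.differentiableWithinAt) ?_
      (by linarith [neg_abs_le w.re]) (by linarith [le_abs_self w.re]) hw4 hw2
      (by simp [hg, hw]) (by rw [hd]; exact mul_ne_zero hne0 hA) ?_
    · rw [show cauchyIntegrand ω τ = fun s => f s / g s from rfl, this, hd, hf]
      simp only [hw]
      field_simp
    · intro ζ hζ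
      rw [Complex.mem_reProdIm] at hζ
      refine ⟨⟨by linarith [hζ.2.1], by linarith [hζ.2.2]⟩, ?_⟩
      have := (arc_mem_lens hζ.2.1 hζ.2.2).1.2.1
      rw [Set.mem_preimage, Set.mem_Iio]
      linarith
    · intro s hs hsw hgs
      obtain ⟨k, hk⟩ := exp_sub_eq_one hgs
      have hs2 : ‖arc s‖ < 2 - ‖τ‖ := hs.2
      by_cases hk0 : k = 0
      · rw [hk0, Int.cast_zero, mul_zero, sub_eq_zero, ← hw] at hk
        exact hsw (arc_injective hs.1.1 hs.1.2 w0 w1 hk.symm)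
      · have := (one_le_norm_add_two_mul_int h1 (neg_ne_zero.mpr hk0)).1
        rw [show τ + 2 * (-k : ℤ) = arc s by push_cast; linear_combination hk] at this
        linarith
  have i4 := integrable_cauchyIntegrand_quarter h hτ h1 h2
  have i2 := integrable_cauchyIntegrand_half (τ := τ) h (n := 0) (by simpa using h1)
  have t4 := intervalIntegral_tendsto_integral i4 Filter.tendsto_neg_atTop_atBot Filter.tendsto_id
  have t2 := intervalIntegral_tendsto_integral i2 Filter.tendsto_neg_atTop_atBot Filter.tendsto_id
  have tr := tendsto_side (ω := ω) (h := h) hτ (c := 1) (by simp)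
  have tl := tendsto_side (ω := ω) (h := h) hτ (c := -1) (by simp)
  have tt := ((t4.sub t2).add tr).sub tl
  rw [add_zero, sub_zero] at tt
  have hc : Filter.Tendsto (fun T : ℝ => rectIntegral (cauchyIntegrand ω τ) (-T) T (π / 4) (π / 2))
      Filter.atTop (nhds (ω τ)) := by
    refine tendsto_const_nhds.congr' ?_
    filter_upwards [Filter.eventually_gt_atTop |w.re|] with T hT
    exact (hrect T hT).symm
  have := tendsto_nhds_unique (tt.congr fun T => by simp [rectIntegral]) hc
  rw [cauchyInt, cauchyInt]
  linear_combination this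

end Jump

section Piece

variable {ω : ℂ → ℂ} {B : ℝ} {τ : ℂ}

lemma cauchyInt_add_two_mul_int (ω : ℂ → ℂ) (α : ℝ) (τ : ℂ) (k : ℤ) :
    cauchyInt ω α (τ + 2 * k) = cauchyInt ω α τ := by
  unfold cauchyInt cauchyIntegrand
  congr 1; ext s; congr 2
  rw [show π * I * (τ + 2 * k - arc (s + α * I)) = π * I * (τ - arc (s + α * I)) +
    k * (2 * π * I) by ring, Complex.exp_add, Complex.exp_int_mul_two_pi_mul_I, mul_one]

open Classical in
/-- The `2`-periodic holomorphic function on the upper half plane whose jump is `ω`. -/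
noncomputable def cauchyPiece (ω : ℂ → ℂ) (τ : ℂ) : ℂ :=
  if h : ∃ n : ℤ, ‖τ - 2 * n‖ < 1 then cauchyInt ω (π / 2) τ + ω (τ - 2 * (h.choose : ℤ))
  else cauchyInt ω (π / 4) τ

lemma disc_index_unique {m n : ℤ} (hm : ‖τ - 2 * m‖ < 1) (hn : ‖τ - 2 * n‖ < 1) : m = n := by
  have h := norm_sub_le (τ - 2 * m) (τ - 2 * n)
  rw [show τ - 2 * m - (τ - 2 * n) = 2 * ((n - m : ℤ) : ℂ) by push_cast; ring, norm_mul,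
    Complex.norm_ofNat, Complex.norm_intCast] at h
  have h1 : |((n - m : ℤ) : ℝ)| < 1 := by linarith
  have h2 : |n - m| < 1 := by exact_mod_cast h1
  rw [Int.abs_lt_one_iff] at h2
  omega

lemma cauchyPiece_of_lt {n : ℤ} (hn : ‖τ - 2 * n‖ < 1) :
    cauchyPiece ω τ = cauchyInt ω (π / 2) τ + ω (τ - 2 * n) := by
  have h : ∃ n : ℤ, ‖τ - 2 * n‖ < 1 := ⟨n, hn⟩
  rw [cauchyPiece, dif_pos h, disc_index_unique h.choose_spec hn]

lemma cauchyPiece_of_le (h : ∀ k : ℤ, 1 ≤ ‖τ + 2 * k‖) :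
    cauchyPiece ω τ = cauchyInt ω (π / 4) τ := by
  rw [cauchyPiece, dif_neg]
  rintro ⟨n, hn⟩
  have := h (-n)
  rw [show τ + 2 * (-n : ℤ) = τ - 2 * n by push_cast; ring] at this
  linarith

lemma norm_translate_cases (τ : ℂ) : (∃ n : ℤ, ‖τ - 2 * n‖ < 1) ∨ ∀ k : ℤ, 1 ≤ ‖τ + 2 * k‖ := by
  by_cases h : ∃ n : ℤ, ‖τ - 2 * n‖ < 1
  · exact Or.inl h
  · refine Or.inr fun k => ?_
    by_contra! hk
    exact h ⟨-k, by rwa [show τ - 2 * (-k : ℤ) = τ + 2 * k by push_cast; ring]⟩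

lemma cauchyPiece_add_two (ω : ℂ → ℂ) (τ : ℂ) : cauchyPiece ω (τ + 2) = cauchyPiece ω τ := by
  have e := fun α => cauchyInt_add_two_mul_int ω α τ 1
  rw [Int.cast_one, mul_one] at e
  rcases norm_translate_cases τ with ⟨n, hn⟩ | h
  · have e1 : τ + 2 - 2 * ((n + 1 : ℤ) : ℂ) = τ - 2 * n := by push_cast; ring
    rw [cauchyPiece_of_lt hn, cauchyPiece_of_lt (n := n + 1) (by rwa [e1]), e1, e]
  · rw [cauchyPiece_of_le h, cauchyPiece_of_le fun k => ?_, e]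
    have := h (k + 1)
    rwa [show τ + 2 * ((k + 1 : ℤ) : ℂ) = τ + 2 + 2 * k by push_cast; ring] at this

lemma cauchyPiece_differentiableAt (h : LensBound ω B) (hτ : 0 < τ.im) :
    DifferentiableAt ℂ (cauchyPiece ω) τ := by
  rcases norm_translate_cases τ with ⟨n, hn⟩ | hk
  · have h1 : DifferentiableAt ℂ (fun σ => cauchyInt ω (π / 2) σ + ω (σ - 2 * n)) τ := by
      refine (differentiableAt_cauchyInt_half h hτ hn).add ?_
      have h2 : DifferentiableAt ℂ ω (τ - 2 * n) :=
        h.diff.differentiableAt ((isOpen_lt continuous_const Complex.continuous_im).mem_nhds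
          (by simpa using hτ))
      exact h2.comp τ (by fun_prop)
    refine h1.congr_of_eventuallyEq ?_
    have : {σ : ℂ | ‖σ - 2 * n‖ < 1} ∈ nhds τ :=
      (isOpen_lt (by fun_prop) continuous_const).mem_nhds hn
    filter_upwards [this] with σ hσ
    exact cauchyPiece_of_lt hσ
  · refine (differentiableAt_cauchyInt_quarter h hτ hk).congr_of_eventuallyEq ?_
    set r := min (τ.im / 4) (1 / 2) with hr
    have r0 : 0 < r := by positivity
    have r1 : r ≤ τ.im / 4 := min_le_left _ _
    have r2 : r ≤ 1 / 2 := min_le_right _ _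
    filter_upwards [Metric.ball_mem_nhds τ r0] with σ hσ
    rw [Metric.mem_ball, dist_eq_norm] at hσ
    rcases norm_translate_cases σ with ⟨n, hn⟩ | h'
    · have him := (abs_le.mp (Complex.abs_im_le_norm (σ - τ))).1
      rw [Complex.sub_im] at him
      have h3 := hk (-n)
      have h4 := norm_sub_le (σ - 2 * n) (σ - τ)
      rw [show σ - 2 * n - (σ - τ) = τ + 2 * (-n : ℤ) by push_cast; ring] at h4
      have h5 : 1 - r < ‖σ - 2 * n‖ := by linarith
      have e := fun α => cauchyInt_add_two_mul_int ω α σ (-n)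
      rw [show σ + 2 * (-n : ℤ) = σ - 2 * n by push_cast; ring] at e
      have e2 : (σ - 2 * n).im = σ.im := by simp
      rw [cauchyPiece_of_lt hn, ← e, ← e, cauchyInt_jump h (by rw [e2]; linarith) hn]
      rw [e2]
      nlinarith
    · exact cauchyPiece_of_le h'

lemma norm_cauchyPiece_le (h : LensBound ω B) (hτ : 0 < τ.im) (hk : ∀ k : ℤ, 1 ≤ ‖τ + 2 * k‖) :
    ‖cauchyPiece ω τ‖ ≤ 16 * B * π := by
  rw [cauchyPiece_of_le hk]
  exact (cauchyInt_quarter_bound h fun k => by nlinarith [hk k]).2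

lemma norm_cauchyPiece_sub_le (h : LensBound ω B) (hτ : 0 < τ.im) (h1 : ‖τ‖ < 1) :
    ‖cauchyPiece ω τ - ω τ‖ ≤ 16 * B * π + B := by
  have hB := h.nonneg
  rw [cauchyPiece_of_lt (n := 0) (by simpa using h1)]
  simp only [Int.cast_zero, mul_zero, sub_zero, add_sub_cancel_right]
  rcases le_total (‖τ‖ ^ 2 + τ.im) 1 with h2 | h2
  · linarith [cauchyInt_half_bound h h2]
  · have hq := (cauchyInt_quarter_bound (τ := τ) h fun k => by
      by_cases hk : k = 0
      · simpa [hk] using h2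
      · nlinarith [(one_le_norm_add_two_mul_int h1 hk).2]).2
    rw [eq_sub_of_add_eq (cauchyInt_jump h hτ h1 (by linarith)).symm]
    have hl := h.bound τ ⟨hτ, h1.le, by linarith⟩
    have h3 : τ.im ≤ 1 := ((abs_le.mp (Complex.abs_im_le_norm τ)).2).trans h1.le
    have h4 : B * τ.im ^ 2 ≤ B := mul_le_of_le_one_right hB (pow_le_one₀ hτ.le h3)
    linarith [norm_sub_le (cauchyInt ω (π / 4) τ) (ω τ)]

lemma integrable_add_smul {ω₂ : ℂ → ℂ} {α : ℝ} {c : ℂ}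
    (h₁ : Integrable fun s : ℝ => cauchyIntegrand ω τ (s + α * I))
    (h₂ : Integrable fun s : ℝ => cauchyIntegrand ω₂ τ (s + α * I)) :
    cauchyInt (fun z => ω z + c * ω₂ z) α τ = cauchyInt ω α τ + c * cauchyInt ω₂ α τ := by
  rw [cauchyInt, cauchyInt, cauchyInt, ← integral_const_mul, ← integral_add h₁ (h₂.const_mul c)]
  congr 1; ext s
  simp only [cauchyIntegrand]
  ring

lemma cauchyPiece_add_smul {ω₂ : ℂ → ℂ} {B₂ : ℝ} (c : ℂ) (h₁ : LensBound ω B)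
    (h₂ : LensBound ω₂ B₂) (hτ : 0 < τ.im) :
    cauchyPiece (fun z => ω z + c * ω₂ z) τ = cauchyPiece ω τ + c * cauchyPiece ω₂ τ := by
  rcases norm_translate_cases τ with ⟨n, hn⟩ | hk
  · rw [cauchyPiece_of_lt hn, cauchyPiece_of_lt hn, cauchyPiece_of_lt hn, integrable_add_smul
      (integrable_cauchyIntegrand_half h₁ hn) (integrable_cauchyIntegrand_half h₂ hn)]
    ring
  · have hk' : ∀ k : ℤ, 1 ≤ ‖τ + 2 * k‖ ^ 2 + τ.im := fun k => by nlinarith [hk k]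
    rw [cauchyPiece_of_le hk, cauchyPiece_of_le hk, cauchyPiece_of_le hk, integrable_add_smul
      (cauchyInt_quarter_bound h₁ hk').1 (cauchyInt_quarter_bound h₂ hk').1]

end Piece

/-! ### Decay of the weight at the cusps and the admissible data -/

lemma etaAbs_cusp {w : ℂ} (hw : 0 < w.im) : etaAbs (1 - 1 / w) = ‖w‖ ^ 4 * etaAbs w := by
  have hw0 : w ≠ 0 := fun h => by simp [h] at hw
  have := etaAbs_moeb (a := 1) (b := -1) (c := 1) (d := 0) (by norm_num) hw
  rw [moeb] at this
  push_cast at this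
  simp only [one_mul, add_zero] at this
  rw [← sub_eq_add_neg, sub_div, div_self hw0] at this
  exact this

lemma norm_etaProd_eq (τ : ℂ) : ‖etaProd τ‖ = rexp (2 * π / 3 * τ.im) * etaAbs τ := by
  rw [etaAbs_eq, ← mul_assoc, ← Real.exp_add]
  simp

lemma etaProd_add_two (τ : ℂ) : etaProd (τ + 2) = etaProd τ := by
  rw [show τ + 2 = τ + 1 + 1 by ring, etaProd_add_one, etaProd_add_one]

lemma exp_neg_le_factorial_mul (M : ℕ) {x : ℝ} (hx : 0 < x) : rexp (-x) ≤ M.factorial / x ^ M := by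
  rw [Real.exp_neg, inv_le_comm₀ (Real.exp_pos x) (by positivity), inv_div]
  exact Real.pow_div_factorial_le_exp x hx.le M

lemma exists_weight_cusp_bound (N : ℕ) : ∃ C : ℝ, 0 < C ∧ ∀ w : ℂ, 1 ≤ w.im →
    (1 - 1 / w).im ≤ 1 → 1 / (10 * (1 - 1 / w).im) ≤ w.im → ‖w‖ * (1 - 1 / w).im ≤ 1 →
    ‖etaProd (1 - 1 / w) / jacobiTheta (1 - 1 / w)‖ ≤ C * (1 - 1 / w).im ^ N := by
  obtain ⟨_, C, _, hC, hV⟩ := exists_etaProd_bounds one_pos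
  refine ⟨rexp (2 * π / 3) * C * (N + 4).factorial * 10 ^ (N + 4), by positivity,
    fun w hw h1 h2 h3 => ?_⟩
  have hw0 : w ≠ 0 := fun h => by simp [h] at hw; linarith
  have hy : 0 < (1 - 1 / w).im := by
    have : (1 - 1 / w).im = w.im / ‖w‖ ^ 2 := by
      rw [← Complex.normSq_eq_norm_sq]; simp [neg_div]
    rw [this]
    have := norm_pos_iff.mpr hw0
    exact div_pos (by linarith) (by positivity)
  set y := (1 - 1 / w).im with hyd
  have hwn : 1 ≤ ‖w‖ := hw.trans ((le_abs_self _).trans (Complex.abs_im_le_norm w))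
  have ht := le_norm_jacobiTheta_cusp hw
  have hE : ‖etaProd (1 - 1 / w)‖ ≤ rexp (2 * π / 3) * (‖w‖ ^ 4 * (rexp (-(2 * π / 3) * w.im) * C)) := by
    rw [norm_etaProd_eq, etaAbs_cusp (by linarith), etaAbs_eq]
    have := (hV w hw).2
    have e1 : rexp (2 * π / 3 * (1 - 1 / w).im) ≤ rexp (2 * π / 3) :=
      Real.exp_le_exp.mpr (mul_le_of_le_one_right (by positivity) h1)
    gcongr
  have hth : rexp (-(π / 4) * w.im) ≤ ‖jacobiTheta (1 - 1 / w)‖ :=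
    (le_mul_of_one_le_left (by positivity) (Real.one_le_rpow hwn (by norm_num))).trans ht
  have hw4 : ‖w‖ ^ 4 ≤ 1 / y ^ 4 := by
    rw [le_div_iff₀ (by positivity), ← mul_pow]
    exact pow_le_one₀ (by positivity) h3
  have hexp : rexp (-w.im) ≤ (N + 4).factorial * (10 * y) ^ (N + 4) := by
    refine (exp_neg_le_factorial_mul (N + 4) (by linarith)).trans ?_
    rw [div_eq_mul_inv, ← inv_pow]
    gcongr
    rw [inv_le_comm₀ (by linarith) (by positivity), ← one_div]
    exact h2
  rw [norm_div]
  calc _ ≤ rexp (2 * π / 3) * (‖w‖ ^ 4 * (rexp (-(2 * π / 3) * w.im) * C)) /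
        rexp (-(π / 4) * w.im) := by gcongr
    _ = rexp (2 * π / 3) * C * ‖w‖ ^ 4 * rexp (-(5 * π / 12) * w.im) := by
        rw [show -(2 * π / 3) * w.im = -(5 * π / 12) * w.im + -(π / 4) * w.im by ring, Real.exp_add]
        field_simp
    _ ≤ rexp (2 * π / 3) * C * (1 / y ^ 4) * ((N + 4).factorial * (10 * y) ^ (N + 4)) := by
        gcongr
        refine le_trans (Real.exp_le_exp.mpr ?_) hexp
        nlinarith [Real.pi_gt_three]
    _ = _ := by
        rw [mul_pow, pow_add y]
        field_simp

lemma lens_cusp {z : ℂ} (hz : z ∈ lens) (hx : 0 ≤ z.re) (hy : z.im ≤ 1 / 10) :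
    1 ≤ (1 / (1 - z)).im ∧ 1 / (10 * z.im) ≤ (1 / (1 - z)).im ∧ ‖1 / (1 - z)‖ * z.im ≤ 1 := by
  obtain ⟨h0, h1, h2⟩ := hz
  have e : ‖1 - z‖ ^ 2 = (1 - z.re) ^ 2 + z.im ^ 2 := by
    rw [norm_sq_eq_re_im]; simp
  have ez := norm_sq_eq_re_im z
  have hz1 : z.re ≤ 1 := (Complex.abs_re_le_norm z |>.trans' (le_abs_self _)).trans h1
  have hx1 : 1 - z.re ≤ 3 * z.im := by nlinarith
  have hle : ‖1 - z‖ ^ 2 ≤ 10 * z.im ^ 2 := by nlinarith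
  have hge : z.im ≤ ‖1 - z‖ := by
    refine le_of_sq_le_sq ?_ (norm_nonneg _)
    nlinarith [sq_nonneg (1 - z.re)]
  have hp : 0 < ‖1 - z‖ := by linarith
  have him : (1 / (1 - z)).im = z.im / ‖1 - z‖ ^ 2 := by
    rw [← Complex.normSq_eq_norm_sq]; simp
  have hv : 1 / (10 * z.im) ≤ (1 / (1 - z)).im := by
    rw [him, div_le_div_iff₀ (by positivity) (by positivity)]
    nlinarith
  refine ⟨le_trans ?_ hv, hv, ?_⟩
  · rw [le_div_iff₀ (by positivity)]; linarith
  · rw [norm_div, norm_one, div_mul_eq_mul_div, one_mul, div_le_one (by linarith)]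
    exact hge

lemma exists_weight_bound (N : ℕ) : ∃ C : ℝ, 0 < C ∧ ∀ z ∈ lens,
    ‖etaProd z / jacobiTheta z‖ ≤ C * z.im ^ N := by
  obtain ⟨C₁, hC₁, h₁⟩ := exists_weight_cusp_bound N
  have hK : IsCompact {z : ℂ | ‖z‖ ≤ 1 ∧ 1 / 10 ≤ z.im} := by
    have : {z : ℂ | ‖z‖ ≤ 1 ∧ 1 / 10 ≤ z.im} =
        Metric.closedBall 0 1 ∩ {z : ℂ | 1 / 10 ≤ z.im} := by
      ext z; simp
    rw [this]
    exact (isCompact_closedBall _ _).inter_right (isClosed_le continuous_const Complex.continuous_im)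
  have hcont : ContinuousOn (fun z => etaProd z / jacobiTheta z) {z : ℂ | ‖z‖ ≤ 1 ∧ 1 / 10 ≤ z.im} := by
    intro z hz
    have hz0 : 0 < z.im := by linarith [hz.2]
    exact ((etaProd_differentiableAt hz0).continuousAt.div
      (differentiableAt_jacobiTheta hz0).continuousAt (jacobiTheta_ne_zero hz0)).continuousWithinAt
  obtain ⟨C₂, hC₂⟩ := hK.exists_bound_of_continuousOn hcont
  refine ⟨C₁ + |C₂| * 10 ^ N, by positivity, fun z hz => ?_⟩
  have hz0 := hz.1
  rcases le_total (1 / 10) z.im with hy | hy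
  · have hy2 : (1 : ℝ) ≤ 10 ^ N * z.im ^ N := by
      rw [← mul_pow]; exact one_le_pow₀ (by linarith)
    have h3 := (hC₂ z ⟨hz.2.1, hy⟩).trans (le_abs_self _)
    have h4 : |C₂| * 1 ≤ |C₂| * (10 ^ N * z.im ^ N) := by gcongr
    have h5 : 0 ≤ C₁ * z.im ^ N := by positivity
    linarith
  · have h3 : ‖etaProd z / jacobiTheta z‖ ≤ C₁ * z.im ^ N := by
      rcases le_total 0 z.re with hx | hx
      · obtain ⟨a, b, c⟩ := lens_cusp hz hx hy
        have e : (1 : ℂ) - 1 / (1 / (1 - z)) = z := by simp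
        have := h₁ (1 / (1 - z)) a
        rw [e] at this
        exact this (by linarith) b c
      · have hw : (-(starRingEnd ℂ) z) ∈ lens := by
          simpa [lens] using hz
        obtain ⟨a, b, c⟩ := lens_cusp hw (by simpa using hx) (by simpa using hy)
        have e0 : (1 - -(starRingEnd ℂ) z) = -(starRingEnd ℂ) (-1 - z) := by
          simp [add_comm]
        have e1 : (1 / (1 - -(starRingEnd ℂ) z)) = -(starRingEnd ℂ) (1 / (-1 - z)) := by
          rw [e0, div_neg, map_div₀, map_one]
        rw [e1] at a b c
        simp only [Complex.neg_im, Complex.conj_im, neg_neg, norm_neg, Complex.norm_conj] at a b c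
        have e : (1 : ℂ) - 1 / (1 / (-1 - z)) = z + 2 := by simp; ring
        have := h₁ (1 / (-1 - z)) a
        have em : (z + 2).im = z.im := by simp
        have et : jacobiTheta (z + 2) = jacobiTheta z := by
          simpa using jacobiTheta_add_two_mul_int z 1
        rw [e, em, etaProd_add_two, et] at this
        exact this (by linarith) b c
    have h5 : 0 ≤ |C₂| * 10 ^ N * z.im ^ N := by positivity
    linarith

/-- The annular part of the upper half plane on which the data is controlled. -/
def annulus : Set ℂ := {z | 0 < z.im ∧ 1 / 3 ≤ ‖z‖ ∧ ‖z‖ ≤ 3}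

lemma lens_subset_annulus : lens ⊆ annulus := by
  rintro z ⟨h0, h1, h2⟩
  refine ⟨h0, ?_, by linarith⟩
  have := (le_abs_self _).trans (Complex.abs_im_le_norm z)
  nlinarith [norm_nonneg z]

/-- Holomorphic data with at most polynomial growth at the cusps `±1`. -/
structure DataBound (φ : ℂ → ℂ) (K : ℕ) (B : ℝ) : Prop where
  diff : DifferentiableOn ℂ φ {s | 0 < s.im}
  bound : ∀ z ∈ annulus, ‖φ z‖ * z.im ^ K ≤ B

lemma DataBound.nonneg {φ : ℂ → ℂ} {K : ℕ} {B : ℝ} (h : DataBound φ K B) : 0 ≤ B := by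
  have := h.bound I (lens_subset_annulus I_mem_lens)
  simp only [Complex.I_im, one_pow, mul_one] at this
  exact (norm_nonneg _).trans this

noncomputable def lensData (φ : ℂ → ℂ) (z : ℂ) : ℂ := etaProd z * φ z / jacobiTheta z

lemma isOpen_upper : IsOpen {s : ℂ | 0 < s.im} := isOpen_lt continuous_const Complex.continuous_im

lemma exists_lensBound (K : ℕ) : ∃ C : ℝ, 0 < C ∧ ∀ φ B, DataBound φ K B →
    LensBound (lensData φ) (C * B) := by
  obtain ⟨C, hC, h⟩ := exists_weight_bound (K + 2)
  refine ⟨C, hC, fun φ B hφ => ⟨fun z hz => ?_, fun z hz => ?_⟩⟩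
  · have hz : 0 < z.im := hz
    exact (((etaProd_differentiableAt hz).mul
      (hφ.diff.differentiableAt (isOpen_upper.mem_nhds hz))).div
      (differentiableAt_jacobiTheta hz) (jacobiTheta_ne_zero hz)).differentiableWithinAt
  · have h0 := hz.1
    have h1 := hφ.bound z (lens_subset_annulus hz)
    have h2 := h z hz
    rw [lensData, mul_div_right_comm, norm_mul]
    calc _ ≤ C * z.im ^ (K + 2) * ‖φ z‖ := by gcongr
      _ = C * (‖φ z‖ * z.im ^ K) * z.im ^ 2 := by ring
      _ ≤ _ := by gcongr

/-! ### A Poincaré-type series over the theta group -/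

lemma sq_add_sq_le_norm_denom {R m : ℝ} (hm : 0 < m) {τ : ℂ} (hre : |τ.re| ≤ R) (him : m ≤ τ.im)
    (c d : ℤ) : (c : ℝ) ^ 2 + d ^ 2 ≤ (2 + (1 + 2 * R ^ 2) / m ^ 2) * ‖(c * τ + d : ℂ)‖ ^ 2 := by
  have e : ‖(c * τ + d : ℂ)‖ ^ 2 = (c * τ.re + d) ^ 2 + (c * τ.im) ^ 2 := by
    rw [norm_sq_eq_re_im]; simp
  have h1 : (c : ℝ) ^ 2 * m ^ 2 ≤ ‖(c * τ + d : ℂ)‖ ^ 2 := by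
    rw [e]
    have : m ^ 2 ≤ τ.im ^ 2 := by gcongr
    nlinarith [sq_nonneg (c * τ.re + d : ℝ), sq_nonneg (c : ℝ)]
  have h2 : τ.re ^ 2 ≤ R ^ 2 := sq_le_sq' (by linarith [neg_abs_le τ.re]) ((le_abs_self _).trans hre)
  have h3 : (c * τ.re + d : ℝ) ^ 2 ≤ ‖(c * τ + d : ℂ)‖ ^ 2 := by
    rw [e]; nlinarith [sq_nonneg (c * τ.im : ℝ)]
  have h4 : (1 + 2 * R ^ 2) * (c : ℝ) ^ 2 ≤ (1 + 2 * R ^ 2) / m ^ 2 * ‖(c * τ + d : ℂ)‖ ^ 2 := by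
    rw [div_mul_eq_mul_div, le_div_iff₀ (by positivity)]
    nlinarith [mul_le_mul_of_nonneg_left h1 (by positivity : 0 ≤ 1 + 2 * R ^ 2)]
  nlinarith [sq_nonneg (c : ℝ), sq_nonneg (c * τ.re * 2 + d : ℝ),
    mul_le_mul_of_nonneg_left h2 (sq_nonneg (c : ℝ))]

lemma summable_inv_sq_add_sq_sq : Summable fun p : ℤ × ℤ => (((p.1 : ℝ) ^ 2 + p.2 ^ 2) ^ 2)⁻¹ := by
  have h := EisensteinSeries.summable_one_div_norm_rpow (k := 4) (by norm_num)
  have h2 := ((finTwoArrowEquiv ℤ).symm.summable_iff).mpr h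
  refine Summable.of_nonneg_of_le (fun p => by positivity) (fun p => ?_) h2
  simp only [Function.comp]
  rw [Real.rpow_neg (norm_nonneg _)]
  by_cases hp : p = 0
  · simp [hp]
  · have h3 : ‖(finTwoArrowEquiv ℤ).symm p‖ ^ 2 ≤ (p.1 : ℝ) ^ 2 + p.2 ^ 2 := by
      rw [Pi.norm_def]
      have : ((Finset.univ.sup fun b => ‖((finTwoArrowEquiv ℤ).symm p) b‖₊ : NNReal) : ℝ) ≤
          Real.sqrt ((p.1 : ℝ) ^ 2 + p.2 ^ 2) := by
        rw [← Pi.norm_def, pi_norm_le_iff_of_nonneg (Real.sqrt_nonneg _)]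
        intro i
        rw [Int.norm_eq_abs]
        refine Real.abs_le_sqrt ?_
        fin_cases i
        · simp only [finTwoArrowEquiv_symm_apply]
          simpa using sq_nonneg (p.2 : ℝ)
        · simp only [finTwoArrowEquiv_symm_apply]
          simpa using sq_nonneg (p.1 : ℝ)
      calc _ ≤ Real.sqrt ((p.1 : ℝ) ^ 2 + p.2 ^ 2) ^ 2 := by gcongr
        _ = _ := Real.sq_sqrt (by positivity)
    have h4 : 0 < ‖(finTwoArrowEquiv ℤ).symm p‖ := by
      rw [norm_pos_iff]
      intro h0
      exact hp (by
        have := congrArg (finTwoArrowEquiv ℤ) h0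
        rw [Equiv.apply_symm_apply] at this
        rw [this]; rfl)
    have h5 : ‖(finTwoArrowEquiv ℤ).symm p‖ ^ (4 : ℝ) = (‖(finTwoArrowEquiv ℤ).symm p‖ ^ 2) ^ 2 := by
      rw [← pow_mul]; exact_mod_cast Real.rpow_natCast _ 4
    rw [h5]
    gcongr

/-- The Eisenstein sum of weight four, with absolute values. -/
noncomputable def eisAbs (τ : ℂ) : ℝ := ∑' p : ℤ × ℤ, (‖(p.1 * τ + p.2 : ℂ)‖ ^ 4)⁻¹

lemma exists_eisAbs_term_le {R m : ℝ} (hm : 0 < m) : ∃ L : ℝ, 0 < L ∧ ∀ τ : ℂ, |τ.re| ≤ R →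
    m ≤ τ.im → ∀ c d : ℤ, (c : ℝ) ^ 2 + d ^ 2 ≤ L * ‖(c * τ + d : ℂ)‖ ^ 2 ∧
      (‖(c * τ + d : ℂ)‖ ^ 4)⁻¹ ≤ L ^ 2 * (((c : ℝ) ^ 2 + d ^ 2) ^ 2)⁻¹ := by
  refine ⟨2 + (1 + 2 * R ^ 2) / m ^ 2, by positivity, fun τ h1 h2 c d => ?_⟩
  have h := sq_add_sq_le_norm_denom hm h1 h2 c d
  refine ⟨h, ?_⟩
  set L := 2 + (1 + 2 * R ^ 2) / m ^ 2
  have hL : 0 < L := by positivity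
  by_cases h0 : (c : ℝ) ^ 2 + d ^ 2 = 0
  · have hc : (c : ℝ) = 0 := by nlinarith [sq_nonneg (c : ℝ), sq_nonneg (d : ℝ)]
    have hd : (d : ℝ) = 0 := by nlinarith [sq_nonneg (c : ℝ), sq_nonneg (d : ℝ)]
    norm_cast at hc hd
    simp [hc, hd]
  · have h1 : 0 < (c : ℝ) ^ 2 + d ^ 2 := lt_of_le_of_ne (by positivity) (Ne.symm h0)
    have h2 : 0 < ‖(c * τ + d : ℂ)‖ ^ 2 := by
      by_contra! hh; nlinarith
    have h3 : ((c : ℝ) ^ 2 + d ^ 2) ^ 2 ≤ L ^ 2 * ‖(c * τ + d : ℂ)‖ ^ 4 := by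
      calc _ ≤ (L * ‖(c * τ + d : ℂ)‖ ^ 2) ^ 2 := by gcongr
        _ = _ := by ring
    rw [← div_eq_mul_inv, inv_eq_one_div, div_le_div_iff₀ (by nlinarith) (by positivity)]
    linarith

lemma summable_eisAbs {τ : ℂ} (hτ : 0 < τ.im) :
    Summable fun p : ℤ × ℤ => (‖(p.1 * τ + p.2 : ℂ)‖ ^ 4)⁻¹ := by
  obtain ⟨L, -, h⟩ := exists_eisAbs_term_le (R := |τ.re|) hτ
  exact Summable.of_nonneg_of_le (fun _ => by positivity)
    (fun p => (h τ le_rfl le_rfl p.1 p.2).2) (summable_inv_sq_add_sq_sq.mul_left _)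

lemma exists_eisAbs_le (R : ℝ) {m : ℝ} (hm : 0 < m) : ∃ C : ℝ, 0 < C ∧ ∀ τ : ℂ, |τ.re| ≤ R →
    m ≤ τ.im → eisAbs τ ≤ C := by
  obtain ⟨L, hL, h⟩ := exists_eisAbs_term_le (R := R) hm
  refine ⟨∑' p : ℤ × ℤ, L ^ 2 * (((p.1 : ℝ) ^ 2 + p.2 ^ 2) ^ 2)⁻¹ + 1, ?_, fun τ h1 h2 => ?_⟩
  · have : 0 ≤ ∑' p : ℤ × ℤ, L ^ 2 * (((p.1 : ℝ) ^ 2 + p.2 ^ 2) ^ 2)⁻¹ :=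
      tsum_nonneg fun _ => by positivity
    linarith
  · have := Summable.tsum_le_tsum (fun p : ℤ × ℤ => (h τ h1 h2 p.1 p.2).2)
      (summable_eisAbs (hm.trans_le h2)) (summable_inv_sq_add_sq_sq.mul_left _)
    rw [eisAbs]; linarith

lemma eisAbs_cusp {w : ℂ} (hw : w ≠ 0) : eisAbs (1 - 1 / w) = ‖w‖ ^ 4 * eisAbs w := by
  let e : ℤ × ℤ ≃ ℤ × ℤ :=
    { toFun := fun p => (p.1 + p.2, -p.1)
      invFun := fun p => (-p.2, p.1 + p.2)
      left_inv := fun p => by simp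
      right_inv := fun p => by simp }
  have hn : ‖w‖ ≠ 0 := norm_ne_zero_iff.mpr hw
  rw [eisAbs, eisAbs, ← e.tsum_eq fun p : ℤ × ℤ => (‖(p.1 * w + p.2 : ℂ)‖ ^ 4)⁻¹,
    ← tsum_mul_left]
  congr 1; ext p
  have h1 : ((p.1 * (1 - 1 / w) + p.2 : ℂ)) = (((e p).1 * w + (e p).2 : ℂ)) / w := by
    simp only [e, Equiv.coe_fn_mk]; push_cast; field_simp; ring
  rw [h1, norm_div, div_pow, inv_div, div_eq_mul_inv]

/-- Index set of the series: elements of the theta group with dominating lower left entry. -/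
def thetaIndex (p : ℤ × ℤ × ℤ × ℤ) : Prop :=
  p.1 * p.2.2.2 - p.2.1 * p.2.2.1 = 1 ∧ Even (p.1 + p.2.2.2) ∧ Even (p.2.1 + p.2.2.1) ∧
    Odd (p.1 + p.2.1)

noncomputable def thetaMoeb (p : ℤ × ℤ × ℤ × ℤ) (τ : ℂ) : ℂ := moeb p.1 p.2.1 p.2.2.1 p.2.2.2 τ

/-- The bottom row of `p`, applied to `τ`. -/
noncomputable def thetaDenom (p : ℤ × ℤ × ℤ × ℤ) (τ : ℂ) : ℂ := p.2.2.1 * τ + p.2.2.2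

lemma thetaIndex_injOn : Set.InjOn (fun p : ℤ × ℤ × ℤ × ℤ => p.2.2)
    {p | thetaIndex p ∧ |p.1| < |p.2.2.1|} := by
  rintro ⟨a, b, c, d⟩ ⟨⟨h1, h2, h3, h4⟩, h5⟩ ⟨a', b', c', d'⟩ ⟨⟨k1, k2, k3, k4⟩, k5⟩ he
  simp only [Prod.mk.injEq] at he
  obtain ⟨rfl, rfl⟩ := he
  simp only at h1 h2 h3 h4 h5 k1 k2 k3 k4 k5
  have hco : IsCoprime c d := ⟨-b, a, by linarith⟩
  have hdvd : c ∣ (a - a') * d := ⟨b - b', by linarith⟩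
  obtain ⟨t, ht⟩ := hco.dvd_of_dvd_mul_right hdvd
  have hc : c ≠ 0 := fun h => by rw [h, abs_zero] at h5; linarith [abs_nonneg a]
  have hbt : b - b' = d * t := by
    have : c * (b - b') = c * (d * t) := by linear_combination d * ht + k1 - h1
    exact mul_left_cancel₀ hc this
  have ht2 : |t| < 2 := by
    by_contra! hh
    have h6 : |a - a'| = |c| * |t| := by rw [ht, abs_mul]
    have h7 := abs_sub a a'
    nlinarith [abs_nonneg c]
  have hev : Even t := by
    by_contra hodd
    rw [Int.not_even_iff_odd] at hodd
    have e1 : Even (c * t) := by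
      rw [← ht]
      have := h2.sub k2
      rwa [show a + d - (a' + d) = a - a' by ring] at this
    have e2 : Even (d * t) := by
      rw [← hbt]
      have := h3.sub k3
      rwa [show b + c - (b' + c) = b - b' by ring] at this
    rw [Int.even_mul] at e1 e2
    have c1 := e1.resolve_right (by rwa [Int.not_even_iff_odd])
    have d1 := e2.resolve_right (by rwa [Int.not_even_iff_odd])
    have : Even (a * d - b * c) := (d1.mul_left a).sub (c1.mul_left b)
    rw [h1] at this
    exact absurd this (by decide)
  have ht0 : t = 0 := by
    rw [abs_lt] at ht2
    obtain ⟨r, hr⟩ := hev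
    omega
  rw [ht0, mul_zero, sub_eq_zero] at ht hbt
  rw [ht, hbt]

/-- Reindexing by translation. -/
def thetaTranslate : ℤ × ℤ × ℤ × ℤ ≃ ℤ × ℤ × ℤ × ℤ where
  toFun p := (p.1, p.2.1 + 2 * p.1, p.2.2.1, p.2.2.2 + 2 * p.2.2.1)
  invFun p := (p.1, p.2.1 - 2 * p.1, p.2.2.1, p.2.2.2 - 2 * p.2.2.1)
  left_inv p := by simp
  right_inv p := by simp

/-- Reindexing by inversion. -/
def thetaInvert : ℤ × ℤ × ℤ × ℤ ≃ ℤ × ℤ × ℤ × ℤ where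
  toFun p := (p.2.1, -p.1, p.2.2.2, -p.2.2.1)
  invFun p := (-p.2.1, p.1, -p.2.2.2, p.2.2.1)
  left_inv p := by simp
  right_inv p := by simp

lemma thetaIndex_translate (p : ℤ × ℤ × ℤ × ℤ) : thetaIndex (thetaTranslate p) ↔ thetaIndex p := by
  obtain ⟨a, b, c, d⟩ := p
  simp only [thetaIndex, thetaTranslate, Equiv.coe_fn_mk]
  constructor <;> rintro ⟨h1, h2, h3, h4⟩ <;>
    refine ⟨by linarith, ?_, ?_, ?_⟩ <;>
    simp only [Int.even_iff, Int.odd_iff] at * <;> omega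

lemma thetaIndex_invert (p : ℤ × ℤ × ℤ × ℤ) : thetaIndex (thetaInvert p) ↔ thetaIndex p := by
  obtain ⟨a, b, c, d⟩ := p
  simp only [thetaIndex, thetaInvert, Equiv.coe_fn_mk]
  constructor <;> rintro ⟨h1, h2, h3, h4⟩ <;>
    refine ⟨by linarith, ?_, ?_, ?_⟩ <;>
    simp only [Int.even_iff, Int.odd_iff] at * <;> omega

lemma thetaMoeb_translate (p : ℤ × ℤ × ℤ × ℤ) (τ : ℂ) :
    thetaMoeb (thetaTranslate p) τ = thetaMoeb p (τ + 2) := by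
  simp only [thetaMoeb, moeb, thetaTranslate, Equiv.coe_fn_mk]
  push_cast
  congr 1 <;> ring

lemma thetaMoeb_invert (p : ℤ × ℤ × ℤ × ℤ) {τ : ℂ} (hτ : τ ≠ 0) :
    thetaMoeb (thetaInvert p) τ = thetaMoeb p (-1 / τ) := by
  simp only [thetaMoeb, moeb, thetaInvert, Equiv.coe_fn_mk]
  have e : ∀ x y : ℂ, x * (-1 / τ) + y = (y * τ + -x) / τ := fun x y => by field_simp; ring
  rw [e, e, div_div_div_cancel_right₀ hτ]
  push_cast; rfl

/-- The four elements on which the two halves of the theta group differ. -/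
def thetaCore : Finset (ℤ × ℤ × ℤ × ℤ) :=
  {(0, -1, 1, 0), (0, 1, -1, 0), (1, 0, 0, 1), (-1, 0, 0, -1)}

lemma abs_lt_iff_of_notMem_thetaCore {p : ℤ × ℤ × ℤ × ℤ} (h : thetaIndex p) (hp : p ∉ thetaCore) :
    |p.1| < |p.2.2.1| ↔ |p.2.1| < |p.2.2.2| := by
  have key : ∀ a b c d : ℤ, a * d - b * c = 1 → Even (a + d) → Even (b + c) → Odd (a + b) →
      |a| < |c| → (a = 0 ∧ b * c = -1 ∧ d = 0) ∨ |b| < |d| := by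
    intro a b c d h1 h2 h3 h4 h5
    by_contra! hcon
    obtain ⟨h6, h7⟩ := hcon
    have e1 : |b| * |c| ≤ |a| * |d| + 1 := by
      rw [← abs_mul, ← abs_mul, show b * c = a * d - 1 by linarith]
      simpa using abs_sub (a * d) 1
    have hb : |b| ≤ 1 := by nlinarith [abs_nonneg a, abs_nonneg b, abs_nonneg d]
    have hd : |d| ≤ 1 := h7.trans hb
    rw [abs_le] at hb hd
    obtain ⟨b1, b2⟩ := hb
    obtain ⟨d1, d2⟩ := hd
    simp only [Int.even_iff, Int.odd_iff] at h2 h3 h4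
    have hb0 : b ≠ 0 := by
      rintro rfl
      have : d = 0 := by simpa using h7
      subst this
      simp at h1
    have hd0 : d = 0 := by omega
    subst hd0
    have hbc : b * c = -1 := by linarith
    have hc : |c| = 1 := by
      have : |b| * |c| = 1 := by rw [← abs_mul, hbc]; rfl
      have hb1 : |b| = 1 := by
        have : b = 1 ∨ b = -1 := by omega
        rcases this with rfl | rfl <;> rfl
      rwa [hb1, one_mul] at this
    rw [hc] at h5
    exact h6 (Int.abs_lt_one_iff.mp h5) hbc rfl
  obtain ⟨a, b, c, d⟩ := p
  obtain ⟨h1, h2, h3, h4⟩ := h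
  simp only [thetaCore, Finset.mem_insert, Finset.mem_singleton, Prod.mk.injEq, not_or] at *
  obtain ⟨p1, p2, p3, p4⟩ := hp
  constructor
  · intro h5
    refine (key a b c d h1 h2 h3 h4 h5).resolve_left ?_
    rintro ⟨rfl, hbc, rfl⟩
    rcases Int.eq_one_or_neg_one_of_mul_eq_neg_one' hbc with h | h <;> omega
  · intro h5
    refine (key b (-a) d (-c) (by linarith) ?_ ?_ ?_ h5).elim ?_ (by simp)
    · simp only [Int.even_iff] at *; omega
    · simp only [Int.even_iff] at *; omega
    · simp only [Int.odd_iff] at *; omega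
    · rintro ⟨rfl, hbc, h0⟩
      have : a * d = 1 := by linarith
      rcases Int.eq_one_or_neg_one_of_mul_eq_one' this with h | h <;> omega

lemma one_le_norm_thetaDenom {p : ℤ × ℤ × ℤ × ℤ} (h : thetaIndex p) {τ : ℂ} (hre : |τ.re| ≤ 1)
    (h1 : 1 ≤ ‖τ‖) : 1 ≤ ‖thetaDenom p τ‖ := by
  obtain ⟨a, b, c, d⟩ := p
  obtain ⟨g1, g2, g3, g4⟩ := h
  simp only [thetaDenom] at *
  have e : ‖(c * τ + d : ℂ)‖ ^ 2 = c ^ 2 * ‖τ‖ ^ 2 + 2 * (c * d * τ.re) + d ^ 2 := by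
    rw [norm_sq_eq_re_im, norm_sq_eq_re_im]; simp; ring
  have e1 : (1 : ℝ) ≤ (|(c : ℝ)| - |(d : ℝ)|) ^ 2 := by
    have : (1 : ℤ) ≤ (|c| - |d|) ^ 2 := by
      have hne : |c| - |d| ≠ 0 := by
        intro h0
        have : c = d ∨ c = -d := abs_eq_abs.mp (sub_eq_zero.mp h0)
        simp only [Int.even_iff, Int.odd_iff] at g2 g3 g4
        omega
      have : 0 < (|c| - |d|) ^ 2 := by positivity
      omega
    exact_mod_cast this
  have e2 : -(|(c : ℝ)| * |(d : ℝ)|) ≤ c * d * τ.re := by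
    have : |c * d * τ.re| ≤ |(c : ℝ)| * |(d : ℝ)| := by
      rw [abs_mul, abs_mul]
      exact mul_le_of_le_one_right (by positivity) hre
    linarith [neg_abs_le (c * d * τ.re : ℝ)]
  have e3 : (1 : ℝ) ≤ ‖τ‖ ^ 2 := by nlinarith
  have e4 : (1 : ℝ) ≤ ‖(c * τ + d : ℂ)‖ ^ 2 := by
    rw [e]
    nlinarith [sq_abs (c : ℝ), sq_abs (d : ℝ), mul_le_mul_of_nonneg_left e3 (sq_nonneg (c : ℝ))]
  nlinarith [norm_nonneg (c * τ + d : ℂ)]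

lemma norm_thetaMoeb_le_one {p : ℤ × ℤ × ℤ × ℤ} (h : thetaIndex p) (hac : |p.1| < |p.2.2.1|)
    {τ : ℂ} (h1 : 1 ≤ ‖thetaDenom p τ‖) : ‖thetaMoeb p τ‖ ≤ 1 := by
  obtain ⟨a, b, c, d⟩ := p
  obtain ⟨g1, -, -, -⟩ := h
  simp only [thetaDenom, thetaMoeb, moeb] at *
  have hD : (c * τ + d : ℂ) ≠ 0 := norm_pos_iff.mp (by linarith)
  rw [norm_div, div_le_one (by linarith)]
  have hc : 0 < |(c : ℝ)| := by
    have : 0 < |c| := (abs_nonneg a).trans_lt hac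
    exact_mod_cast this
  have hac' : |(a : ℝ)| + 1 ≤ |(c : ℝ)| := by
    have : |a| + 1 ≤ |c| := hac
    exact_mod_cast this
  have hdet : ((a * d - b * c : ℤ) : ℂ) = 1 := by rw [g1]; simp
  push_cast at hdet
  have e : (c : ℂ) * (a * τ + b) = a * (c * τ + d) - 1 := by linear_combination -hdet
  have e2 : |(c : ℝ)| * ‖(a * τ + b : ℂ)‖ ≤ |(a : ℝ)| * ‖(c * τ + d : ℂ)‖ + 1 := by
    rw [← Complex.norm_intCast, ← Complex.norm_intCast, ← norm_mul, e, ← norm_mul]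
    simpa using norm_sub_le (a * (c * τ + d) : ℂ) 1
  nlinarith

section Series

variable {ε : ℂ} {h : ℂ → ℂ} {η : ℝ} {τ : ℂ}

open Classical in
noncomputable def thetaTerm (ε : ℂ) (h : ℂ → ℂ) (τ : ℂ) (p : ℤ × ℤ × ℤ × ℤ) : ℂ :=
  if thetaIndex p then (if Odd p.1 then 1 else -ε) * h (thetaMoeb p τ) else 0

open Classical in
noncomputable def thetaHalfTerm (ε : ℂ) (h : ℂ → ℂ) (τ : ℂ) (p : ℤ × ℤ × ℤ × ℤ) : ℂ :=
  if |p.1| < |p.2.2.1| then thetaTerm ε h τ p else 0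

noncomputable def thetaSeries (ε : ℂ) (h : ℂ → ℂ) (τ : ℂ) : ℂ := ∑' p, thetaHalfTerm ε h τ p

/-- Holomorphic functions on the upper half plane which are `O(η / |η(τ)|⁸)` in the unit disc. -/
structure DiscBound (h : ℂ → ℂ) (η : ℝ) : Prop where
  diff : DifferentiableOn ℂ h {s | 0 < s.im}
  nonneg : 0 ≤ η
  bound : ∀ σ : ℂ, 0 < σ.im → ‖σ‖ ≤ 1 → ‖h σ‖ ≤ η / etaAbs σ

lemma thetaIndex.moeb_im_pos {p : ℤ × ℤ × ℤ × ℤ} (hp : thetaIndex p) (hτ : 0 < τ.im) :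
    0 < (thetaMoeb p τ).im := PerturbedInterpolation.moeb_im_pos hp.1 hτ

lemma norm_thetaHalfTerm_le (hh : DiscBound h η) (hε : ‖ε‖ = 1) (hτ : 0 < τ.im)
    (p : ℤ × ℤ × ℤ × ℤ) (hp : thetaIndex p → 1 ≤ ‖thetaDenom p τ‖) :
    ‖thetaHalfTerm ε h τ p‖ ≤ η / etaAbs τ * (‖thetaDenom p τ‖ ^ 4)⁻¹ := by
  have hE := etaAbs_pos hτ
  have h0 : 0 ≤ η / etaAbs τ * (‖thetaDenom p τ‖ ^ 4)⁻¹ := by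
    have := hh.nonneg; positivity
  unfold thetaHalfTerm thetaTerm
  split_ifs with h1 h2
  · rw [one_mul]
    have := hh.bound _ (h2.moeb_im_pos hτ) (norm_thetaMoeb_le_one h2 h1 (hp h2))
    refine this.trans (le_of_eq ?_)
    rw [thetaMoeb, etaAbs_moeb h2.1 hτ, thetaDenom]; ring
  · rw [norm_mul, norm_neg, hε, one_mul]
    have := hh.bound _ (h2.moeb_im_pos hτ) (norm_thetaMoeb_le_one h2 h1 (hp h2))
    refine this.trans (le_of_eq ?_)
    rw [thetaMoeb, etaAbs_moeb h2.1 hτ, thetaDenom]; ring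
  · simpa using h0
  · simpa using h0

lemma thetaHalfTerm_eq_zero {p : ℤ × ℤ × ℤ × ℤ} (hp : p ∉ {p | thetaIndex p ∧ |p.1| < |p.2.2.1|}) :
    thetaHalfTerm ε h τ p = 0 := by
  unfold thetaHalfTerm thetaTerm
  split_ifs with h1 h2
  · exact absurd ⟨h2, h1⟩ hp
  · exact absurd ⟨h2, h1⟩ hp
  · rfl
  · rfl

lemma summable_indicator_comp {g : ℤ × ℤ → ℝ} (hg : Summable g) :
    Summable ({p : ℤ × ℤ × ℤ × ℤ | thetaIndex p ∧ |p.1| < |p.2.2.1|}.indicator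
      fun p => g p.2.2) := by
  rw [← summable_subtype_iff_indicator]
  exact hg.comp_injective (i := fun p : {p : ℤ × ℤ × ℤ × ℤ | thetaIndex p ∧ |p.1| < |p.2.2.1|} =>
    p.1.2.2) thetaIndex_injOn.injective

lemma differentiableAt_thetaHalfTerm (hh : DiscBound h η) (hτ : 0 < τ.im) (p : ℤ × ℤ × ℤ × ℤ) :
    DifferentiableAt ℂ (fun σ => thetaHalfTerm ε h σ p) τ := by
  unfold thetaHalfTerm thetaTerm
  by_cases h1 : |p.1| < |p.2.2.1|
  · by_cases h2 : thetaIndex p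
    · simp only [if_pos h1, if_pos h2]
      refine DifferentiableAt.const_mul ?_ _
      have h3 : DifferentiableAt ℂ (thetaMoeb p) τ := by
        unfold thetaMoeb moeb
        refine DifferentiableAt.div (by fun_prop) (by fun_prop) (denom_ne_zero ?_ hτ)
        left
        rintro h0
        rw [h0, abs_zero] at h1
        linarith [abs_nonneg p.1]
      exact (hh.diff.differentiableAt (isOpen_upper.mem_nhds (h2.moeb_im_pos hτ))).comp τ h3
    · simp [if_neg h2]
  · simp [if_neg h1]

/-- Locally uniform majorant for the series. -/
lemma exists_thetaHalfTerm_majorant (hh : DiscBound h η) (hε : ‖ε‖ = 1) (hτ : 0 < τ.im) :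
    ∃ u : ℤ × ℤ × ℤ × ℤ → ℝ, Summable u ∧ ∀ p, ∀ σ ∈ Metric.ball τ (τ.im / 2),
      ‖thetaHalfTerm ε h σ p‖ ≤ u p := by
  have hη := hh.nonneg
  have hball : ∀ σ ∈ Metric.closedBall τ (τ.im / 2), τ.im / 2 ≤ σ.im ∧ |σ.re| ≤ |τ.re| + τ.im := by
    intro σ hσ
    rw [Metric.mem_closedBall, dist_eq_norm] at hσ
    have h1 := (abs_le.mp ((Complex.abs_im_le_norm (σ - τ)).trans hσ)).1
    have h2 := (Complex.abs_re_le_norm (σ - τ)).trans hσ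
    rw [Complex.sub_im] at h1
    rw [Complex.sub_re] at h2
    refine ⟨by linarith, ?_⟩
    have := abs_add_le (σ.re - τ.re) τ.re
    rw [sub_add_cancel] at this
    linarith
  obtain ⟨L, hL, hLb⟩ := exists_eisAbs_term_le (R := |τ.re| + τ.im) (half_pos hτ)
  have hcomp : IsCompact (Metric.closedBall τ (τ.im / 2)) := isCompact_closedBall _ _
  obtain ⟨E, hE⟩ := hcomp.exists_bound_of_continuousOn (f := fun σ => ((etaAbs σ)⁻¹ : ℝ)) (by
    intro σ hσ
    have h1 : 0 < σ.im := by linarith [(hball σ hσ).1]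
    have h2 : ContinuousAt etaAbs σ := by
      have : etaAbs = fun σ => rexp (-(2 * π / 3) * σ.im) * ‖etaProd σ‖ := funext etaAbs_eq
      rw [this]
      exact ContinuousAt.mul (by fun_prop) (etaProd_differentiableAt h1).continuousAt.norm
    exact (h2.inv₀ (etaAbs_pos h1).ne').continuousWithinAt)
  have hM : ∀ p, ∃ M : ℝ, ∀ σ ∈ Metric.closedBall τ (τ.im / 2), ‖thetaHalfTerm ε h σ p‖ ≤ M :=
    fun p => hcomp.exists_bound_of_continuousOn fun σ hσ =>
      (differentiableAt_thetaHalfTerm hh (by linarith [(hball σ hσ).1])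
        p).continuousAt.continuousWithinAt
  choose M hM using hM
  set S : Set (ℤ × ℤ × ℤ × ℤ) := {p | thetaIndex p ∧ |p.1| < |p.2.2.1|} with hS
  set g : ℤ × ℤ → ℝ := fun p => η * E * (L ^ 2 * (((p.1 : ℝ) ^ 2 + p.2 ^ 2) ^ 2)⁻¹) with hg
  have hgs : Summable (S.indicator fun p => g p.2.2) :=
    summable_indicator_comp ((summable_inv_sq_add_sq_sq.mul_left _).mul_left _)
  set X : Set (ℤ × ℤ × ℤ × ℤ) := S ∩ {p | (p.2.2.1 : ℝ) ^ 2 + p.2.2.2 ^ 2 < L} with hX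
  have hXf : X.Finite := by
    refine Set.Finite.of_finite_image (f := fun p => p.2.2) ?_
      (thetaIndex_injOn.mono Set.inter_subset_left)
    have hb : (Set.Icc (-⌈L⌉, -⌈L⌉) (⌈L⌉, ⌈L⌉) : Set (ℤ × ℤ)).Finite := Set.finite_Icc _ _
    refine hb.subset ?_
    rintro _ ⟨⟨a, b, c, d⟩, ⟨-, h2⟩, rfl⟩
    have h2 : (c : ℝ) ^ 2 + d ^ 2 < L := h2
    have hLc := Int.le_ceil L
    have aux : ∀ n : ℤ, (n : ℝ) ^ 2 < L → -⌈L⌉ ≤ n ∧ n ≤ ⌈L⌉ := by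
      intro n hn
      have h3 : (n : ℝ) ^ 2 < ⌈L⌉ := by linarith
      have h4 : n ^ 2 < ⌈L⌉ := by exact_mod_cast h3
      constructor <;> nlinarith [sq_nonneg (n - 1), sq_nonneg (n + 1)]
    have hc := aux c (by nlinarith [sq_nonneg (d : ℝ)])
    have hd := aux d (by nlinarith [sq_nonneg (c : ℝ)])
    exact ⟨⟨hc.1, hd.1⟩, ⟨hc.2, hd.2⟩⟩
  classical
  refine ⟨fun p => if p ∈ X then M p else S.indicator (fun p => g p.2.2) p, ?_, fun p σ hσ => ?_⟩
  · refine (summable_congr_cofinite ?_).mpr hgs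
    filter_upwards [hXf.compl_mem_cofinite] with p hp
    rw [if_neg hp]
  · have hσ' := Metric.ball_subset_closedBall hσ
    obtain ⟨b1, b2⟩ := hball σ hσ'
    have hσ0 : 0 < σ.im := by linarith
    dsimp only
    split_ifs with h1
    · exact hM p σ hσ'
    · by_cases hp : p ∈ S
      · rw [Set.indicator_of_mem hp]
        have h2 : L ≤ (p.2.2.1 : ℝ) ^ 2 + p.2.2.2 ^ 2 := by
          by_contra! h3; exact h1 ⟨hp, h3⟩
        obtain ⟨c1, c2⟩ := hLb σ b2 b1 p.2.2.1 p.2.2.2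
        have h3 : 1 ≤ ‖thetaDenom p σ‖ := by
          have : 1 ≤ ‖thetaDenom p σ‖ ^ 2 := by
            by_contra! h4
            have : L * ‖thetaDenom p σ‖ ^ 2 < L * 1 := mul_lt_mul_of_pos_left h4 hL
            rw [thetaDenom] at this
            linarith
          nlinarith [norm_nonneg (thetaDenom p σ)]
        refine (norm_thetaHalfTerm_le hh hε hσ0 p fun _ => h3).trans ?_
        have h5 := (le_abs_self _).trans (hE σ hσ')
        rw [hg, div_eq_mul_inv]
        have := etaAbs_pos hσ0
        have hE0 : 0 ≤ E := le_trans (by positivity) h5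
        exact mul_le_mul (by gcongr) c2 (by positivity) (by positivity)
      · rw [thetaHalfTerm_eq_zero hp, Set.indicator_of_notMem hp, norm_zero]

lemma summable_thetaHalfTerm (hh : DiscBound h η) (hε : ‖ε‖ = 1) (hτ : 0 < τ.im) :
    Summable (thetaHalfTerm ε h τ) := by
  obtain ⟨u, hu, hb⟩ := exists_thetaHalfTerm_majorant hh hε hτ
  exact Summable.of_norm_bounded hu fun p => hb p τ (Metric.mem_ball_self (half_pos hτ))

lemma differentiableAt_thetaSeries (hh : DiscBound h η) (hε : ‖ε‖ = 1) (hτ : 0 < τ.im) :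
    DifferentiableAt ℂ (thetaSeries ε h) τ := by
  obtain ⟨u, hu, hb⟩ := exists_thetaHalfTerm_majorant hh hε hτ
  refine (Complex.differentiableOn_tsum_of_summable_norm hu (fun p σ hσ => ?_) Metric.isOpen_ball
    (fun p σ hσ => hb p σ hσ)).differentiableAt (Metric.ball_mem_nhds τ (half_pos hτ))
  rw [Metric.mem_ball, dist_eq_norm] at hσ
  have h1 := (abs_le.mp ((Complex.abs_im_le_norm (σ - τ)).trans hσ.le)).1
  rw [Complex.sub_im] at h1
  exact (differentiableAt_thetaHalfTerm hh (by linarith) p).differentiableWithinAt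

lemma thetaSeries_add_two (ε : ℂ) (h : ℂ → ℂ) (τ : ℂ) :
    thetaSeries ε h (τ + 2) = thetaSeries ε h τ := by
  rw [thetaSeries, thetaSeries, ← thetaTranslate.tsum_eq (thetaHalfTerm ε h τ)]
  congr 1; ext p
  have e1 : (thetaTranslate p).1 = p.1 := rfl
  have e2 : (thetaTranslate p).2.2.1 = p.2.2.1 := rfl
  by_cases hp : thetaIndex p
  · simp only [thetaHalfTerm, thetaTerm, if_pos hp, if_pos ((thetaIndex_translate p).mpr hp),
      thetaMoeb_translate, e1, e2]
  · have := mt (thetaIndex_translate p).mp hp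
    simp only [thetaHalfTerm, thetaTerm, if_neg hp, if_neg this, e1, e2]

lemma thetaTerm_invert (hε : ε ^ 2 = 1) (hτ : τ ≠ 0) (p : ℤ × ℤ × ℤ × ℤ) :
    ε * thetaTerm ε h (-1 / τ) p = -thetaTerm ε h τ (thetaInvert p) := by
  by_cases hp : thetaIndex p
  · rw [thetaTerm, thetaTerm, if_pos hp, if_pos ((thetaIndex_invert p).mpr hp),
      thetaMoeb_invert p hτ]
    have hodd : Odd (thetaInvert p).1 ↔ ¬ Odd p.1 := by
      obtain ⟨-, -, -, h4⟩ := hp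
      change Odd p.2.1 ↔ _
      simp only [Int.odd_iff] at *
      omega
    by_cases h1 : Odd p.1
    · rw [if_pos h1, if_neg (by rw [hodd]; simpa using h1)]; ring
    · rw [if_neg h1, if_pos (hodd.mpr h1)]
      linear_combination (-h (thetaMoeb p (-1 / τ))) * hε
  · rw [thetaTerm, thetaTerm, if_neg hp, if_neg (by rwa [thetaIndex_invert])]; simp

/-- The inversion formula of the series. -/
lemma thetaSeries_add_mul_neg_inv (hh : DiscBound h η) (hε : ε ^ 2 = 1) (hτ : 0 < τ.im) :
    thetaSeries ε h τ + ε * thetaSeries ε h (-1 / τ) = -2 * (h τ + ε * h (-1 / τ)) := by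
  have hε1 : ‖ε‖ = 1 := by
    have := congrArg norm hε
    rw [norm_pow, norm_one] at this
    exact (pow_eq_one_iff_of_nonneg (norm_nonneg _) two_ne_zero).mp this
  have hτ0 : τ ≠ 0 := fun h0 => by simp [h0] at hτ
  have hS : 0 < (-1 / τ).im := by
    have := neg_inv_add_im τ 0
    simp only [Int.cast_zero, mul_zero, add_zero] at this
    rw [this]
    have := norm_pos_iff.mpr hτ0
    positivity
  have s1 := summable_thetaHalfTerm hh hε1 hτ
  have s2 := (summable_thetaHalfTerm hh hε1 hS).mul_left ε
  classical
  set G : ℤ × ℤ × ℤ × ℤ → ℂ := fun p => if |p.2.1| < |p.2.2.2| then -thetaTerm ε h τ p else 0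
  have hG : (fun p => ε * thetaHalfTerm ε h (-1 / τ) p) = fun p => G (thetaInvert p) := by
    ext p
    have e : |(thetaInvert p).2.1| < |(thetaInvert p).2.2.2| ↔ |p.1| < |p.2.2.1| := by
      change |-p.1| < |-p.2.2.1| ↔ _
      rw [abs_neg, abs_neg]
    simp only [thetaHalfTerm, G, e]
    split_ifs
    · exact thetaTerm_invert hε hτ0 p
    · simp
  have hG' : ∑' p, ε * thetaHalfTerm ε h (-1 / τ) p = ∑' p, G p := by
    rw [hG]; exact thetaInvert.tsum_eq G
  have sG : Summable G := by
    rw [hG] at s2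
    exact thetaInvert.summable_iff.mp s2
  rw [thetaSeries, thetaSeries, ← tsum_mul_left, hG', ← s1.tsum_add sG,
    tsum_eq_sum (s := thetaCore)]
  · have e1 : thetaMoeb (0, -1, 1, 0) τ = -1 / τ := by simp [thetaMoeb, moeb]
    have e2 : thetaMoeb (0, 1, -1, 0) τ = -1 / τ := by
      simp [thetaMoeb, moeb, neg_div, div_neg]
    have e3 : thetaMoeb (1, 0, 0, 1) τ = τ := by simp [thetaMoeb, moeb]
    have e4 : thetaMoeb (-1, 0, 0, -1) τ = τ := by simp [thetaMoeb, moeb]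
    have i1 : thetaIndex (0, -1, 1, 0) := by unfold thetaIndex; decide
    have i2 : thetaIndex (0, 1, -1, 0) := by unfold thetaIndex; decide
    have i3 : thetaIndex (1, 0, 0, 1) := by unfold thetaIndex; decide
    have i4 : thetaIndex (-1, 0, 0, -1) := by unfold thetaIndex; decide
    have o1 : ¬ Odd (0 : ℤ) := by decide
    have o2 : Odd (1 : ℤ) := by decide
    have o3 : Odd (-1 : ℤ) := by decide
    rw [thetaCore, Finset.sum_insert (by decide), Finset.sum_insert (by decide),
      Finset.sum_insert (by decide), Finset.sum_singleton]
    simp only [thetaHalfTerm, thetaTerm, G, i1, i2, i3, i4, e1, e2, e3, e4, if_true, o1, o2, o3,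
      if_false]
    norm_num
    ring
  · intro p hp
    by_cases hi : thetaIndex p
    · have := abs_lt_iff_of_notMem_thetaCore hi hp
      simp only [thetaHalfTerm, G, this]
      split_ifs <;> simp
    · simp [thetaHalfTerm, thetaTerm, G, hi]

lemma norm_thetaSeries_le (hh : DiscBound h η) (hε : ‖ε‖ = 1) (hτ : 0 < τ.im) (hre : |τ.re| ≤ 1)
    (h1 : 1 ≤ ‖τ‖) : ‖thetaSeries ε h τ‖ ≤ η / etaAbs τ * eisAbs τ := by
  have hη := hh.nonneg
  have hE := etaAbs_pos hτ
  have hs := summable_indicator_comp (summable_eisAbs hτ)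
  have hb : ∀ p, ‖thetaHalfTerm ε h τ p‖ ≤ η / etaAbs τ *
      {p : ℤ × ℤ × ℤ × ℤ | thetaIndex p ∧ |p.1| < |p.2.2.1|}.indicator
        (fun p => (‖(p.2.2.1 * τ + p.2.2.2 : ℂ)‖ ^ 4)⁻¹) p := by
    intro p
    by_cases hp : p ∈ {p : ℤ × ℤ × ℤ × ℤ | thetaIndex p ∧ |p.1| < |p.2.2.1|}
    · rw [Set.indicator_of_mem hp]
      exact norm_thetaHalfTerm_le hh hε hτ p fun hi => one_le_norm_thetaDenom hi hre h1
    · rw [thetaHalfTerm_eq_zero hp, Set.indicator_of_notMem hp, norm_zero, mul_zero]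
  refine (tsum_of_norm_bounded (hs.mul_left _).hasSum hb).trans ?_
  rw [tsum_mul_left]
  gcongr
  rw [← tsum_subtype]
  exact tsum_comp_le_tsum_of_inj (summable_eisAbs hτ) (fun _ => by positivity)
    (i := fun p : {p : ℤ × ℤ × ℤ × ℤ | thetaIndex p ∧ |p.1| < |p.2.2.1|} => p.1.2.2)
    thetaIndex_injOn.injective

lemma thetaSeries_add_smul {h₂ : ℂ → ℂ} {η₂ : ℝ} (c : ℂ) (hh : DiscBound h η)
    (hh₂ : DiscBound h₂ η₂) (hε : ‖ε‖ = 1) (hτ : 0 < τ.im) :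
    thetaSeries ε (fun z => h z + c * h₂ z) τ = thetaSeries ε h τ + c * thetaSeries ε h₂ τ := by
  rw [thetaSeries, thetaSeries, thetaSeries, ← tsum_mul_left, ← (summable_thetaHalfTerm hh hε
    hτ).tsum_add ((summable_thetaHalfTerm hh₂ hε hτ).mul_left c)]
  congr 1; ext p
  unfold thetaHalfTerm thetaTerm
  split_ifs <;> ring

lemma thetaSeries_congr {h₂ : ℂ → ℂ} (he : ∀ z : ℂ, 0 < z.im → h z = h₂ z) (hτ : 0 < τ.im) :
    thetaSeries ε h τ = thetaSeries ε h₂ τ := by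
  unfold thetaSeries
  congr 1; ext p
  unfold thetaHalfTerm thetaTerm
  by_cases hp : thetaIndex p
  · rw [he _ (hp.moeb_im_pos hτ)]
  · simp [hp]

end Series

section Solution

variable {ε : ℂ} {φ : ℂ → ℂ} {B : ℝ} {K : ℕ} {τ : ℂ}

noncomputable def solPiece (φ : ℂ → ℂ) (τ : ℂ) : ℂ := cauchyPiece (lensData φ) τ / etaProd τ

noncomputable def solDisc (φ : ℂ → ℂ) (τ : ℂ) : ℂ :=
  (cauchyPiece (lensData φ) τ - lensData φ τ) / etaProd τ

noncomputable def solQuot (ε : ℂ) (φ : ℂ → ℂ) (τ : ℂ) : ℂ :=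
  solPiece φ τ + 1 / 2 * thetaSeries ε (solDisc φ) τ

/-- The `2`-periodic solution `F` of `F + ε F|S = φ + ε φ|S`. -/
noncomputable def sol (ε : ℂ) (φ : ℂ → ℂ) (τ : ℂ) : ℂ := jacobiTheta τ * solQuot ε φ τ

lemma sq_eq_one_of_sign (hε : ε = 1 ∨ ε = -1) : ε ^ 2 = 1 := by
  rcases hε with rfl | rfl <;> norm_num

lemma norm_eq_one_of_sign (hε : ε = 1 ∨ ε = -1) : ‖ε‖ = 1 := by
  rcases hε with rfl | rfl <;> simp

lemma neg_inv_im_pos (hτ : 0 < τ.im) : 0 < (-1 / τ).im := by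
  have := neg_inv_add_im τ 0
  simp only [Int.cast_zero, mul_zero, add_zero] at this
  rw [this]
  have : τ ≠ 0 := fun h0 => by simp [h0] at hτ
  have := norm_pos_iff.mpr this
  positivity

lemma etaAbs_le_norm_etaProd (hτ : 0 < τ.im) : etaAbs τ ≤ ‖etaProd τ‖ := by
  rw [etaAbs_eq]
  refine mul_le_of_le_one_left (norm_nonneg _) (Real.exp_le_one_iff.mpr ?_)
  have := Real.pi_pos
  have : 0 < 2 * π / 3 * τ.im := by positivity
  linarith

lemma exists_solution_bounds (K : ℕ) : ∃ C : ℝ, 0 < C ∧ ∀ φ B, DataBound φ K B →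
    LensBound (lensData φ) (C * B) ∧ DiscBound (solDisc φ) (C * B) ∧
      ∀ τ : ℂ, 0 < τ.im → (∀ k : ℤ, 1 ≤ ‖τ + 2 * k‖) → ‖solPiece φ τ‖ ≤ C * B / etaAbs τ := by
  obtain ⟨C₀, hC₀, hL⟩ := exists_lensBound K
  have hπ := Real.pi_pos
  refine ⟨(16 * π + 1) * C₀, by positivity, fun φ B h => ?_⟩
  have hl := hL φ B h
  have hB := h.nonneg
  have hb1 : 0 ≤ C₀ * B := by positivity
  have e1 : (16 * π + 1) * C₀ * B = 16 * (C₀ * B) * π + C₀ * B := by ring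
  have hl' : LensBound (lensData φ) ((16 * π + 1) * C₀ * B) := by
    refine ⟨hl.diff, fun z hz => (hl.bound z hz).trans ?_⟩
    rw [e1]
    have : 0 ≤ 16 * (C₀ * B) * π := by positivity
    gcongr
    linarith
  refine ⟨hl', ⟨?_, by positivity, ?_⟩, ?_⟩
  · intro s hs
    exact (((cauchyPiece_differentiableAt hl hs).sub (hl.diff.differentiableAt
      (isOpen_upper.mem_nhds hs))).div (etaProd_differentiableAt hs)
        (etaProd_ne_zero hs)).differentiableWithinAt
  · intro σ hσ h1
    rw [solDisc, norm_div]
    have hnum : ‖cauchyPiece (lensData φ) σ - lensData φ σ‖ ≤ (16 * π + 1) * C₀ * B := by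
      rw [e1]
      rcases h1.lt_or_eq with h1 | h1
      · exact norm_cauchyPiece_sub_le hl hσ h1
      · have hk : ∀ k : ℤ, 1 ≤ ‖σ + 2 * k‖ := by
          rcases norm_translate_cases σ with ⟨n, hn⟩ | h
          · exfalso
            have hn0 : n ≠ 0 := by
              rintro rfl
              simp only [Int.cast_zero, mul_zero, sub_zero] at hn
              linarith
            have := (one_le_norm_add_two_mul_int hn hn0).1
            rw [sub_add_cancel, h1] at this
            linarith
          · exact h
        have h2 := norm_cauchyPiece_le hl hσ hk
        have h3 : ‖lensData φ σ‖ ≤ C₀ * B := by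
          have h4 := hl.bound σ ⟨hσ, h1.le, by rw [h1]; linarith⟩
          have h5 : σ.im ^ 2 ≤ 1 := by
            have := (Complex.abs_im_le_norm σ).trans h1.le
            rw [abs_of_pos hσ] at this
            nlinarith
          nlinarith
        exact (norm_sub_le _ _).trans (add_le_add h2 h3)
    exact div_le_div₀ (by positivity) hnum (etaAbs_pos hσ) (etaAbs_le_norm_etaProd hσ)
  · intro τ hτ hk
    rw [solPiece, norm_div]
    refine div_le_div₀ (by positivity) ((norm_cauchyPiece_le hl hτ hk).trans ?_) (etaAbs_pos hτ)
      (etaAbs_le_norm_etaProd hτ)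
    linarith

lemma solQuot_add_two (ε : ℂ) (φ : ℂ → ℂ) (τ : ℂ) : solQuot ε φ (τ + 2) = solQuot ε φ τ := by
  rw [solQuot, solQuot, solPiece, solPiece, cauchyPiece_add_two, etaProd_add_two,
    thetaSeries_add_two]

lemma solQuot_add_two_mul_int (ε : ℂ) (φ : ℂ → ℂ) (τ : ℂ) (k : ℤ) :
    solQuot ε φ (τ + 2 * k) = solQuot ε φ τ := by
  have h : Function.Periodic (solQuot ε φ) 2 := solQuot_add_two ε φ
  have := h.int_mul k τ
  rwa [mul_comm] at this

lemma sol_add_two_mul_int (ε : ℂ) (φ : ℂ → ℂ) (τ : ℂ) (k : ℤ) :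
    sol ε φ (τ + 2 * k) = sol ε φ τ := by
  rw [sol, sol, jacobiTheta_add_two_mul_int, solQuot_add_two_mul_int]

lemma solQuot_differentiableAt (hε : ε = 1 ∨ ε = -1) (h : DataBound φ K B) (hτ : 0 < τ.im) :
    DifferentiableAt ℂ (solQuot ε φ) τ := by
  obtain ⟨C, _, hC⟩ := exists_solution_bounds K
  obtain ⟨hl, hd, -⟩ := hC φ B h
  exact ((cauchyPiece_differentiableAt hl hτ).div (etaProd_differentiableAt hτ)
    (etaProd_ne_zero hτ)).add ((differentiableAt_thetaSeries hd (norm_eq_one_of_sign hε)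
      hτ).const_mul _)

lemma sol_differentiableAt (hε : ε = 1 ∨ ε = -1) (h : DataBound φ K B) (hτ : 0 < τ.im) :
    DifferentiableAt ℂ (sol ε φ) τ :=
  (differentiableAt_jacobiTheta hτ).mul (solQuot_differentiableAt hε h hτ)

lemma solQuot_add_mul_neg_inv (hε : ε = 1 ∨ ε = -1) (h : DataBound φ K B) (hτ : 0 < τ.im) :
    solQuot ε φ τ + ε * solQuot ε φ (-1 / τ) =
      φ τ / jacobiTheta τ + ε * (φ (-1 / τ) / jacobiTheta (-1 / τ)) := by
  obtain ⟨C, _, hC⟩ := exists_solution_bounds K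
  obtain ⟨-, hd, -⟩ := hC φ B h
  have key := thetaSeries_add_mul_neg_inv hd (sq_eq_one_of_sign hε) hτ
  have aux : ∀ σ : ℂ, 0 < σ.im → solPiece φ σ - solDisc φ σ = φ σ / jacobiTheta σ := by
    intro σ hσ
    rw [solPiece, solDisc, lensData]
    have := etaProd_ne_zero hσ
    have := jacobiTheta_ne_zero hσ
    field_simp
    ring
  have a1 := aux τ hτ
  have a2 := aux _ (neg_inv_im_pos hτ)
  rw [solQuot, solQuot, ← a1, ← a2]
  linear_combination (1 / 2) * key

/-- The weight `1/2` inversion. -/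
noncomputable def slash (f : ℂ → ℂ) (τ : ℂ) : ℂ := f (-1 / τ) / (-I * τ) ^ (1 / 2 : ℂ)

lemma neg_I_mul_cpow_ne_zero (hτ : 0 < τ.im) : (-I * τ) ^ (1 / 2 : ℂ) ≠ 0 := by
  have h0 : τ ≠ 0 := fun h0 => by simp [h0] at hτ
  rw [Complex.cpow_def_of_ne_zero (by simp [h0])]
  exact Complex.exp_ne_zero _

theorem sol_add_slash (hε : ε = 1 ∨ ε = -1) (h : DataBound φ K B) (hτ : 0 < τ.im) :
    sol ε φ τ + ε * slash (sol ε φ) τ = φ τ + ε * slash φ τ := by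
  have key := solQuot_add_mul_neg_inv hε h hτ
  have h1 := jacobiTheta_ne_zero hτ
  have h2 := neg_I_mul_cpow_ne_zero hτ
  rw [slash, slash, sol, sol, jacobiTheta_neg_inv hτ]
  rw [jacobiTheta_neg_inv hτ] at key
  set r := (-I * τ) ^ (1 / 2 : ℂ)
  have e : jacobiTheta τ * solQuot ε φ τ + ε * (r * jacobiTheta τ * solQuot ε φ (-1 / τ) / r) =
      jacobiTheta τ * (solQuot ε φ τ + ε * solQuot ε φ (-1 / τ)) := by
    field_simp
  rw [e, key]
  field_simp

lemma DataBound.add_smul {φ₂ : ℂ → ℂ} {B₂ : ℝ} (h : DataBound φ K B) (h₂ : DataBound φ₂ K B₂)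
    (c : ℂ) : DataBound (fun z => φ z + c * φ₂ z) K (B + ‖c‖ * B₂) := by
  refine ⟨h.diff.add (h₂.diff.const_mul c), fun z hz => ?_⟩
  have h1 := h.bound z hz
  have h2 := h₂.bound z hz
  have h3 : 0 ≤ z.im ^ K := pow_nonneg hz.1.le K
  calc ‖φ z + c * φ₂ z‖ * z.im ^ K ≤ (‖φ z‖ + ‖c‖ * ‖φ₂ z‖) * z.im ^ K := by
        gcongr
        exact (norm_add_le _ _).trans (by rw [norm_mul])
    _ = ‖φ z‖ * z.im ^ K + ‖c‖ * (‖φ₂ z‖ * z.im ^ K) := by ring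
    _ ≤ B + ‖c‖ * B₂ := by gcongr

theorem sol_add_smul {φ₂ : ℂ → ℂ} {B₂ : ℝ} {K₂ : ℕ} (hε : ε = 1 ∨ ε = -1) (h : DataBound φ K B)
    (h₂ : DataBound φ₂ K₂ B₂) (c : ℂ) (hτ : 0 < τ.im) :
    sol ε (fun z => φ z + c * φ₂ z) τ = sol ε φ τ + c * sol ε φ₂ τ := by
  obtain ⟨C, _, hC⟩ := exists_solution_bounds K
  obtain ⟨hl, hd, -⟩ := hC φ B h
  obtain ⟨C₂, _, hC₂⟩ := exists_solution_bounds K₂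
  obtain ⟨hl₂, hd₂, -⟩ := hC₂ φ₂ B₂ h₂
  have e1 : lensData (fun z => φ z + c * φ₂ z) = fun z => lensData φ z + c * lensData φ₂ z := by
    ext z; unfold lensData; ring
  have e2 : ∀ z : ℂ, 0 < z.im → cauchyPiece (lensData (fun z => φ z + c * φ₂ z)) z =
      cauchyPiece (lensData φ) z + c * cauchyPiece (lensData φ₂) z := by
    intro z hz
    rw [e1, cauchyPiece_add_smul c hl hl₂ hz]
  have e3 : ∀ z : ℂ, 0 < z.im → solDisc (fun z => φ z + c * φ₂ z) z =
      solDisc φ z + c * solDisc φ₂ z := by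
    intro z hz
    rw [solDisc, e2 z hz, e1, solDisc, solDisc]
    ring
  rw [sol, sol, sol, solQuot, solQuot, solQuot, solPiece, e2 τ hτ, thetaSeries_congr e3 hτ,
    thetaSeries_add_smul c hd hd₂ (norm_eq_one_of_sign hε) hτ, solPiece, solPiece]
  ring

lemma etaAbs_add_two_mul_int (τ : ℂ) (k : ℤ) : etaAbs (τ + 2 * k) = etaAbs τ := by
  have h : Function.Periodic etaProd 2 := etaProd_add_two
  have := h.int_mul k τ
  rw [mul_comm] at this
  rw [etaAbs_eq, etaAbs_eq, this]
  simp

lemma eisAbs_add_two_mul_int (τ : ℂ) (k : ℤ) : eisAbs (τ + 2 * k) = eisAbs τ := by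
  let e : ℤ × ℤ ≃ ℤ × ℤ :=
    { toFun := fun p => (p.1, p.2 + 2 * k * p.1)
      invFun := fun p => (p.1, p.2 - 2 * k * p.1)
      left_inv := fun p => by simp
      right_inv := fun p => by simp }
  rw [eisAbs, eisAbs, ← e.tsum_eq (fun p : ℤ × ℤ => (‖(p.1 * τ + p.2 : ℂ)‖ ^ 4)⁻¹)]
  congr 1; ext p
  simp only [e, Equiv.coe_fn_mk]
  congr 3
  push_cast
  ring

lemma exists_norm_solQuot_le (K : ℕ) : ∃ C : ℝ, 0 < C ∧ ∀ ε φ B, (ε = 1 ∨ ε = -1) →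
    DataBound φ K B → ∀ τ : ℂ, 0 < τ.im → (∀ k : ℤ, 1 ≤ ‖τ + 2 * k‖) →
      ‖solQuot ε φ τ‖ ≤ C * B / etaAbs τ * (1 + eisAbs τ) := by
  obtain ⟨C, hC, hC'⟩ := exists_solution_bounds K
  refine ⟨C, hC, fun ε φ B hε h τ hτ hk => ?_⟩
  obtain ⟨-, hd, hp⟩ := hC' φ B h
  obtain ⟨k, hkre⟩ := exists_translate τ.re
  set σ := τ + 2 * k with hσ
  have hσim : σ.im = τ.im := by simp [hσ]
  have hσre : |σ.re| ≤ 1 := by simpa [hσ] using hkre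
  have h1 := hp τ hτ hk
  have h2 := norm_thetaSeries_le hd (norm_eq_one_of_sign hε) (hσim ▸ hτ) hσre (hk k)
  have h3 : thetaSeries ε (solDisc φ) σ = thetaSeries ε (solDisc φ) τ := by
    have h : Function.Periodic (thetaSeries ε (solDisc φ)) 2 := thetaSeries_add_two ε _
    have := h.int_mul k τ
    rwa [mul_comm] at this
  rw [h3, hσ, etaAbs_add_two_mul_int, eisAbs_add_two_mul_int] at h2
  rw [solQuot]
  refine (norm_add_le _ _).trans ?_
  rw [norm_mul]
  have h4 : ‖(1 / 2 : ℂ)‖ ≤ 1 := by norm_num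
  have h5 : ‖(1 / 2 : ℂ)‖ * ‖thetaSeries ε (solDisc φ) τ‖ ≤ ‖thetaSeries ε (solDisc φ) τ‖ :=
    mul_le_of_le_one_left (norm_nonneg _) h4
  linarith

end Solution

section Periodic

open Function.Periodic Filter

variable {Y : ℂ → ℂ} {M : ℝ}

lemma exists_reduced (hper : Function.Periodic Y ((2 : ℝ) : ℂ)) (τ : ℂ) :
    ∃ σ : ℂ, |σ.re| ≤ 1 ∧ σ.im = τ.im ∧ Y σ = Y τ := by
  obtain ⟨k, hk⟩ := exists_translate τ.re
  refine ⟨τ + 2 * k, by simpa using hk, by simp, ?_⟩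
  have := hper.int_mul k τ
  rw [mul_comm] at this
  simpa using this

lemma boundedAtFilter_of_growth (hY : ∀ τ : ℂ, 0 < τ.im → DifferentiableAt ℂ Y τ)
    (hper : Function.Periodic Y ((2 : ℝ) : ℂ))
    (hb : ∀ τ : ℂ, |τ.re| ≤ 1 → 2 ≤ τ.im → ‖Y τ‖ ≤ M * rexp (2 * π / 3 * τ.im)) :
    BoundedAtFilter (comap Complex.im atTop) Y := by
  have hb' : ∀ τ : ℂ, 2 ≤ τ.im → ‖Y τ‖ ≤ M * rexp (2 * π / 3 * τ.im) := by
    intro τ hτ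
    obtain ⟨σ, h1, h2, h3⟩ := exists_reduced hper τ
    rw [← h3, ← h2]
    exact hb σ h1 (h2 ▸ hτ)
  have hev : ∀ a : ℝ, ∀ᶠ τ : ℂ in comap Complex.im atTop, a ≤ τ.im := fun a =>
    tendsto_comap.eventually (eventually_ge_atTop a)
  set g : ℂ → ℂ := fun τ => qParam 2 τ * Y τ with hg
  have hgper : Function.Periodic g ((2 : ℝ) : ℂ) := by
    intro τ
    have : qParam 2 (τ + ((2 : ℝ) : ℂ)) = qParam 2 τ := by
      have e : 2 * π * I * (τ + ((2 : ℝ) : ℂ)) / ((2 : ℝ) : ℂ) =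
          2 * π * I * τ / ((2 : ℝ) : ℂ) + 2 * π * I := by
        push_cast; ring
      rw [qParam, e, Complex.exp_periodic, qParam]
    simp only [hg]
    rw [this, hper τ]
  have hgd : ∀ᶠ τ : ℂ in comap Complex.im atTop, DifferentiableAt ℂ g τ := by
    filter_upwards [hev 1] with τ hτ
    exact (differentiable_qParam τ).mul (hY τ (by linarith))
  have hz : ZeroAtFilter (comap Complex.im atTop) g := by
    rw [ZeroAtFilter, tendsto_zero_iff_norm_tendsto_zero]
    have h1 : Tendsto (fun τ : ℂ => M * rexp (-(π / 3) * τ.im)) (comap Complex.im atTop)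
        (nhds (M * 0)) := by
      refine Tendsto.const_mul _ (Real.tendsto_exp_atBot.comp ?_)
      exact tendsto_comap.const_mul_atTop_of_neg (by linarith [Real.pi_pos])
    rw [mul_zero] at h1
    refine squeeze_zero' (Eventually.of_forall fun _ => norm_nonneg _) ?_ h1
    filter_upwards [hev 2] with τ hτ
    rw [hg, norm_mul, norm_qParam]
    calc _ ≤ rexp (-2 * π * τ.im / 2) * (M * rexp (2 * π / 3 * τ.im)) := by
          gcongr; exact hb' τ hτ
      _ = M * (rexp (-2 * π * τ.im / 2) * rexp (2 * π / 3 * τ.im)) := by ring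
      _ = _ := by rw [← Real.exp_add]; congr 2; ring
  have hO := exp_decay_of_zero_at_inf two_pos hgper hgd hz
  obtain ⟨c, hc⟩ := hO.bound
  refine Asymptotics.IsBigO.of_bound c ?_
  filter_upwards [hc] with τ hτ
  rw [hg, norm_mul, norm_qParam, Real.norm_of_nonneg (Real.exp_pos _).le, mul_comm] at hτ
  rw [Pi.one_apply, norm_one, mul_one]
  exact le_of_mul_le_mul_right hτ (Real.exp_pos _)

lemma differentiableAt_cuspFunction_of_growth (hY : ∀ τ : ℂ, 0 < τ.im → DifferentiableAt ℂ Y τ)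
    (hper : Function.Periodic Y ((2 : ℝ) : ℂ))
    (hb : ∀ τ : ℂ, |τ.re| ≤ 1 → 2 ≤ τ.im → ‖Y τ‖ ≤ M * rexp (2 * π / 3 * τ.im)) {q : ℂ}
    (hq : ‖q‖ < 1) : DifferentiableAt ℂ (cuspFunction 2 Y) q := by
  by_cases h0 : q = 0
  · rw [h0]
    refine differentiableAt_cuspFunction_zero two_pos hper ?_ (boundedAtFilter_of_growth hY hper hb)
    filter_upwards [tendsto_comap.eventually (eventually_gt_atTop 0)] with τ hτ using hY τ hτ
  · have h1 : 0 < (invQParam 2 q).im := by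
      rw [im_invQParam]
      have := Real.log_neg (norm_pos_iff.mpr h0) hq
      have := Real.pi_pos
      have h3 : -2 / (2 * π) < 0 := div_neg_of_neg_of_pos (by norm_num) (by positivity)
      exact mul_pos_of_neg_of_neg h3 ‹_›
    have := differentiableAt_cuspFunction two_ne_zero hper (hY _ h1)
    rwa [qParam_right_inv two_ne_zero h0] at this

lemma norm_le_of_periodic (hY : ∀ τ : ℂ, 0 < τ.im → DifferentiableAt ℂ Y τ)
    (hper : Function.Periodic Y ((2 : ℝ) : ℂ))
    (hb : ∀ τ : ℂ, |τ.re| ≤ 1 → 2 ≤ τ.im → ‖Y τ‖ ≤ M * rexp (2 * π / 3 * τ.im)) {y A : ℝ}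
    (hy : 0 < y) (hA : ∀ τ : ℂ, |τ.re| ≤ 1 → τ.im = y → ‖Y τ‖ ≤ A) (τ : ℂ) (hτ : y ≤ τ.im) :
    ‖Y τ‖ ≤ A := by
  have hπ := Real.pi_pos
  have hd : ∀ q : ℂ, ‖q‖ < 1 → DifferentiableAt ℂ (cuspFunction 2 Y) q := fun q hq =>
    differentiableAt_cuspFunction_of_growth hY hper hb hq
  rw [← eq_cuspFunction two_ne_zero hper τ]
  set r := rexp (-(π * y)) with hr
  have hr0 : 0 < r := Real.exp_pos _
  have hr1 : r < 1 := by rw [hr, Real.exp_lt_one_iff]; nlinarith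
  refine Complex.norm_le_of_forall_mem_frontier_norm_le (U := Metric.ball 0 r)
    Metric.isBounded_ball (DifferentiableOn.diffContOnCl ?_) ?_ ?_
  · intro q hq
    rw [closure_ball 0 hr0.ne', mem_closedBall_zero_iff] at hq
    exact (hd q (by linarith)).differentiableWithinAt
  · intro q hq
    rw [frontier_ball 0 hr0.ne', mem_sphere_zero_iff_norm] at hq
    have hq0 : q ≠ 0 := by rw [← norm_pos_iff, hq]; exact hr0
    rw [cuspFunction_eq_of_nonzero _ _ hq0]
    obtain ⟨σ, h1, h2, h3⟩ := exists_reduced hper (invQParam 2 q)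
    rw [← h3]
    refine hA σ h1 ?_
    rw [h2, im_invQParam, hq, hr, Real.log_exp]
    field_simp
  · rw [closure_ball 0 hr0.ne', mem_closedBall_zero_iff, norm_qParam, hr, Real.exp_le_exp]
    nlinarith

end Periodic

section CuspGeometry

lemma int_abs_le_sq (n : ℤ) : |n| ≤ n ^ 2 := by
  rw [← sq_abs]
  rcases eq_or_ne n 0 with rfl | h
  · simp
  · nlinarith [Int.one_le_abs h]

lemma one_le_norm_sq_add_two_mul_int {τ : ℂ} (hre : |τ.re| ≤ 1) (h1 : 1 ≤ ‖τ‖) (k : ℤ) :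
    1 ≤ ‖τ + 2 * k‖ := by
  have h2 : 1 ≤ ‖τ‖ ^ 2 := one_le_pow₀ h1
  have h3 : ‖τ + 2 * k‖ ^ 2 = ‖τ‖ ^ 2 + 4 * (k * τ.re + k ^ 2) := by
    rw [norm_sq_eq_re_im, norm_sq_eq_re_im]
    simp
    ring
  have h4 : 0 ≤ (k : ℝ) * τ.re + k ^ 2 := by
    have : |(k : ℝ)| ≤ (k : ℝ) ^ 2 := by exact_mod_cast int_abs_le_sq k
    have h5 := neg_abs_le ((k : ℝ) * τ.re)
    rw [abs_mul] at h5
    nlinarith [abs_nonneg (k : ℝ)]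
  have : 1 ≤ ‖τ + 2 * k‖ ^ 2 := by linarith
  exact (one_le_sq_iff₀ (norm_nonneg _)).mp this

variable {w : ℂ}

lemma one_le_norm_cusp_add (hre : |w.re| ≤ 1 / 2) (him : 1 ≤ w.im) (k : ℤ) :
    1 ≤ ‖1 - 1 / w + 2 * k‖ := by
  have hw : w ≠ 0 := fun h0 => by simp [h0] at him; linarith
  have hw' := norm_pos_iff.mpr hw
  have e : 1 - 1 / w + 2 * k = (((1 + 2 * k : ℤ) : ℂ) * w - 1) / w := by
    push_cast; field_simp; ring
  set n : ℤ := 1 + 2 * k with hn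
  have hn0 : n ≠ 0 := by omega
  rw [e, norm_div, le_div_iff₀ hw', one_mul]
  have h3 : ‖(n : ℂ) * w - 1‖ ^ 2 = n ^ 2 * ‖w‖ ^ 2 - 2 * n * w.re + 1 := by
    rw [norm_sq_eq_re_im, norm_sq_eq_re_im]
    simp
    ring
  have h4 : ‖w‖ ^ 2 ≤ ‖(n : ℂ) * w - 1‖ ^ 2 := by
    have h5 : 1 ≤ ‖w‖ ^ 2 := by rw [norm_sq_eq_re_im]; nlinarith [sq_nonneg w.re]
    have h6 : |(n : ℝ)| ≤ (n : ℝ) ^ 2 := by exact_mod_cast int_abs_le_sq n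
    have h7 : (1 : ℝ) ≤ (n : ℝ) ^ 2 := by
      have : 1 ≤ n ^ 2 := by nlinarith [int_abs_le_sq n, Int.one_le_abs hn0]
      exact_mod_cast this
    have h8 : (n : ℝ) * w.re ≤ |(n : ℝ)| * (1 / 2) := by
      refine (le_abs_self _).trans ?_
      rw [abs_mul]
      gcongr
    rw [h3]
    nlinarith
  exact (sq_le_sq₀ hw'.le (norm_nonneg _)).mp h4

/-- Geometry of the two points `1 - 1 / w` and `-1 / (1 - 1 / w)` near the cusp `1`. -/
lemma cusp_points (hre : |w.re| ≤ 3 / 2) (him : 1 ≤ w.im) :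
    1 - 1 / w ∈ annulus ∧ -1 / (1 - 1 / w) ∈ annulus ∧ 1 / (8 * w.im) ≤ (1 - 1 / w).im ∧
      1 / (8 * w.im) ≤ (-1 / (1 - 1 / w)).im ∧ 1 / 4 ≤ ‖1 - 1 / w‖ := by
  have hw : w ≠ 0 := fun h0 => by simp [h0] at him; linarith
  have hw1 : w - 1 ≠ 0 := fun h0 => by
    have := congrArg Complex.im h0
    simp at this; linarith
  have hv : 0 < w.im := by linarith
  obtain ⟨hl, hr⟩ := abs_le.mp hre
  have e1 : 1 - 1 / w = (w - 1) / w := by field_simp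
  have e2 : -1 / (1 - 1 / w) = -w / (w - 1) := by rw [e1]; field_simp
  have n0 := norm_pos_iff.mpr hw
  have n1 := norm_pos_iff.mpr hw1
  have a1 : ‖w‖ ^ 2 = w.re ^ 2 + w.im ^ 2 := norm_sq_eq_re_im w
  have a2 : ‖w - 1‖ ^ 2 = (w.re - 1) ^ 2 + w.im ^ 2 := by
    rw [norm_sq_eq_re_im]; simp
  have b1 : ‖w - 1‖ ≤ 3 * ‖w‖ := by
    refine (sq_le_sq₀ n1.le (by positivity)).mp ?_
    rw [mul_pow, a1, a2]
    nlinarith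
  have b2 : ‖w‖ ≤ 3 * ‖w - 1‖ := by
    refine (sq_le_sq₀ n0.le (by positivity)).mp ?_
    rw [mul_pow, a1, a2]
    nlinarith
  have i1 : (1 - 1 / w).im = w.im / ‖w‖ ^ 2 := by
    rw [Complex.sub_im, Complex.one_im, Complex.div_im, ← Complex.normSq_eq_norm_sq]
    simp
  have i2 : (-1 / (1 - 1 / w)).im = w.im / ‖w - 1‖ ^ 2 := by
    have : -w / (w - 1) = -1 - 1 / (w - 1) := by field_simp; ring
    rw [e2, this, Complex.sub_im, Complex.div_im, ← Complex.normSq_eq_norm_sq]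
    simp
  have m1 : ‖1 - 1 / w‖ = ‖w - 1‖ / ‖w‖ := by rw [e1, norm_div]
  have m2 : ‖-1 / (1 - 1 / w)‖ = ‖w‖ / ‖w - 1‖ := by rw [e2, norm_div, norm_neg]
  have c1 : 1 / (8 * w.im) ≤ w.im / ‖w‖ ^ 2 := by
    rw [div_le_div_iff₀ (by positivity) (by positivity), a1]
    nlinarith
  have c2 : 1 / (8 * w.im) ≤ w.im / ‖w - 1‖ ^ 2 := by
    rw [div_le_div_iff₀ (by positivity) (by positivity), a2]
    nlinarith
  refine ⟨⟨?_, ?_, ?_⟩, ⟨?_, ?_, ?_⟩, ?_, ?_, ?_⟩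
  · rw [i1]; positivity
  · rw [m1, le_div_iff₀ n0]; linarith
  · rw [m1, div_le_iff₀ n0]; exact b1
  · rw [i2]; positivity
  · rw [m2, le_div_iff₀ n1]; linarith
  · rw [m2, div_le_iff₀ n1]; exact b2
  · rw [i1]; exact c1
  · rw [i2]; exact c2
  · rw [m1, le_div_iff₀ n0]; linarith

end CuspGeometry

lemma solQuot_periodic (ε : ℂ) (φ : ℂ → ℂ) :
    Function.Periodic (solQuot ε φ) ((2 : ℝ) : ℂ) := by
  intro τ
  have := solQuot_add_two ε φ τ
  push_cast
  exact this

/-- The quotient `F / θ` grows at most like `exp (2π y / 3)`. -/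
lemma exists_solQuot_growth (K : ℕ) : ∃ C : ℝ, 0 < C ∧ ∀ ε φ B, (ε = 1 ∨ ε = -1) →
    DataBound φ K B → ∀ τ : ℂ, |τ.re| ≤ 1 → 1 / 2 ≤ τ.im → (∀ k : ℤ, 1 ≤ ‖τ + 2 * k‖) →
      ‖solQuot ε φ τ‖ ≤ C * B * rexp (2 * π / 3 * τ.im) := by
  obtain ⟨C₀, hC₀, hb⟩ := exists_norm_solQuot_le K
  obtain ⟨c, _, hc, _, hV⟩ := exists_etaProd_bounds (y₀ := 1 / 2) (by norm_num)
  obtain ⟨E, hE, hEb⟩ := exists_eisAbs_le 1 (m := 1 / 2) (by norm_num)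
  refine ⟨C₀ / c * (1 + E), by positivity, fun ε φ B hε h τ hre him hk => ?_⟩
  have hB := h.nonneg
  have h0 : 0 < τ.im := by linarith
  refine (hb ε φ B hε h τ h0 hk).trans ?_
  have h1 : rexp (-(2 * π / 3 * τ.im)) * c ≤ etaAbs τ := by
    rw [etaAbs_eq, neg_mul]
    gcongr
    exact (hV τ him).1
  have h2 : C₀ * B / etaAbs τ ≤ C₀ * B / (rexp (-(2 * π / 3 * τ.im)) * c) := by gcongr
  have h3 := hEb τ hre him
  have h4 : 0 ≤ C₀ * B / etaAbs τ := div_nonneg (by positivity) (etaAbs_pos h0).le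
  calc _ ≤ C₀ * B / (rexp (-(2 * π / 3 * τ.im)) * c) * (1 + E) :=
        mul_le_mul h2 (add_le_add_right h3 1) (add_nonneg zero_le_one (tsum_nonneg fun _ => by positivity))
          (h4.trans h2)
    _ = _ := by rw [Real.exp_neg]; field_simp

lemma exists_solQuot_top_bound (K : ℕ) : ∃ C : ℝ, 0 < C ∧ ∀ ε φ B, (ε = 1 ∨ ε = -1) →
    DataBound φ K B → ∀ τ : ℂ, |τ.re| ≤ 1 → 1 ≤ ‖τ‖ → 1 / 2 ≤ τ.im →
      ‖solQuot ε φ τ‖ ≤ C * B := by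
  obtain ⟨C, hC, hb⟩ := exists_solQuot_growth K
  refine ⟨C * rexp (2 * π / 3), by positivity, fun ε φ B hε h τ hre h1 him => ?_⟩
  have hB := h.nonneg
  have low : ∀ σ : ℂ, |σ.re| ≤ 1 → 1 ≤ ‖σ‖ → 1 / 2 ≤ σ.im → σ.im ≤ 1 →
      ‖solQuot ε φ σ‖ ≤ C * rexp (2 * π / 3) * B := by
    intro σ s1 s2 s3 s4
    refine (hb ε φ B hε h σ s1 s3 (one_le_norm_sq_add_two_mul_int s1 s2)).trans ?_
    have : rexp (2 * π / 3 * σ.im) ≤ rexp (2 * π / 3) := by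
      apply Real.exp_le_exp.mpr
      exact mul_le_of_le_one_right (by positivity) s4
    calc _ ≤ C * B * rexp (2 * π / 3) := by gcongr
      _ = _ := by ring
  have big : ∀ σ : ℂ, 1 ≤ σ.im → 1 ≤ ‖σ‖ := fun σ hσ =>
    hσ.trans ((le_abs_self _).trans (Complex.abs_im_le_norm σ))
  rcases le_total τ.im 1 with h2 | h2
  · exact low τ hre h1 him h2
  · refine norm_le_of_periodic (M := C * B) (y := 1) (fun σ hσ => solQuot_differentiableAt hε h hσ)
      (solQuot_periodic ε φ) ?_ one_pos ?_ τ h2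
    · intro σ s1 s2
      exact hb ε φ B hε h σ s1 (by linarith)
        (one_le_norm_sq_add_two_mul_int s1 (big σ (by linarith)))
    · intro σ s1 s2
      exact low σ s1 (big σ s2.ge) (by linarith) s2.le

lemma exists_solQuot_cusp_growth (K : ℕ) : ∃ C : ℝ, 0 < C ∧ ∀ ε φ B, (ε = 1 ∨ ε = -1) →
    DataBound φ K B → ∀ w : ℂ, |w.re| ≤ 1 / 2 → 1 ≤ w.im →
      ‖solQuot ε φ (1 - 1 / w)‖ ≤ C * B * rexp (2 * π / 3 * w.im) := by
  obtain ⟨C₀, hC₀, hb⟩ := exists_norm_solQuot_le K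
  obtain ⟨c, _, hc, _, hV⟩ := exists_etaProd_bounds (y₀ := 1) one_pos
  obtain ⟨E, hE, hEb⟩ := exists_eisAbs_le (1 / 2) (m := 1) one_pos
  refine ⟨C₀ / c * (1 + E), by positivity, fun ε φ B hε h w hre him => ?_⟩
  have hB := h.nonneg
  have h0 : 0 < w.im := by linarith
  have hw : w ≠ 0 := fun h0 => by simp [h0] at him; linarith
  have hpos := (cusp_points (by linarith) him).1.1
  refine (hb ε φ B hε h _ hpos (one_le_norm_cusp_add hre him)).trans ?_
  have hn : 1 ≤ ‖w‖ ^ 4 :=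
    one_le_pow₀ (him.trans ((le_abs_self _).trans (Complex.abs_im_le_norm w)))
  rw [etaAbs_cusp h0, eisAbs_cusp hw]
  have h1 : rexp (-(2 * π / 3 * w.im)) * c ≤ etaAbs w := by
    rw [etaAbs_eq, neg_mul]
    gcongr
    exact (hV w him).1
  have h2 : C₀ * B / etaAbs w ≤ C₀ * B / (rexp (-(2 * π / 3 * w.im)) * c) := by gcongr
  have h3 := hEb w hre him
  have hE0 : 0 ≤ eisAbs w := tsum_nonneg fun _ => by positivity
  have hη := etaAbs_pos h0
  have h4 : 0 ≤ C₀ * B / etaAbs w := div_nonneg (by positivity) hη.le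
  calc C₀ * B / (‖w‖ ^ 4 * etaAbs w) * (1 + ‖w‖ ^ 4 * eisAbs w)
      ≤ C₀ * B / (‖w‖ ^ 4 * etaAbs w) * (‖w‖ ^ 4 * (1 + eisAbs w)) := by
        gcongr
        nlinarith
    _ = C₀ * B / etaAbs w * (1 + eisAbs w) := by
        have : ‖w‖ ^ 4 ≠ 0 := by positivity
        field_simp
    _ ≤ C₀ * B / (rexp (-(2 * π / 3 * w.im)) * c) * (1 + E) :=
        mul_le_mul h2 (by linarith) (by linarith) (h4.trans h2)
    _ = _ := by rw [Real.exp_neg]; field_simp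

lemma DataBound.norm_div_jacobiTheta_le {φ : ℂ → ℂ} {K : ℕ} {B : ℝ} (h : DataBound φ K B) {w : ℂ}
    (hre : |w.re| ≤ 3 / 2) (him : 1 ≤ w.im) :
    ‖φ (1 - 1 / w) / jacobiTheta (1 - 1 / w)‖ +
      ‖φ (-1 / (1 - 1 / w)) / jacobiTheta (-1 / (1 - 1 / w))‖ ≤
      3 * 8 ^ K * B * (w.im ^ K * rexp (π / 4 * w.im)) := by
  obtain ⟨p1, p2, p3, p4, p5⟩ := cusp_points hre him
  have hB := h.nonneg
  have hv : 0 < w.im := by linarith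
  have d1 : ∀ z ∈ annulus, 1 / (8 * w.im) ≤ z.im → ‖φ z‖ ≤ 8 ^ K * B * w.im ^ K := by
    intro z hz hle
    have h1 := h.bound z hz
    have h2 : (1 / (8 * w.im)) ^ K ≤ z.im ^ K := by gcongr
    have h3 : ‖φ z‖ * (1 / (8 * w.im)) ^ K ≤ B :=
      (mul_le_mul_of_nonneg_left h2 (norm_nonneg _)).trans h1
    rw [one_div_pow, mul_one_div, div_le_iff₀ (by positivity), mul_pow] at h3
    linarith
  have t1 : rexp (-(π / 4) * w.im) ≤ ‖jacobiTheta (1 - 1 / w)‖ := by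
    refine le_trans ?_ (le_norm_jacobiTheta_cusp him)
    refine le_mul_of_one_le_left (Real.exp_pos _).le (Real.one_le_rpow ?_ (by norm_num))
    exact him.trans ((le_abs_self _).trans (Complex.abs_im_le_norm w))
  have t2 : 1 / 2 * rexp (-(π / 4) * w.im) ≤ ‖jacobiTheta (-1 / (1 - 1 / w))‖ := by
    rw [norm_jacobiTheta_neg_inv p1.1]
    have : (1 / 2 : ℝ) ≤ ‖1 - 1 / w‖ ^ (1 / 2 : ℝ) := by
      rw [← Real.sqrt_eq_rpow]
      exact Real.le_sqrt_of_sq_le (by linarith)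
    gcongr
  have hexp : rexp (π / 4 * w.im) = 1 / rexp (-(π / 4) * w.im) := by
    rw [neg_mul, Real.exp_neg, one_div, inv_inv]
  set X := 8 ^ K * B * w.im ^ K
  have hX : 0 ≤ X := by positivity
  have u1 : ‖φ (1 - 1 / w) / jacobiTheta (1 - 1 / w)‖ ≤ X * rexp (π / 4 * w.im) := by
    rw [norm_div, hexp, mul_one_div]
    exact div_le_div₀ hX (d1 _ p1 p3) (Real.exp_pos _) t1
  have u2 : ‖φ (-1 / (1 - 1 / w)) / jacobiTheta (-1 / (1 - 1 / w))‖ ≤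
      2 * (X * rexp (π / 4 * w.im)) := by
    rw [norm_div, hexp]
    refine (div_le_div₀ hX (d1 _ p2 p4) (by positivity) t2).trans (le_of_eq ?_)
    field_simp
  calc _ ≤ X * rexp (π / 4 * w.im) + 2 * (X * rexp (π / 4 * w.im)) := add_le_add u1 u2
    _ = _ := by ring

lemma exists_solQuot_cusp_bound (K : ℕ) : ∃ C : ℝ, 0 < C ∧ ∀ ε φ B, (ε = 1 ∨ ε = -1) →
    DataBound φ K B → ∀ w : ℂ, |w.re| ≤ 1 / 2 → 1 ≤ w.im →
      ‖solQuot ε φ (1 - 1 / w)‖ ≤ C * B * (w.im ^ K * rexp (π / 4 * w.im)) := by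
  obtain ⟨C₀, hC₀, hg⟩ := exists_solQuot_cusp_growth K
  obtain ⟨C, hC, hc⟩ := exists_cusp_bound K
  refine ⟨C * (C₀ + 3 * 8 ^ K), by positivity, fun ε φ B hε h w hre him => ?_⟩
  have hB := h.nonneg
  have hεsq := sq_eq_one_of_sign hε
  set Y : ℂ → ℂ := fun s => solQuot ε φ (1 - 1 / s) with hY
  set g : ℂ → ℂ := fun s => ε * (φ (1 - 1 / s) / jacobiTheta (1 - 1 / s) +
    ε * (φ (-1 / (1 - 1 / s)) / jacobiTheta (-1 / (1 - 1 / s)))) with hgdef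
  have him1 : ∀ s : ℂ, 0 < s.im → 0 < (1 - 1 / s).im := by
    intro s hs
    have h0 : s ≠ 0 := fun h0 => by simp [h0] at hs
    rw [Complex.sub_im, Complex.one_im, Complex.div_im]
    have := Complex.normSq_pos.mpr h0
    simp only [Complex.one_im, Complex.one_re, zero_mul, zero_div, one_mul, zero_sub, neg_neg]
    positivity
  have hp : ∃ p : ℝ, 1 / 2 ≤ p ∧ p ≤ 1 ∧ Complex.exp (-(2 * π * I * p)) * (-ε) = 1 := by
    rcases hε with rfl | rfl
    · refine ⟨1 / 2, le_rfl, by norm_num, ?_⟩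
      have e : -(2 * π * I * ((1 / 2 : ℝ) : ℂ)) = -(π * I) := by push_cast; ring
      rw [e, Complex.exp_neg, Complex.exp_pi_mul_I]; norm_num
    · refine ⟨1, by norm_num, le_rfl, ?_⟩
      rw [Complex.ofReal_one, mul_one, Complex.exp_neg, Complex.exp_two_pi_mul_I]; norm_num
  obtain ⟨p, hp1, hp2, hp3⟩ := hp
  have hrel : ∀ s : ℂ, 0 < s.im → Y (s - 1) = -ε * Y s + g s := by
    intro s hs
    have hs0 : s ≠ 0 := fun h0 => by simp [h0] at hs
    have hs1 : s - 1 ≠ 0 := fun h0 => by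
      have := congrArg Complex.im h0
      simp at this; linarith
    have key := solQuot_add_mul_neg_inv hε h (him1 s hs)
    have e : solQuot ε φ (-1 / (1 - 1 / s)) = Y (s - 1) := by
      rw [hY]
      dsimp only
      rw [← solQuot_add_two_mul_int ε φ (-1 / (1 - 1 / s)) 1]
      congr 1
      have : (1 - 1 / s) = (s - 1) / s := by field_simp
      rw [this]
      push_cast
      field_simp
      ring
    rw [e] at key
    simp only [hgdef, hY]
    simp only [hY] at key
    linear_combination ε * key - solQuot ε φ (1 - 1 / (s - 1)) * hεsq
  have hdiff : DifferentiableOn ℂ Y {s | 0 < s.im} := by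
    intro s hs
    have h0 : s ≠ 0 := fun h0 => by
      rw [Set.mem_ofPred_eq, h0] at hs; simp at hs
    have h1 : DifferentiableAt ℂ (fun s : ℂ => 1 - 1 / s) s := by
      simp only [one_div]
      exact (differentiableAt_const _).sub (differentiableAt_inv h0)
    exact ((solQuot_differentiableAt hε h (him1 s hs)).comp s h1).differentiableWithinAt
  have := hc p (-ε) Y g (C₀ * B) (3 * 8 ^ K * B) hp1 hp2 (by rw [norm_neg, norm_eq_one_of_sign hε])
    hp3 hdiff hrel (by positivity) (by positivity) (fun s s1 s2 => hg ε φ B hε h s s1 s2) ?_ w hre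
    him
  · refine this.trans ?_
    have h1 : 1 ≤ w.im ^ K * rexp (π / 4 * w.im) :=
      one_le_mul_of_one_le_of_one_le (one_le_pow₀ him) (Real.one_le_exp (by positivity))
    have h2 : C₀ * B ≤ C₀ * B * (w.im ^ K * rexp (π / 4 * w.im)) :=
      le_mul_of_one_le_right (by positivity) h1
    calc _ ≤ C * (C₀ * B * (w.im ^ K * rexp (π / 4 * w.im)) +
          3 * 8 ^ K * B * (w.im ^ K * rexp (π / 4 * w.im))) := by gcongr
      _ = _ := by ring
  · intro s s1 s2
    refine le_trans ?_ (h.norm_div_jacobiTheta_le s1 s2)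
    rw [hgdef]
    dsimp only
    rw [norm_mul, norm_eq_one_of_sign hε, one_mul]
    refine (norm_add_le _ _).trans ?_
    rw [norm_mul, norm_eq_one_of_sign hε, one_mul]

/-- Bounds for the solution on the fundamental domain `|Re τ| ≤ 1 ≤ |τ|`. -/
theorem exists_sol_bound (K : ℕ) : ∃ C : ℝ, 0 < C ∧ ∀ ε φ B, (ε = 1 ∨ ε = -1) →
    DataBound φ K B → ∀ τ : ℂ, |τ.re| ≤ 1 → 0 < τ.im → 1 ≤ ‖τ‖ →
      (1 / 2 ≤ τ.im → ‖sol ε φ τ‖ ≤ C * B) ∧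
        (τ.im ≤ 1 → ‖sol ε φ τ‖ * (τ.im ^ K * √τ.im) ≤ C * B) := by
  obtain ⟨C₁, hC₁, h₁⟩ := exists_solQuot_top_bound K
  obtain ⟨C₂, hC₂, h₂⟩ := exists_solQuot_cusp_bound K
  have top : ∀ ε φ B, (ε = 1 ∨ ε = -1) → DataBound φ K B → ∀ τ : ℂ, |τ.re| ≤ 1 → 1 ≤ ‖τ‖ →
      1 / 2 ≤ τ.im → ‖sol ε φ τ‖ ≤ (2 * C₁ + 6 * C₂) * B := by
    intro ε φ B hε h τ hre h1 him
    have hB := h.nonneg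
    have ht : ‖jacobiTheta τ‖ ≤ 2 := by
      have := norm_jacobiTheta_sub_one_le_of_half_le him
      have h3 := norm_add_le (jacobiTheta τ - 1) 1
      rw [sub_add_cancel, norm_one] at h3
      linarith
    rw [sol, norm_mul]
    calc _ ≤ 2 * (C₁ * B) := by
          gcongr
          exact h₁ ε φ B hε h τ hre h1 him
      _ ≤ _ := by nlinarith [mul_nonneg hC₂.le hB]
  refine ⟨2 * C₁ + 6 * C₂, by positivity, fun ε φ B hε h τ hre him h1 =>
    ⟨top ε φ B hε h τ hre h1, fun hle => ?_⟩⟩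
  have hB := h.nonneg
  have hs : 0 ≤ τ.im ^ K * √τ.im := by positivity
  have hs1 : τ.im ^ K * √τ.im ≤ 1 :=
    mul_le_one₀ (pow_le_one₀ him.le hle) (Real.sqrt_nonneg _) (Real.sqrt_le_one.mpr hle)
  rcases le_or_gt (1 / 2) τ.im with hhalf | hhalf
  · exact (mul_le_of_le_one_right (norm_nonneg _) hs1).trans (top ε φ B hε h τ hre h1 hhalf)
  obtain ⟨w, k, w1, w2, w3, w4⟩ := exists_cusp_coordinate hre him h1 hhalf
  have hv : 0 < w.im := by linarith
  rw [w3, sol_add_two_mul_int, sol, norm_mul, ← w3]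
  have a1 := norm_jacobiTheta_cusp_le w2
  have a2 := h₂ ε φ B hε h w w1 w2
  have hw : ‖w‖ ^ (1 / 2 : ℝ) ≤ 2 * √w.im := by
    rw [← Real.sqrt_eq_rpow, Real.sqrt_le_left (by positivity), mul_pow, Real.sq_sqrt hv.le]
    have := Complex.norm_le_abs_re_add_abs_im w
    rw [abs_of_pos hv] at this
    linarith
  have hy : w.im * τ.im ≤ 1 := by rwa [le_div_iff₀ him] at w4
  have hprod : w.im ^ K * √w.im * (τ.im ^ K * √τ.im) ≤ 1 := by
    calc _ = (w.im * τ.im) ^ K * √(w.im * τ.im) := by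
          rw [mul_pow, Real.sqrt_mul hv.le]; ring
      _ ≤ 1 := mul_le_one₀ (pow_le_one₀ (by positivity) hy) (Real.sqrt_nonneg _)
          (Real.sqrt_le_one.mpr hy)
  have hexp : rexp (-(π / 4) * w.im) * rexp (π / 4 * w.im) = 1 := by
    rw [← Real.exp_add]; simp
  calc ‖jacobiTheta (1 - 1 / w)‖ * ‖solQuot ε φ (1 - 1 / w)‖ * (τ.im ^ K * √τ.im)
      ≤ (3 * (2 * √w.im) * rexp (-(π / 4) * w.im)) *
          (C₂ * B * (w.im ^ K * rexp (π / 4 * w.im))) * (τ.im ^ K * √τ.im) := by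
        gcongr
        exact a1.trans (by gcongr)
    _ = 6 * C₂ * B * (w.im ^ K * √w.im * (τ.im ^ K * √τ.im)) *
          (rexp (-(π / 4) * w.im) * rexp (π / 4 * w.im)) := by ring
    _ ≤ 6 * C₂ * B * 1 * 1 := by
        rw [hexp]
        gcongr
    _ ≤ _ := by nlinarith [mul_nonneg hC₁.le hB]

section Slash

variable {f g : ℂ → ℂ} {τ : ℂ}

lemma norm_slash (f : ℂ → ℂ) (τ : ℂ) : ‖slash f τ‖ = ‖f (-1 / τ)‖ / ‖τ‖ ^ (1 / 2 : ℝ) := by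
  have := norm_neg_I_mul_cpow τ (1 / 2)
  push_cast at this
  rw [slash, norm_div, this]

lemma neg_I_mul_re (τ : ℂ) : (-I * τ).re = τ.im := by simp

lemma neg_I_mul_mem_slitPlane (hτ : 0 < τ.im) : -I * τ ∈ Complex.slitPlane :=
  Or.inl (by rwa [neg_I_mul_re])

lemma slash_slash (f : ℂ → ℂ) (hτ : 0 < τ.im) : slash (slash f) τ = f τ := by
  have h0 : τ ≠ 0 := fun h0 => by simp [h0] at hτ
  have e1 : -1 / (-1 / τ) = τ := by field_simp
  have e2 : -I * (-1 / τ) = (-I * τ)⁻¹ := by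
    rw [mul_inv, inv_neg, Complex.inv_I, neg_neg]
    field_simp
  have h2 := neg_I_mul_cpow_ne_zero hτ
  rw [slash, slash, e1, e2, Complex.inv_cpow]
  · field_simp
  · exact Complex.slitPlane_arg_ne_pi (neg_I_mul_mem_slitPlane hτ)

lemma slash_differentiableAt (hf : ∀ τ : ℂ, 0 < τ.im → DifferentiableAt ℂ f τ) (hτ : 0 < τ.im) :
    DifferentiableAt ℂ (slash f) τ := by
  have h0 : τ ≠ 0 := fun h0 => by simp [h0] at hτ
  have h1 : DifferentiableAt ℂ (fun s : ℂ => -1 / s) τ :=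
    (differentiableAt_const _).div differentiableAt_id h0
  refine DifferentiableAt.div ((hf _ (neg_inv_im_pos hτ)).comp τ h1) ?_ (neg_I_mul_cpow_ne_zero hτ)
  exact DifferentiableAt.cpow (by fun_prop) (by fun_prop) (neg_I_mul_mem_slitPlane hτ)

lemma neg_inv_im (τ : ℂ) : (-1 / τ).im = τ.im / ‖τ‖ ^ 2 := by
  simpa using neg_inv_add_im τ 0

/-- `exp (π i r τ)`. -/
noncomputable def expo (r : ℝ) (τ : ℂ) : ℂ := Complex.exp (π * I * r * τ)

lemma norm_expo (r : ℝ) (τ : ℂ) : ‖expo r τ‖ = rexp (-(π * r * τ.im)) := by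
  rw [expo, Complex.norm_exp]
  congr 1
  simp

lemma expo_differentiable (r : ℝ) : Differentiable ℂ (expo r) := by
  unfold expo; fun_prop

lemma norm_slash_expo (r : ℝ) (τ : ℂ) :
    ‖slash (expo r) τ‖ = rexp (-(π * r * (τ.im / ‖τ‖ ^ 2))) / ‖τ‖ ^ (1 / 2 : ℝ) := by
  rw [norm_slash, norm_expo, neg_inv_im]

/-- The symmetrised exponential, the `ε`-eigenpart of `exp (π i r τ)` under inversion. -/
noncomputable def symExpo (ε : ℂ) (r : ℝ) (τ : ℂ) : ℂ := (expo r τ + ε * slash (expo r) τ) / 2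

lemma symExpo_differentiableAt (ε : ℂ) (r : ℝ) (hτ : 0 < τ.im) :
    DifferentiableAt ℂ (symExpo ε r) τ :=
  ((expo_differentiable r τ).add ((slash_differentiableAt (fun τ _ => expo_differentiable r τ)
    hτ).const_mul ε)).div_const 2

lemma symExpo_add_slash {ε : ℂ} (hε : ε = 1 ∨ ε = -1) (r : ℝ) (hτ : 0 < τ.im) :
    symExpo ε r τ + ε * slash (symExpo ε r) τ = expo r τ + ε * slash (expo r) τ := by
  have h1 : slash (symExpo ε r) τ = (slash (expo r) τ + ε * slash (slash (expo r)) τ) / 2 := by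
    simp only [slash, symExpo]
    ring
  rw [h1, slash_slash _ hτ, symExpo]
  linear_combination (expo r τ / 2) * sq_eq_one_of_sign hε

lemma exists_pow_mul_exp_le (K : ℕ) {c : ℝ} (hc : 0 < c) (a : ℝ) : ∃ C : ℝ, 0 < C ∧
    ∀ t : ℝ, 0 ≤ a + t → (a + t) ^ K * rexp (-(c * t)) ≤ C := by
  refine ⟨K.factorial * rexp (c * a) / c ^ K, by positivity, fun t ht => ?_⟩
  have h := Real.pow_div_factorial_le_exp (c * (a + t)) (by positivity) K
  rw [div_le_iff₀ (by positivity), mul_pow] at h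
  rw [le_div_iff₀ (by positivity)]
  calc (a + t) ^ K * rexp (-(c * t)) * c ^ K = c ^ K * (a + t) ^ K * rexp (-(c * t)) := by ring
    _ ≤ rexp (c * (a + t)) * K.factorial * rexp (-(c * t)) := by gcongr
    _ = K.factorial * (rexp (c * (a + t)) * rexp (-(c * t))) := by ring
    _ = _ := by rw [← Real.exp_add]; congr 2; ring

lemma norm_symExpo_le {ε : ℂ} (hε : ε = 1 ∨ ε = -1) {r : ℝ} (hr : 0 ≤ r) (hτ : τ ∈ annulus) :
    ‖symExpo ε r τ‖ ≤ 2 * rexp (-(π / 9 * (r * τ.im))) := by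
  obtain ⟨h0, h1, h2⟩ := hτ
  have hn : 0 < ‖τ‖ := by linarith
  have hπ := Real.pi_pos
  have e1 : ‖expo r τ‖ ≤ rexp (-(π / 9 * (r * τ.im))) := by
    rw [norm_expo, Real.exp_le_exp]
    have : 0 ≤ π * (r * τ.im) := by positivity
    linarith
  have e2 : ‖slash (expo r) τ‖ ≤ 3 * rexp (-(π / 9 * (r * τ.im))) := by
    rw [norm_slash_expo, div_le_iff₀ (by positivity)]
    have h3 : (1 / 3 : ℝ) ≤ ‖τ‖ ^ (1 / 2 : ℝ) := by
      rw [← Real.sqrt_eq_rpow]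
      exact Real.le_sqrt_of_sq_le (by linarith)
    have h4 : rexp (-(π * r * (τ.im / ‖τ‖ ^ 2))) ≤ rexp (-(π / 9 * (r * τ.im))) := by
      rw [Real.exp_le_exp, neg_le_neg_iff]
      have : τ.im / 9 ≤ τ.im / ‖τ‖ ^ 2 := by
        gcongr
        nlinarith
      calc π / 9 * (r * τ.im) = π * r * (τ.im / 9) := by ring
        _ ≤ _ := by gcongr
    nlinarith [Real.exp_pos (-(π / 9 * (r * τ.im)))]
  rw [symExpo, norm_div, Complex.norm_two, div_le_iff₀ two_pos]
  refine (norm_add_le _ _).trans ?_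
  rw [norm_mul, norm_eq_one_of_sign hε, one_mul]
  linarith

lemma exists_dataBound_symExpo (K : ℕ) : ∃ C : ℝ, 0 < C ∧ ∀ ε, (ε = 1 ∨ ε = -1) → ∀ r : ℝ, 0 ≤ r →
    DataBound (symExpo ε r) K (C / (1 + r) ^ K) := by
  obtain ⟨C, hC, hb⟩ := exists_pow_mul_exp_le K (c := π / 9) (by positivity) 3
  refine ⟨2 * C, by positivity, fun ε hε r hr => ⟨fun τ hτ =>
    (symExpo_differentiableAt ε r hτ).differentiableWithinAt, fun τ hτ => ?_⟩⟩
  have h1 := norm_symExpo_le hε hr hτ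
  have h0 := hτ.1
  have h3 : τ.im ≤ 3 := (le_abs_self _).trans ((Complex.abs_im_le_norm τ).trans hτ.2.2)
  rw [le_div_iff₀ (by positivity)]
  calc ‖symExpo ε r τ‖ * τ.im ^ K * (1 + r) ^ K
      ≤ 2 * rexp (-(π / 9 * (r * τ.im))) * τ.im ^ K * (1 + r) ^ K := by gcongr
    _ = 2 * ((τ.im + r * τ.im) ^ K * rexp (-(π / 9 * (r * τ.im)))) := by
        rw [show τ.im + r * τ.im = τ.im * (1 + r) by ring, mul_pow]; ring
    _ ≤ 2 * ((3 + r * τ.im) ^ K * rexp (-(π / 9 * (r * τ.im)))) := by gcongr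
    _ ≤ 2 * C := by
        gcongr
        exact hb _ (by positivity)

end Slash

section Chain

variable {F Φ : ℂ → ℂ} {ε : ℂ} {Q : ℂ → ℝ} {y₀ : ℝ}

/-- Iteration of the functional equation along the reduction to the fundamental domain. -/
theorem chain_bound (hε : ε = 1 ∨ ε = -1) (hper : ∀ (τ : ℂ) (k : ℤ), F (τ + 2 * k) = F τ)
    (hF : ∀ τ : ℂ, 0 < τ.im → F τ + ε * slash F τ = Φ τ)
    (base : ∀ τ : ℂ, |τ.re| ≤ 1 → 0 < τ.im → 1 ≤ ‖τ‖ → y₀ ≤ τ.im → τ.im * y₀ ≤ 1 →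
      τ.im ^ (1 / 4 : ℝ) * ‖F τ‖ ≤ Q τ)
    (step : ∀ (τ : ℂ) (k : ℤ), |τ.re| ≤ 1 → 0 < τ.im → ‖τ‖ < 1 → y₀ ≤ τ.im →
      |(-1 / τ + 2 * k).re| ≤ 1 → τ.im ^ (1 / 4 : ℝ) * ‖Φ τ‖ + Q (-1 / τ + 2 * k) ≤ Q τ)
    (τ : ℂ) (hre : |τ.re| ≤ 1) (him : 0 < τ.im) (h1 : y₀ ≤ τ.im) (h2 : τ.im * y₀ ≤ 1) :
    τ.im ^ (1 / 4 : ℝ) * ‖F τ‖ ≤ Q τ := by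
  refine reduction_induction (P := fun τ => y₀ ≤ τ.im → τ.im * y₀ ≤ 1 →
    τ.im ^ (1 / 4 : ℝ) * ‖F τ‖ ≤ Q τ) base ?_ τ hre him h1 h2
  intro τ k hre him hn hre' ih h1 h2
  have h0 : τ ≠ 0 := fun h0 => by simp [h0] at him
  have hnp := norm_pos_iff.mpr h0
  have him' := neg_inv_add_im τ k
  have hn2 : ‖τ‖ ^ 2 ≤ 1 := pow_le_one₀ hnp.le hn.le
  have hge : τ.im ≤ (-1 / τ + 2 * k).im := by
    rw [him', le_div_iff₀ (by positivity)]
    exact mul_le_of_le_one_right him.le hn2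
  have hle : (-1 / τ + 2 * k).im * τ.im ≤ 1 := by
    rw [him', div_mul_eq_mul_div, div_le_one (by positivity), norm_sq_eq_re_im]
    nlinarith [sq_nonneg τ.re]
  have hle' : (-1 / τ + 2 * k).im * y₀ ≤ 1 := by
    refine le_trans ?_ hle
    have : 0 ≤ (-1 / τ + 2 * k).im := him.le.trans hge
    gcongr
  have ih' := ih (h1.trans hge) hle'
  rw [hper] at ih'
  have e1 : F τ = Φ τ - ε * slash F τ := by rw [← hF τ him]; ring
  have e2 : τ.im ^ (1 / 4 : ℝ) * ‖slash F τ‖ =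
      (-1 / τ + 2 * k).im ^ (1 / 4 : ℝ) * ‖F (-1 / τ)‖ := by
    rw [norm_slash, him', Real.div_rpow him.le (by positivity), ← Real.rpow_natCast ‖τ‖ 2,
      ← Real.rpow_mul hnp.le]
    norm_num
    ring
  refine le_trans ?_ (step τ k hre him hn h1 hre')
  calc τ.im ^ (1 / 4 : ℝ) * ‖F τ‖ ≤ τ.im ^ (1 / 4 : ℝ) * (‖Φ τ‖ + ‖slash F τ‖) := by
        gcongr
        rw [e1]
        refine (norm_sub_le _ _).trans ?_
        rw [norm_mul, norm_eq_one_of_sign hε, one_mul]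
    _ = τ.im ^ (1 / 4 : ℝ) * ‖Φ τ‖ + (-1 / τ + 2 * k).im ^ (1 / 4 : ℝ) * ‖F (-1 / τ)‖ := by
        rw [mul_add, e2]
    _ ≤ _ := by gcongr

/-- Iteration with a constant cost per step. -/
theorem chain_bound_of_le (hε : ε = 1 ∨ ε = -1) (hper : ∀ (τ : ℂ) (k : ℤ), F (τ + 2 * k) = F τ)
    (hF : ∀ τ : ℂ, 0 < τ.im → F τ + ε * slash F τ = Φ τ) {A : ℝ} (hA : 0 ≤ A)
    (base : ∀ τ : ℂ, |τ.re| ≤ 1 → 0 < τ.im → 1 ≤ ‖τ‖ → y₀ ≤ τ.im → τ.im * y₀ ≤ 1 →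
      τ.im ^ (1 / 4 : ℝ) * ‖F τ‖ ≤ A)
    (step : ∀ τ : ℂ, |τ.re| ≤ 1 → 0 < τ.im → ‖τ‖ < 1 → y₀ ≤ τ.im →
      τ.im ^ (1 / 4 : ℝ) * ‖Φ τ‖ ≤ A)
    (τ : ℂ) (hre : |τ.re| ≤ 1) (him : 0 < τ.im) (h1 : y₀ ≤ τ.im) (h2 : τ.im * y₀ ≤ 1) :
    τ.im ^ (1 / 4 : ℝ) * ‖F τ‖ ≤ A * (1 / τ.im ^ 2 + 1) := by
  classical
  set Q : ℂ → ℝ := fun σ => A * if ‖σ‖ < 1 then 1 / σ.im ^ 2 + 1 else 1 with hQ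
  have key : τ.im ^ (1 / 4 : ℝ) * ‖F τ‖ ≤ Q τ := by
    refine chain_bound hε hper hF (Q := Q) ?_ ?_ τ hre him h1 h2
    · intro σ s1 s2 s3 s4 s5
      simp only [hQ, not_lt.mpr s3, if_false, mul_one]
      exact base σ s1 s2 s3 s4 s5
    · intro σ k s1 s2 s3 s4 s5
      refine (add_le_add_left (step σ s1 s2 s3 s4) _).trans ?_
      simp only [hQ, s3, if_true]
      have hσ1 : 1 ≤ 1 / σ.im ^ 2 := by
        rw [le_div_iff₀ (by positivity), one_mul]
        exact pow_le_one₀ s2.le (((le_abs_self _).trans (Complex.abs_im_le_norm σ)).trans s3.le)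
      split_ifs with h
      · nlinarith [reduction_drop s2 s3 s5 h]
      · nlinarith
  refine key.trans ?_
  simp only [hQ]
  gcongr
  split_ifs
  · exact le_rfl
  · have : 0 ≤ 1 / τ.im ^ 2 := by positivity
    linarith

end Chain

section Crude

lemma rpow_mul_norm_slash (f : ℂ → ℂ) {τ : ℂ} (hτ : 0 < τ.im) :
    τ.im ^ (1 / 4 : ℝ) * ‖slash f τ‖ = (-1 / τ).im ^ (1 / 4 : ℝ) * ‖f (-1 / τ)‖ := by
  have hnp : 0 < ‖τ‖ := norm_pos_iff.mpr (by rintro rfl; simp at hτ)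
  rw [norm_slash, neg_inv_im, Real.div_rpow hτ.le (by positivity), ← Real.rpow_natCast ‖τ‖ 2,
    ← Real.rpow_mul hnp.le]
  norm_num
  ring

lemma neg_inv_im_mem {τ : ℂ} {y₀ : ℝ} (h0 : 0 < τ.im) (hn : ‖τ‖ < 1) (hy : y₀ ≤ τ.im) :
    y₀ ≤ (-1 / τ).im ∧ (-1 / τ).im * τ.im ≤ 1 := by
  have hnp : 0 < ‖τ‖ := norm_pos_iff.mpr (by rintro rfl; simp at h0)
  rw [neg_inv_im]
  constructor
  · rw [le_div_iff₀ (by positivity)]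
    have : ‖τ‖ ^ 2 ≤ 1 := pow_le_one₀ hnp.le hn.le
    nlinarith [mul_le_mul_of_nonneg_right hy (sq_nonneg ‖τ‖)]
  · rw [div_mul_eq_mul_div, div_le_one (by positivity), norm_sq_eq_re_im]
    nlinarith [sq_nonneg τ.re]

lemma rpow_le_one_div {t y₀ : ℝ} (h0 : 0 < y₀) (h1 : y₀ ≤ 1) (ht : 0 < t) (ht' : t * y₀ ≤ 1) :
    t ^ (1 / 4 : ℝ) ≤ 1 / y₀ := by
  have h2 : t ≤ 1 / y₀ := by rwa [le_div_iff₀ h0]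
  have h3 : 1 ≤ 1 / y₀ := by rwa [le_div_iff₀ h0, one_mul]
  calc t ^ (1 / 4 : ℝ) ≤ (1 / y₀) ^ (1 / 4 : ℝ) := by gcongr
    _ ≤ (1 / y₀) ^ (1 : ℝ) := Real.rpow_le_rpow_of_exponent_le h3 (by norm_num)
    _ = _ := Real.rpow_one _

lemma sol_add_slash_symExpo {ε : ℂ} (hε : ε = 1 ∨ ε = -1) {r : ℝ} (hr : 0 ≤ r) {τ : ℂ}
    (hτ : 0 < τ.im) : sol ε (symExpo ε r) τ + ε * slash (sol ε (symExpo ε r)) τ =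
      expo r τ + ε * slash (expo r) τ := by
  obtain ⟨C, -, h⟩ := exists_dataBound_symExpo 0
  rw [sol_add_slash hε (h ε hε r hr) hτ, symExpo_add_slash hε r hτ]

/-- Decay in `r` and polynomial growth in `1 / y` of the solutions attached to `exp (π i r τ)`. -/
theorem exists_sol_symExpo_bound (K : ℕ) : ∃ C : ℝ, 0 < C ∧ ∀ ε, (ε = 1 ∨ ε = -1) →
    ∀ r : ℝ, 0 ≤ r → ∀ τ : ℂ, 0 < τ.im → τ.im ≤ 1 →
      ‖sol ε (symExpo ε r) τ‖ ≤ C / ((1 + r) ^ K * τ.im ^ (K + 4)) := by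
  obtain ⟨C₁, hC₁, hsol⟩ := exists_sol_bound K
  obtain ⟨C₂, hC₂, hdata⟩ := exists_dataBound_symExpo K
  obtain ⟨C₃, hC₃, hexp⟩ := exists_pow_mul_exp_le K Real.pi_pos 1
  refine ⟨(C₁ * C₂ + 2 * C₃) * 2, by positivity, fun ε hε r hr τ him him1 => ?_⟩
  obtain ⟨k, hk⟩ := exists_translate τ.re
  set y₀ := τ.im with hy₀
  have hd := hdata ε hε r hr
  set A : ℝ := (C₁ * C₂ + 2 * C₃) / ((1 + r) ^ K * y₀ ^ (K + 1)) with hA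
  have hA0 : 0 ≤ A := by positivity
  have hexp' : ∀ t : ℝ, y₀ ≤ t → t * y₀ ≤ 1 → t ^ (1 / 4 : ℝ) * ‖expo r ⟨0, t⟩‖ ≤
      C₃ / ((1 + r) ^ K * y₀ ^ (K + 1)) := by
    intro t h1 h2
    have ht : 0 < t := him.trans_le h1
    rw [norm_expo, le_div_iff₀ (by positivity)]
    have e1 : rexp (-(π * r * t)) ≤ rexp (-(π * (r * y₀))) := by
      rw [Real.exp_le_exp, neg_le_neg_iff, mul_assoc]
      gcongr
    calc t ^ (1 / 4 : ℝ) * rexp (-(π * r * t)) * ((1 + r) ^ K * y₀ ^ (K + 1))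
        ≤ 1 / y₀ * rexp (-(π * (r * y₀))) * ((1 + r) ^ K * y₀ ^ (K + 1)) := by
          gcongr
          exact rpow_le_one_div him him1 ht h2
      _ = (y₀ + r * y₀) ^ K * rexp (-(π * (r * y₀))) := by
          rw [show y₀ + r * y₀ = (1 + r) * y₀ by ring, mul_pow, pow_succ]
          field_simp
      _ ≤ (1 + r * y₀) ^ K * rexp (-(π * (r * y₀))) := by gcongr
      _ ≤ C₃ := hexp _ (by positivity)
  have hexp2 : ∀ σ : ℂ, y₀ ≤ σ.im → σ.im * y₀ ≤ 1 → σ.im ^ (1 / 4 : ℝ) * ‖expo r σ‖ ≤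
      C₃ / ((1 + r) ^ K * y₀ ^ (K + 1)) := by
    intro σ h1 h2
    have := hexp' σ.im h1 h2
    rwa [norm_expo] at this ⊢
  have key := chain_bound_of_le hε (fun σ k => sol_add_two_mul_int ε (symExpo ε r) σ k)
    (fun σ hσ => sol_add_slash_symExpo hε hr hσ) hA0 (y₀ := y₀) ?_ ?_ (τ + 2 * k)
    (by simpa using hk) (by simpa using him) (by simp [hy₀]) (by simp [← hy₀]; nlinarith)
  · rw [sol_add_two_mul_int] at key
    have hi : (τ + 2 * (k : ℂ)).im = y₀ := by simp [hy₀]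
    rw [hi] at key
    have h4 : y₀ ≤ y₀ ^ (1 / 4 : ℝ) := by
      simpa using Real.rpow_le_rpow_of_exponent_ge him him1 (by norm_num : (1 / 4 : ℝ) ≤ 1)
    have h5 : 1 / y₀ ^ 2 + 1 ≤ 2 / y₀ ^ 2 := by
      rw [le_div_iff₀ (by positivity), add_mul, one_div, inv_mul_cancel₀ (by positivity)]
      nlinarith
    rw [le_div_iff₀ (by positivity)]
    calc ‖sol ε (symExpo ε r) τ‖ * ((1 + r) ^ K * y₀ ^ (K + 4))
        = y₀ * ‖sol ε (symExpo ε r) τ‖ * ((1 + r) ^ K * y₀ ^ (K + 3)) := by ring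
      _ ≤ A * (2 / y₀ ^ 2) * ((1 + r) ^ K * y₀ ^ (K + 3)) := by
          refine mul_le_mul_of_nonneg_right ?_ (by positivity)
          exact (mul_le_mul_of_nonneg_right h4 (norm_nonneg _)).trans
            (key.trans (mul_le_mul_of_nonneg_left h5 hA0))
      _ = (C₁ * C₂ + 2 * C₃) * 2 := by
          rw [hA, show K + 3 = K + 1 + 2 by rfl, pow_add y₀ (K + 1)]
          field_simp
  · intro σ s1 s2 s3 s4 s5
    obtain ⟨b1, b2⟩ := hsol ε _ _ hε hd σ s1 s2 s3
    have hpow : y₀ ^ K ≤ 1 := pow_le_one₀ him.le him1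
    have main : σ.im ^ (1 / 4 : ℝ) * ‖sol ε (symExpo ε r) σ‖ ≤
        C₁ * (C₂ / (1 + r) ^ K) / y₀ ^ (K + 1) := by
      rw [le_div_iff₀ (by positivity)]
      by_cases h : 1 / 2 ≤ σ.im
      · calc σ.im ^ (1 / 4 : ℝ) * ‖sol ε (symExpo ε r) σ‖ * y₀ ^ (K + 1)
            ≤ 1 / y₀ * (C₁ * (C₂ / (1 + r) ^ K)) * y₀ ^ (K + 1) := by
              gcongr
              · exact rpow_le_one_div him him1 s2 s5
              · exact b1 h
          _ = y₀ ^ K * (C₁ * (C₂ / (1 + r) ^ K)) := by rw [pow_succ]; field_simp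
          _ ≤ _ := mul_le_of_le_one_left (by positivity) hpow
      · have h' : σ.im ≤ 1 := by linarith
        have e1 : σ.im ^ (1 / 4 : ℝ) ≤ 1 := Real.rpow_le_one s2.le h' (by norm_num)
        have e2 : y₀ ≤ √σ.im := Real.le_sqrt_of_sq_le (by nlinarith)
        calc σ.im ^ (1 / 4 : ℝ) * ‖sol ε (symExpo ε r) σ‖ * y₀ ^ (K + 1)
            ≤ 1 * ‖sol ε (symExpo ε r) σ‖ * (σ.im ^ K * √σ.im) := by
              rw [pow_succ]; gcongr
          _ ≤ _ := by rw [one_mul]; exact b2 h'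
    refine main.trans (le_of_eq_of_le ?_ (?_ : C₁ * C₂ / ((1 + r) ^ K * y₀ ^ (K + 1)) ≤ _))
    · field_simp
    · rw [hA]; gcongr; linarith
  · intro σ s1 s2 s3 s4
    have hn1 : σ.im ≤ 1 := ((le_abs_self _).trans (Complex.abs_im_le_norm σ)).trans s3.le
    obtain ⟨q1, q2⟩ := neg_inv_im_mem s2 s3 s4
    have q0 : 0 < (-1 / σ).im := neg_inv_im_pos s2
    calc σ.im ^ (1 / 4 : ℝ) * ‖expo r σ + ε * slash (expo r) σ‖
        ≤ σ.im ^ (1 / 4 : ℝ) * (‖expo r σ‖ + ‖slash (expo r) σ‖) := by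
          gcongr
          refine (norm_add_le _ _).trans ?_
          rw [norm_mul, norm_eq_one_of_sign hε, one_mul]
      _ = σ.im ^ (1 / 4 : ℝ) * ‖expo r σ‖ + (-1 / σ).im ^ (1 / 4 : ℝ) * ‖expo r (-1 / σ)‖ := by
          rw [mul_add, rpow_mul_norm_slash _ s2]
      _ ≤ C₃ / ((1 + r) ^ K * y₀ ^ (K + 1)) + C₃ / ((1 + r) ^ K * y₀ ^ (K + 1)) := by
          refine add_le_add (hexp2 σ s4 (by nlinarith)) (hexp2 _ q1 ?_)
          nlinarith
      _ = 2 * C₃ / ((1 + r) ^ K * y₀ ^ (K + 1)) := by ring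
      _ ≤ A := by
          rw [hA]; gcongr
          have : 0 < C₁ * C₂ := by positivity
          linarith

end Crude

section Perturbation

/-- The ratio making the cusp values at `±1` of the perturbed data cancel. -/
noncomputable def cuspRatio (ε : ℂ) (e : ℝ) : ℝ := cos (π * e) + (ε.re * √2 - 1) * sin (π * e)

/-- The difference `exp (π i (m + e) τ) - C exp (π i m τ)`. -/
noncomputable def pert (ε : ℂ) (m : ℕ) (e : ℝ) (τ : ℂ) : ℂ :=
  expo (m + e) τ - cuspRatio ε e * expo m τ

variable {ε : ℂ} {m : ℕ} {e : ℝ} {τ : ℂ}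

lemma abs_cuspRatio_sub_one_le (hε : ε = 1 ∨ ε = -1) (e : ℝ) :
    |cuspRatio ε e - 1| ≤ 16 * |e| := by
  have h1 : |cos (π * e) - 1| ≤ π * |e| := by
    rw [← Real.cos_zero]
    refine (Real.abs_cos_sub_cos_le _ _).trans ?_
    rw [sub_zero, abs_mul, abs_of_pos Real.pi_pos]
  have h2 : |sin (π * e)| ≤ π * |e| := by
    refine (Real.abs_sin_le_abs (x := π * e)).trans ?_
    rw [abs_mul, abs_of_pos Real.pi_pos]
  have h3 : |ε.re * √2 - 1| ≤ 5 / 2 := by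
    have : √2 ≤ 3 / 2 := Real.sqrt_le_iff.mpr ⟨by norm_num, by norm_num⟩
    have h0 := Real.sqrt_nonneg 2
    rcases hε with rfl | rfl <;> rw [abs_le] <;> constructor <;> norm_num <;> linarith
  have h4 := Real.pi_lt_d2
  have h5 := abs_nonneg e
  calc |cuspRatio ε e - 1| = |(cos (π * e) - 1) + (ε.re * √2 - 1) * sin (π * e)| := by
        rw [cuspRatio]; congr 1; ring
    _ ≤ |cos (π * e) - 1| + |ε.re * √2 - 1| * |sin (π * e)| := by
        rw [← abs_mul]; exact abs_add_le _ _
    _ ≤ π * |e| + 5 / 2 * (π * |e|) := by gcongr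
    _ ≤ 16 * |e| := by nlinarith

lemma neg_I_cpow : (-I : ℂ) ^ (1 / 2 : ℂ) = (√2 / 2 : ℝ) - (√2 / 2 : ℝ) * I := by
  rw [Complex.cpow_def_of_ne_zero (by simp), Complex.log_neg_I,
    show -(π / 2) * I * (1 / 2 : ℂ) = ((-(π / 4) : ℝ) : ℂ) * I by push_cast; ring,
    Complex.exp_mul_I, ← Complex.ofReal_cos, ← Complex.ofReal_sin, Real.cos_neg, Real.sin_neg,
    Real.cos_pi_div_four, Real.sin_pi_div_four]
  push_cast
  ring

lemma cusp_cancel (hε : ε = 1 ∨ ε = -1) (e : ℝ) :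
    (expo e 1 - cuspRatio ε e) * (-I) ^ (1 / 2 : ℂ) + ε * (expo e (-1) - cuspRatio ε e) = 0 := by
  have h1 : expo e 1 = cos (π * e) + sin (π * e) * I := by
    rw [expo, show π * I * e * 1 = ((π * e : ℝ) : ℂ) * I by push_cast; ring, Complex.exp_mul_I,
      ← Complex.ofReal_cos, ← Complex.ofReal_sin]
  have h2 : expo e (-1) = cos (π * e) - sin (π * e) * I := by
    rw [expo, show π * I * e * -1 = ((-(π * e) : ℝ) : ℂ) * I by push_cast; ring,
      Complex.exp_mul_I, ← Complex.ofReal_cos, ← Complex.ofReal_sin, Real.cos_neg, Real.sin_neg]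
    push_cast
    ring
  have h3 : (√2 : ℂ) ^ 2 = 2 := by
    rw [← Complex.ofReal_pow, Real.sq_sqrt zero_le_two]; norm_num
  rw [h1, h2, neg_I_cpow, cuspRatio]
  rcases hε with rfl | rfl
  · push_cast
    simp only [Complex.one_re, Complex.ofReal_one]
    linear_combination (-(Complex.sin (π * e)) / 2) * (Complex.I_sq) * √2 +
      Complex.sin (π * e) / 2 * (I - 1) * h3
  · push_cast
    simp only [Complex.neg_re, Complex.one_re, Complex.ofReal_one, Complex.ofReal_neg]
    linear_combination (-(Complex.sin (π * e)) / 2) * (Complex.I_sq) * √2 -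
      Complex.sin (π * e) / 2 * (I - 1) * h3

lemma norm_exp_sub_exp_le {a b : ℂ} {M : ℝ} (ha : a.re ≤ M) (hb : b.re ≤ M) :
    ‖Complex.exp a - Complex.exp b‖ ≤ rexp M * ‖a - b‖ := by
  refine Convex.norm_image_sub_le_of_norm_deriv_le (s := {z : ℂ | z.re ≤ M})
    (fun x _ => Complex.differentiable_exp x) (fun x hx => ?_)
    (convex_halfSpace_re_le M) hb ha
  rw [Complex.deriv_exp, Complex.norm_exp, Real.exp_le_exp]
  exact hx

lemma norm_expo_sub_expo_le {r M : ℝ} {σ τ : ℂ} (h1 : -(π * r * σ.im) ≤ M)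
    (h2 : -(π * r * τ.im) ≤ M) :
    ‖expo r σ - expo r τ‖ ≤ rexp M * (π * |r| * ‖σ - τ‖) := by
  refine (norm_exp_sub_exp_le (M := M) (by simpa using h1) (by simpa using h2)).trans_eq ?_
  rw [← mul_sub, norm_mul, norm_mul, norm_mul, Complex.norm_I, Complex.norm_real,
    Complex.norm_real, Real.norm_eq_abs, Real.norm_eq_abs, abs_of_pos Real.pi_pos, mul_one]

lemma expo_natCast_add (m : ℕ) (e : ℝ) (τ : ℂ) : expo (m + e) τ = expo m τ * expo e τ := by
  rw [expo, expo, expo, ← Complex.exp_add]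
  push_cast
  congr 1; ring

lemma pert_eq (ε : ℂ) (m : ℕ) (e : ℝ) (τ : ℂ) :
    pert ε m e τ = expo m τ * (expo e τ - cuspRatio ε e) := by
  rw [pert, expo_natCast_add]; ring

lemma norm_expo_sub_cuspRatio_le (hε : ε = 1 ∨ ε = -1) (he : |e| ≤ 1 / 2) (hτ : 0 ≤ τ.im) :
    ‖expo e τ - cuspRatio ε e‖ ≤ 16 * |e| * (1 + ‖τ‖) * rexp (π / 2 * τ.im) := by
  have hπ := Real.pi_pos
  have h4 := Real.pi_lt_d2
  have hM : 1 ≤ rexp (π / 2 * τ.im) := Real.one_le_exp (by positivity)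
  have h1 : ‖expo e τ - expo e 0‖ ≤ rexp (π / 2 * τ.im) * (π * |e| * ‖τ - 0‖) := by
    refine norm_expo_sub_expo_le ?_ (by simp; positivity)
    have : -e ≤ 1 / 2 := (neg_le_abs e).trans he
    calc -(π * e * τ.im) = π * (-e) * τ.im := by ring
      _ ≤ π * (1 / 2) * τ.im := by gcongr
      _ = _ := by ring
  rw [show expo e 0 = 1 by simp [expo], sub_zero] at h1
  have h2 : ‖(1 : ℂ) - cuspRatio ε e‖ ≤ 16 * |e| := by
    rw [norm_sub_rev, ← Complex.ofReal_one, ← Complex.ofReal_sub, Complex.norm_real,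
      Real.norm_eq_abs]
    exact abs_cuspRatio_sub_one_le hε e
  have h5 := abs_nonneg e
  calc ‖expo e τ - cuspRatio ε e‖ = ‖(expo e τ - 1) + (1 - cuspRatio ε e)‖ := by congr 1; ring
    _ ≤ rexp (π / 2 * τ.im) * (π * |e| * ‖τ‖) + 16 * |e| :=
        (norm_add_le _ _).trans (add_le_add h1 h2)
    _ ≤ rexp (π / 2 * τ.im) * (16 * |e| * ‖τ‖) + rexp (π / 2 * τ.im) * (16 * |e|) := by
        have : 0 ≤ |e| * ‖τ‖ := by positivity
        refine add_le_add (mul_le_mul_of_nonneg_left (by nlinarith) (Real.exp_pos _).le) ?_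
        exact le_mul_of_one_le_left (by positivity) hM
    _ = _ := by ring

lemma norm_pert_le (hε : ε = 1 ∨ ε = -1) (hm : 1 ≤ m) (he : |e| ≤ 1 / 2) (hτ : 0 ≤ τ.im) :
    ‖pert ε m e τ‖ ≤ 16 * |e| * (1 + ‖τ‖) * rexp (-(π / 2 * (m * τ.im))) := by
  have hm' : (1 : ℝ) ≤ m := by exact_mod_cast hm
  rw [pert_eq, norm_mul, norm_expo]
  calc _ ≤ rexp (-(π * m * τ.im)) * (16 * |e| * (1 + ‖τ‖) * rexp (π / 2 * τ.im)) := by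
        gcongr
        exact norm_expo_sub_cuspRatio_le hε he hτ
    _ = 16 * |e| * (1 + ‖τ‖) * rexp (-(π * m * τ.im) + π / 2 * τ.im) := by
        rw [Real.exp_add]; ring
    _ ≤ _ := by
        gcongr
        have : τ.im ≤ m * τ.im := le_mul_of_one_le_left hτ hm'
        have := mul_le_mul_of_nonneg_left this (by positivity : 0 ≤ π / 2)
        nlinarith

lemma expo_natCast_add_two (m : ℕ) (τ : ℂ) : expo m (τ + 2) = expo m τ := by
  rw [expo, expo, mul_add, Complex.exp_add,
    show (π * I * (m : ℝ) * 2 : ℂ) = m * (2 * π * I) by push_cast; ring,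
    Complex.exp_nat_mul_two_pi_mul_I, mul_one]

lemma re_neg_I_mul_cpow_nonneg (hτ : -I * τ ≠ 0) : 0 ≤ ((-I * τ) ^ (1 / 2 : ℂ)).re := by
  rw [Complex.cpow_def_of_ne_zero hτ, Complex.exp_re]
  have h : (Complex.log (-I * τ) * (1 / 2)).im = Complex.arg (-I * τ) / 2 := by
    rw [show (1 / 2 : ℂ) = ((1 / 2 : ℝ) : ℂ) by norm_num, Complex.im_mul_ofReal, Complex.log_im]
    ring
  rw [h]
  refine mul_nonneg (Real.exp_pos _).le (Real.cos_nonneg_of_mem_Icc ⟨?_, ?_⟩)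
  · linarith [Complex.neg_pi_lt_arg (-I * τ)]
  · linarith [Complex.arg_le_pi (-I * τ)]

lemma norm_cpow_sub_le (h0 : τ ≠ 0) :
    ‖(-I * τ) ^ (1 / 2 : ℂ) - (-I) ^ (1 / 2 : ℂ)‖ ≤ 2 * ‖1 - τ‖ := by
  set p := (-I * τ) ^ (1 / 2 : ℂ) with hp
  set q := (-I : ℂ) ^ (1 / 2 : ℂ) with hq
  have e1 : p ^ 2 = -I * τ := by
    rw [hp, one_div]; exact Complex.cpow_nat_inv_pow _ two_ne_zero
  have e2 : q ^ 2 = -I := by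
    rw [hq, one_div]; exact Complex.cpow_nat_inv_pow _ two_ne_zero
  have h1 : 0 ≤ p.re := re_neg_I_mul_cpow_nonneg (by simp [h0])
  have h2 : 1 / 2 ≤ q.re := by
    have h := neg_I_cpow
    rw [← hq] at h
    rw [h]
    have : (1 : ℝ) ≤ √2 := Real.le_sqrt_of_sq_le (by norm_num)
    simp
    linarith
  have h3 : 1 / 2 ≤ ‖p + q‖ := by
    refine le_trans ?_ (Complex.re_le_norm _)
    rw [Complex.add_re]; linarith
  have h4 : ‖p - q‖ * ‖p + q‖ = ‖1 - τ‖ := by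
    rw [← norm_mul, show (p - q) * (p + q) = p ^ 2 - q ^ 2 by ring, e1, e2,
      show -I * τ - -I = I * (1 - τ) by ring, norm_mul, Complex.norm_I, one_mul]
  nlinarith [norm_nonneg (p - q)]

/-- Near the cusp `1` the symmetrised perturbation is small. -/
theorem norm_pert_add_slash_le (hε : ε = 1 ∨ ε = -1) (he : |e| ≤ 1 / 2) (hτ : 0 < τ.im)
    (h1 : ‖τ‖ < 1) (hd : ‖1 - τ‖ ≤ 1 / 2) :
    ‖pert ε m e τ + ε * slash (pert ε m e) τ‖ ≤
      1000 * |e| * rexp (-(π * m * τ.im)) * (‖1 - τ‖ + min 1 (m * ‖1 - τ‖ ^ 2)) := by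
  have h0 : τ ≠ 0 := fun h0 => by simp [h0] at hτ
  have hn : 1 / 2 ≤ ‖τ‖ := by
    have := norm_add_le (1 - τ) τ
    rw [sub_add_cancel, norm_one] at this
    linarith
  have hnp : 0 < ‖τ‖ := by linarith
  have hπ := Real.pi_pos
  have hπ4 := Real.pi_lt_d2
  have hea := abs_nonneg e
  set d := ‖1 - τ‖ with hdd
  have hd0 : 0 ≤ d := norm_nonneg _
  set y := τ.im with hy
  have hyd : y ≤ d := by
    have := Complex.abs_im_le_norm (1 - τ)
    simp only [Complex.sub_im, Complex.one_im, zero_sub, abs_neg] at this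
    exact (le_abs_self _).trans this
  set σ := -1 / τ with hσ
  have hσim : σ.im = y / ‖τ‖ ^ 2 := neg_inv_im τ
  have hσ0 : 0 < σ.im := neg_inv_im_pos hτ
  have hσy : y ≤ σ.im := by
    rw [hσim, le_div_iff₀ (by positivity)]
    exact mul_le_of_le_one_right hτ.le (pow_le_one₀ hnp.le h1.le)
  have hσ2 : σ.im ≤ 2 := by
    rw [hσim, div_le_iff₀ (by positivity)]
    nlinarith
  have hσ1 : ‖σ - -1‖ ≤ 2 * d := by
    rw [show σ - -1 = -(1 - τ) / τ by rw [hσ]; field_simp; ring, norm_div, norm_neg,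
      div_le_iff₀ hnp]
    nlinarith
  have hστ : ‖τ - (σ + 2)‖ ≤ 2 * d ^ 2 := by
    rw [show τ - (σ + 2) = (1 - τ) ^ 2 / τ by rw [hσ]; field_simp; ring, norm_div, norm_pow,
      div_le_iff₀ hnp]
    nlinarith [sq_nonneg d]
  have hexp : rexp π ≤ 25 := by
    have e1 : rexp 1 ≤ 2.7183 := Real.exp_one_lt_d9.le.trans (by norm_num)
    have e2 : rexp (π - 3) ≤ 1.2 := by
      have := Real.exp_bound_div_one_sub_of_interval (x := π - 3) (by linarith [Real.pi_gt_three])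
        (by linarith)
      refine this.trans ?_
      rw [div_le_iff₀ (by linarith)]
      linarith
    calc rexp π = rexp 1 ^ 3 * rexp (π - 3) := by
          rw [← Real.exp_nat_mul, ← Real.exp_add]; congr 1; push_cast; ring
      _ ≤ 2.7183 ^ 3 * 1.2 := by gcongr
      _ ≤ 25 := by norm_num
  have hneg : -e ≤ 1 / 2 := (neg_le_abs e).trans he
  have hL : ∀ z w : ℂ, 0 ≤ z.im → z.im ≤ 2 → w.im = 0 → ‖expo e z - expo e w‖ ≤
      80 * |e| * ‖z - w‖ := by
    intro z w hz hz2 hw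
    refine (norm_expo_sub_expo_le (M := π) ?_ ?_).trans ?_
    · calc -(π * e * z.im) = π * (-e * z.im) := by ring
        _ ≤ π * (1 / 2 * 2) := by gcongr
        _ = π := by ring
    · rw [hw]; simp [hπ.le]
    · calc rexp π * (π * |e| * ‖z - w‖) ≤ 25 * (3.15 * |e| * ‖z - w‖) := by gcongr
        _ ≤ _ := by nlinarith [mul_nonneg hea (norm_nonneg (z - w))]
  have g1 : ‖expo e τ - expo e 1‖ ≤ 80 * |e| * d := by
    refine (hL τ 1 hτ.le (by linarith) (by simp)).trans_eq ?_
    rw [norm_sub_rev]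
  have g2 : ‖expo e σ - expo e (-1)‖ ≤ 80 * |e| * (2 * d) :=
    (hL σ (-1) hσ0.le hσ2 (by simp)).trans (by gcongr)
  have u1 : ‖expo e 1 - cuspRatio ε e‖ ≤ 32 * |e| := by
    refine (norm_expo_sub_cuspRatio_le hε he (by simp)).trans_eq ?_
    simp; ring
  have hcusp := cusp_cancel hε e
  set p := (-I * τ) ^ (1 / 2 : ℂ) with hp
  set q := (-I : ℂ) ^ (1 / 2 : ℂ) with hq
  have hp0 : p ≠ 0 := neg_I_mul_cpow_ne_zero hτ
  have hpn : 1 / 2 ≤ ‖p‖ := by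
    have := norm_neg_I_mul_cpow τ (1 / 2)
    push_cast at this
    rw [hp, this, ← Real.sqrt_eq_rpow]
    exact Real.le_sqrt_of_sq_le (by linarith)
  have hpi : ‖p⁻¹‖ ≤ 2 := by
    rw [norm_inv]; exact inv_le_of_inv_le₀ two_pos (by simpa using hpn)
  have hpq : ‖p - q‖ ≤ 2 * d := norm_cpow_sub_le h0
  set X := rexp (-(π * m * y)) with hX
  have ha : ‖expo m τ‖ ≤ X := (norm_expo _ _).le
  have hb : ‖expo m σ‖ ≤ X := by
    rw [norm_expo, hX, Real.exp_le_exp, neg_le_neg_iff]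
    gcongr
  have hab : ‖expo m τ - expo m σ‖ ≤ X * (7 * min 1 (m * d ^ 2)) := by
    rcases min_choice (1 : ℝ) (m * d ^ 2) with h | h <;> rw [h]
    · refine (norm_sub_le _ _).trans ?_
      have := Real.exp_pos (-(π * m * y))
      linarith
    · rw [← expo_natCast_add_two m σ]
      refine (norm_expo_sub_expo_le (M := -(π * m * y)) le_rfl ?_).trans ?_
      · simp only [Complex.add_im, Complex.im_ofNat, add_zero, neg_le_neg_iff]
        gcongr
      · rw [abs_of_nonneg (Nat.cast_nonneg m)]
        calc X * (π * m * ‖τ - (σ + 2)‖) ≤ X * (3.15 * m * (2 * d ^ 2)) := by gcongr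
          _ ≤ _ := by
            refine mul_le_mul_of_nonneg_left ?_ (Real.exp_pos _).le
            nlinarith [mul_nonneg (Nat.cast_nonneg (α := ℝ) m) (sq_nonneg d)]
  have key : pert ε m e τ + ε * slash (pert ε m e) τ =
      expo m τ * (expo e τ - expo e 1) + ε * expo m σ * (expo e σ - expo e (-1)) * p⁻¹ +
        (expo e 1 - cuspRatio ε e) * (expo m τ - expo m σ) +
        (expo e 1 - cuspRatio ε e) * expo m σ * (p - q) * p⁻¹ := by
    rw [slash, pert_eq, pert_eq, ← hσ, ← hp]
    field_simp
    linear_combination expo m σ * hcusp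
  have hX0 : 0 < X := Real.exp_pos _
  have hε1 := norm_eq_one_of_sign hε
  have hmin : 0 ≤ min 1 (m * d ^ 2) := by positivity
  rw [key]
  calc _ ≤ ‖expo m τ * (expo e τ - expo e 1)‖ +
        ‖ε * expo m σ * (expo e σ - expo e (-1)) * p⁻¹‖ +
        ‖(expo e 1 - cuspRatio ε e) * (expo m τ - expo m σ)‖ +
        ‖(expo e 1 - cuspRatio ε e) * expo m σ * (p - q) * p⁻¹‖ := norm_add₄_le
    _ ≤ X * (80 * |e| * d) + 1 * X * (80 * |e| * (2 * d)) * 2 +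
        32 * |e| * (X * (7 * min 1 (m * d ^ 2))) + 32 * |e| * X * (2 * d) * 2 := by
        simp only [norm_mul, hε1]
        gcongr
    _ = |e| * X * (528 * d + 224 * min 1 (m * d ^ 2)) := by ring
    _ ≤ |e| * X * (1000 * d + 1000 * min 1 (m * d ^ 2)) := by gcongr <;> norm_num
    _ = _ := by ring

end Perturbation

section Potential

/-- Squared distance to the nearest of the cusps `±1`, for `|Re τ| ≤ 1`. -/
noncomputable def cuspDistSq (τ : ℂ) : ℝ := (1 - |τ.re|) ^ 2 + τ.im ^ 2

/-- The angular part of the potential, controlling passages along the cusps `±1`. -/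
noncomputable def cuspAngle (τ : ℂ) : ℝ := (1 - |τ.re|) * τ.im / cuspDistSq τ

/-- The potential decreasing along the reduction to the fundamental domain. -/
noncomputable def potential (y₀ : ℝ) (τ : ℂ) : ℝ :=
  if ‖τ‖ < 1 then 2 / √y₀ + 60 / √τ.im + 3 * cuspAngle τ else 1 / √y₀

variable {τ : ℂ} {y₀ c : ℝ}

lemma cuspDistSq_pos (h : 0 < τ.im) : 0 < cuspDistSq τ := by
  unfold cuspDistSq; positivity

lemma cuspAngle_nonneg (hre : |τ.re| ≤ 1) (h : 0 < τ.im) : 0 ≤ cuspAngle τ :=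
  div_nonneg (mul_nonneg (by linarith) h.le) (cuspDistSq_pos h).le

lemma cuspAngle_le (h : 0 < τ.im) : cuspAngle τ ≤ 1 / 2 := by
  rw [cuspAngle, div_le_iff₀ (cuspDistSq_pos h), cuspDistSq]
  nlinarith [sq_nonneg (1 - |τ.re| - τ.im)]

lemma cuspAngle_step {a y N S : ℝ} (hN0 : 0 < N) (hS : S = a ^ 2 + y ^ 2) (hN : N = 1 - 2 * a + S)
    (hS0 : 0 < S) : a * y / S - (a - S) * y / (N * S) = y * (y ^ 2 - a ^ 2 + a * S) / (N * S) := by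
  field_simp
  rw [hN, hS]
  ring

lemma cusp_step_le {a y N S c : ℝ} (ha : 0 ≤ a) (hy : 0 < y) (hy1 : y ≤ 1) (hN0 : 0 < N)
    (hN1 : N < 1) (hS : S = a ^ 2 + y ^ 2) (hN : N = 1 - 2 * a + S) (hS4 : S ≤ 1 / 4)
    (h1 : c ≤ √S / √y) (h2 : 4 * a ^ 2 < S → c ≤ y) :
    c + (60 * (√N / √y) + 3 * ((a - S) * y / (N * S))) ≤ 60 / √y + 3 * (a * y / S) := by
  have hS0 : 0 < S := by rw [hS]; positivity
  have hstep := cuspAngle_step hN0 hS hN hS0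
  have hsy : 0 < √y := Real.sqrt_pos.mpr hy
  have hsN : √N ≤ (1 + N) / 2 := by
    rw [Real.sqrt_le_left (by linarith)]; nlinarith [sq_nonneg (1 - N)]
  have hd : √S * √S = S := Real.mul_self_sqrt hS0.le
  have hd0 : 0 < √S := Real.sqrt_pos.mpr hS0
  have hd2 : √S ≤ 1 / 2 := by rw [Real.sqrt_le_left (by norm_num)]; linarith
  have hsplit : 60 / √y - 60 * (√N / √y) = 60 * (1 - √N) / √y := by ring
  by_cases h : 4 * a ^ 2 < S
  · have e1 : y / 2 ≤ y * (y ^ 2 - a ^ 2 + a * S) / (N * S) := by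
      rw [le_div_iff₀ (by positivity)]
      have : 0 ≤ a * S := by positivity
      have : N * S ≤ S := by nlinarith
      nlinarith
    have e2 : 0 ≤ 60 * (1 - √N) / √y := by
      apply div_nonneg _ hsy.le
      linarith
    have := h2 h
    linarith
  · have had : √S ≤ 2 * a := by
      rw [Real.sqrt_le_left (by linarith)]; linarith
    have hN4 : 1 / 4 ≤ N := by
      have : a ≤ √S := Real.le_sqrt_of_sq_le (by rw [hS]; nlinarith)
      nlinarith
    have e1 : -(4 * y) ≤ y * (y ^ 2 - a ^ 2 + a * S) / (N * S) := by
      rw [le_div_iff₀ (by positivity)]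
      have : 0 ≤ a * S := by positivity
      have : S ≤ 4 * N * S := by nlinarith
      nlinarith
    have e2 : 15 * (√S / √y) ≤ 60 * (1 - √N) / √y := by
      rw [mul_div_assoc', div_le_div_iff_of_pos_right hsy]
      nlinarith
    have e3 : y ≤ √S / √y := by
      rw [le_div_iff₀ hsy]
      have : y ≤ √S := Real.le_sqrt_of_sq_le (by rw [hS]; nlinarith)
      have : √y ≤ 1 := Real.sqrt_le_one.mpr hy1
      nlinarith
    linarith

lemma potential_step (h0 : 0 < y₀) (him : 0 < τ.im) (hre : |τ.re| ≤ 1) (hn : ‖τ‖ < 1) {k : ℤ}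
    (hre' : |(-1 / τ + 2 * k).re| ≤ 1) (h1 : c ≤ 1 / √τ.im)
    (h2 : cuspDistSq τ ≤ 1 / 4 → c ≤ √(cuspDistSq τ) / √τ.im)
    (h3 : cuspDistSq τ ≤ 1 / 4 → 4 * (1 - |τ.re|) ^ 2 < cuspDistSq τ → c ≤ τ.im) :
    c + potential y₀ (-1 / τ + 2 * k) ≤ potential y₀ τ := by
  have hM0 := cuspAngle_nonneg hre him
  have hsy : 0 < √τ.im := Real.sqrt_pos.mpr him
  have hsy0 : 0 < √y₀ := Real.sqrt_pos.mpr h0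
  have hy1 : τ.im ≤ 1 := ((le_abs_self _).trans (Complex.abs_im_le_norm τ)).trans hn.le
  have h60 : 60 / √τ.im = 60 * (1 / √τ.im) := by ring
  have hpos : 0 < 1 / √τ.im := by positivity
  rw [potential, potential, if_pos hn]
  split_ifs with hn'
  swap
  · have : 2 / √y₀ = 2 * (1 / √y₀) := by ring
    have : 0 < 1 / √y₀ := by positivity
    linarith
  have hnp : 0 < ‖τ‖ := norm_pos_iff.mpr (by rintro rfl; simp at him)
  have him' := neg_inv_add_im τ k
  have hre2 := neg_inv_add_re τ k
  have him0 : 0 < (-1 / τ + 2 * k).im := by rw [him']; positivity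
  have hsq : 60 / √(-1 / τ + 2 * k).im = 60 * (‖τ‖ / √τ.im) := by
    rw [him', Real.sqrt_div him.le, Real.sqrt_sq hnp.le]
    field_simp
  have hone : 1 ≤ 1 / √τ.im := by
    rw [le_div_iff₀ hsy, one_mul]; exact Real.sqrt_le_one.mpr hy1
  have far : ‖τ‖ ≤ 3 / 4 → c + (2 / √y₀ + 60 / √(-1 / τ + 2 * k).im +
      3 * cuspAngle (-1 / τ + 2 * k)) ≤ 2 / √y₀ + 60 / √τ.im + 3 * cuspAngle τ := by
    intro h
    have e1 := cuspAngle_le him0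
    have e2 : ‖τ‖ / √τ.im ≤ 3 / 4 * (1 / √τ.im) := by
      rw [div_eq_mul_one_div]; gcongr
    rw [hsq]
    linarith
  have hNe : ‖τ‖ ^ 2 = 1 - 2 * (1 - |τ.re|) + cuspDistSq τ := by
    rw [norm_sq_eq_re_im, cuspDistSq, ← sq_abs τ.re]; ring
  have near : 3 * ‖τ‖ ^ 2 + 1 < 4 * |τ.re| →
      |(-1 / τ + 2 * k).re| = |2 - |τ.re| / ‖τ‖ ^ 2| → c + (2 / √y₀ +
        60 / √(-1 / τ + 2 * k).im + 3 * cuspAngle (-1 / τ + 2 * k)) ≤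
        2 / √y₀ + 60 / √τ.im + 3 * cuspAngle τ := by
    intro h h'
    by_cases hS : cuspDistSq τ ≤ 1 / 4
    · have hN0 : 0 < ‖τ‖ ^ 2 := by positivity
      have hN1 : ‖τ‖ ^ 2 < 1 := by nlinarith
      have hS0 := cuspDistSq_pos him
      have key := cusp_step_le (a := 1 - |τ.re|) (by linarith) him hy1 hN0 hN1
        (S := cuspDistSq τ) rfl hNe hS (h2 hS) (h3 hS)
      rw [Real.sqrt_sq hnp.le] at key
      have ha2 : 1 - |τ.re| ≤ 1 / 2 := by
        have : (1 - |τ.re|) ^ 2 ≤ 1 / 4 := le_trans (by unfold cuspDistSq; nlinarith) hS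
        nlinarith
      have hx2 : |τ.re| / ‖τ‖ ^ 2 ≤ 2 := by
        rw [div_le_iff₀ hN0]
        have : (1 - |τ.re|) ^ 2 ≤ cuspDistSq τ := by unfold cuspDistSq; nlinarith
        nlinarith
      have ea : 1 - |(-1 / τ + 2 * k).re| = ((1 - |τ.re|) - cuspDistSq τ) / ‖τ‖ ^ 2 := by
        rw [h', abs_of_nonneg (by linarith)]
        field_simp
        linarith
      have eS : cuspDistSq (-1 / τ + 2 * k) = cuspDistSq τ / ‖τ‖ ^ 2 := by
        rw [cuspDistSq, ea, him', eq_div_iff hN0.ne', div_pow, div_pow, ← add_div, div_mul_eq_mul_div,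
          div_eq_iff (by positivity)]
        rw [hNe]
        unfold cuspDistSq
        ring
      have eM : cuspAngle (-1 / τ + 2 * k) =
          ((1 - |τ.re|) - cuspDistSq τ) * τ.im / (‖τ‖ ^ 2 * cuspDistSq τ) := by
        rw [cuspAngle, ea, eS, him']
        field_simp
      rw [hsq, eM]
      rw [cuspAngle]
      linarith
    · refine far ?_
      rw [not_le] at hS
      have : ‖τ‖ ^ 2 ≤ (3 / 4) ^ 2 := by nlinarith
      exact le_of_sq_le_sq this (by norm_num)
  rcases reduction_cases him hn hre' hn' with ⟨rfl, h⟩ | ⟨rfl, h⟩ | h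
  · have hp : 0 < τ.re := by nlinarith [sq_nonneg ‖τ‖]
    refine near (by rwa [abs_of_pos hp]) ?_
    rw [hre2, abs_of_pos hp]
    congr 1; push_cast; ring
  · have hp : τ.re < 0 := by nlinarith [sq_nonneg ‖τ‖]
    refine near (by rw [abs_of_neg hp]; linarith) ?_
    rw [hre2, abs_of_neg hp, ← abs_neg]
    congr 1; push_cast; ring
  · exact far (by linarith)

end Potential

section Sharp

variable {ε : ℂ} {m : ℕ} {e : ℝ} {τ : ℂ}

lemma pert_differentiable (ε : ℂ) (m : ℕ) (e : ℝ) : Differentiable ℂ (pert ε m e) :=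
  (expo_differentiable _).sub ((expo_differentiable _).const_mul _)

lemma exists_dataBound_pert (K : ℕ) : ∃ C : ℝ, 0 < C ∧ ∀ ε, (ε = 1 ∨ ε = -1) → ∀ m : ℕ, 1 ≤ m →
    ∀ e : ℝ, |e| ≤ 1 / 2 → DataBound (pert ε m e) K (C * |e| / m ^ K) := by
  obtain ⟨C, hC, hb⟩ := exists_pow_mul_exp_le K (c := π / 2) (by positivity) 0
  refine ⟨64 * C, by positivity, fun ε hε m hm e he => ⟨(pert_differentiable ε m e).differentiableOn,
    fun z hz => ?_⟩⟩
  have hm0 : (0 : ℝ) < m := by exact_mod_cast hm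
  have h1 := norm_pert_le hε hm he hz.1.le
  have h2 : 1 + ‖z‖ ≤ 4 := by linarith [hz.2.2]
  have h3 := hb (m * z.im) (by have := hz.1; positivity)
  have hz0 := hz.1
  rw [le_div_iff₀ (by positivity)]
  rw [zero_add] at h3
  calc ‖pert ε m e z‖ * z.im ^ K * m ^ K
      ≤ 16 * |e| * 4 * rexp (-(π / 2 * (m * z.im))) * z.im ^ K * m ^ K := by
        gcongr
        exact h1.trans (by gcongr)
    _ = 64 * |e| * ((m * z.im) ^ K * rexp (-(π / 2 * (m * z.im)))) := by rw [mul_pow]; ring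
    _ ≤ 64 * |e| * C := by gcongr
    _ = _ := by ring

lemma quarter_rpow_mul_sqrt_le {t y₀ : ℝ} (h0 : 0 < y₀) (h1 : y₀ ≤ 1) (ht : 0 < t)
    (ht' : t * y₀ ≤ 1) : t ^ (1 / 4 : ℝ) * √y₀ ≤ 1 := by
  have e1 : √y₀ ≤ y₀ ^ (1 / 4 : ℝ) := by
    rw [Real.sqrt_eq_rpow]
    exact Real.rpow_le_rpow_of_exponent_ge h0 h1 (by norm_num)
  calc t ^ (1 / 4 : ℝ) * √y₀ ≤ t ^ (1 / 4 : ℝ) * y₀ ^ (1 / 4 : ℝ) := by gcongr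
    _ = (t * y₀) ^ (1 / 4 : ℝ) := (Real.mul_rpow ht.le h0.le).symm
    _ ≤ 1 := Real.rpow_le_one (by positivity) ht' (by norm_num)

lemma exists_sol_pert_base (K : ℕ) : ∃ C : ℝ, 0 < C ∧ ∀ ε, (ε = 1 ∨ ε = -1) → ∀ m : ℕ, 1 ≤ m →
    ∀ e : ℝ, |e| ≤ 1 / 2 → ∀ y₀ : ℝ, 0 < y₀ → y₀ ≤ 1 → ∀ τ : ℂ, |τ.re| ≤ 1 → 1 ≤ ‖τ‖ → y₀ ≤ τ.im →
      τ.im * y₀ ≤ 1 →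
      τ.im ^ (1 / 4 : ℝ) * ‖sol ε (pert ε m e) τ‖ ≤ C * |e| / (1 + m * y₀) ^ K * (1 / √y₀) := by
  obtain ⟨A₀, hA₀, hs₀⟩ := exists_sol_bound 0
  obtain ⟨A₁, hA₁, hs₁⟩ := exists_sol_bound K
  obtain ⟨B₀, hB₀, hd₀⟩ := exists_dataBound_pert 0
  obtain ⟨B₁, hB₁, hd₁⟩ := exists_dataBound_pert K
  refine ⟨2 ^ K * (A₀ * B₀ + A₁ * B₁), by positivity, fun ε hε m hm e he y₀ h0 h1 τ hre hn hy hy' => ?_⟩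
  have hm1 : (1 : ℝ) ≤ m := by exact_mod_cast hm
  have hm0 : (0 : ℝ) < m := by linarith
  have him : 0 < τ.im := by linarith
  obtain ⟨p1, p2⟩ := hs₀ ε _ _ hε (hd₀ ε hε m hm e he) τ hre him hn
  obtain ⟨q1, q2⟩ := hs₁ ε _ _ hε (hd₁ ε hε m hm e he) τ hre him hn
  have hsy0 : 0 < √y₀ := Real.sqrt_pos.mpr h0
  rw [mul_one_div, le_div_iff₀ hsy0, le_div_iff₀ (by positivity)]
  have hea := abs_nonneg e
  by_cases h : 1 / 2 ≤ τ.im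
  · have e1 : (1 + m * y₀) ^ K ≤ 2 ^ K * m ^ K := by
      rw [← mul_pow]
      gcongr
      nlinarith
    calc τ.im ^ (1 / 4 : ℝ) * ‖sol ε (pert ε m e) τ‖ * √y₀ * (1 + m * y₀) ^ K
        = (τ.im ^ (1 / 4 : ℝ) * √y₀) * ‖sol ε (pert ε m e) τ‖ * (1 + m * y₀) ^ K := by ring
      _ ≤ 1 * (A₁ * (B₁ * |e| / m ^ K)) * (2 ^ K * m ^ K) := by
          gcongr
          · exact quarter_rpow_mul_sqrt_le h0 h1 him hy'
          · exact q1 h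
      _ = 2 ^ K * (A₁ * B₁) * |e| := by field_simp
      _ ≤ _ := by
          gcongr
          have : 0 < A₀ * B₀ := by positivity
          linarith
  · rw [not_le] at h
    have p2 := p2 (by linarith)
    have q2 := q2 (by linarith)
    have hs : 0 < √τ.im := Real.sqrt_pos.mpr him
    have e1 : τ.im ^ (1 / 4 : ℝ) ≤ 1 := Real.rpow_le_one him.le (by linarith) (by norm_num)
    have e2 : (1 + m * τ.im) ^ K ≤ 2 ^ K * (1 + (m * τ.im) ^ K) := by
      have := add_pow_le (zero_le_one (α := ℝ)) (by positivity : 0 ≤ m * τ.im) K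
      rw [one_pow] at this
      refine this.trans ?_
      gcongr
      · norm_num
      · omega
    rw [mul_div_assoc', le_div_iff₀ (by positivity)] at q2
    simp only [pow_zero, one_mul, div_one] at p2
    calc τ.im ^ (1 / 4 : ℝ) * ‖sol ε (pert ε m e) τ‖ * √y₀ * (1 + m * y₀) ^ K
        ≤ 1 * ‖sol ε (pert ε m e) τ‖ * √τ.im * (1 + m * τ.im) ^ K := by gcongr
      _ ≤ 1 * ‖sol ε (pert ε m e) τ‖ * √τ.im * (2 ^ K * (1 + (m * τ.im) ^ K)) := by gcongr
      _ = 2 ^ K * (‖sol ε (pert ε m e) τ‖ * √τ.im +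
            ‖sol ε (pert ε m e) τ‖ * (τ.im ^ K * √τ.im) * m ^ K) := by rw [mul_pow]; ring
      _ ≤ 2 ^ K * (A₀ * (B₀ * |e|) + A₁ * (B₁ * |e|)) := by gcongr
      _ = _ := by ring

lemma rpow_le_one_add {t s : ℝ} (ht : 0 ≤ t) (hs : 0 ≤ s) (hs1 : s ≤ 1) : t ^ s ≤ 1 + t := by
  rcases le_total t 1 with h | h
  · exact (Real.rpow_le_one ht h hs).trans (by linarith)
  · calc t ^ s ≤ t ^ (1 : ℝ) := Real.rpow_le_rpow_of_exponent_le h hs1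
      _ ≤ 1 + t := by rw [Real.rpow_one]; linarith

lemma exists_pert_far (K : ℕ) : ∃ C : ℝ, 0 < C ∧ ∀ ε, (ε = 1 ∨ ε = -1) → ∀ m : ℕ, 1 ≤ m →
    ∀ e : ℝ, |e| ≤ 1 / 2 → ∀ y₀ : ℝ, 0 < y₀ → ∀ τ : ℂ, 0 < τ.im → ‖τ‖ < 1 → y₀ ≤ τ.im →
      τ.im ^ (1 / 4 : ℝ) * ‖pert ε m e τ + ε * slash (pert ε m e) τ‖ ≤
        C * |e| / (1 + m * y₀) ^ K * (1 / √τ.im) := by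
  obtain ⟨C, hC, hb⟩ := exists_pow_mul_exp_le (K + 1) (c := π / 2) (by positivity) 1
  refine ⟨64 * C, by positivity, fun ε hε m hm e he y₀ h0 τ him hn hy => ?_⟩
  have hm1 : (1 : ℝ) ≤ m := by exact_mod_cast hm
  have hm0 : (0 : ℝ) < m := by linarith
  have hea := abs_nonneg e
  have hnp : 0 < ‖τ‖ := norm_pos_iff.mpr (by rintro rfl; simp at him)
  have hsy : 0 < √τ.im := Real.sqrt_pos.mpr him
  have hy1 : τ.im ≤ 1 := ((le_abs_self _).trans (Complex.abs_im_le_norm τ)).trans hn.le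
  set σ := -1 / τ with hσ
  obtain ⟨hσy, -⟩ := neg_inv_im_mem him hn hy
  rw [← hσ] at hσy
  have hσim : σ.im = τ.im / ‖τ‖ ^ 2 := neg_inv_im τ
  have hσ0 : 0 < σ.im := by linarith
  have hσn : ‖σ‖ = 1 / ‖τ‖ := by rw [hσ, norm_div, norm_neg, norm_one]
  have h1 := norm_pert_le hε hm he him.le
  have h2 := norm_pert_le hε hm he hσ0.le
  have hone : 1 ≤ 1 / ‖τ‖ := by rw [le_div_iff₀ hnp]; linarith
  have hgen : ∀ t : ℝ, y₀ ≤ t → (1 + t) * rexp (-(π / 2 * (m * t))) * (1 + m * y₀) ^ K ≤ C := by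
    intro t ht
    have ht0 : 0 < t := by linarith
    calc (1 + t) * rexp (-(π / 2 * (m * t))) * (1 + m * y₀) ^ K
        ≤ (1 + m * t) * rexp (-(π / 2 * (m * t))) * (1 + m * t) ^ K := by
          gcongr
          nlinarith
      _ = (1 + m * t) ^ (K + 1) * rexp (-(π / 2 * (m * t))) := by ring
      _ ≤ C := hb _ (by positivity)
  have a1 : τ.im ^ (1 / 4 : ℝ) * ‖pert ε m e τ‖ * √τ.im * (1 + m * y₀) ^ K ≤ 32 * C * |e| := by
    have := hgen τ.im hy
    calc _ ≤ 1 * (16 * |e| * (1 + 1) * rexp (-(π / 2 * (m * τ.im)))) * 1 * (1 + m * y₀) ^ K := by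
          gcongr
          · exact Real.rpow_le_one him.le hy1 (by norm_num)
          · exact h1.trans (by gcongr)
          · exact Real.sqrt_le_one.mpr hy1
      _ = 32 * |e| * (1 * rexp (-(π / 2 * (m * τ.im))) * (1 + m * y₀) ^ K) := by ring
      _ ≤ 32 * |e| * ((1 + τ.im) * rexp (-(π / 2 * (m * τ.im))) * (1 + m * y₀) ^ K) := by
          gcongr; linarith
      _ ≤ 32 * |e| * C := by gcongr
      _ = _ := by ring
  have a2 : σ.im ^ (1 / 4 : ℝ) * ‖pert ε m e σ‖ * √τ.im * (1 + m * y₀) ^ K ≤ 32 * C * |e| := by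
    have := hgen σ.im hσy
    have hs : √τ.im * (1 / ‖τ‖) = σ.im ^ (1 / 2 : ℝ) := by
      rw [hσim, ← Real.sqrt_eq_rpow, Real.sqrt_div him.le, Real.sqrt_sq hnp.le]; ring
    have hpow : σ.im ^ (1 / 4 : ℝ) * σ.im ^ (1 / 2 : ℝ) ≤ 1 + σ.im := by
      rw [← Real.rpow_add hσ0]
      exact rpow_le_one_add hσ0.le (by norm_num) (by norm_num)
    calc _ ≤ σ.im ^ (1 / 4 : ℝ) * (16 * |e| * (1 / ‖τ‖ + 1 / ‖τ‖) *
            rexp (-(π / 2 * (m * σ.im)))) * √τ.im * (1 + m * y₀) ^ K := by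
          gcongr
          refine h2.trans ?_
          rw [hσn]
          gcongr
      _ = 32 * |e| * ((σ.im ^ (1 / 4 : ℝ) * (√τ.im * (1 / ‖τ‖))) *
            rexp (-(π / 2 * (m * σ.im))) * (1 + m * y₀) ^ K) := by ring
      _ ≤ 32 * |e| * ((1 + σ.im) * rexp (-(π / 2 * (m * σ.im))) * (1 + m * y₀) ^ K) := by
          rw [hs]; gcongr
      _ ≤ 32 * |e| * C := by gcongr
      _ = _ := by ring
  rw [mul_one_div, le_div_iff₀ hsy, le_div_iff₀ (by positivity)]
  calc _ ≤ τ.im ^ (1 / 4 : ℝ) * (‖pert ε m e τ‖ + ‖slash (pert ε m e) τ‖) * √τ.im *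
        (1 + m * y₀) ^ K := by
        gcongr
        refine (norm_add_le _ _).trans ?_
        rw [norm_mul, norm_eq_one_of_sign hε, one_mul]
    _ = τ.im ^ (1 / 4 : ℝ) * ‖pert ε m e τ‖ * √τ.im * (1 + m * y₀) ^ K +
        σ.im ^ (1 / 4 : ℝ) * ‖pert ε m e σ‖ * √τ.im * (1 + m * y₀) ^ K := by
        rw [mul_add, rpow_mul_norm_slash _ him]; ring
    _ ≤ _ := by linarith

lemma expo_neg_conj (r : ℝ) (τ : ℂ) :
    expo r (-(starRingEnd ℂ) τ) = (starRingEnd ℂ) (expo r τ) := by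
  rw [expo, expo, ← Complex.exp_conj]
  simp

lemma pert_neg_conj (ε : ℂ) (m : ℕ) (e : ℝ) (τ : ℂ) :
    pert ε m e (-(starRingEnd ℂ) τ) = (starRingEnd ℂ) (pert ε m e τ) := by
  simp [pert, expo_neg_conj]

lemma norm_pert_add_slash_neg_conj (hε : ε = 1 ∨ ε = -1) (m : ℕ) (e : ℝ) (hτ : 0 < τ.im) :
    ‖pert ε m e (-(starRingEnd ℂ) τ) + ε * slash (pert ε m e) (-(starRingEnd ℂ) τ)‖ =
      ‖pert ε m e τ + ε * slash (pert ε m e) τ‖ := by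
  have hε' : (starRingEnd ℂ) ε = ε := by rcases hε with rfl | rfl <;> simp
  have h2 : slash (pert ε m e) (-(starRingEnd ℂ) τ) = (starRingEnd ℂ) (slash (pert ε m e) τ) := by
    have h3 := Complex.conj_cpow (-I * τ) (1 / 2)
      (Complex.slitPlane_arg_ne_pi (neg_I_mul_mem_slitPlane hτ))
    rw [show (starRingEnd ℂ) (1 / 2 : ℂ) = 1 / 2 by
      rw [map_div₀, map_one, Complex.conj_ofNat]] at h3
    rw [slash, slash, map_div₀, ← pert_neg_conj, ← h3]
    congr 2
    · simp [neg_div, div_neg]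
    · simp
  rw [pert_neg_conj, h2, ← Complex.norm_conj (pert ε m e τ + _), map_add, map_mul, hε']

lemma exists_pert_near (K : ℕ) : ∃ C : ℝ, 0 < C ∧ ∀ ε, (ε = 1 ∨ ε = -1) → ∀ m : ℕ, 1 ≤ m →
    ∀ e : ℝ, |e| ≤ 1 / 2 → ∀ y₀ : ℝ, 0 < y₀ → ∀ τ : ℂ, |τ.re| ≤ 1 → 0 < τ.im → ‖τ‖ < 1 →
      y₀ ≤ τ.im → cuspDistSq τ ≤ 1 / 4 →
      τ.im ^ (1 / 4 : ℝ) * ‖pert ε m e τ + ε * slash (pert ε m e) τ‖ ≤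
          C * |e| / (1 + m * y₀) ^ K * (√(cuspDistSq τ) / √τ.im) ∧
        (4 * (1 - |τ.re|) ^ 2 < cuspDistSq τ →
          τ.im ^ (1 / 4 : ℝ) * ‖pert ε m e τ + ε * slash (pert ε m e) τ‖ ≤
            C * |e| / (1 + m * y₀) ^ K * τ.im) := by
  obtain ⟨C, hC, hb⟩ := exists_pow_mul_exp_le (K + 1) Real.pi_pos 1
  refine ⟨2000 * C, by positivity, fun ε hε m hm e he y₀ h0 τ hre him hn hy hS => ?_⟩
  have hm1 : (1 : ℝ) ≤ m := by exact_mod_cast hm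
  have hm0 : (0 : ℝ) < m := by linarith
  have hea := abs_nonneg e
  have hsy : 0 < √τ.im := Real.sqrt_pos.mpr him
  have hy1 : τ.im ≤ 1 := ((le_abs_self _).trans (Complex.abs_im_le_norm τ)).trans hn.le
  set S := cuspDistSq τ with hSd
  set d := √S with hd
  have hS0 : 0 < S := cuspDistSq_pos him
  have hd0 : 0 < d := Real.sqrt_pos.mpr hS0
  have hdS : d ^ 2 = S := Real.sq_sqrt hS0.le
  have hd2 : d ≤ 1 / 2 := by rw [hd, Real.sqrt_le_left (by norm_num)]; linarith
  have hnorm : ∀ σ : ℂ, σ.re = |τ.re| → σ.im = τ.im → ‖1 - σ‖ = d := by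
    intro σ h1 h2
    rw [hd, hSd, cuspDistSq, ← Real.sqrt_sq (norm_nonneg (1 - σ)), norm_sq_eq_re_im]
    simp [h1, h2]
  have main : ‖pert ε m e τ + ε * slash (pert ε m e) τ‖ ≤
      1000 * |e| * rexp (-(π * m * τ.im)) * (d + min 1 (m * d ^ 2)) := by
    rcases le_total 0 τ.re with h | h
    · have e1 := hnorm τ (abs_of_nonneg h).symm rfl
      have := norm_pert_add_slash_le (m := m) hε he him hn (by rw [e1]; exact hd2)
      rwa [e1] at this
    · have e1 := hnorm (-(starRingEnd ℂ) τ) (by simp [abs_of_nonpos h]) (by simp)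
      have := norm_pert_add_slash_le (m := m) (τ := -(starRingEnd ℂ) τ) hε he (by simpa using him)
        (by simpa using hn) (by rw [e1]; exact hd2)
      rw [norm_pert_add_slash_neg_conj hε m e him, e1] at this
      simpa using this
  have hgen : (1 + m * τ.im) * rexp (-(π * m * τ.im)) * (1 + m * y₀) ^ K ≤ C := by
    calc (1 + m * τ.im) * rexp (-(π * m * τ.im)) * (1 + m * y₀) ^ K
        ≤ (1 + m * τ.im) * rexp (-(π * m * τ.im)) * (1 + m * τ.im) ^ K := by gcongr
      _ = (1 + m * τ.im) ^ (K + 1) * rexp (-(π * (m * τ.im))) := by rw [mul_assoc π]; ring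
      _ ≤ C := hb _ (by positivity)
  have hq : τ.im ^ (1 / 4 : ℝ) ≤ 1 := Real.rpow_le_one him.le hy1 (by norm_num)
  have hX := Real.exp_pos (-(π * m * τ.im))
  constructor
  · have hq' : τ.im ^ (1 / 4 : ℝ) * √τ.im ≤ √τ.im := mul_le_of_le_one_left hsy.le hq
    have hmin : min 1 (m * d ^ 2) ≤ √m * d := by
      have hs : (√m * d) ^ 2 = m * d ^ 2 := by rw [mul_pow, Real.sq_sqrt hm0.le]
      rcases le_total 1 (√m * d) with h | h
      · exact (min_le_left _ _).trans h
      · refine (min_le_right _ _).trans ?_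
        rw [← hs]
        nlinarith [mul_nonneg (Real.sqrt_nonneg m) hd0.le]
    have hsm : √τ.im * √m ≤ 1 + m * τ.im := by
      rw [← Real.sqrt_mul him.le, Real.sqrt_le_left (by positivity)]
      nlinarith [mul_pos hm0 him]
    have hs1 : √τ.im ≤ 1 + m * τ.im := by
      have : √τ.im ≤ 1 := Real.sqrt_le_one.mpr hy1
      have : 0 < m * τ.im := by positivity
      linarith
    rw [mul_div_assoc', le_div_iff₀ hsy, div_mul_eq_mul_div, le_div_iff₀ (by positivity)]
    calc _ ≤ τ.im ^ (1 / 4 : ℝ) * (1000 * |e| * rexp (-(π * m * τ.im)) * (d + √m * d)) * √τ.im *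
          (1 + m * y₀) ^ K := by
          gcongr
          exact main.trans (by gcongr)
      _ = 1000 * |e| * rexp (-(π * m * τ.im)) * (d + √m * d) * (1 + m * y₀) ^ K *
          (τ.im ^ (1 / 4 : ℝ) * √τ.im) := by ring
      _ ≤ 1000 * |e| * rexp (-(π * m * τ.im)) * (d + √m * d) * (1 + m * y₀) ^ K * √τ.im := by
          gcongr
      _ = 1000 * |e| * d * (rexp (-(π * m * τ.im)) * (1 + m * y₀) ^ K) *
          (√τ.im + √τ.im * √m) := by ring
      _ ≤ 1000 * |e| * d * (rexp (-(π * m * τ.im)) * (1 + m * y₀) ^ K) *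
          ((1 + m * τ.im) + (1 + m * τ.im)) := by gcongr
      _ = 2000 * |e| * d * ((1 + m * τ.im) * rexp (-(π * m * τ.im)) * (1 + m * y₀) ^ K) := by ring
      _ ≤ 2000 * |e| * d * C := by gcongr
      _ = _ := by ring
  · intro hA
    have hSe : S = (1 - |τ.re|) ^ 2 + τ.im ^ 2 := rfl
    have hdy : d ≤ 2 * τ.im := by
      rw [hd, Real.sqrt_le_left (by positivity)]; nlinarith
    have hdy2 : d ^ 2 ≤ 2 * τ.im ^ 2 := by rw [hdS]; nlinarith
    rw [div_mul_eq_mul_div, le_div_iff₀ (by positivity)]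
    calc _ ≤ 1 * (1000 * |e| * rexp (-(π * m * τ.im)) * (2 * τ.im + m * (2 * τ.im ^ 2))) *
          (1 + m * y₀) ^ K := by
          gcongr
          refine main.trans ?_
          gcongr
          exact (min_le_right _ _).trans (by gcongr)
      _ = 2000 * |e| * τ.im *
          ((1 + m * τ.im) * rexp (-(π * m * τ.im)) * (1 + m * y₀) ^ K) := by ring
      _ ≤ 2000 * |e| * τ.im * C := by gcongr
      _ = _ := by ring

/-- The sharp bound for solutions attached to perturbed data. -/
theorem exists_sol_pert_bound (K : ℕ) : ∃ C : ℝ, 0 < C ∧ ∀ ε, (ε = 1 ∨ ε = -1) → ∀ m : ℕ, 1 ≤ m →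
    ∀ e : ℝ, |e| ≤ 1 / 2 → ∀ τ : ℂ, 0 < τ.im → τ.im ≤ 1 →
      ‖sol ε (pert ε m e) τ‖ ≤ C * |e| / (1 + m * τ.im) ^ K * (1 / τ.im ^ (3 / 4 : ℝ)) := by
  obtain ⟨C₁, hC₁, hbase⟩ := exists_sol_pert_base K
  obtain ⟨C₂, hC₂, hfar⟩ := exists_pert_far K
  obtain ⟨C₃, hC₃, hnear⟩ := exists_pert_near K
  obtain ⟨C₄, -, hdata⟩ := exists_dataBound_pert 0
  set C := C₁ + C₂ + C₃ with hC
  refine ⟨C * 64, by positivity, fun ε hε m hm e he τ him him1 => ?_⟩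
  obtain ⟨k, hk⟩ := exists_translate τ.re
  set y₀ := τ.im with hy₀
  have hea := abs_nonneg e
  have hm0 : (0 : ℝ) ≤ m := Nat.cast_nonneg m
  have hs0 : 0 < √y₀ := Real.sqrt_pos.mpr him
  set A : ℝ := C * |e| / (1 + m * y₀) ^ K with hA
  have hA0 : 0 ≤ A := by positivity
  have hle : ∀ D : ℝ, D ≤ C → D * |e| / (1 + m * y₀) ^ K ≤ A := fun D hD => by
    rw [hA]; gcongr
  have key := chain_bound hε (fun σ k => sol_add_two_mul_int ε (pert ε m e) σ k)
    (fun σ hσ => sol_add_slash hε (hdata ε hε m hm e he) hσ) (y₀ := y₀)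
    (Q := fun σ => A * potential y₀ σ) ?_ ?_ (τ + 2 * k)
    (by simpa using hk) (by simpa using him) (by simp [hy₀]) (by simp [← hy₀]; nlinarith)
  · rw [sol_add_two_mul_int] at key
    have hi : (τ + 2 * (k : ℂ)).im = y₀ := by simp [hy₀]
    rw [hi] at key
    have hpot : potential y₀ (τ + 2 * k) ≤ 64 * (1 / √y₀) := by
      have h1 : 1 ≤ 1 / √y₀ := by
        rw [le_div_iff₀ hs0, one_mul]; exact Real.sqrt_le_one.mpr him1
      have h2 := cuspAngle_le (τ := τ + 2 * k) (by rw [hi]; exact him)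
      rw [potential, hi]
      split_ifs
      · rw [div_eq_mul_one_div 2, div_eq_mul_one_div 60]; linarith
      · linarith
    have hpos : 0 < y₀ ^ (1 / 4 : ℝ) := by positivity
    have h34 : y₀ ^ (3 / 4 : ℝ) = y₀ ^ (1 / 4 : ℝ) * √y₀ := by
      rw [Real.sqrt_eq_rpow, ← Real.rpow_add him]; norm_num
    have h5 : y₀ ^ (1 / 4 : ℝ) * ‖sol ε (pert ε m e) τ‖ ≤ A * (64 * (1 / √y₀)) :=
      key.trans (mul_le_mul_of_nonneg_left hpot hA0)
    calc ‖sol ε (pert ε m e) τ‖ ≤ A * (64 * (1 / √y₀)) / y₀ ^ (1 / 4 : ℝ) := by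
          rw [le_div_iff₀ hpos]; linarith
      _ = _ := by rw [h34, hA]; field_simp
  · intro σ s1 s2 s3 s4 s5
    refine (hbase ε hε m hm e he y₀ him him1 σ s1 s3 s4 s5).trans ?_
    rw [potential, if_neg (not_lt.mpr s3)]
    gcongr
    exact hle C₁ (by rw [hC]; linarith)
  · intro σ j s1 s2 s3 s4 s5
    have hf := hfar ε hε m hm e he y₀ him σ s2 s3 s4
    rcases hA0.eq_or_lt with hAe | hApos
    · rw [← hAe, zero_mul, zero_mul, add_zero]
      refine hf.trans (mul_nonpos_of_nonpos_of_nonneg ?_ (by positivity))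
      exact (hle C₂ (by rw [hC]; linarith)).trans_eq hAe.symm
    set c := σ.im ^ (1 / 4 : ℝ) * ‖pert ε m e σ + ε * slash (pert ε m e) σ‖ / A with hc
    have hcA : σ.im ^ (1 / 4 : ℝ) * ‖pert ε m e σ + ε * slash (pert ε m e) σ‖ = A * c := by
      rw [hc]; field_simp
    have hdiv : ∀ D X : ℝ, D ≤ C → 0 ≤ X → σ.im ^ (1 / 4 : ℝ) *
        ‖pert ε m e σ + ε * slash (pert ε m e) σ‖ ≤ D * |e| / (1 + m * y₀) ^ K * X → c ≤ X := by
      intro D X hD hX h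
      rw [hc, div_le_iff₀ hApos, mul_comm X]
      exact h.trans (mul_le_mul_of_nonneg_right (hle D hD) hX)
    rw [hcA, ← mul_add]
    refine mul_le_mul_of_nonneg_left (potential_step him s2 s1 s3 s5 ?_ ?_ ?_) hA0
    · exact hdiv C₂ _ (by rw [hC]; linarith) (by positivity) hf
    · exact fun hS => hdiv C₃ _ (by rw [hC]; linarith) (by positivity)
        (hnear ε hε m hm e he y₀ him σ s1 s2 s3 s4 hS).1
    · exact fun hS hS' => hdiv C₃ _ (by rw [hC]; linarith) s2.le
        ((hnear ε hε m hm e he y₀ him σ s1 s2 s3 s4 hS).2 hS')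

end Sharp

section Coefficients

open AddCircle

/-- The `n`-th coefficient of the expansion of a `2`-periodic holomorphic function. -/
noncomputable def coef (Y : ℂ → ℂ) (n : ℕ) : ℂ :=
  (1 / 2) * ∫ t in (-1 : ℝ)..1, expo (-n) (t + I) * Y (t + I)

lemma expo_fourier [Fact (0 < (2 : ℝ))] (n : ℕ) (t y : ℝ) :
    expo n (t + y * I) = rexp (-(π * n * y)) * fourier (T := 2) n (t : AddCircle (2 : ℝ)) := by
  rw [fourier_coe_apply, expo, Complex.ofReal_exp, ← Complex.exp_add]
  congr 1
  push_cast
  linear_combination (π * n * y : ℂ) * Complex.I_sq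

lemma fourierCoeff_tsum [hT : Fact (0 < (2 : ℝ))] {c : ℕ → ℂ} (hc : Summable fun n => ‖c n‖)
    (n : ℕ) : fourierCoeff (∑' k : ℕ, c k • fourier (T := 2) k : C(AddCircle (2 : ℝ), ℂ)) n = c n := by
  have hs : Summable fun k : ℕ => c k • fourier (T := 2) k := by
    refine Summable.of_norm ?_
    simpa [norm_smul, fourier_norm] using hc
  rw [← fourierCoeff_toLp, ← fourierBasis_repr, fourierBasis.repr_apply_apply, coe_fourierBasis]
  let L : C(AddCircle (2 : ℝ), ℂ) →L[ℂ] ℂ := (innerSL ℂ (fourierLp (T := 2) 2 n)).comp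
    (ContinuousMap.toLp (E := ℂ) 2 haarAddCircle ℂ)
  change L _ = _
  rw [L.map_tsum hs, tsum_eq_single n]
  · rw [L.map_smul]
    have := orthonormal_iff_ite.mp (orthonormal_fourier (T := 2)) (n : ℤ) n
    rw [if_pos rfl] at this
    change c n • inner ℂ (fourierLp (T := 2) 2 (n : ℤ)) (fourierLp 2 (n : ℤ)) = _
    rw [this, smul_eq_mul, mul_one]
  · intro k hk
    rw [L.map_smul]
    have := orthonormal_iff_ite.mp (orthonormal_fourier (T := 2)) (n : ℤ) k
    rw [if_neg (by exact_mod_cast hk.symm)] at this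
    change c k • inner ℂ (fourierLp (T := 2) 2 (n : ℤ)) (fourierLp 2 (k : ℤ)) = _
    rw [this, smul_zero]

lemma sum_sq_fourierCoeff_le [hT : Fact (0 < (2 : ℝ))] {f : C(AddCircle (2 : ℝ), ℂ)} {A : ℝ}
    (hA : ∀ t, ‖f t‖ ≤ A) (s : Finset ℕ) : ∑ n ∈ s, ‖fourierCoeff f n‖ ^ 2 ≤ A ^ 2 := by
  have hA0 : 0 ≤ A := (norm_nonneg _).trans (hA 0)
  have h1 := (orthonormal_fourier (T := 2)).sum_inner_products_le
    (ContinuousMap.toLp (E := ℂ) 2 haarAddCircle ℂ f) (s := s.map Nat.castEmbedding)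
  rw [Finset.sum_map] at h1
  have h2 : ‖ContinuousMap.toLp (E := ℂ) 2 (haarAddCircle (T := 2)) ℂ f‖ ≤ A := by
    have h3 : ‖(ContinuousMap.toLp 2 (haarAddCircle (T := 2)) ℂ : C(AddCircle (2 : ℝ), ℂ) →L[ℂ] _)‖
        ≤ 1 := (ContinuousMap.toLp_norm_le _).trans (by simp [measureUnivNNReal])
    refine (ContinuousLinearMap.le_of_opNorm_le _ h3 f).trans ?_
    rw [one_mul]
    exact (ContinuousMap.norm_le _ hA0).mpr hA
  calc ∑ n ∈ s, ‖fourierCoeff f n‖ ^ 2 = ∑ n ∈ s, ‖inner ℂ (fourierLp (T := 2) 2 (n : ℤ))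
        (ContinuousMap.toLp (E := ℂ) 2 haarAddCircle ℂ f)‖ ^ 2 := by
        refine Finset.sum_congr rfl fun n _ => ?_
        rw [← fourierCoeff_toLp, ← fourierBasis_repr, fourierBasis.repr_apply_apply,
          coe_fourierBasis]
    _ ≤ _ := h1
    _ ≤ A ^ 2 := by gcongr

variable {Y : ℂ → ℂ} {M : ℝ}

lemma exists_hasSum_expo (hY : ∀ τ : ℂ, 0 < τ.im → DifferentiableAt ℂ Y τ)
    (hper : Function.Periodic Y ((2 : ℝ) : ℂ))
    (hb : ∀ τ : ℂ, |τ.re| ≤ 1 → 2 ≤ τ.im → ‖Y τ‖ ≤ M * rexp (2 * π / 3 * τ.im)) :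
    ∃ a : ℕ → ℂ, ∀ τ : ℂ, 0 < τ.im → HasSum (fun n : ℕ => a n * expo n τ) (Y τ) := by
  refine ⟨fun n => (n.factorial : ℂ)⁻¹ * iteratedDeriv n (Function.Periodic.cuspFunction 2 Y) 0,
    fun τ hτ => ?_⟩
  have hd : DifferentiableOn ℂ (Function.Periodic.cuspFunction 2 Y) (Metric.ball 0 1) :=
    fun q hq => (differentiableAt_cuspFunction_of_growth hY hper hb
      (by simpa using hq)).differentiableWithinAt
  have hq : Function.Periodic.qParam 2 τ ∈ Metric.ball (0 : ℂ) 1 := by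
    simpa using Function.Periodic.norm_qParam_lt_one two_pos hτ
  have := Complex.hasSum_taylorSeries_on_ball hd hq
  rw [Function.Periodic.eq_cuspFunction two_ne_zero hper] at this
  refine (congrArg (HasSum · (Y τ)) (funext fun n => ?_)).mp this
  have hqe : Function.Periodic.qParam 2 τ ^ n = expo n τ := by
    rw [Function.Periodic.qParam, ← Complex.exp_nat_mul, expo]
    congr 1
    push_cast
    ring
  rw [sub_zero, hqe, smul_eq_mul, smul_eq_mul]
  ring

variable {a : ℕ → ℂ}

lemma summable_norm_of_hasSum_expo
    (ha : ∀ τ : ℂ, 0 < τ.im → HasSum (fun n : ℕ => a n * expo n τ) (Y τ)) {y : ℝ} (hy : 0 < y) :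
    Summable fun n : ℕ => ‖a n * (rexp (-(π * n * y)) : ℂ)‖ := by
  have h := (ha (y * I) (by simpa using hy)).summable.norm
  refine h.congr fun n => ?_
  rw [norm_mul, norm_expo, norm_mul, Complex.norm_real, Real.norm_of_nonneg (Real.exp_pos _).le]
  simp

/-- The restriction of a series of exponentials to a horizontal line. -/
noncomputable def lineRestriction [Fact (0 < (2 : ℝ))] (a : ℕ → ℂ) (y : ℝ) :
    C(AddCircle (2 : ℝ), ℂ) :=
  ∑' k : ℕ, (a k * (rexp (-(π * k * y)) : ℂ)) • fourier (T := 2) k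

lemma lineRestriction_apply [Fact (0 < (2 : ℝ))]
    (ha : ∀ τ : ℂ, 0 < τ.im → HasSum (fun n : ℕ => a n * expo n τ) (Y τ)) {y : ℝ} (hy : 0 < y)
    (t : ℝ) : lineRestriction a y (t : AddCircle (2 : ℝ)) = Y (t + y * I) := by
  have hs : Summable fun k : ℕ => (a k * (rexp (-(π * k * y)) : ℂ)) • fourier (T := 2) k := by
    refine Summable.of_norm ?_
    have := summable_norm_of_hasSum_expo ha hy
    simpa only [norm_smul, fourier_norm, mul_one] using this
  rw [lineRestriction, ← ContinuousMap.tsum_apply hs,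
    ← (ha (t + y * I) (by simpa using hy)).tsum_eq]
  refine tsum_congr fun n => ?_
  rw [expo_fourier, ContinuousMap.smul_apply, smul_eq_mul]
  ring

lemma fourierCoeff_lineRestriction [Fact (0 < (2 : ℝ))]
    (ha : ∀ τ : ℂ, 0 < τ.im → HasSum (fun n : ℕ => a n * expo n τ) (Y τ)) {y : ℝ} (hy : 0 < y)
    (n : ℕ) : fourierCoeff (lineRestriction a y) n = a n * (rexp (-(π * n * y)) : ℂ) :=
  fourierCoeff_tsum (summable_norm_of_hasSum_expo ha hy) n

/-- A convergent expansion in exponentials is given by the coefficients `coef`. -/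
lemma coef_eq_of_hasSum (ha : ∀ τ : ℂ, 0 < τ.im → HasSum (fun n : ℕ => a n * expo n τ) (Y τ))
    (n : ℕ) : coef Y n = a n := by
  have : Fact (0 < (2 : ℝ)) := ⟨two_pos⟩
  have h1 := fourierCoeff_lineRestriction ha one_pos n
  rw [fourierCoeff_eq_intervalIntegral _ _ (-1), show (-1 : ℝ) + 2 = 1 by norm_num] at h1
  have h2 : ∀ t : ℝ, expo (-n) (t + I) * Y (t + I) = (rexp (π * n) : ℂ) *
      (fourier (-n) (t : AddCircle (2 : ℝ)) • lineRestriction a 1 (t : AddCircle (2 : ℝ))) := by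
    intro t
    rw [lineRestriction_apply ha one_pos, smul_eq_mul, fourier_coe_apply, expo, ← mul_assoc,
      Complex.ofReal_exp, ← Complex.exp_add, Complex.ofReal_one, one_mul]
    congr 2
    push_cast
    linear_combination (-π * n : ℂ) * Complex.I_sq
  rw [coef]
  simp_rw [h2]
  rw [intervalIntegral.integral_const_mul]
  rw [Complex.real_smul] at h1
  have h3 : (rexp (π * n) : ℂ) * (rexp (-(π * n * 1)) : ℂ) = 1 := by
    rw [← Complex.ofReal_mul, ← Real.exp_add]; simp
  push_cast at h1 h3 ⊢
  linear_combination (Complex.exp (π * n)) * h1 + a n * h3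

lemma hasSum_coef (hY : ∀ τ : ℂ, 0 < τ.im → DifferentiableAt ℂ Y τ)
    (hper : Function.Periodic Y ((2 : ℝ) : ℂ))
    (hb : ∀ τ : ℂ, |τ.re| ≤ 1 → 2 ≤ τ.im → ‖Y τ‖ ≤ M * rexp (2 * π / 3 * τ.im))
    {τ : ℂ} (hτ : 0 < τ.im) : HasSum (fun n : ℕ => coef Y n * expo n τ) (Y τ) := by
  obtain ⟨a, ha⟩ := exists_hasSum_expo hY hper hb
  simpa only [coef_eq_of_hasSum ha] using ha τ hτ

/-- Bessel's inequality on a horizontal line. -/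
lemma sum_sq_coef_le (ha : ∀ τ : ℂ, 0 < τ.im → HasSum (fun n : ℕ => coef Y n * expo n τ) (Y τ))
    {y A : ℝ} (hy : 0 < y) (hA : ∀ τ : ℂ, τ.im = y → ‖Y τ‖ ≤ A) (s : Finset ℕ) :
    ∑ n ∈ s, (‖coef Y n‖ * rexp (-(π * n * y))) ^ 2 ≤ A ^ 2 := by
  have : Fact (0 < (2 : ℝ)) := ⟨two_pos⟩
  have h : ∀ t : AddCircle (2 : ℝ), ‖lineRestriction (coef Y) y t‖ ≤ A := by
    intro t
    obtain ⟨t, rfl⟩ := QuotientAddGroup.mk_surjective t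
    rw [lineRestriction_apply ha hy]
    exact hA _ (by simp)
  refine (le_of_eq (Finset.sum_congr rfl fun n _ => ?_)).trans (sum_sq_fourierCoeff_le h s)
  rw [fourierCoeff_lineRestriction ha hy, norm_mul, Complex.norm_real,
    Real.norm_of_nonneg (Real.exp_pos _).le]

lemma norm_coef_le (ha : ∀ τ : ℂ, 0 < τ.im → HasSum (fun n : ℕ => coef Y n * expo n τ) (Y τ))
    {y A : ℝ} (hy : 0 < y) (hA : ∀ τ : ℂ, τ.im = y → ‖Y τ‖ ≤ A) (n : ℕ) :
    ‖coef Y n‖ ≤ rexp (π * n * y) * A := by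
  have hA0 : 0 ≤ A := (norm_nonneg _).trans (hA (y * I) (by simp))
  have h := sum_sq_coef_le ha hy hA {n}
  rw [Finset.sum_singleton, sq_le_sq₀ (by positivity) hA0, Real.exp_neg, ← div_eq_mul_inv,
    div_le_iff₀ (Real.exp_pos _)] at h
  linarith

end Coefficients

section SolCoefficients

variable {ε : ℂ} {φ φ₂ : ℂ → ℂ} {K : ℕ} {B B₂ : ℝ}

lemma sol_periodic (ε : ℂ) (φ : ℂ → ℂ) : Function.Periodic (sol ε φ) ((2 : ℝ) : ℂ) := by
  intro τ
  simpa using sol_add_two_mul_int ε φ τ 1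

lemma exists_sol_bound_high (K : ℕ) : ∃ C > 0, ∀ ε : ℂ, ∀ φ : ℂ → ℂ, ∀ B : ℝ, (ε = 1 ∨ ε = -1) →
    DataBound φ K B → ∀ τ : ℂ, 1 ≤ τ.im → ‖sol ε φ τ‖ ≤ C * B := by
  obtain ⟨C, hC, h⟩ := exists_sol_bound K
  refine ⟨C, hC, fun ε φ B hε hφ τ hτ => ?_⟩
  obtain ⟨σ, h1, h2, h3⟩ := exists_reduced (sol_periodic ε φ) τ
  rw [← h3]
  rw [← h2] at hτ
  exact (h ε φ B hε hφ σ h1 (by linarith) (hτ.trans ((le_abs_self _).trans σ.abs_im_le_norm))).1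
    (by linarith)

lemma hasSum_coef_sol (hε : ε = 1 ∨ ε = -1) (h : DataBound φ K B) {τ : ℂ} (hτ : 0 < τ.im) :
    HasSum (fun n : ℕ => coef (sol ε φ) n * expo n τ) (sol ε φ τ) := by
  obtain ⟨C, hC, hb⟩ := exists_sol_bound_high K
  refine hasSum_coef (M := C * B) (fun τ hτ => sol_differentiableAt hε h hτ) (sol_periodic ε φ)
    (fun τ _ h2 => ?_) hτ
  refine (hb ε φ B hε h τ (by linarith)).trans (le_mul_of_one_le_right
    (mul_nonneg hC.le h.nonneg) (Real.one_le_exp ?_))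
  have := Real.pi_pos
  positivity

lemma exists_coef_sol_bound (K n : ℕ) : ∃ C > 0, ∀ ε : ℂ, ∀ φ : ℂ → ℂ, ∀ B : ℝ,
    (ε = 1 ∨ ε = -1) → DataBound φ K B → ‖coef (sol ε φ) n‖ ≤ C * B := by
  obtain ⟨C, hC, hb⟩ := exists_sol_bound_high K
  refine ⟨rexp (π * n) * C, by positivity, fun ε φ B hε h => ?_⟩
  have := norm_coef_le (fun τ hτ => hasSum_coef_sol hε h hτ) one_pos
    (fun τ hτ => hb ε φ B hε h τ hτ.ge) n
  simpa [mul_assoc] using this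

lemma coef_sol_add_smul (hε : ε = 1 ∨ ε = -1) (h : DataBound φ K B) (h₂ : DataBound φ₂ K B₂)
    (c : ℂ) (n : ℕ) : coef (sol ε (fun z => φ z + c * φ₂ z)) n
      = coef (sol ε φ) n + c * coef (sol ε φ₂) n := by
  refine coef_eq_of_hasSum (a := fun n => coef (sol ε φ) n + c * coef (sol ε φ₂) n)
    (fun τ hτ => ?_) n
  rw [sol_add_smul hε h h₂ c hτ]
  have := (hasSum_coef_sol hε h hτ).add ((hasSum_coef_sol hε h₂ hτ).mul_left c)
  refine (congrArg (HasSum · _) (funext fun n => ?_)).mp this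
  ring

/-- Polynomial bound in `n`, with decay in the parameter, for the coefficients of the solution with
symmetrised exponential data. -/
lemma exists_coef_symExpo_bound (K : ℕ) : ∃ C > 0, ∀ ε : ℂ, (ε = 1 ∨ ε = -1) → ∀ r : ℝ, 0 ≤ r →
    ∀ n : ℕ, ‖coef (sol ε (symExpo ε r)) n‖ ≤ C * (n + 1 : ℝ) ^ (K + 4) / (1 + r) ^ K := by
  obtain ⟨C, hC, h⟩ := exists_sol_symExpo_bound K
  obtain ⟨D, hD, hd⟩ := exists_dataBound_symExpo K
  refine ⟨rexp π * C, by positivity, fun ε hε r hr n => ?_⟩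
  have hn : (0 : ℝ) < n + 1 := by positivity
  have hy : (0 : ℝ) < 1 / (n + 1) := by positivity
  have hy1 : (1 : ℝ) / (n + 1) ≤ 1 := by
    rw [div_le_one hn]; linarith [(Nat.cast_nonneg n : (0 : ℝ) ≤ n)]
  have h1 := norm_coef_le (fun τ hτ => hasSum_coef_sol hε (hd ε hε r hr) hτ) hy
    (fun τ hτ => by
      have := h ε hε r hr τ (hτ ▸ hy) (hτ ▸ hy1)
      rwa [hτ] at this) n
  refine h1.trans ?_
  have h2 : rexp (π * n * (1 / (n + 1))) ≤ rexp π := by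
    rw [Real.exp_le_exp, mul_assoc]
    refine mul_le_of_le_one_right Real.pi_pos.le ?_
    rw [mul_one_div, div_le_one hn]
    linarith
  refine (mul_le_mul_of_nonneg_right h2 (by positivity)).trans (le_of_eq ?_)
  rw [one_div_pow]
  field_simp

end SolCoefficients

section Rows

/-- Cauchy–Schwarz on a dyadic block. -/
lemma sum_block_le {c : ℕ → ℂ} {N : ℕ} (hN : 1 ≤ N) {A : ℝ} (hA : 0 ≤ A)
    (h : ∀ S : Finset ℕ, ∑ n ∈ S, (‖c n‖ * rexp (-(π * n * (1 / N)))) ^ 2 ≤ A ^ 2) (s : ℕ) :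
    ∑ n ∈ Finset.Ico (N - 1) (2 * N - 1), ‖c n‖ / (n + 1 : ℝ) ^ s
      ≤ rexp (2 * π) * (N : ℝ) ^ (1 / 2 : ℝ) * A / (N : ℝ) ^ s := by
  have hN0 : (0 : ℝ) < N := by exact_mod_cast hN
  have h1 : ∑ n ∈ Finset.Ico (N - 1) (2 * N - 1), ‖c n‖ / (n + 1 : ℝ) ^ s
      ≤ (∑ n ∈ Finset.Ico (N - 1) (2 * N - 1), ‖c n‖) / (N : ℝ) ^ s := by
    rw [Finset.sum_div]
    refine Finset.sum_le_sum fun n hn => ?_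
    have : (N : ℝ) ≤ n + 1 := by
      have := (Finset.mem_Ico.mp hn).1
      exact_mod_cast (by omega : N ≤ n + 1)
    gcongr
  refine h1.trans (div_le_div_of_nonneg_right ?_ (by positivity))
  refine abs_le_of_sq_le_sq' ?_ (by positivity) |>.2
  refine sq_sum_le_card_mul_sum_sq.trans ?_
  have h2 : ∑ n ∈ Finset.Ico (N - 1) (2 * N - 1), ‖c n‖ ^ 2 ≤ rexp (2 * π) ^ 2 * A ^ 2 := by
    refine le_trans ?_ (mul_le_mul_of_nonneg_left (h (Finset.Ico (N - 1) (2 * N - 1))) (by positivity))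
    rw [Finset.mul_sum]
    refine Finset.sum_le_sum fun n hn => ?_
    rw [← mul_pow]
    refine pow_le_pow_left₀ (norm_nonneg _) ?_ 2
    rw [mul_left_comm, ← Real.exp_add]
    refine le_mul_of_one_le_right (norm_nonneg _) (Real.one_le_exp ?_)
    have h3 : (n : ℝ) ≤ 2 * N := by
      have := (Finset.mem_Ico.mp hn).2
      exact_mod_cast (by omega : n ≤ 2 * N)
    have h4 : π * n * (1 / N) ≤ 2 * π := by
      rw [mul_one_div, div_le_iff₀ hN0]
      nlinarith [Real.pi_pos]
    linarith
  have h5 : ((N : ℝ) ^ (1 / 2 : ℝ)) ^ 2 = N := by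
    rw [← Real.rpow_natCast, ← Real.rpow_mul hN0.le]; norm_num
  have h6 : ((Finset.Ico (N - 1) (2 * N - 1)).card : ℝ) = N := by
    rw [Nat.card_Ico]
    exact_mod_cast (by omega : 2 * N - 1 - (N - 1) = N)
  rw [h6, mul_pow, mul_pow, h5]
  nlinarith

lemma scale_bound {x m : ℝ} (hx : 0 < x) (hm : 1 ≤ m) {s : ℕ} (hs : 3 ≤ s) :
    x ^ (1 / 2 : ℝ) * (1 / (1 + m * (1 / x)) ^ (2 * s) * (1 / (1 / x) ^ (3 / 4 : ℝ))) / x ^ s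
      ≤ 2 * (m ^ (5 / 4 : ℝ) / m ^ s) * (2 * x / (m + 2 * x) - x / (m + x)) := by
  have hm0 : 0 < m := by linarith
  obtain ⟨t, ht, rfl⟩ : ∃ t : ℝ, 0 < t ∧ x = m * t := ⟨x / m, by positivity, by field_simp⟩
  have e1 : (m * t) ^ (1 / 2 : ℝ) * (1 / (1 / (m * t)) ^ (3 / 4 : ℝ))
      = m ^ (5 / 4 : ℝ) * t ^ (5 / 4 : ℝ) := by
    rw [one_div (m * t), Real.inv_rpow (by positivity), one_div ((m * t) ^ (3 / 4 : ℝ))⁻¹, inv_inv,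
      ← Real.rpow_add (by positivity), Real.mul_rpow hm0.le ht.le]
    norm_num
  have e2 : t ^ (5 / 4 : ℝ) ≤ (1 + t) ^ 2 := by
    calc t ^ (5 / 4 : ℝ) ≤ (1 + t) ^ (5 / 4 : ℝ) := by gcongr; linarith
      _ ≤ (1 + t) ^ (2 : ℝ) := Real.rpow_le_rpow_of_exponent_le (by linarith) (by norm_num)
      _ = (1 + t) ^ 2 := by norm_cast
  have e3 : 2 * (m * t) / (m + 2 * (m * t)) - m * t / (m + m * t)
      = t / ((1 + 2 * t) * (1 + t)) := by
    field_simp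
    ring
  have e4 : 1 / (1 + m * (1 / (m * t))) ^ (2 * s) = (t / (1 + t)) ^ (2 * s) := by
    rw [← one_div_pow]
    congr 1
    field_simp
    ring
  have e5 : (t / (1 + t)) ^ (2 * s) * (1 + t) ^ 2 / t ^ s ≤ 2 * (t / ((1 + 2 * t) * (1 + t))) := by
    obtain ⟨k, rfl⟩ : ∃ k, s = k + 3 := ⟨s - 3, by omega⟩
    have f1 : (t / (1 + t)) ^ (2 * (k + 3)) * (1 + t) ^ 2 / t ^ (k + 3)
        = (t / (1 + t)) ^ (k + 2) * (t / (1 + t) ^ 2) * (1 / (1 + t)) ^ k := by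
      rw [div_pow, div_pow, one_div_pow]
      field_simp
      ring
    rw [f1]
    have f2 : (t / (1 + t)) ^ (k + 2) ≤ 1 :=
      pow_le_one₀ (by positivity) (by rw [div_le_one (by positivity)]; linarith)
    have f3 : (1 / (1 + t)) ^ k ≤ 1 :=
      pow_le_one₀ (by positivity) (by rw [div_le_one (by positivity)]; linarith)
    calc _ ≤ 1 * (t / (1 + t) ^ 2) * 1 := by gcongr
      _ ≤ _ := by
        rw [one_mul, mul_one, ← mul_div_assoc, div_le_div_iff₀ (by positivity) (by positivity)]
        nlinarith [mul_pos ht ht, mul_pos (mul_pos ht ht) ht]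
  rw [e3, e4]
  calc _ = m ^ (5 / 4 : ℝ) / m ^ s * ((t / (1 + t)) ^ (2 * s) * t ^ (5 / 4 : ℝ) / t ^ s) := by
        rw [mul_left_comm, e1, mul_pow m t s]
        field_simp
    _ ≤ m ^ (5 / 4 : ℝ) / m ^ s * ((t / (1 + t)) ^ (2 * s) * (1 + t) ^ 2 / t ^ s) := by gcongr
    _ ≤ m ^ (5 / 4 : ℝ) / m ^ s * (2 * (t / ((1 + 2 * t) * (1 + t)))) := by gcongr
    _ = _ := by ring

lemma exists_row_bound {s : ℕ} (hs : 3 ≤ s) : ∃ C > 0, ∀ ε : ℂ, (ε = 1 ∨ ε = -1) →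
    ∀ m : ℕ, 1 ≤ m → ∀ e : ℝ, |e| ≤ 1 / 2 → ∀ S : Finset ℕ,
      ∑ n ∈ S, ‖coef (sol ε (pert ε m e)) n‖ / (n + 1 : ℝ) ^ s
        ≤ C * |e| * ((m : ℝ) ^ (5 / 4 : ℝ) / (m : ℝ) ^ s) := by
  obtain ⟨C, hC, hb⟩ := exists_sol_pert_bound (2 * s)
  obtain ⟨D, hD, hd⟩ := exists_dataBound_pert (2 * s)
  refine ⟨2 * (rexp (2 * π) * C), by positivity, fun ε hε m hm e he S => ?_⟩
  have hm1 : (1 : ℝ) ≤ m := by exact_mod_cast hm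
  set c := coef (sol ε (pert ε m e)) with hc
  set R : ℝ := 2 * (rexp (2 * π) * C) * |e| * ((m : ℝ) ^ (5 / 4 : ℝ) / (m : ℝ) ^ s) with hR
  have hR0 : 0 ≤ R := by positivity
  have hblock : ∀ N : ℕ, 1 ≤ N → ∑ n ∈ Finset.Ico (N - 1) (2 * N - 1), ‖c n‖ / (n + 1 : ℝ) ^ s
      ≤ R * (2 * N / (m + 2 * N) - N / (m + N)) := by
    intro N hN
    have hN0 : (0 : ℝ) < N := by exact_mod_cast hN
    have hN1 : (1 : ℝ) / N ≤ 1 := by rw [div_le_one hN0]; exact_mod_cast hN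
    have h1 := sum_sq_coef_le (fun τ hτ => hasSum_coef_sol hε (hd ε hε m hm e he) hτ)
      (one_div_pos.mpr hN0) (fun τ hτ => by
        have := hb ε hε m hm e he τ (hτ ▸ one_div_pos.mpr hN0) (hτ ▸ hN1)
        rwa [hτ] at this)
    refine (sum_block_le hN (by positivity) h1 s).trans ?_
    have h2 := mul_le_mul_of_nonneg_left (scale_bound hN0 hm1 hs)
      (by positivity : 0 ≤ rexp (2 * π) * C * |e|)
    calc _ = _ := ?_
      _ ≤ _ := h2
      _ = _ := by rw [hR]; ring
    ring
  have hdyad : ∀ J : ℕ, ∑ n ∈ Finset.Ico 0 (2 ^ J - 1), ‖c n‖ / (n + 1 : ℝ) ^ s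
      ≤ R * ((2 : ℝ) ^ J / (m + 2 ^ J)) := by
    intro J
    induction J with
    | zero => simpa using mul_nonneg hR0 (by positivity)
    | succ J ih =>
      have hJ : 1 ≤ 2 ^ J := Nat.one_le_two_pow
      have h1 := hblock (2 ^ J) hJ
      rw [← Finset.sum_Ico_consecutive _ (Nat.zero_le _)
        (by rw [pow_succ]; omega : 2 ^ J - 1 ≤ 2 ^ (J + 1) - 1), pow_succ', pow_succ']
      push_cast at h1
      linarith
  have hsub : S ⊆ Finset.Ico 0 (2 ^ (S.sup id + 1) - 1) := by
    intro n hn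
    have h1 : n ≤ S.sup id := Finset.le_sup (f := id) hn
    have h2 : S.sup id + 1 < 2 ^ (S.sup id + 1) := Nat.lt_two_pow_self
    rw [Finset.mem_Ico]
    omega
  refine (Finset.sum_le_sum_of_subset_of_nonneg hsub fun n _ _ => by positivity).trans ?_
  refine (hdyad _).trans (mul_le_of_le_one_right hR0 ?_)
  rw [div_le_one (by positivity)]
  linarith

end Rows

section Fourier

variable {f g : ℝ → ℂ}

lemma integrable_fourier_kernel_mul (hf : Integrable f) (ξ : ℝ) :
    Integrable fun x : ℝ => Complex.exp (↑(-2 * π * x * ξ) * I) * f x := by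
  refine hf.bdd_mul (c := 1) (by fun_prop) (.of_forall fun x => ?_)
  rw [Complex.norm_exp_ofReal_mul_I]

lemma fourier_const_mul_apply (c : ℂ) (f : ℝ → ℂ) (ξ : ℝ) :
    𝓕 (fun x => c * f x) ξ = c * 𝓕 f ξ := by
  rw [fourier_real_eq_integral_exp_smul, fourier_real_eq_integral_exp_smul,
    ← integral_const_mul]
  refine integral_congr_ae (.of_forall fun x => ?_)
  simp only [smul_eq_mul]
  ring

lemma fourier_add_mul_apply (hf : Integrable f) (hg : Integrable g) (c : ℂ) (ξ : ℝ) :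
    𝓕 (fun x => f x + c * g x) ξ = 𝓕 f ξ + c * 𝓕 g ξ := by
  rw [← fourier_const_mul_apply, fourier_real_eq_integral_exp_smul,
    fourier_real_eq_integral_exp_smul, fourier_real_eq_integral_exp_smul]
  simp only [smul_eq_mul, mul_add]
  exact integral_add (integrable_fourier_kernel_mul hf ξ)
    (integrable_fourier_kernel_mul (hg.const_mul c) ξ)

end Fourier

section Functional

variable {ε : ℂ} {φ : ℂ → ℂ} {K : ℕ} {B : ℝ}

/-- The data of finite weighted supremum norm. -/
def dataSpace (K : ℕ) : Submodule ℂ (ℂ → ℂ) where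
  carrier := {φ | ∃ B, DataBound φ K B}
  zero_mem' := ⟨0, by simp, by simp⟩
  add_mem' := by
    rintro φ φ₂ ⟨B, h⟩ ⟨B₂, h₂⟩
    exact ⟨_, by simpa [Pi.add_def] using h.add_smul h₂ 1⟩
  smul_mem' := by
    rintro c φ ⟨B, h⟩
    have h0 : DataBound (fun _ => 0) K 0 := ⟨by simp, by simp⟩
    exact ⟨_, by simpa [Pi.smul_def] using h0.add_smul h c⟩

lemma DataBound.continuous_weight (h : DataBound φ K B) :
    Continuous fun z : annulus => (z : ℂ).im ^ K * φ z := by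
  have h1 : ContinuousOn φ annulus := h.diff.continuousOn.mono fun z hz => hz.1
  have h2 : Continuous fun z : annulus => φ z := h1.domRestrict
  have h3 : Continuous fun z : annulus => (((z : ℂ).im : ℝ) : ℂ) := by fun_prop
  exact (h3.pow K).mul h2

lemma DataBound.norm_weight_le (h : DataBound φ K B) (z : annulus) :
    ‖((z : ℂ).im : ℂ) ^ K * φ z‖ ≤ B := by
  rw [norm_mul, norm_pow, Complex.norm_real, Real.norm_of_nonneg z.2.1.le, mul_comm]
  exact h.bound z z.2

/-- Restriction of data to the annulus, weighted by a power of the imaginary part. -/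
noncomputable def weightMap (K : ℕ) : dataSpace K →ₗ[ℂ] (annulus →ᵇ ℂ) where
  toFun φ := BoundedContinuousFunction.ofNormedAddCommGroup
    (fun z : annulus => ((z : ℂ).im : ℂ) ^ K * (φ : ℂ → ℂ) z)
    φ.2.choose_spec.continuous_weight φ.2.choose φ.2.choose_spec.norm_weight_le
  map_add' φ φ₂ := by ext z; simp [mul_add]
  map_smul' c φ := by ext z; simp; ring

/-- The coefficient of the solution as a linear functional of the data. -/
noncomputable def coefMap (hε : ε = 1 ∨ ε = -1) (K n : ℕ) : dataSpace K →ₗ[ℂ] ℂ where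
  toFun φ := coef (sol ε φ) n
  map_add' φ φ₂ := by
    have := coef_sol_add_smul hε φ.2.choose_spec φ₂.2.choose_spec 1 n
    simpa [Pi.add_def] using this
  map_smul' c φ := by
    have h0 : DataBound (fun _ => 0) K 0 := ⟨by simp, by simp⟩
    have h1 := coef_sol_add_smul hε h0 φ.2.choose_spec c n
    obtain ⟨C, hC, h2⟩ := exists_coef_sol_bound K n
    have h3 := h2 ε _ 0 hε h0
    rw [mul_zero, norm_le_zero_iff] at h3
    simpa [Pi.smul_def, h3] using h1

/-- The coefficients of the solution extend to continuous functionals on weighted data. -/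
lemma exists_coef_functional (hε : ε = 1 ∨ ε = -1) (K n : ℕ) :
    ∃ Λ : (annulus →ᵇ ℂ) →L[ℂ] ℂ, ∀ φ : dataSpace K,
      Λ (weightMap K φ) = coef (sol ε φ) n := by
  obtain ⟨C, hC, hb⟩ := exists_coef_sol_bound K n
  have hb' : ∀ φ : dataSpace K, ‖coefMap hε K n φ‖ ≤ C * ‖weightMap K φ‖ := by
    intro φ
    refine hb ε φ _ hε ⟨φ.2.choose_spec.diff, fun z hz => ?_⟩
    have := (weightMap K φ).norm_coe_le_norm ⟨z, hz⟩
    simp only [weightMap, LinearMap.coe_mk, AddHom.coe_mk,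
      BoundedContinuousFunction.coe_ofNormedAddCommGroup] at this
    rwa [norm_mul, norm_pow, Complex.norm_real, Real.norm_of_nonneg hz.1.le, mul_comm] at this
  have hker : LinearMap.ker (weightMap K) ≤ LinearMap.ker (coefMap hε K n) := by
    intro φ hφ
    rw [LinearMap.mem_ker] at hφ ⊢
    have := hb' φ
    rwa [hφ, norm_zero, mul_zero, norm_le_zero_iff] at this
  let g : LinearMap.range (weightMap K) →ₗ[ℂ] ℂ :=
    ((LinearMap.ker (weightMap K)).liftQ (coefMap hε K n) hker).comp
      (weightMap K).quotKerEquivRange.symm.toLinearMap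
  have hg : ∀ φ : dataSpace K, g ⟨weightMap K φ, φ, rfl⟩ = coefMap hε K n φ := by
    intro φ
    have : (weightMap K).quotKerEquivRange.symm ⟨weightMap K φ, φ, rfl⟩
        = (LinearMap.ker (weightMap K)).mkQ φ := by
      rw [LinearEquiv.symm_apply_eq]
      rfl
    change (LinearMap.ker (weightMap K)).liftQ (coefMap hε K n) hker
      ((weightMap K).quotKerEquivRange.symm ⟨weightMap K φ, φ, rfl⟩) = _
    rw [this]
    rfl
  have hgb : ∀ e, ‖g e‖ ≤ C * ‖e‖ := by
    rintro ⟨_, φ, rfl⟩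
    rw [hg]
    exact hb' φ
  obtain ⟨Λ, hΛ, -⟩ := exists_extension_norm_eq (LinearMap.range (weightMap K))
    (g.mkContinuous C hgb)
  exact ⟨Λ, fun φ => (hΛ ⟨weightMap K φ, φ, rfl⟩).trans (hg φ)⟩

end Functional

section Curve

variable {ε : ℂ}

lemma symExpo_mem (hε : ε = 1 ∨ ε = -1) (K : ℕ) (x : ℝ) : symExpo ε (x ^ 2) ∈ dataSpace K := by
  obtain ⟨C, hC, h⟩ := exists_dataBound_symExpo K
  exact ⟨_, h ε hε _ (sq_nonneg x)⟩

/-- The weighted symmetrised Gaussian data, as a curve in the parameter. -/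
noncomputable def symCurve (hε : ε = 1 ∨ ε = -1) (x : ℝ) : annulus →ᵇ ℂ :=
  weightMap 2 ⟨symExpo ε (x ^ 2), symExpo_mem hε 2 x⟩

lemma symCurve_apply (hε : ε = 1 ∨ ε = -1) (x : ℝ) (z : annulus) :
    symCurve hε x z = ((z : ℂ).im : ℂ) ^ 2 * symExpo ε (x ^ 2) z := rfl

lemma norm_expo_sub_param_le {r r' : ℝ} (hr : 0 ≤ r) (hr' : 0 ≤ r') {τ : ℂ} (hτ : 0 ≤ τ.im) :
    ‖expo r τ - expo r' τ‖ ≤ π * ‖τ‖ * |r - r'| := by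
  have := norm_exp_sub_exp_le (a := π * I * r * τ) (b := π * I * r' * τ) (M := 0)
    (by simp; positivity) (by simp; positivity)
  rw [expo, expo]
  refine this.trans_eq ?_
  rw [Real.exp_zero, one_mul, show (π * I * r * τ - π * I * r' * τ : ℂ)
    = π * I * τ * ((r - r' : ℝ) : ℂ) by push_cast; ring, norm_mul, norm_mul, norm_mul,
    Complex.norm_I, Complex.norm_real, Complex.norm_real, Real.norm_of_nonneg Real.pi_pos.le,
    Real.norm_eq_abs, mul_one]

lemma norm_symExpo_sub_le (hε : ε = 1 ∨ ε = -1) {r r' : ℝ} (hr : 0 ≤ r) (hr' : 0 ≤ r') {z : ℂ}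
    (hz : z ∈ annulus) : ‖symExpo ε r z - symExpo ε r' z‖ ≤ 6 * π * |r - r'| := by
  obtain ⟨h0, h1, h2⟩ := hz
  have hz0 : 0 < ‖z‖ := by linarith
  have e1 : ‖expo r z - expo r' z‖ ≤ 3 * π * |r - r'| := by
    refine (norm_expo_sub_param_le hr hr' h0.le).trans ?_
    rw [mul_comm 3 π]
    gcongr
  have e2 : ‖slash (expo r) z - slash (expo r') z‖ ≤ 9 * π * |r - r'| := by
    have e3 : slash (expo r) z - slash (expo r') z = slash (fun z => expo r z - expo r' z) z := by
      rw [slash, slash, slash, sub_div]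
    rw [e3, norm_slash, div_le_iff₀ (by positivity)]
    have h4 : ‖(-1 : ℂ) / z‖ ≤ 3 := by
      rw [norm_div, norm_neg, norm_one, div_le_iff₀ hz0]
      linarith
    have h5 : (1 / 3 : ℝ) ≤ ‖z‖ ^ (1 / 2 : ℝ) := by
      calc (1 / 3 : ℝ) = (1 / 3) ^ (1 : ℝ) := (Real.rpow_one _).symm
        _ ≤ (1 / 3) ^ (1 / 2 : ℝ) :=
          Real.rpow_le_rpow_of_exponent_ge (by norm_num) (by norm_num) (by norm_num)
        _ ≤ _ := by gcongr
    refine (norm_expo_sub_param_le hr hr' (neg_inv_im_pos h0).le).trans ?_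
    calc π * ‖(-1 : ℂ) / z‖ * |r - r'| ≤ π * 3 * |r - r'| := by gcongr
      _ = 9 * π * |r - r'| * (1 / 3) := by ring
      _ ≤ _ := by gcongr
  have e4 : symExpo ε r z - symExpo ε r' z
      = ((expo r z - expo r' z) + ε * (slash (expo r) z - slash (expo r') z)) / 2 := by
    rw [symExpo, symExpo]; ring
  rw [e4, norm_div, Complex.norm_ofNat, div_le_iff₀ two_pos]
  refine (norm_add_le _ _).trans ?_
  rw [norm_mul, norm_eq_one_of_sign hε, one_mul]
  linarith

lemma continuous_symCurve (hε : ε = 1 ∨ ε = -1) : Continuous (symCurve hε) := by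
  rw [continuous_iff_continuousAt]
  intro x
  rw [ContinuousAt, tendsto_iff_dist_tendsto_zero]
  refine squeeze_zero (g := fun y => 9 * (6 * π * |y ^ 2 - x ^ 2|)) (fun y => dist_nonneg)
    (fun y => ?_) ?_
  · refine (BoundedContinuousFunction.dist_le (by positivity)).mpr fun z => ?_
    rw [symCurve_apply, symCurve_apply, dist_eq_norm, ← mul_sub, norm_mul, norm_pow,
      Complex.norm_real, Real.norm_of_nonneg z.2.1.le]
    have h1 : (z : ℂ).im ≤ 3 := (le_abs_self _).trans ((z : ℂ).abs_im_le_norm.trans z.2.2.2)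
    refine mul_le_mul ?_ (norm_symExpo_sub_le hε (sq_nonneg _) (sq_nonneg _) z.2)
      (norm_nonneg _) (by norm_num)
    nlinarith [z.2.1]
  · have : Continuous fun y : ℝ => 9 * (6 * π * |y ^ 2 - x ^ 2|) := by fun_prop
    simpa using this.tendsto x

lemma exists_norm_symCurve_le : ∃ C > 0, ∀ ε : ℂ, ∀ hε : ε = 1 ∨ ε = -1, ∀ x : ℝ,
    ‖symCurve hε x‖ ≤ C / (1 + x ^ 2) ^ 2 := by
  obtain ⟨C, hC, h⟩ := exists_dataBound_symExpo 2
  refine ⟨C, hC, fun ε hε x => (BoundedContinuousFunction.norm_le (by positivity)).mpr fun z => ?_⟩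
  exact (h ε hε _ (sq_nonneg x)).norm_weight_le z

lemma fourier_expo_sq {τ : ℂ} (hτ : 0 < τ.im) (ξ : ℝ) :
    𝓕 (fun x : ℝ => expo (x ^ 2) τ) ξ = slash (expo (ξ ^ 2)) τ := by
  have h := congrFun (fourier_gaussian_pi (b := -I * τ) (by simpa using hτ)) ξ
  have h0 : τ ≠ 0 := fun h0 => by simp [h0] at hτ
  have e1 : (fun x : ℝ => expo (x ^ 2) τ) = fun x : ℝ => Complex.exp (-π * (-I * τ) * x ^ 2) := by
    funext x
    rw [expo]
    congr 1
    push_cast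
    ring
  rw [e1, h, slash, one_div, mul_comm, ← div_eq_mul_inv, expo]
  congr 2
  field_simp
  push_cast
  linear_combination (ξ ^ 2 : ℂ) * Complex.I_sq

lemma fourier_slash_expo_sq {τ : ℂ} (hτ : 0 < τ.im) (ξ : ℝ) :
    𝓕 (fun x : ℝ => slash (expo (x ^ 2)) τ) ξ = expo (ξ ^ 2) τ := by
  have h := fourier_expo_sq (neg_inv_im_pos hτ) ξ
  rw [← slash_slash (expo (ξ ^ 2)) hτ, slash, ← h, fourier_real_eq, fourier_real_eq,
    div_eq_mul_inv, ← integral_mul_const]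
  refine integral_congr_ae (.of_forall fun x => ?_)
  simp only [slash, Circle.smul_def, smul_eq_mul]
  ring

lemma integrable_expo_sq {τ : ℂ} (hτ : 0 < τ.im) : Integrable fun x : ℝ => expo (x ^ 2) τ := by
  have h := integrable_cexp_neg_mul_sq (b := -(π * I) * τ) (by simp; positivity)
  refine h.congr (.of_forall fun x => ?_)
  simp only [expo]
  congr 1
  push_cast
  ring

lemma fourier_symExpo_sq (hε : ε = 1 ∨ ε = -1) {τ : ℂ} (hτ : 0 < τ.im) (ξ : ℝ) :
    𝓕 (fun x : ℝ => symExpo ε (x ^ 2) τ) ξ = ε * symExpo ε (ξ ^ 2) τ := by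
  have i1 := integrable_expo_sq hτ
  have i2 : Integrable fun x : ℝ => slash (expo (x ^ 2)) τ := by
    simpa only [slash] using (integrable_expo_sq (neg_inv_im_pos hτ)).div_const _
  have e1 : (fun x : ℝ => symExpo ε (x ^ 2) τ) = fun x : ℝ =>
      (1 / 2 : ℂ) * (expo (x ^ 2) τ + ε * slash (expo (x ^ 2)) τ) := by
    funext x
    rw [symExpo]
    ring
  rw [e1, fourier_const_mul_apply, fourier_add_mul_apply i1 i2, fourier_expo_sq hτ,
    fourier_slash_expo_sq hτ, symExpo]
  linear_combination (-slash (expo (ξ ^ 2)) τ / 2) * sq_eq_one_of_sign hε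

lemma integrable_symCurve (hε : ε = 1 ∨ ε = -1) : Integrable (symCurve hε) := by
  obtain ⟨C, hC, h⟩ := exists_norm_symCurve_le
  refine (integrable_inv_one_add_sq.const_mul C).mono'
    (continuous_symCurve hε).aestronglyMeasurable (.of_forall fun x => (h ε hε x).trans ?_)
  rw [div_eq_mul_inv]
  gcongr
  nlinarith [sq_nonneg x]

lemma integrable_kernel_smul_symCurve (hε : ε = 1 ∨ ε = -1) (ξ : ℝ) :
    Integrable fun x : ℝ => Complex.exp (↑(-2 * π * x * ξ) * I) • symCurve hε x := by
  refine (integrable_symCurve hε).mono ?_ (.of_forall fun x => ?_)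
  · exact ((by fun_prop : Continuous fun x : ℝ => Complex.exp (↑(-2 * π * x * ξ) * I)).smul
      (continuous_symCurve hε)).aestronglyMeasurable
  · rw [norm_smul, Complex.norm_exp_ofReal_mul_I, one_mul]

lemma integral_symCurve (hε : ε = 1 ∨ ε = -1) (ξ : ℝ) :
    ∫ x : ℝ, Complex.exp (↑(-2 * π * x * ξ) * I) • symCurve hε x = ε • symCurve hε ξ := by
  have hint := integrable_kernel_smul_symCurve hε ξ
  ext z
  have h1 := (BoundedContinuousFunction.evalCLM ℂ z).integral_comp_comm hint
  simp only [BoundedContinuousFunction.evalCLM_apply] at h1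
  rw [← h1]
  have h2 := fourier_symExpo_sq hε z.2.1 ξ
  rw [fourier_real_eq_integral_exp_smul] at h2
  simp only [BoundedContinuousFunction.coe_smul, symCurve_apply, smul_eq_mul] at h2 ⊢
  rw [mul_left_comm, ← h2, ← integral_const_mul]
  refine integral_congr_ae (.of_forall fun x => ?_)
  ring

/-- The interpolation functions at the unperturbed nodes. -/
noncomputable def basisFun (ε : ℂ) (n : ℕ) (x : ℝ) : ℂ := coef (sol ε (symExpo ε (x ^ 2))) n

lemma exists_functional_basisFun (hε : ε = 1 ∨ ε = -1) (n : ℕ) :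
    ∃ Λ : (annulus →ᵇ ℂ) →L[ℂ] ℂ, ∀ x, basisFun ε n x = Λ (symCurve hε x) := by
  obtain ⟨Λ, hΛ⟩ := exists_coef_functional hε 2 n
  exact ⟨Λ, fun x => (hΛ ⟨symExpo ε (x ^ 2), symExpo_mem hε 2 x⟩).symm⟩

lemma continuous_basisFun (hε : ε = 1 ∨ ε = -1) (n : ℕ) : Continuous (basisFun ε n) := by
  obtain ⟨Λ, hΛ⟩ := exists_functional_basisFun hε n
  rw [funext hΛ]
  exact Λ.continuous.comp (continuous_symCurve hε)

lemma fourier_basisFun (hε : ε = 1 ∨ ε = -1) (n : ℕ) (ξ : ℝ) :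
    𝓕 (basisFun ε n) ξ = ε * basisFun ε n ξ := by
  obtain ⟨Λ, hΛ⟩ := exists_functional_basisFun hε n
  have hint := integrable_kernel_smul_symCurve hε ξ
  have h2 := Λ.integral_comp_comm hint
  rw [integral_symCurve, Λ.map_smul] at h2
  rw [hΛ ξ, funext hΛ, fourier_real_eq_integral_exp_smul]
  simpa only [Λ.map_smul, smul_eq_mul] using h2

end Curve

section Contour

/-- The kernel on the unit circle turning `exp (v * z)` into `cos`. -/
noncomputable def cosKernel (w : ℂ) (θ : ℝ) : ℂ :=
  ∑' k : ℕ, (k.factorial / (2 * k).factorial : ℂ) * (w * Complex.exp (-(θ * I))) ^ k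

lemma norm_cosKernel_term_le (w : ℂ) (θ : ℝ) (k : ℕ) :
    ‖(k.factorial / (2 * k).factorial : ℂ) * (w * Complex.exp (-(θ * I))) ^ k‖ ≤
      ‖w‖ ^ k / k.factorial := by
  have h1 : ‖Complex.exp (-(θ * I))‖ = 1 := by
    rw [← neg_mul, ← Complex.ofReal_neg, Complex.norm_exp_ofReal_mul_I]
  have h2 : ((k.factorial * k.factorial : ℕ) : ℝ) ≤ ((2 * k).factorial : ℕ) := by
    exact_mod_cast Nat.le_of_dvd (Nat.factorial_pos _)
      (by simpa [two_mul] using Nat.factorial_mul_factorial_dvd_factorial_add k k)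
  rw [norm_mul, norm_pow, norm_mul, h1, mul_one, norm_div, Complex.norm_natCast,
    Complex.norm_natCast, mul_comm, div_eq_mul_inv, div_eq_mul_inv]
  gcongr
  rw [← div_eq_mul_inv, div_le_iff₀ (by positivity), inv_mul_eq_div, le_div_iff₀ (by positivity)]
  exact_mod_cast h2

lemma summable_norm_pow_div_factorial (w : ℂ) : Summable fun k : ℕ => ‖w‖ ^ k / k.factorial :=
  Real.summable_pow_div_factorial ‖w‖

lemma continuous_cosKernel (w : ℂ) : Continuous (cosKernel w) :=
  continuous_tsum (fun k => by fun_prop) (summable_norm_pow_div_factorial w)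
    (fun k θ => norm_cosKernel_term_le w θ k)

lemma exists_norm_cosKernel_le (w : ℂ) : ∃ C : ℝ, 0 < C ∧ ∀ θ, ‖cosKernel w θ‖ ≤ C := by
  refine ⟨(∑' k : ℕ, ‖w‖ ^ k / k.factorial) + 1, ?_, fun θ => ?_⟩
  · have : 0 ≤ ∑' k : ℕ, ‖w‖ ^ k / k.factorial := tsum_nonneg fun k => by positivity
    positivity
  · exact (tsum_of_norm_bounded (summable_norm_pow_div_factorial w).hasSum
      (norm_cosKernel_term_le w θ)).trans (by linarith)

lemma integral_pow_mul_exp_circle (u v : ℂ) (k : ℕ) :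
    ∫ θ in (0 : ℝ)..2 * π, (u * Complex.exp (-(θ * I))) ^ k * Complex.exp (v * Complex.exp (θ * I))
      = 2 * π * (u * v) ^ k / k.factorial := by
  have h := (Differentiable.diffContOnCl (s := Metric.ball (0 : ℂ) 1)
    (f := fun z : ℂ => Complex.exp (v * z)) (by fun_prop)
    ).circleIntegral_one_div_sub_center_pow_smul one_pos k
  rw [iteratedDeriv_cexp_const_mul] at h
  simp only [circleIntegral, deriv_circleMap, circleMap, sub_zero, smul_eq_mul, zero_add, mul_zero,
    Complex.exp_zero, mul_one, Complex.ofReal_one, one_mul] at h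
  have h2 : ∀ θ : ℝ, (u * Complex.exp (-(θ * I))) ^ k * Complex.exp (v * Complex.exp (θ * I)) =
      (u ^ k / I) * (Complex.exp (θ * I) * I *
        (1 / Complex.exp (θ * I) ^ (k + 1) * Complex.exp (v * Complex.exp (θ * I)))) := by
    intro θ
    rw [mul_pow, Complex.exp_neg, inv_pow]
    have := Complex.exp_ne_zero (θ * I)
    field_simp
    ring
  simp_rw [h2]
  rw [intervalIntegral.integral_const_mul, h, mul_pow]
  field_simp

lemma integral_cosKernel_mul_exp (w : ℂ) (v c : ℂ) (h : w * v = -c ^ 2) :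
    ∫ θ in (0 : ℝ)..2 * π, cosKernel w θ * Complex.exp (v * Complex.exp (θ * I)) =
      2 * π * Complex.cos c := by
  have key := intervalIntegral.hasSum_integral_of_dominated_convergence (a := 0) (b := 2 * π)
    (μ := volume) (F := fun (k : ℕ) (θ : ℝ) => (k.factorial / (2 * k).factorial : ℂ) *
      (w * Complex.exp (-(θ * I))) ^ k * Complex.exp (v * Complex.exp (θ * I)))
    (f := fun θ => cosKernel w θ * Complex.exp (v * Complex.exp (θ * I)))
    (fun k _ => ‖w‖ ^ k / k.factorial * rexp ‖v‖)
    (fun k => (by fun_prop : Continuous _).aestronglyMeasurable)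
    (fun k => Filter.Eventually.of_forall fun θ _ => ?_)
    (Filter.Eventually.of_forall fun θ _ => (summable_norm_pow_div_factorial w).mul_right _)
    (by simp)
    (Filter.Eventually.of_forall fun θ _ => ?_)
  · refine key.unique ?_
    have h3 := (Complex.hasSum_cos c).mul_left (2 * π : ℂ)
    refine (congrArg (HasSum · _) (funext fun k => ?_)).mp h3
    simp_rw [mul_assoc ((k.factorial / (2 * k).factorial : ℂ))]
    rw [intervalIntegral.integral_const_mul, integral_pow_mul_exp_circle, h, neg_pow (c ^ 2),
      ← pow_mul]
    have : (k.factorial : ℂ) ≠ 0 := by exact_mod_cast k.factorial_ne_zero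
    field_simp
  · rw [norm_mul]
    refine mul_le_mul (norm_cosKernel_term_le w θ k) ?_ (norm_nonneg _) (by positivity)
    refine (Complex.norm_exp_le_exp_norm _).trans ?_
    rw [norm_mul, Complex.norm_exp_ofReal_mul_I, mul_one]
  · exact ((Summable.of_norm_bounded (summable_norm_pow_div_factorial w)
      (norm_cosKernel_term_le w θ)).hasSum).mul_right _

end Contour

section Vanishing

/-- A circle in the upper half-plane around `a * I`. -/
noncomputable def circlePoint (a θ : ℝ) : ℂ := I * (a + a / 2 * Complex.exp (θ * I))

variable {a : ℝ}

lemma circlePoint_im (a θ : ℝ) : (circlePoint a θ).im = a + a / 2 * Real.cos θ := by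
  have : (a / 2 : ℂ) = ((a / 2 : ℝ) : ℂ) := by push_cast; rfl
  rw [circlePoint, Complex.I_mul_im, Complex.add_re, Complex.ofReal_re, this,
    Complex.re_ofReal_mul, Complex.exp_ofReal_mul_I_re]

lemma le_circlePoint_im (ha : 0 < a) (θ : ℝ) : a / 2 ≤ (circlePoint a θ).im := by
  rw [circlePoint_im]
  nlinarith [Real.neg_one_le_cos θ]

lemma circlePoint_im_pos (ha : 0 < a) (θ : ℝ) : 0 < (circlePoint a θ).im :=
  (half_pos ha).trans_le (le_circlePoint_im ha θ)

lemma norm_circlePoint_le (ha : 0 < a) (θ : ℝ) : ‖circlePoint a θ‖ ≤ 3 / 2 * a := by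
  have : (a / 2 : ℂ) = ((a / 2 : ℝ) : ℂ) := by push_cast; rfl
  rw [circlePoint, norm_mul, Complex.norm_I, one_mul]
  refine (norm_add_le _ _).trans (le_of_eq ?_)
  rw [norm_mul, Complex.norm_exp_ofReal_mul_I, this, Complex.norm_real, Complex.norm_real,
    Real.norm_of_nonneg ha.le, Real.norm_of_nonneg (by positivity)]
  ring

lemma continuous_circlePoint : Continuous (circlePoint a) := by
  unfold circlePoint
  fun_prop

lemma continuous_symExpo_circlePoint (ε : ℂ) (ha : 0 < a) (r : ℝ) :
    Continuous fun θ => symExpo ε r (circlePoint a θ) :=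
  continuous_iff_continuousAt.mpr fun θ => ContinuousAt.comp (f := circlePoint a)
    (symExpo_differentiableAt ε r (circlePoint_im_pos ha θ)).continuousAt
    continuous_circlePoint.continuousAt

lemma continuous_slash_circlePoint (ha : 0 < a) (r : ℝ) :
    Continuous fun θ => slash (expo r) (circlePoint a θ) :=
  continuous_iff_continuousAt.mpr fun θ => ContinuousAt.comp (f := circlePoint a)
    (slash_differentiableAt (fun τ _ => expo_differentiable r τ)
      (circlePoint_im_pos ha θ)).continuousAt continuous_circlePoint.continuousAt

lemma norm_expo_circlePoint_le (ha : 0 < a) {r : ℝ} (hr : 0 ≤ r) (θ : ℝ) :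
    ‖expo r (circlePoint a θ)‖ ≤ rexp (-(π * r * (a / 2))) := by
  rw [norm_expo]
  gcongr
  exact le_circlePoint_im ha θ

lemma exists_norm_symExpo_circlePoint_le {ε : ℂ} (hε : ε = 1 ∨ ε = -1) (ha : 0 < a) (N : ℕ) :
    ∃ C : ℝ, 0 < C ∧ ∀ r, 0 ≤ r → ∀ θ, ‖symExpo ε r (circlePoint a θ)‖ ≤ C / (1 + r) ^ N := by
  obtain ⟨C₁, hC₁, h1⟩ := exists_pow_mul_exp_le N (c := π * (a / 2)) (by positivity) 1
  obtain ⟨C₂, hC₂, h2⟩ := exists_pow_mul_exp_le N (c := π * (2 / (9 * a))) (by positivity) 1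
  refine ⟨C₁ + C₂ / (a / 2) ^ (1 / 2 : ℝ), by positivity, fun r hr θ => ?_⟩
  have hp := circlePoint_im_pos ha θ
  have hn : a / 2 ≤ ‖circlePoint a θ‖ :=
    (le_circlePoint_im ha θ).trans ((le_abs_self _).trans (Complex.abs_im_le_norm _))
  have hn0 : 0 < ‖circlePoint a θ‖ := (half_pos ha).trans_le hn
  have g1 := norm_expo_circlePoint_le ha hr θ
  have g2 : ‖slash (expo r) (circlePoint a θ)‖ ≤
      rexp (-(π * (2 / (9 * a)) * r)) / (a / 2) ^ (1 / 2 : ℝ) := by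
    rw [norm_slash_expo]
    have : 2 / (9 * a) ≤ (circlePoint a θ).im / ‖circlePoint a θ‖ ^ 2 := by
      calc 2 / (9 * a) = (a / 2) / (3 / 2 * a) ^ 2 := by field_simp; norm_num
        _ ≤ _ := div_le_div₀ hp.le (le_circlePoint_im ha θ) (pow_pos hn0 2)
          (pow_le_pow_left₀ (norm_nonneg _) (norm_circlePoint_le ha θ) 2)
    have h3 : π * (2 / (9 * a)) * r ≤
        π * (r * ((circlePoint a θ).im / ‖circlePoint a θ‖ ^ 2)) := by
      rw [mul_assoc, mul_comm _ r]
      gcongr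
    refine div_le_div₀ (by positivity) (Real.exp_le_exp.mpr ?_) (by positivity)
      (Real.rpow_le_rpow (by positivity) hn (by norm_num))
    linarith
  have hs : ‖symExpo ε r (circlePoint a θ)‖ ≤
      rexp (-(π * (a / 2) * r)) + rexp (-(π * (2 / (9 * a)) * r)) / (a / 2) ^ (1 / 2 : ℝ) := by
    rw [symExpo, norm_div, Complex.norm_ofNat]
    have h3 := norm_add_le (expo r (circlePoint a θ)) (ε * slash (expo r) (circlePoint a θ))
    rw [norm_mul, norm_eq_one_of_sign hε, one_mul] at h3
    have : π * r * (a / 2) = π * (a / 2) * r := by ring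
    rw [this] at g1
    have := norm_nonneg (expo r (circlePoint a θ) + ε * slash (expo r) (circlePoint a θ))
    linarith
  rw [le_div_iff₀ (by positivity), mul_comm]
  refine (mul_le_mul_of_nonneg_left hs (by positivity)).trans ?_
  rw [mul_add, ← mul_div_assoc ((1 + r) ^ N)]
  exact add_le_add (h1 r (by positivity))
    (div_le_div_of_nonneg_right (h2 r (by positivity)) (by positivity))

/-- A cosine times a Gaussian, symmetrized under the Fourier transform. -/
noncomputable def symCos (ε : ℂ) (a s y : ℝ) : ℂ :=
  Complex.cos (2 * π * s * y) * Complex.exp (-π * a * y ^ 2) +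
    ε * (1 / 2 * (1 / (a : ℂ) ^ (1 / 2 : ℂ) * Complex.exp (-π / a * (y - s) ^ 2) +
      1 / (a : ℂ) ^ (1 / 2 : ℂ) * Complex.exp (-π / a * (y + s) ^ 2)))

lemma integral_cosKernel_mul_expo (ha : 0 < a) (s y : ℝ) :
    ∫ θ in (0 : ℝ)..2 * π, cosKernel (8 * π * s ^ 2 / a) θ * expo (y ^ 2) (circlePoint a θ) =
      2 * π * (Complex.cos (2 * π * s * y) * Complex.exp (-π * a * y ^ 2)) := by
  have ha0 : (a : ℂ) ≠ 0 := by exact_mod_cast ha.ne'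
  have h := integral_cosKernel_mul_exp (8 * π * s ^ 2 / a) (-π * (a / 2) * y ^ 2)
    (2 * π * s * y) (by field_simp; ring)
  rw [← mul_assoc, ← h, ← intervalIntegral.integral_mul_const]
  refine intervalIntegral.integral_congr fun θ _ => ?_
  simp only [mul_assoc]
  rw [← Complex.exp_add, expo, circlePoint]
  congr 2
  push_cast
  linear_combination (π * y ^ 2 * (a + a / 2 * Complex.exp (θ * I))) * Complex.I_sq

lemma fourier_cos_mul_gaussian (ha : 0 < a) (s y : ℝ) :
    𝓕 (fun x : ℝ => Complex.cos (2 * π * s * x) * Complex.exp (-π * a * x ^ 2)) y =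
      1 / 2 * (1 / (a : ℂ) ^ (1 / 2 : ℂ) * Complex.exp (-π / a * (y - s) ^ 2) +
        1 / (a : ℂ) ^ (1 / 2 : ℂ) * Complex.exp (-π / a * (y + s) ^ 2)) := by
  have h (c : ℂ) := congrFun (fourier_gaussian_pi' (b := (a : ℂ)) (by simpa using ha) c) y
  have hi (c : ℂ) : Integrable fun x : ℝ =>
      Complex.exp (-π * a * x ^ 2 + 2 * π * c * x) := by
    have := integrable_cexp_quadratic' (b := -π * a) (by simp; positivity) (2 * π * c) 0
    simpa using this
  have e1 : (fun x : ℝ => Complex.cos (2 * π * s * x) * Complex.exp (-π * a * x ^ 2)) =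
      fun x : ℝ => (1 / 2 : ℂ) * (Complex.exp (-π * a * x ^ 2 + 2 * π * (I * s) * x) +
        1 * Complex.exp (-π * a * x ^ 2 + 2 * π * (-(I * s)) * x)) := by
    funext x
    rw [Complex.exp_add, Complex.exp_add, Complex.cos]
    have e2 : 2 * π * s * x * I = 2 * π * (I * s) * x := by ring
    have e3 : -(2 * π * s * x) * I = 2 * π * (-(I * s)) * x := by ring
    rw [e2, e3]
    ring
  rw [e1, fourier_const_mul_apply, fourier_add_mul_apply (hi _) (hi _), h, h, one_mul]
  have e2 : (y + I * (I * s) : ℂ) = y - s := by linear_combination s * Complex.I_sq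
  have e3 : (y + I * -(I * s) : ℂ) = y + s := by linear_combination -s * Complex.I_sq
  rw [e2, e3]

lemma integral_cosKernel_mul_slash (ha : 0 < a) (s y : ℝ) :
    ∫ θ in (0 : ℝ)..2 * π,
      cosKernel (8 * π * s ^ 2 / a) θ * slash (expo (y ^ 2)) (circlePoint a θ) =
      2 * π * (1 / 2 * (1 / (a : ℂ) ^ (1 / 2 : ℂ) * Complex.exp (-π / a * (y - s) ^ 2) +
        1 / (a : ℂ) ^ (1 / 2 : ℂ) * Complex.exp (-π / a * (y + s) ^ 2))) := by
  obtain ⟨C, hC, hb⟩ := exists_norm_cosKernel_le (8 * π * s ^ 2 / a)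
  have hk := continuous_cosKernel (8 * π * s ^ 2 / a)
  set κ := cosKernel (8 * π * s ^ 2 / a) with hκ
  have hint : Integrable (Function.uncurry fun θ x : ℝ =>
      Complex.exp (((-2 * π * x * y : ℝ) : ℂ) * I) * (κ θ * expo (x ^ 2) (circlePoint a θ)))
      ((volume.restrict (Set.uIoc 0 (2 * π))).prod volume) := by
    have : IsFiniteMeasure (volume.restrict (Set.uIoc 0 (2 * π))) := ⟨by simp [Set.uIoc]⟩
    have hg := (integrable_exp_neg_mul_sq (b := π * (a / 2)) (by positivity)).const_mul C
    refine (hg.comp_snd (volume.restrict (Set.uIoc 0 (2 * π)))).mono' ?_ (.of_forall fun p => ?_)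
    · refine Continuous.aestronglyMeasurable ?_
      simp only [Function.uncurry_def, expo]
      have := continuous_circlePoint (a := a)
      fun_prop
    · simp only [Function.uncurry_def]
      rw [norm_mul, Complex.norm_exp_ofReal_mul_I, one_mul, norm_mul]
      have h1 := norm_expo_circlePoint_le ha (sq_nonneg p.2) p.1
      have e1 : -(π * p.2 ^ 2 * (a / 2)) = -(π * (a / 2)) * p.2 ^ 2 := by ring
      rw [e1] at h1
      exact mul_le_mul (hb _) h1 (norm_nonneg _) hC.le
  rw [← fourier_cos_mul_gaussian ha, ← fourier_const_mul_apply, fourier_real_eq_integral_exp_smul]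
  simp_rw [smul_eq_mul, ← integral_cosKernel_mul_expo ha s, ← hκ,
    ← intervalIntegral.integral_const_mul]
  rw [← intervalIntegral_integral_swap hint]
  refine intervalIntegral.integral_congr fun θ _ => ?_
  rw [← fourier_expo_sq (circlePoint_im_pos ha θ), ← fourier_const_mul_apply,
    fourier_real_eq_integral_exp_smul]
  rfl

lemma integral_cosKernel_mul_symExpo (ε : ℂ) (ha : 0 < a) (s y : ℝ) :
    ∫ θ in (0 : ℝ)..2 * π, cosKernel (8 * π * s ^ 2 / a) θ * symExpo ε (y ^ 2) (circlePoint a θ) =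
      π * symCos ε a s y := by
  have hk := continuous_cosKernel (8 * π * s ^ 2 / a)
  have h1 := integral_cosKernel_mul_expo ha s y
  have h2 := integral_cosKernel_mul_slash ha s y
  have e : ∀ θ, cosKernel (8 * π * s ^ 2 / a) θ * symExpo ε (y ^ 2) (circlePoint a θ) =
      (1 / 2 : ℂ) * (cosKernel (8 * π * s ^ 2 / a) θ * expo (y ^ 2) (circlePoint a θ)) +
      (ε / 2) * (cosKernel (8 * π * s ^ 2 / a) θ * slash (expo (y ^ 2)) (circlePoint a θ)) := by
    intro θ
    rw [symExpo]
    ring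
  simp_rw [e]
  have c1 : Continuous fun θ => expo (y ^ 2) (circlePoint a θ) :=
    (expo_differentiable (y ^ 2)).continuous.comp continuous_circlePoint
  have c2 := continuous_slash_circlePoint ha (y ^ 2)
  rw [intervalIntegral.integral_add, intervalIntegral.integral_const_mul,
    intervalIntegral.integral_const_mul, h1, h2, symCos]
  · ring
  · exact (continuous_const.mul (hk.mul c1)).intervalIntegrable _ _
  · exact (continuous_const.mul (hk.mul c2)).intervalIntegrable _ _

/-- A linear functional that kills every symmetrized Gaussian kills `symCos`. -/
lemma hasSum_symCos {ε : ℂ} (hε : ε = 1 ∨ ε = -1) (ha : 0 < a) {d : ℕ → ℂ} {y : ℕ → ℝ} {N : ℕ}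
    (hd : Summable fun n => ‖d n‖ / (1 + y n ^ 2) ^ N)
    (h : ∀ τ : ℂ, 0 < τ.im → HasSum (fun n => d n * symExpo ε (y n ^ 2) τ) 0) (s : ℝ) :
    HasSum (fun n => d n * symCos ε a s (y n)) 0 := by
  obtain ⟨C, hC, hb⟩ := exists_norm_cosKernel_le (8 * π * s ^ 2 / a)
  obtain ⟨D, hD, hs⟩ := exists_norm_symExpo_circlePoint_le hε ha N
  have key := intervalIntegral.hasSum_integral_of_dominated_convergence (a := 0) (b := 2 * π)
    (μ := volume) (F := fun (n : ℕ) (θ : ℝ) => d n *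
      (cosKernel (8 * π * s ^ 2 / a) θ * symExpo ε (y n ^ 2) (circlePoint a θ)))
    (f := fun θ => 0) (fun n _ => C * D * (‖d n‖ / (1 + y n ^ 2) ^ N))
    (fun n => (continuous_const.mul ((continuous_cosKernel _).mul
      (continuous_symExpo_circlePoint ε ha _))).aestronglyMeasurable)
    (fun n => .of_forall fun θ _ => ?_) (.of_forall fun θ _ => hd.mul_left _) (by simp)
    (.of_forall fun θ _ => ?_)
  · have h3 := key.mul_left (π : ℂ)⁻¹
    simp only [intervalIntegral.integral_const_mul, integral_cosKernel_mul_symExpo ε ha,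
      intervalIntegral.integral_zero, mul_zero] at h3
    have hpi : (π : ℂ) ≠ 0 := by exact_mod_cast Real.pi_ne_zero
    refine (congrArg (HasSum · _) (funext fun n => ?_)).mp h3
    field_simp
  · rw [norm_mul, norm_mul]
    calc _ ≤ ‖d n‖ * (C * (D / (1 + y n ^ 2) ^ N)) := by
          gcongr
          · exact hb θ
          · exact hs _ (sq_nonneg _) θ
      _ = _ := by ring
  · have h3 := (h _ (circlePoint_im_pos ha θ)).mul_left (cosKernel (8 * π * s ^ 2 / a) θ)
    rw [mul_zero] at h3
    refine (congrArg (HasSum · _) (funext fun n => ?_)).mp h3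
    ring

end Vanishing

section Density

variable {a : ℝ} {ε : ℂ}

lemma exists_norm_schwartz_le (f : SchwartzMap ℝ ℂ) (N : ℕ) :
    ∃ C : ℝ, 0 < C ∧ ∀ x, ‖f x‖ ≤ C / (1 + x ^ 2) ^ N := by
  obtain ⟨C, hC⟩ : ∃ C : ℝ, ∀ x, (1 + ‖x‖) ^ (2 * N) * ‖f x‖ ≤ C := by
    have h := fun x : ℝ => SchwartzMap.one_add_le_sup_seminorm_apply (𝕜 := ℂ)
      (m := (2 * N, 0)) (k := 2 * N) (n := 0) le_rfl le_rfl f x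
    simp only [norm_iteratedFDeriv_zero] at h
    exact ⟨_, h⟩
  refine ⟨|C| + 1, by positivity, fun x => ?_⟩
  rw [le_div_iff₀ (by positivity), mul_comm]
  calc (1 + x ^ 2) ^ N * ‖f x‖ ≤ ((1 + ‖x‖) ^ 2) ^ N * ‖f x‖ := by
        gcongr
        rw [Real.norm_eq_abs, ← sq_abs]
        nlinarith [abs_nonneg x]
    _ ≤ C := by rw [← pow_mul]; exact hC x
    _ ≤ |C| + 1 := by linarith [le_abs_self C]

lemma one_add_sq_add_le (s t : ℝ) : 1 + (s + t) ^ 2 ≤ 2 * ((1 + s ^ 2) * (1 + t ^ 2)) := by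
  nlinarith [sq_nonneg (s - t), sq_nonneg (s * t), sq_nonneg (s * t - 1)]

lemma ofReal_cpow_half (ha : 0 < a) : (a : ℂ) ^ (1 / 2 : ℂ) = (√a : ℂ) := by
  rw [Real.sqrt_eq_rpow, Complex.ofReal_cpow ha.le]
  norm_num

lemma norm_gaussian_div (ha : 0 < a) (u : ℝ) :
    ‖1 / (a : ℂ) ^ (1 / 2 : ℂ) * Complex.exp (-π / a * u ^ 2)‖ =
      1 / √a * rexp (-(π / a * u ^ 2)) := by
  have e1 : (-π / a * u ^ 2 : ℂ) = ((-(π / a * u ^ 2) : ℝ) : ℂ) := by push_cast; ring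
  rw [ofReal_cpow_half ha, e1, ← Complex.ofReal_exp, norm_mul, norm_div, norm_one,
    Complex.norm_real, Complex.norm_real, Real.norm_of_nonneg (by positivity),
    Real.norm_of_nonneg (by positivity)]

lemma norm_exp_neg_pi_mul_sq (a u : ℝ) : ‖Complex.exp (-π * a * u ^ 2)‖ = rexp (-(π * a * u ^ 2)) := by
  have e1 : (-π * a * u ^ 2 : ℂ) = ((-(π * a * u ^ 2) : ℝ) : ℂ) := by push_cast; ring
  rw [e1, ← Complex.ofReal_exp, Complex.norm_real, Real.norm_of_nonneg (by positivity)]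

lemma exists_exp_neg_mul_sq_le {c : ℝ} (hc : 0 < c) (N : ℕ) :
    ∃ C : ℝ, 0 < C ∧ ∀ u : ℝ, rexp (-(c * u ^ 2)) ≤ C / (1 + u ^ 2) ^ N := by
  obtain ⟨C, hC, h⟩ := exists_pow_mul_exp_le N hc 1
  refine ⟨C, hC, fun u => ?_⟩
  rw [le_div_iff₀ (by positivity), mul_comm]
  exact h _ (by positivity)

lemma norm_cos_le_one (x : ℝ) : ‖Complex.cos x‖ ≤ 1 := by
  rw [← Complex.ofReal_cos, Complex.norm_real]
  exact Real.abs_cos_le_one x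

lemma div_one_add_sq_sub_le {C : ℝ} (hC : 0 ≤ C) (N : ℕ) (s t : ℝ) :
    C / (1 + t ^ 2) ^ N ≤ 2 ^ N * C * (1 + s ^ 2) ^ N / (1 + (s + t) ^ 2) ^ N := by
  rw [div_le_div_iff₀ (by positivity) (by positivity)]
  calc C * (1 + (s + t) ^ 2) ^ N ≤ C * (2 * ((1 + s ^ 2) * (1 + t ^ 2))) ^ N := by
        gcongr
        exact one_add_sq_add_le s t
    _ = _ := by rw [mul_pow, mul_pow]; ring

lemma exists_norm_symCos_le (hε : ε = 1 ∨ ε = -1) (ha : 0 < a) (N : ℕ) :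
    ∃ C : ℝ, 0 < C ∧ ∀ s y, ‖symCos ε a s y‖ ≤ C * (1 + s ^ 2) ^ N / (1 + y ^ 2) ^ N := by
  obtain ⟨C₁, hC₁, h1⟩ := exists_exp_neg_mul_sq_le (c := π * a) (by positivity) N
  obtain ⟨C₂, hC₂, h2⟩ := exists_exp_neg_mul_sq_le (c := π / a) (by positivity) N
  refine ⟨C₁ + 1 / √a * (2 ^ N * C₂), by positivity, fun s y => ?_⟩
  have g1 : ‖Complex.cos (2 * π * s * y) * Complex.exp (-π * a * y ^ 2)‖ ≤
      C₁ * (1 + s ^ 2) ^ N / (1 + y ^ 2) ^ N := by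
    have h3 := norm_cos_le_one (2 * π * s * y)
    push_cast at h3
    rw [norm_mul, norm_exp_neg_pi_mul_sq]
    calc _ ≤ 1 * (C₁ * 1 / (1 + y ^ 2) ^ N) := by
          rw [mul_one]
          gcongr
          exact h1 y
      _ ≤ _ := by
          rw [one_mul]
          gcongr
          exact one_le_pow₀ (by nlinarith [sq_nonneg s])
  have g2 (s : ℝ) : ‖1 / (a : ℂ) ^ (1 / 2 : ℂ) * Complex.exp (-π / a * (y - s) ^ 2)‖ ≤
      1 / √a * (2 ^ N * C₂ * (1 + s ^ 2) ^ N / (1 + y ^ 2) ^ N) := by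
    have h3 := norm_gaussian_div ha (y - s)
    push_cast at h3
    rw [h3]
    have h4 := div_one_add_sq_sub_le hC₂.le N s (y - s)
    rw [add_sub_cancel] at h4
    gcongr
    exact (h2 _).trans h4
  have g3 := g2 (-s)
  rw [Complex.ofReal_neg, sub_neg_eq_add, neg_sq] at g3
  have g4 := norm_add_le (1 / (a : ℂ) ^ (1 / 2 : ℂ) * Complex.exp (-π / a * (y - s) ^ 2))
    (1 / (a : ℂ) ^ (1 / 2 : ℂ) * Complex.exp (-π / a * (y + s) ^ 2))
  rw [symCos]
  refine (norm_add_le _ _).trans ?_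
  rw [norm_mul ε, norm_eq_one_of_sign hε, one_mul, norm_mul (1 / 2 : ℂ)]
  have e : ‖(1 / 2 : ℂ)‖ = 1 / 2 := by norm_num
  have e2 : (C₁ + 1 / √a * (2 ^ N * C₂)) * (1 + s ^ 2) ^ N / (1 + y ^ 2) ^ N =
      C₁ * (1 + s ^ 2) ^ N / (1 + y ^ 2) ^ N +
        1 / √a * (2 ^ N * C₂ * (1 + s ^ 2) ^ N / (1 + y ^ 2) ^ N) := by ring
  rw [e, e2]
  linarith [g2 s]

lemma continuous_symCos (ε : ℂ) (a y : ℝ) : Continuous fun s => symCos ε a s y := by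
  unfold symCos
  fun_prop

lemma integral_mul_gaussian_sub (ha : 0 < a) (f : ℝ → ℂ) (y : ℝ) :
    ∫ s, f s * (1 / (a : ℂ) ^ (1 / 2 : ℂ) * Complex.exp (-π / a * (y - s) ^ 2)) =
      ∫ t, f (y - √a * t) * rexp (-(π * t ^ 2)) := by
  have hs : 0 < √a := Real.sqrt_pos.mpr ha
  set G : ℝ → ℂ := fun u => f (y - u) * (1 / (a : ℂ) ^ (1 / 2 : ℂ) *
    Complex.exp (-π / a * u ^ 2)) with hG
  have h1 := integral_sub_left_eq_self G volume y
  have h2 := Measure.integral_comp_mul_left G √a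
  rw [← h1, abs_of_pos (inv_pos.mpr hs), eq_inv_smul_iff₀ hs.ne', ← integral_smul] at h2
  simp only [hG, sub_sub_cancel, Complex.ofReal_sub, Complex.real_smul] at h2
  rw [← h2]
  refine integral_congr_ae (.of_forall fun t => ?_)
  have hc : (√a : ℂ) ≠ 0 := by exact_mod_cast hs.ne'
  have hsq : (√a : ℂ) ^ 2 = a := by exact_mod_cast Real.sq_sqrt ha.le
  have hac : (a : ℂ) ≠ 0 := by exact_mod_cast ha.ne'
  simp only
  rw [ofReal_cpow_half ha]
  push_cast
  have e : (-π / a * (√a * t) ^ 2 : ℂ) = -(π * t ^ 2) := by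
    rw [mul_pow, hsq]
    field_simp
  rw [e]
  field_simp

lemma integral_mul_cos (f : SchwartzMap ℝ ℂ) (hf : ∀ x, f (-x) = f x) (y : ℝ) :
    ∫ s, f s * Complex.cos (2 * π * s * y) = 𝓕 (⇑f) y := by
  have hi (y : ℝ) : Integrable fun s : ℝ => Complex.exp (((-2 * π * s * y : ℝ) : ℂ) * I) • f s :=
    f.integrable.bdd_mul (c := 1) (by fun_prop : Continuous _).aestronglyMeasurable
      (.of_forall fun s => by rw [Complex.norm_exp_ofReal_mul_I])
  have h1 : 𝓕 (⇑f) (-y) = 𝓕 (⇑f) y := by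
    rw [fourier_real_eq_integral_exp_smul, fourier_real_eq_integral_exp_smul,
      ← integral_neg_eq_self]
    simp only [hf, mul_neg, neg_mul, neg_neg]
  have h2 : (∫ s, f s * Complex.cos (2 * π * s * y)) = (1 / 2 : ℂ) * (𝓕 (⇑f) y + 𝓕 (⇑f) (-y)) := by
    rw [fourier_real_eq_integral_exp_smul, fourier_real_eq_integral_exp_smul,
      ← integral_add (hi y) (hi (-y)), ← integral_const_mul]
    refine integral_congr_ae (.of_forall fun s => ?_)
    simp only [Complex.cos, smul_eq_mul]
    push_cast
    have e1 : 2 * π * s * y * I = -2 * π * s * -y * I := by ring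
    have e2 : -(2 * π * s * y) * I = -2 * π * s * y * I := by ring
    rw [e1, e2]
    ring
  rw [h2, h1]
  ring

lemma integral_mul_symCos (ε : ℂ) (ha : 0 < a) (f : SchwartzMap ℝ ℂ) (hf : ∀ x, f (-x) = f x)
    (y : ℝ) : ∫ s, f s * symCos ε a s y = 𝓕 (⇑f) y * rexp (-(π * a * y ^ 2)) +
      ε * ∫ t, f (y - √a * t) * rexp (-(π * t ^ 2)) := by
  have hi (s₀ : ℝ → ℝ) (hs : Continuous s₀) : Integrable fun s : ℝ =>
      f s * (1 / (a : ℂ) ^ (1 / 2 : ℂ) * Complex.exp (-π / a * (s₀ s) ^ 2)) := by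
    refine f.integrable.mul_bdd (c := 1 / √a) (by fun_prop : Continuous _).aestronglyMeasurable
      (.of_forall fun s => ?_)
    rw [norm_gaussian_div ha]
    exact mul_le_of_le_one_right (by positivity)
      (Real.exp_le_one_iff.mpr (by have := ha.le; simp only [Left.neg_nonpos_iff]; positivity))
  have hi1 := hi (fun s => y - s) (by fun_prop)
  have hi2 := hi (fun s => y + s) (by fun_prop)
  push_cast at hi1 hi2
  have hi3 : Integrable fun s : ℝ => f s * Complex.cos (2 * π * s * y) := by
    refine f.integrable.mul_bdd (c := 1) (by fun_prop : Continuous _).aestronglyMeasurable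
      (.of_forall fun s => ?_)
    have h3 := norm_cos_le_one (2 * π * s * y)
    push_cast at h3
    exact h3
  have e2 : ∫ s, f s * (1 / (a : ℂ) ^ (1 / 2 : ℂ) * Complex.exp (-π / a * (y + s) ^ 2)) =
      ∫ s, f s * (1 / (a : ℂ) ^ (1 / 2 : ℂ) * Complex.exp (-π / a * (y - s) ^ 2)) := by
    rw [← integral_neg_eq_self]
    simp only [hf, Complex.ofReal_neg, ← sub_eq_add_neg]
  have e3 : ∀ s, f s * symCos ε a s y =
      f s * Complex.cos (2 * π * s * y) * Complex.exp (-π * a * y ^ 2) +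
      (ε / 2 * (f s * (1 / (a : ℂ) ^ (1 / 2 : ℂ) * Complex.exp (-π / a * (y - s) ^ 2))) +
      ε / 2 * (f s * (1 / (a : ℂ) ^ (1 / 2 : ℂ) * Complex.exp (-π / a * (y + s) ^ 2)))) := by
    intro s
    rw [symCos]
    ring
  simp_rw [e3]
  have hi4 : Integrable fun s : ℝ =>
      ε / 2 * (f s * (1 / (a : ℂ) ^ (1 / 2 : ℂ) * Complex.exp (-π / a * (y - s) ^ 2))) +
      ε / 2 * (f s * (1 / (a : ℂ) ^ (1 / 2 : ℂ) * Complex.exp (-π / a * (y + s) ^ 2))) :=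
    (hi1.const_mul _).add (hi2.const_mul _)
  rw [integral_add (hi3.mul_const _) hi4,
    integral_add (hi1.const_mul _) (hi2.const_mul _), integral_mul_const, integral_const_mul,
    integral_const_mul, e2, integral_mul_gaussian_sub ha, integral_mul_cos f hf]
  push_cast
  have e4 : (-(π * a * y ^ 2) : ℂ) = -π * a * y ^ 2 := by ring
  rw [e4]
  ring

variable {d : ℕ → ℂ} {y : ℕ → ℝ} {N : ℕ}

lemma hasSum_integral_symCos (hε : ε = 1 ∨ ε = -1) (ha : 0 < a)
    (hd : Summable fun n => ‖d n‖ / (1 + y n ^ 2) ^ N)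
    (h : ∀ τ : ℂ, 0 < τ.im → HasSum (fun n => d n * symExpo ε (y n ^ 2) τ) 0)
    (f : SchwartzMap ℝ ℂ) : HasSum (fun n => d n * ∫ s, f s * symCos ε a s (y n)) 0 := by
  obtain ⟨C, hC, hb⟩ := exists_norm_symCos_le hε ha N
  obtain ⟨D, hD, hf⟩ := exists_norm_schwartz_le f (N + 1)
  have key := hasSum_integral_of_dominated_convergence (μ := volume)
    (F := fun (n : ℕ) (s : ℝ) => d n * (f s * symCos ε a s (y n))) (f := fun _ => 0)
    (fun n s => ‖d n‖ / (1 + y n ^ 2) ^ N * (C * D * (1 + s ^ 2)⁻¹))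
    (fun n => (continuous_const.mul (f.continuous.mul
      (continuous_symCos ε a (y n)))).aestronglyMeasurable)
    (fun n => .of_forall fun s => ?_) (.of_forall fun s => hd.mul_right _) ?_
    (.of_forall fun s => ?_)
  · simpa only [integral_const_mul, integral_zero] using key
  · rw [norm_mul, norm_mul]
    calc _ ≤ ‖d n‖ * (D / (1 + s ^ 2) ^ (N + 1) * (C * (1 + s ^ 2) ^ N / (1 + y n ^ 2) ^ N)) := by
          gcongr
          · exact hf s
          · exact hb s _
      _ = _ := by rw [pow_succ (1 + _)]; field_simp
  · simp_rw [tsum_mul_right]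
    exact (integrable_inv_one_add_sq.const_mul _).const_mul _
  · have h3 := (hasSum_symCos hε ha hd h s).mul_left (f s)
    rw [mul_zero] at h3
    refine (congrArg (HasSum · _) (funext fun n => ?_)).mp h3
    ring

lemma integral_exp_neg_pi_mul_sq : ∫ t : ℝ, (rexp (-(π * t ^ 2)) : ℂ) = 1 := by
  have h := integral_gaussian π
  rw [div_self Real.pi_ne_zero, Real.sqrt_one] at h
  simp only [neg_mul] at h
  rw [integral_complex_ofReal, h, Complex.ofReal_one]

/-- A linear functional of polynomial growth killing every symmetrized Gaussian kills the
symmetrization of every even Schwartz function. -/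
theorem hasSum_schwartz_of_symExpo (hε : ε = 1 ∨ ε = -1)
    (hd : Summable fun n => ‖d n‖ / (1 + y n ^ 2) ^ N)
    (h : ∀ τ : ℂ, 0 < τ.im → HasSum (fun n => d n * symExpo ε (y n ^ 2) τ) 0)
    (f : SchwartzMap ℝ ℂ) (hf : ∀ x, f (-x) = f x) :
    HasSum (fun n => d n * (𝓕 (⇑f) (y n) + ε * f (y n))) 0 := by
  obtain ⟨D, hD, hb⟩ := exists_norm_schwartz_le f N
  obtain ⟨D', hD', hb'⟩ := exists_norm_schwartz_le (𝓕 f) N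
  rw [SchwartzMap.fourier_coe] at hb'
  obtain ⟨C, hC, hexp⟩ := exists_exp_neg_mul_sq_le Real.pi_pos (N + 1)
  have hpt : ∀ a : ℝ, 0 < a → a ≤ 1 → ∀ x t : ℝ, ‖f (x - √a * t) * (rexp (-(π * t ^ 2)) : ℂ)‖ ≤
      2 ^ N * D * C / (1 + x ^ 2) ^ N * (1 + t ^ 2)⁻¹ := by
    intro a ha ha1 x t
    have h1 := (hb (x - √a * t)).trans (div_one_add_sq_sub_le hD.le N (√a * t) (x - √a * t))
    rw [add_sub_cancel, mul_pow, Real.sq_sqrt ha.le] at h1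
    rw [norm_mul, Complex.norm_real, Real.norm_of_nonneg (Real.exp_pos _).le]
    calc _ ≤ 2 ^ N * D * (1 + t ^ 2) ^ N / (1 + x ^ 2) ^ N * (C / (1 + t ^ 2) ^ (N + 1)) := by
          refine mul_le_mul (h1.trans ?_) (hexp t) (Real.exp_pos _).le (by positivity)
          gcongr
          nlinarith [sq_nonneg t]
      _ = _ := by rw [pow_succ (1 + _)]; field_simp
  set I₁ : ℝ := ∫ t : ℝ, (1 + t ^ 2)⁻¹
  have hint : ∀ a : ℝ, 0 < a → a ≤ 1 → ∀ x : ℝ,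
      ‖∫ t, f (x - √a * t) * (rexp (-(π * t ^ 2)) : ℂ)‖ ≤ 2 ^ N * D * C * I₁ / (1 + x ^ 2) ^ N := by
    intro a ha ha1 x
    refine (norm_integral_le_of_norm_le (integrable_inv_one_add_sq.const_mul _)
      (.of_forall (hpt a ha ha1 x))).trans (le_of_eq ?_)
    rw [integral_const_mul]
    ring
  have hsmall : ∀ᶠ a : ℝ in nhdsWithin 0 (Set.Ioi 0), 0 < a ∧ a ≤ 1 := by
    filter_upwards [Ioc_mem_nhdsGT one_pos] with a ha using ha
  have hlim : Filter.Tendsto (fun a : ℝ => ∑' n, d n * (𝓕 (⇑f) (y n) *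
      (rexp (-(π * a * y n ^ 2)) : ℂ) +
      ε * ∫ t, f (y n - √a * t) * (rexp (-(π * t ^ 2)) : ℂ))) (nhdsWithin 0 (Set.Ioi 0))
      (nhds (∑' n, d n * (𝓕 (⇑f) (y n) + ε * f (y n)))) := by
    refine tendsto_tsum_of_dominated_convergence
      (bound := fun n => (D' + 2 ^ N * D * C * I₁) * (‖d n‖ / (1 + y n ^ 2) ^ N))
      (hd.mul_left _) (fun n => ?_) ?_
    · have h1 : Filter.Tendsto (fun a : ℝ => (rexp (-(π * a * y n ^ 2)) : ℂ))
          (nhdsWithin 0 (Set.Ioi 0)) (nhds 1) := by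
        have : Continuous fun a : ℝ => (rexp (-(π * a * y n ^ 2)) : ℂ) := by fun_prop
        simpa using (this.tendsto 0).mono_left nhdsWithin_le_nhds
      have h2 : Filter.Tendsto (fun a : ℝ => ∫ t, f (y n - √a * t) * (rexp (-(π * t ^ 2)) : ℂ))
          (nhdsWithin 0 (Set.Ioi 0)) (nhds (∫ t, f (y n) * (rexp (-(π * t ^ 2)) : ℂ))) := by
        refine tendsto_integral_filter_of_dominated_convergence
          (fun t => 2 ^ N * D * C / (1 + y n ^ 2) ^ N * (1 + t ^ 2)⁻¹)
          (.of_forall fun a => Continuous.aestronglyMeasurable ?_)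
          (hsmall.mono fun a ha => .of_forall (hpt a ha.1 ha.2 (y n)))
          (integrable_inv_one_add_sq.const_mul _) (.of_forall fun t => ?_)
        · have := f.continuous
          fun_prop
        · have : Continuous fun a : ℝ => f (y n - √a * t) * (rexp (-(π * t ^ 2)) : ℂ) := by
            have := f.continuous
            fun_prop
          simpa using (this.tendsto 0).mono_left nhdsWithin_le_nhds
      rw [integral_const_mul, integral_exp_neg_pi_mul_sq, mul_one] at h2
      simpa using ((h1.const_mul (𝓕 (⇑f) (y n))).add (h2.const_mul ε)).const_mul (d n)
    · filter_upwards [hsmall] with a ha n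
      rw [norm_mul]
      have h1 : ‖𝓕 (⇑f) (y n) * (rexp (-(π * a * y n ^ 2)) : ℂ)‖ ≤ D' / (1 + y n ^ 2) ^ N := by
        rw [norm_mul, Complex.norm_real, Real.norm_of_nonneg (Real.exp_pos _).le]
        refine (mul_le_of_le_one_right (norm_nonneg _) (Real.exp_le_one_iff.mpr ?_)).trans
          (hb' _)
        have := ha.1.le
        simp only [Left.neg_nonpos_iff]
        positivity
      have h2 := hint a ha.1 ha.2 (y n)
      have h3 := norm_add_le (𝓕 (⇑f) (y n) * (rexp (-(π * a * y n ^ 2)) : ℂ))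
        (ε * ∫ t, f (y n - √a * t) * (rexp (-(π * t ^ 2)) : ℂ))
      rw [norm_mul ε, norm_eq_one_of_sign hε, one_mul] at h3
      refine (mul_le_mul_of_nonneg_left (h3.trans (add_le_add h1 h2)) (norm_nonneg _)).trans
        (le_of_eq ?_)
      ring
  have hzero := hlim.congr' (hsmall.mono fun a ha => by
    simp_rw [← integral_mul_symCos ε ha.1 f hf]
    exact (hasSum_integral_symCos hε ha.1 hd h f).tsum_eq)
  have hsum : Summable fun n => d n * (𝓕 (⇑f) (y n) + ε * f (y n)) := by
    refine Summable.of_norm_bounded (hd.mul_left (D' + D)) fun n => ?_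
    rw [norm_mul]
    have h3 := norm_add_le (𝓕 (⇑f) (y n)) (ε * f (y n))
    rw [norm_mul ε, norm_eq_one_of_sign hε, one_mul] at h3
    refine (mul_le_mul_of_nonneg_left (h3.trans (add_le_add (hb' _) (hb _)))
      (norm_nonneg _)).trans (le_of_eq ?_)
    ring
  rw [← tendsto_nhds_unique hzero tendsto_const_nhds]
  exact hsum.hasSum

end Density

section Perturbation

/-- The Banach space of absolutely summable complex sequences. -/
abbrev EllOne : Type := lp (fun _ : ℕ => ℂ) 1

lemma EllOne.hasSum_norm (β : EllOne) : HasSum (fun m => ‖β m‖) ‖β‖ := by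
  simpa using lp.hasSum_norm (p := 1) (by simp) β

lemma exists_lift_ellOne {Y : Type*} [NormedAddCommGroup Y] [NormedSpace ℂ Y] [CompleteSpace Y]
    (y : ℕ → Y) {M : ℝ} (hM : 0 ≤ M) (hy : ∀ m, ‖y m‖ ≤ M) :
    ∃ L : EllOne →L[ℂ] Y, ‖L‖ ≤ M ∧ ∀ β : EllOne, HasSum (fun m => β m • y m) (L β) := by
  have hb (β : EllOne) (m : ℕ) : ‖β m • y m‖ ≤ M * ‖β m‖ := by
    rw [norm_smul, mul_comm]
    exact mul_le_mul_of_nonneg_right (hy m) (norm_nonneg _)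
  have hs (β : EllOne) : Summable fun m => β m • y m :=
    Summable.of_norm_bounded (β.hasSum_norm.summable.mul_left M) (hb β)
  refine ⟨LinearMap.mkContinuous
    { toFun := fun β => ∑' m, β m • y m
      map_add' := fun β β' => by
        rw [← (hs β).tsum_add (hs β')]
        simp only [lp.coeFn_add, Pi.add_apply, add_smul]
      map_smul' := fun c β => by
        rw [RingHom.id_apply, ← tsum_const_smul'' c]
        simp only [lp.coeFn_smul, Pi.smul_apply, smul_assoc] } M
    (fun β => tsum_of_norm_bounded (β.hasSum_norm.mul_left M) (hb β)),
    LinearMap.mkContinuous_norm_le _ hM _, fun β => (hs β).hasSum⟩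

/-- Inverting a small perturbation of the identity matrix. -/
lemma exists_inverse_matrix (E : ℕ → ℕ → ℂ)
    (hE : ∀ m, ∀ S : Finset ℕ, ∑ n ∈ S, ‖E m n‖ ≤ 1 / 2) :
    ∃ γ : ℕ → ℕ → ℂ, (∀ n, ∀ S : Finset ℕ, ∑ m ∈ S, ‖γ m n‖ ≤ 2) ∧
      ∀ (v u : ℕ → ℂ) (M : ℝ), (∀ n, ‖v n‖ ≤ M) →
        (∀ m, HasSum (fun n => E m n * v n) (u m - v m)) →
        ∀ n, HasSum (fun m => γ m n * u m) (v n) := by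
  have hmem (m : ℕ) : Memℓp (E m) 1 := memℓp_gen (by
    simpa using summable_of_sum_le (fun n => norm_nonneg _) (hE m))
  set row : ℕ → EllOne := fun m => ⟨E m, hmem m⟩
  have hrow (m : ℕ) : ‖row m‖ ≤ 1 / 2 :=
    hasSum_le_of_sum_le (row m).hasSum_norm (hE m)
  obtain ⟨R, hR, hRs⟩ := exists_lift_ellOne row (by norm_num) hrow
  have hunit : IsUnit (1 - -R) := isUnit_one_sub_of_norm_lt_one (by rw [norm_neg]; linarith)
  obtain ⟨U, hU⟩ := hunit
  set β : ℕ → EllOne := fun n => (↑U⁻¹ : EllOne →L[ℂ] EllOne) (lp.single 1 n 1)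
  have hβ (n : ℕ) : β n + R (β n) = lp.single 1 n 1 := by
    have h1 : (↑U : EllOne →L[ℂ] EllOne) (β n) = lp.single 1 n 1 := by
      rw [← mul_apply_eq_comp, U.mul_inv]
      rfl
    rw [hU] at h1
    simpa using h1
  have hβn (n : ℕ) : ‖β n‖ ≤ 2 := by
    have h1 : ‖(lp.single 1 n 1 : EllOne)‖ = 1 := by
      rw [lp.norm_single (by simp)]
      exact norm_one
    have h2 : β n = lp.single 1 n 1 - R (β n) := by rw [← hβ n]; abel
    have h3 := norm_sub_le (lp.single 1 n 1 : EllOne) (R (β n))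
    rw [← h2, h1] at h3
    have h4 := (R.le_opNorm (β n)).trans (mul_le_mul_of_nonneg_right hR (norm_nonneg _))
    linarith
  refine ⟨fun m n => β n m, fun n S => (sum_le_hasSum S (fun _ _ => norm_nonneg _)
    (β n).hasSum_norm).trans (hβn n), fun v u M hv hu n => ?_⟩
  obtain ⟨V, -, hVs⟩ := exists_lift_ellOne v ((norm_nonneg _).trans (hv 0)) hv
  have hVrow (m : ℕ) : V (row m) = u m - v m := (hVs (row m)).unique (hu m)
  have h1 := (hRs (β n)).mapL V
  simp only [map_smul, hVrow] at h1
  have h2 := (hVs (β n)).add h1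
  rw [← map_add, hβ n] at h2
  have h3 : V (lp.single 1 n 1) = v n := by
    refine (hVs _).unique ?_
    have := hasSum_single (f := fun m => (lp.single 1 n (1 : ℂ) : EllOne) m • v m) n
      (fun m hm => by simp [lp.single_apply, hm])
    simpa [lp.single_apply] using this
  rw [h3] at h2
  refine (congrArg (HasSum · _) (funext fun m => ?_)).mp h2
  simp only [smul_eq_mul]
  ring

end Perturbation

section Expansion

variable {ε : ℂ}

/-- An expansion solving the functional equation of a Gaussian yields an interpolation formula at
the nodes `√n`. -/
lemma hasSum_of_expansion (hε : ε = 1 ∨ ε = -1) {a : ℕ → ℂ} {H : ℂ → ℂ} {x : ℝ} {N : ℕ}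
    (ha : Summable fun n => ‖a n‖ / (n + 1 : ℝ) ^ N)
    (hH : ∀ τ : ℂ, 0 < τ.im → HasSum (fun n : ℕ => a n * expo n τ) (H τ))
    (hfe : ∀ τ : ℂ, 0 < τ.im →
      H τ + ε * slash H τ = expo (x ^ 2) τ + ε * slash (expo (x ^ 2)) τ)
    (f : SchwartzMap ℝ ℂ) (hf : ∀ x, f (-x) = f x) :
    HasSum (fun n : ℕ => a n * (𝓕 (⇑f) (√n) + ε * f (√n))) (𝓕 (⇑f) x + ε * f x) := by
  set d : ℕ → ℂ := fun n => Nat.casesOn n 1 (fun k => -a k)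
  set y : ℕ → ℝ := fun n => Nat.casesOn n x (fun k => √k)
  have hy (n : ℕ) : y (n + 1) ^ 2 = n := Real.sq_sqrt n.cast_nonneg
  have hd : Summable fun n => ‖d n‖ / (1 + y n ^ 2) ^ N := by
    refine (summable_nat_add_iff 1).mp (ha.congr fun n => ?_)
    rw [hy, add_comm (1 : ℝ)]
    simp [d]
  have h (τ : ℂ) (hτ : 0 < τ.im) : HasSum (fun n => d n * symExpo ε (y n ^ 2) τ) 0 := by
    have h1 := ((hH _ (neg_inv_im_pos hτ)).div_const ((-I * τ) ^ (1 / 2 : ℂ))).mul_left ε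
    have h2 := (((hH τ hτ).add h1).div_const 2).neg
    have e1 : H τ + ε * (H (-1 / τ) / (-I * τ) ^ (1 / 2 : ℂ)) =
        expo (x ^ 2) τ + ε * slash (expo (x ^ 2)) τ := hfe τ hτ
    rw [e1] at h2
    have h3 : HasSum (fun n => d (n + 1) * symExpo ε (y (n + 1) ^ 2) τ)
        (-((expo (x ^ 2) τ + ε * slash (expo (x ^ 2)) τ) / 2)) := by
      refine (congrArg (HasSum · _) (funext fun n => ?_)).mp h2
      rw [hy, symExpo, slash]
      simp only [d]
      ring
    have h4 := (hasSum_nat_add_iff (f := fun n => d n * symExpo ε (y n ^ 2) τ) 1).mp h3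
    simpa [d, y, symExpo] using h4
  have key := (hasSum_nat_add_iff' (f := fun n => d n * (𝓕 (⇑f) (y n) + ε * f (y n))) 1).mpr
    (hasSum_schwartz_of_symExpo hε hd h f hf)
  simpa [d, y] using key.neg

lemma hasSum_basisFun (hε : ε = 1 ∨ ε = -1) (f : SchwartzMap ℝ ℂ) (hf : ∀ x, f (-x) = f x)
    (x : ℝ) : HasSum (fun n : ℕ => basisFun ε n x * (𝓕 (⇑f) (√n) + ε * f (√n)))
      (𝓕 (⇑f) x + ε * f x) := by
  obtain ⟨C, hC, hb⟩ := exists_coef_symExpo_bound 0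
  obtain ⟨D, hD, hφ⟩ := exists_dataBound_symExpo 0
  refine hasSum_of_expansion (N := 6) hε ?_
    (fun τ hτ => hasSum_coef_sol hε (hφ ε hε (x ^ 2) (sq_nonneg x)) hτ)
    (fun τ hτ => sol_add_slash_symExpo hε (sq_nonneg x) hτ) f hf
  have hs : Summable fun n : ℕ => C * ((n + 1 : ℝ) ^ 2)⁻¹ := by
    have := ((summable_nat_add_iff 1).mpr (Real.summable_nat_pow_inv.mpr one_lt_two)).mul_left C
    simpa using this
  refine hs.of_nonneg_of_le (fun n => by positivity) fun n => ?_
  rw [div_le_iff₀ (by positivity)]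
  refine (hb ε hε (x ^ 2) (sq_nonneg x) n).trans (le_of_eq ?_)
  field_simp

/-- The off-diagonal part of the matrix comparing perturbed and unperturbed nodes. -/
noncomputable def nodeMatrix (ε : ℂ) (e : ℕ → ℝ) (m n : ℕ) : ℂ :=
  if m = 0 then 0
  else coef (sol ε (pert ε m (e m))) n + if n = m then (cuspRatio ε (e m) - 1 : ℂ) else 0

variable {e : ℕ → ℝ}

lemma summable_coef_pert (hε : ε = 1 ∨ ε = -1) {m : ℕ} (hm : 1 ≤ m) {r : ℝ} (hr : |r| ≤ 1 / 2) :
    Summable fun n => ‖coef (sol ε (pert ε m r)) n‖ / (n + 1 : ℝ) ^ 12 := by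
  obtain ⟨C, -, h⟩ := exists_row_bound (s := 12) (by norm_num)
  exact summable_of_sum_le (fun n => by positivity) (h ε hε m hm r hr)

lemma hasSum_nodeMatrix (hε : ε = 1 ∨ ε = -1) (h0 : e 0 = 0) (he : ∀ k, |e k| ≤ 1 / 2)
    (f : SchwartzMap ℝ ℂ) (hf : ∀ x, f (-x) = f x) (m : ℕ) :
    HasSum (fun n : ℕ => nodeMatrix ε e m n * (𝓕 (⇑f) (√n) + ε * f (√n)))
      (𝓕 (⇑f) (√(m + e m)) + ε * f (√(m + e m)) - (𝓕 (⇑f) (√m) + ε * f (√m))) := by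
  rcases Nat.eq_zero_or_pos m with rfl | hm
  · simp [nodeMatrix, h0, hasSum_zero]
  have hm1 : (1 : ℝ) ≤ m := by exact_mod_cast hm
  have hpos : 0 ≤ m + e m := by linarith [(abs_le.mp (he m)).1]
  obtain ⟨C, hC, hφ⟩ := exists_dataBound_pert 0
  have hdata := hφ ε hε m hm (e m) (he m)
  have hsingle (c : ℂ) (w : ℕ → ℂ) : HasSum (fun n => (if n = m then c else 0) * w n) (c * w m) := by
    have := hasSum_single (f := fun n => (if n = m then c else 0) * w n) m
      (fun n hn => by simp [hn])
    simpa using this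
  have h1 := hasSum_of_expansion (N := 12) (x := √(m + e m)) hε
    (a := fun n => coef (sol ε (pert ε m (e m))) n + if n = m then (cuspRatio ε (e m) : ℂ) else 0)
    (H := fun τ => sol ε (pert ε m (e m)) τ + cuspRatio ε (e m) * expo m τ) ?_ (fun τ hτ => ?_)
    (fun τ hτ => ?_) f hf
  · refine (congrArg (HasSum · _) (funext fun n => ?_)).mp
      (h1.sub (by simpa using hsingle 1 fun n => 𝓕 (⇑f) (√n) + ε * f (√n)))
    rw [nodeMatrix, if_neg hm.ne']
    split_ifs <;> ring
  · refine Summable.of_nonneg_of_le (fun n => by positivity) (fun n => ?_)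
      ((summable_coef_pert hε hm (he m)).add
      (summable_of_ne_finset_zero (s := {m})
        (f := fun n : ℕ => (if n = m then |cuspRatio ε (e m)| else 0) / (n + 1 : ℝ) ^ 12)
        fun n hn => by simp [Finset.notMem_singleton.mp hn]))
    rw [← add_div]
    gcongr
    refine (norm_add_le _ _).trans (add_le_add_right ?_ _)
    split_ifs <;> simp
  · refine (congrArg (HasSum · _) (funext fun n => ?_)).mp
      ((hasSum_coef_sol hε hdata hτ).add (hsingle _ fun n => expo n τ))
    ring
  · have h2 := sol_add_slash hε hdata hτ
    rw [Real.sq_sqrt hpos]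
    simp only [slash, pert] at h2 ⊢
    linear_combination h2

lemma exists_sum_nodeMatrix_le : ∃ δ : ℝ, 0 < δ ∧ ∀ ε : ℂ, (ε = 1 ∨ ε = -1) → ∀ e : ℕ → ℝ,
    (∀ k, |e k| ≤ 1 / 2) → (∀ k : ℕ, |e k| * (1 + (k : ℝ)) ^ ((5 : ℝ) / 4) < δ) →
    ∀ (m : ℕ) (S : Finset ℕ),
      ∑ n ∈ S, ‖nodeMatrix ε e m n * ((m + 1) ^ 12 / (n + 1) ^ 12)‖ ≤ 1 / 2 := by
  obtain ⟨C, hC, hb⟩ := exists_row_bound (s := 12) (by norm_num)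
  refine ⟨1 / (2 * (2 ^ 12 * C + 16)), by positivity, fun ε hε e he hδ m S => ?_⟩
  rcases Nat.eq_zero_or_pos m with rfl | hm
  · simp [nodeMatrix]
  have hm1 : (1 : ℝ) ≤ m := by exact_mod_cast hm
  have hpow : (1 : ℝ) ≤ (1 + m) ^ ((5 : ℝ) / 4) := Real.one_le_rpow (by linarith) (by norm_num)
  have hle (n : ℕ) : ‖nodeMatrix ε e m n * ((m + 1) ^ 12 / (n + 1) ^ 12)‖ ≤
      (m + 1 : ℝ) ^ 12 * (‖coef (sol ε (pert ε m (e m))) n‖ / (n + 1 : ℝ) ^ 12) +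
        if n = m then 16 * |e m| else 0 := by
    have e1 : ‖((m + 1) ^ 12 / (n + 1) ^ 12 : ℂ)‖ = (m + 1 : ℝ) ^ 12 / (n + 1 : ℝ) ^ 12 := by
      rw [norm_div, norm_pow, norm_pow]
      norm_cast
    have h1 := abs_cuspRatio_sub_one_le hε (e m)
    rw [norm_mul, e1, nodeMatrix, if_neg hm.ne']
    split_ifs with hn
    · have h2 := norm_add_le (coef (sol ε (pert ε m (e m))) n) (cuspRatio ε (e m) - 1 : ℂ)
      have e2 : ‖(cuspRatio ε (e m) - 1 : ℂ)‖ = |cuspRatio ε (e m) - 1| := by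
        rw [← Complex.ofReal_one, ← Complex.ofReal_sub, Complex.norm_real, Real.norm_eq_abs]
      rw [e2] at h2
      rw [hn] at h2 ⊢
      rw [div_self (by positivity), mul_one, mul_div_cancel₀ _ (by positivity)]
      linarith
    · rw [add_zero, add_zero]
      exact le_of_eq (by ring)
  refine (Finset.sum_le_sum fun n _ => hle n).trans ?_
  rw [Finset.sum_add_distrib, ← Finset.mul_sum, Finset.sum_ite_eq']
  have h1 : (m + 1 : ℝ) ^ 12 * ∑ n ∈ S, ‖coef (sol ε (pert ε m (e m))) n‖ / (n + 1 : ℝ) ^ 12 ≤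
      2 ^ 12 * C * (|e m| * (1 + m) ^ ((5 : ℝ) / 4)) := by
    calc _ ≤ (2 * m : ℝ) ^ 12 * (C * |e m| * ((m : ℝ) ^ (5 / 4 : ℝ) / (m : ℝ) ^ 12)) := by
          gcongr
          · linarith
          · exact hb ε hε m hm (e m) (he m) S
      _ = 2 ^ 12 * C * (|e m| * (m : ℝ) ^ ((5 : ℝ) / 4)) := by
          rw [mul_pow]
          field_simp
      _ ≤ _ := by
          gcongr
          linarith
  have h2 : (if m ∈ S then 16 * |e m| else 0) ≤ 16 * (|e m| * (1 + m) ^ ((5 : ℝ) / 4)) := by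
    split_ifs
    · gcongr
      exact le_mul_of_one_le_right (abs_nonneg _) hpow
    · positivity
  have h3 := mul_le_mul_of_nonneg_left (hδ m).le (by positivity : 0 ≤ 2 ^ 12 * C + 16)
  have h4 : (2 ^ 12 * C + 16) * (1 / (2 * (2 ^ 12 * C + 16))) = 1 / 2 := by field_simp
  rw [h4] at h3
  linarith

end Expansion

section Dual

lemma hasSum_fourier {F : ℕ → ℝ → ℂ} {w : ℕ → ℝ} (hw : Summable w) (hF : ∀ n, Continuous (F n))
    (hb : ∀ n x, ‖F n x‖ ≤ w n / (1 + x ^ 2)) (ξ : ℝ) :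
    HasSum (fun n => 𝓕 (F n) ξ) (𝓕 (fun x => ∑' n, F n x) ξ) := by
  simp only [fourier_real_eq_integral_exp_smul, smul_eq_mul]
  refine hasSum_integral_of_dominated_convergence (fun n x => w n / (1 + x ^ 2))
    (fun n => (by fun_prop : Continuous _).aestronglyMeasurable)
    (fun n => .of_forall fun x => ?_) (.of_forall fun x => hw.div_const _) ?_
    (.of_forall fun x => ?_)
  · rw [norm_mul, Complex.norm_exp_ofReal_mul_I, one_mul]
    exact hb n x
  · simp only [div_eq_mul_inv, tsum_mul_right]
    exact integrable_inv_one_add_sq.const_mul _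
  · exact (Summable.of_norm_bounded (hw.div_const _) fun n => hb n x).hasSum.mul_left _

lemma summable_inv_succ_cube : Summable fun n : ℕ => ((n + 1 : ℝ) ^ 3)⁻¹ := by
  simpa using (summable_nat_add_iff 1).mpr (Real.summable_nat_pow_inv.mpr (by norm_num : 1 < 3))

/-- The interpolation functions at the perturbed nodes attached to an inverse matrix `γ`. -/
noncomputable def dualFun (ε : ℂ) (γ : ℕ → ℕ → ℂ) (j : ℕ) (x : ℝ) : ℂ :=
  ∑' n : ℕ, γ j n * ((j + 1) ^ 12 / (n + 1) ^ 12) * basisFun ε n x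

variable {ε : ℂ} {γ : ℕ → ℕ → ℂ}

lemma norm_succ_pow (n : ℕ) : ‖(n + 1 : ℂ) ^ 12‖ = (n + 1 : ℝ) ^ 12 := by
  rw [norm_pow]
  norm_cast

lemma exists_norm_dualFun_term_le : ∃ C : ℝ, 0 < C ∧ ∀ ε : ℂ, (ε = 1 ∨ ε = -1) →
    ∀ (γ : ℕ → ℕ → ℂ) (j n : ℕ) (x : ℝ),
      ‖γ j n * ((j + 1) ^ 12 / (n + 1) ^ 12) * basisFun ε n x‖ ≤
        ‖γ j n‖ * (C * (j + 1 : ℝ) ^ 12 * ((n + 1 : ℝ) ^ 3)⁻¹) / (1 + x ^ 2) ^ 5 := by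
  obtain ⟨C, hC, hb⟩ := exists_coef_symExpo_bound 5
  refine ⟨C, hC, fun ε hε γ j n x => ?_⟩
  rw [norm_mul, norm_mul, norm_div, norm_succ_pow, norm_succ_pow]
  calc _ ≤ ‖γ j n‖ * ((j + 1 : ℝ) ^ 12 / (n + 1 : ℝ) ^ 12) *
        (C * (n + 1 : ℝ) ^ (5 + 4) / (1 + x ^ 2) ^ 5) := by
        gcongr
        exact hb ε hε (x ^ 2) (sq_nonneg x) n
    _ = _ := by
        field_simp

lemma exists_dualFun_bounds : ∃ w : ℕ → ℝ, Summable w ∧ ∀ ε : ℂ, (ε = 1 ∨ ε = -1) →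
    ∀ γ : ℕ → ℕ → ℂ, (∀ m n, ‖γ m n‖ ≤ 2) → ∀ (j n : ℕ) (x : ℝ),
      ‖γ j n * ((j + 1) ^ 12 / (n + 1) ^ 12) * basisFun ε n x‖ ≤
        w n * (j + 1 : ℝ) ^ 12 / (1 + x ^ 2) ^ 5 := by
  obtain ⟨C, hC, hb⟩ := exists_norm_dualFun_term_le
  refine ⟨fun n => 2 * C * ((n + 1 : ℝ) ^ 3)⁻¹, summable_inv_succ_cube.mul_left _,
    fun ε hε γ hγ j n x => (hb ε hε γ j n x).trans ?_⟩
  rw [show 2 * C * ((n + 1 : ℝ) ^ 3)⁻¹ * (j + 1 : ℝ) ^ 12 =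
    2 * (C * (j + 1 : ℝ) ^ 12 * ((n + 1 : ℝ) ^ 3)⁻¹) by ring]
  gcongr
  exact hγ j n

lemma div_one_add_sq_pow_le {c : ℝ} (hc : 0 ≤ c) (x : ℝ) :
    c / (1 + x ^ 2) ^ 5 ≤ c / (1 + x ^ 2) := by
  gcongr
  exact le_self_pow₀ (by nlinarith [sq_nonneg x]) (by norm_num)

lemma exists_dualFun_properties : ∃ C : ℝ, 0 < C ∧ ∀ ε : ℂ, (ε = 1 ∨ ε = -1) →
    ∀ γ : ℕ → ℕ → ℂ, (∀ m n, ‖γ m n‖ ≤ 2) → ∀ j,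
      Continuous (dualFun ε γ j) ∧
      (∀ x, ‖dualFun ε γ j x‖ ≤ C * (j + 1 : ℝ) ^ 12 / (1 + x ^ 2) ^ 5) ∧
      (∀ x, 𝓕 (dualFun ε γ j) x = ε * dualFun ε γ j x) ∧
      ∀ x, HasSum (fun n : ℕ => γ j n * ((j + 1) ^ 12 / (n + 1) ^ 12) * basisFun ε n x)
        (dualFun ε γ j x) := by
  obtain ⟨w, hw, hb⟩ := exists_dualFun_bounds
  refine ⟨|∑' n, w n| + 1, by positivity, fun ε hε γ hγ j => ?_⟩
  have hbj := hb ε hε γ hγ j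
  have hw0 (n : ℕ) : 0 ≤ w n * (j + 1 : ℝ) ^ 12 := by
    simpa using (norm_nonneg _).trans (hbj n 0)
  have hwj (x : ℝ) : Summable fun n => w n * (j + 1 : ℝ) ^ 12 / (1 + x ^ 2) ^ 5 :=
    (hw.mul_right _).div_const _
  have hsum (x : ℝ) := (Summable.of_norm_bounded (hwj x) fun n => hbj n x).hasSum
  refine ⟨continuous_tsum (fun n => continuous_const.mul (continuous_basisFun hε n))
    (hw.mul_right ((j + 1 : ℝ) ^ 12)) fun n x => (hbj n x).trans ?_, fun x => ?_, fun x => ?_, hsum⟩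
  · exact div_le_self (hw0 n) (one_le_pow₀ (by nlinarith [sq_nonneg x]))
  · refine (tsum_of_norm_bounded (hwj x).hasSum fun n => hbj n x).trans ?_
    rw [tsum_div_const, tsum_mul_right]
    gcongr
    linarith [le_abs_self (∑' n, w n)]
  · have h := hasSum_fourier (F := fun n x => γ j n * ((j + 1) ^ 12 / (n + 1) ^ 12) * basisFun ε n x)
      (hw.mul_right ((j + 1 : ℝ) ^ 12))
      (fun n => continuous_const.mul (continuous_basisFun hε n))
      (fun n x => (hbj n x).trans (div_one_add_sq_pow_le (hw0 n) x)) x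
    refine h.unique ?_
    refine (congrArg (HasSum · _) (funext fun n => ?_)).mp ((hsum x).mul_left ε)
    rw [fourier_const_mul_apply, fourier_basisFun hε]
    ring

lemma exists_norm_node_le (hε : ε = 1 ∨ ε = -1) (f : SchwartzMap ℝ ℂ) :
    ∃ M : ℝ, 0 < M ∧ ∀ (m : ℕ) (r : ℝ), |r| ≤ 1 / 2 → 0 ≤ m + r →
      ‖(m + 1 : ℂ) ^ 12 * (𝓕 (⇑f) (√(m + r)) + ε * f (√(m + r)))‖ ≤ M := by
  obtain ⟨A, hA, hfA⟩ := exists_norm_schwartz_le f 12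
  obtain ⟨B, hB, hfB⟩ := exists_norm_schwartz_le (𝓕 f) 12
  refine ⟨2 ^ 12 * (B + A), by positivity, fun m r hr h0 => ?_⟩
  have h1 : (m + 1 : ℝ) ≤ 2 * (1 + √(m + r) ^ 2) := by
    rw [Real.sq_sqrt h0]
    have := (abs_le.mp hr).1
    linarith [(m.cast_nonneg : (0 : ℝ) ≤ m)]
  have h2 : ‖𝓕 (⇑f) (√(m + r)) + ε * f (√(m + r))‖ ≤ (B + A) / (1 + √(m + r) ^ 2) ^ 12 := by
    refine (norm_add_le _ _).trans ?_
    rw [norm_mul, norm_eq_one_of_sign hε, one_mul, add_div]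
    gcongr
    · simpa only [SchwartzMap.fourier_coe] using hfB (√(m + r))
    · exact hfA _
  rw [norm_mul, norm_succ_pow]
  calc _ ≤ (2 * (1 + √(m + r) ^ 2)) ^ 12 * ((B + A) / (1 + √(m + r) ^ 2) ^ 12) := by gcongr
    _ = _ := by
        rw [mul_pow]
        field_simp

lemma hasSum_dualFun (hε : ε = 1 ∨ ε = -1) (hγ : ∀ n S, ∑ m ∈ S, ‖γ m n‖ ≤ 2)
    {f : SchwartzMap ℝ ℂ} (hf : ∀ x, f (-x) = f x) {u : ℕ → ℂ} {M : ℝ}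
    (hu : ∀ m : ℕ, ‖(m + 1 : ℂ) ^ 12 * u m‖ ≤ M)
    (huv : ∀ n : ℕ, HasSum (fun m : ℕ => γ m n * ((m + 1) ^ 12 * u m))
      ((n + 1) ^ 12 * (𝓕 (⇑f) (√n) + ε * f (√n)))) (x : ℝ) :
    HasSum (fun j => dualFun ε γ j x * u j) (𝓕 (⇑f) x + ε * f x) := by
  obtain ⟨C, hC, hb⟩ := exists_norm_dualFun_term_le
  obtain ⟨D, -, hdual⟩ := exists_dualFun_properties
  have hM : 0 ≤ M := (norm_nonneg _).trans (hu 0)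
  set T : ℕ × ℕ → ℂ := fun p =>
    γ p.2 p.1 * ((p.2 + 1) ^ 12 / (p.1 + 1) ^ 12) * basisFun ε p.1 x * u p.2
  have hT (n j : ℕ) : ‖T (n, j)‖ ≤ ‖γ j n‖ * (C * M * ((n + 1 : ℝ) ^ 3)⁻¹) := by
    have h1 := hb ε hε γ j n x
    have h2 := hu j
    rw [norm_mul, norm_succ_pow] at h2
    calc ‖T (n, j)‖ ≤ ‖γ j n‖ * (C * (j + 1 : ℝ) ^ 12 * ((n + 1 : ℝ) ^ 3)⁻¹) * ‖u j‖ := by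
          rw [norm_mul]
          gcongr
          exact h1.trans (div_le_self (by positivity) (one_le_pow₀ (by nlinarith [sq_nonneg x])))
      _ = ‖γ j n‖ * (C * ((j + 1 : ℝ) ^ 12 * ‖u j‖) * ((n + 1 : ℝ) ^ 3)⁻¹) := by ring
      _ ≤ _ := by gcongr
  have hγs (n : ℕ) : Summable fun j => ‖γ j n‖ :=
    summable_of_sum_le (fun _ => norm_nonneg _) (hγ n)
  have hTs (n : ℕ) : Summable fun j => ‖T (n, j)‖ :=
    ((hγs n).mul_right _).of_nonneg_of_le (fun _ => norm_nonneg _) (hT n)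
  have hsum : Summable T := by
    refine Summable.of_norm ((summable_prod_of_nonneg fun _ => norm_nonneg _).mpr ⟨hTs, ?_⟩)
    refine Summable.of_nonneg_of_le (fun n => tsum_nonneg fun _ => norm_nonneg _) (fun n => ?_)
      (summable_inv_succ_cube.mul_left (2 * (C * M)))
    calc ∑' j, ‖T (n, j)‖ ≤ ∑' j, ‖γ j n‖ * (C * M * ((n + 1 : ℝ) ^ 3)⁻¹) :=
          (hTs n).tsum_le_tsum (hT n) ((hγs n).mul_right _)
      _ ≤ 2 * (C * M * ((n + 1 : ℝ) ^ 3)⁻¹) := by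
          rw [tsum_mul_right]
          gcongr
          exact (hγs n).tsum_le_of_sum_le (hγ n)
      _ = _ := by ring
  have h1 := hsum.hasSum.prod_fiberwise (g := fun n : ℕ =>
    basisFun ε n x * (𝓕 (⇑f) (√n) + ε * f (√n))) fun n => by
      have hn : (n + 1 : ℂ) ≠ 0 := n.cast_add_one_ne_zero
      have := (huv n).mul_left (basisFun ε n x / (n + 1) ^ 12)
      have e : basisFun ε n x / (n + 1) ^ 12 * ((n + 1) ^ 12 * (𝓕 (⇑f) (√n) + ε * f (√n))) =
          basisFun ε n x * (𝓕 (⇑f) (√n) + ε * f (√n)) := by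
        field_simp
      rw [e] at this
      refine (congrArg (HasSum · _) (funext fun j => ?_)).mp this
      simp only [T]
      ring
  have h2 := hsum.hasSum
  rw [h1.unique (hasSum_basisFun hε f hf x), ← (Equiv.prodComm ℕ ℕ).hasSum_iff] at h2
  refine h2.prod_fiberwise fun j => ?_
  have hγ2 (m n : ℕ) : ‖γ m n‖ ≤ 2 := by simpa using hγ n {m}
  exact ((hdual ε hε γ hγ2 j).2.2.2 x).mul_right (u j)

theorem exists_interpolation : ∃ δ C : ℝ, 0 < δ ∧ 0 < C ∧ ∀ ε : ℂ, (ε = 1 ∨ ε = -1) →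
    ∀ e : ℕ → ℝ, e 0 = 0 → (∀ k, |e k| ≤ 1 / 2) →
    (∀ k : ℕ, |e k| * (1 + (k : ℝ)) ^ ((5 : ℝ) / 4) < δ) →
    ∃ β : ℕ → ℝ → ℂ, (∀ j, Continuous (β j)) ∧
      (∀ j x, ‖β j x‖ ≤ C * (j + 1 : ℝ) ^ 12 / (1 + x ^ 2) ^ 5) ∧
      (∀ j x, 𝓕 (β j) x = ε * β j x) ∧
      ∀ f : SchwartzMap ℝ ℂ, (∀ x, f (-x) = f x) → ∀ x,
        HasSum (fun j => β j x * (𝓕 (⇑f) (√(j + e j)) + ε * f (√(j + e j))))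
          (𝓕 (⇑f) x + ε * f x) := by
  obtain ⟨δ, hδ, hE⟩ := exists_sum_nodeMatrix_le
  obtain ⟨C, hC, hdual⟩ := exists_dualFun_properties
  refine ⟨δ, C, hδ, hC, fun ε hε e h0 he hs => ?_⟩
  obtain ⟨γ, hγ, hinv⟩ := exists_inverse_matrix
    (fun m n => nodeMatrix ε e m n * ((m + 1) ^ 12 / (n + 1) ^ 12)) (hE ε hε e he hs)
  have hd := hdual ε hε γ fun m n => by simpa using hγ n {m}
  refine ⟨dualFun ε γ, fun j => (hd j).1, fun j => (hd j).2.1, fun j => (hd j).2.2.1,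
    fun f hf x => ?_⟩
  obtain ⟨M, -, hM⟩ := exists_norm_node_le hε f
  have hpos (m : ℕ) : 0 ≤ m + e m := by
    rcases Nat.eq_zero_or_pos m with rfl | hm
    · simp [h0]
    · have : (1 : ℝ) ≤ m := by exact_mod_cast hm
      linarith [(abs_le.mp (he m)).1]
  refine hasSum_dualFun hε hγ hf (fun m => hM m (e m) (he m) (hpos m))
    (hinv (fun n => (n + 1) ^ 12 * (𝓕 (⇑f) (√n) + ε * f (√n)))
      (fun m => (m + 1) ^ 12 * (𝓕 (⇑f) (√(m + e m)) + ε * f (√(m + e m)))) M (fun n => ?_)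
      fun m => ?_) x
  · simpa using hM n 0 (by norm_num) (by simp)
  · have h := (hasSum_nodeMatrix hε h0 he f hf m).mul_left ((m + 1 : ℂ) ^ 12)
    rw [mul_sub] at h
    refine (congrArg (HasSum · _) (funext fun n => ?_)).mp h
    have hn : (n + 1 : ℂ) ≠ 0 := n.cast_add_one_ne_zero
    field_simp

end Dual

section RealParts

variable {g h : ℝ → ℂ}

lemma conj_fourier_apply (g : ℝ → ℂ) (x : ℝ) :
    (starRingEnd ℂ) (𝓕 g x) = 𝓕 (fun t => (starRingEnd ℂ) (g t)) (-x) := by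
  rw [fourier_real_eq_integral_exp_smul, fourier_real_eq_integral_exp_smul, ← integral_conj]
  refine integral_congr_ae (.of_forall fun t => ?_)
  simp only [smul_eq_mul, map_mul, ← Complex.exp_conj, Complex.conj_ofReal, Complex.conj_I]
  congr 2
  push_cast
  ring

lemma im_fourier_eq_zero {f : SchwartzMap ℝ ℂ} (hf : ∀ x, f (-x) = f x) (him : ∀ x, (f x).im = 0)
    (x : ℝ) : (𝓕 (⇑f) x).im = 0 := by
  have hc (t : ℝ) : (starRingEnd ℂ) (f t) = f t := Complex.conj_eq_iff_im.mpr (him t)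
  rw [← Complex.conj_eq_iff_im, ← integral_mul_cos f hf, ← integral_conj]
  refine integral_congr_ae (.of_forall fun t => ?_)
  simp only [map_mul, hc, ← Complex.cos_conj, Complex.conj_ofReal, map_ofNat]

lemma integrable_of_norm_le {D : ℝ} (hg : Continuous g)
    (hb : ∀ x, ‖g x‖ ≤ D / (1 + x ^ 2) ^ 5) : Integrable g := by
  have hD : 0 ≤ D := by simpa using (norm_nonneg _).trans (hb 0)
  refine (integrable_inv_one_add_sq.const_mul D).mono' hg.aestronglyMeasurable
    (.of_forall fun x => (hb x).trans ?_)
  simpa only [div_eq_mul_inv] using div_one_add_sq_pow_le hD x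

lemma fourier_re_apply (hg : Integrable g) (x : ℝ) :
    𝓕 (fun t => ((g t).re : ℂ)) x = (𝓕 g x + (starRingEnd ℂ) (𝓕 g (-x))) / 2 := by
  have hc : Integrable fun t => (starRingEnd ℂ) (g t) :=
    Complex.conjLIE.integrable_comp_iff.mpr hg
  have e : (fun t => ((g t).re : ℂ)) =
      fun t => (1 / 2 : ℂ) * (g t + 1 * (starRingEnd ℂ) (g t)) := by
    funext t
    rw [Complex.re_eq_add_conj]
    ring
  rw [e, fourier_const_mul_apply, fourier_add_mul_apply hg hc, conj_fourier_apply, neg_neg]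
  ring

lemma norm_fourier_re_le {D : ℝ} (hg : Integrable g)
    (hb : ∀ x, ‖𝓕 g x‖ ≤ D / (1 + x ^ 2) ^ 5) (x : ℝ) :
    ‖𝓕 (fun t => ((g t).re : ℂ)) x‖ ≤ D / (1 + x ^ 2) ^ 5 := by
  have h1 := hb x
  have h2 := hb (-x)
  rw [neg_sq] at h2
  have h3 := norm_add_le (𝓕 g x) ((starRingEnd ℂ) (𝓕 g (-x)))
  rw [RCLike.norm_conj] at h3
  rw [fourier_re_apply hg, norm_div, Complex.norm_ofNat]
  linarith

lemma div_one_add_sq_pow_le_rpow {D : ℝ} (hD : 0 ≤ D) (x : ℝ) :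
    D / (1 + x ^ 2) ^ 5 ≤ 2 ^ 5 * D * (1 + |x|) ^ (-(10 : ℝ)) := by
  have h : (1 + |x|) ^ 2 ≤ 2 * (1 + x ^ 2) := by
    rw [← sq_abs x]
    nlinarith [sq_nonneg (1 - |x|)]
  rw [Real.rpow_neg (by positivity), ← div_eq_mul_inv,
    div_le_div_iff₀ (by positivity) (by positivity)]
  calc D * (1 + |x|) ^ (10 : ℝ) = D * ((1 + |x|) ^ 2) ^ 5 := by
        rw [← pow_mul]
        norm_cast
    _ ≤ D * (2 * (1 + x ^ 2)) ^ 5 := by gcongr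
    _ = _ := by rw [mul_pow]; ring

end RealParts

end PerturbedInterpolation

open PerturbedInterpolation

theorem stmt3 :
    ∃ δ : ℝ, 0 < δ ∧
      ∀ ε : ℕ → ℝ, ε 0 = 0 → (∀ k : ℕ, ε k ∈ Set.Ioo (-(1/2) : ℝ) (1/2)) →
        (∀ k : ℕ, |ε k| * (1 + (k : ℝ)) ^ ((5 : ℝ)/4) < δ) →
        ∃ θ η : ℕ → ℝ → ℝ,
          (∀ j : ℕ, Continuous (θ j) ∧ Continuous (η j)) ∧
          (∃ C C' : ℝ, 0 < C ∧ 0 < C' ∧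
            ∀ j : ℕ, ∀ x : ℝ,
              |θ j x| + |η j x| + ‖𝓕 (fun t : ℝ => (θ j t : ℂ)) x‖ +
                  ‖𝓕 (fun t : ℝ => (η j t : ℂ)) x‖ ≤
                C' * (1 + (j : ℝ)) ^ C * (1 + |x|) ^ (-(10 : ℝ))) ∧
          ∀ f : SchwartzMap ℝ ℂ, (∀ x : ℝ, f (-x) = f x) → (∀ x : ℝ, (f x).im = 0) →
            ∀ x : ℝ,
              Summable (fun j : ℕ =>
                ‖f (Real.sqrt ((j : ℝ) + ε j)) * (θ j x : ℂ) +
                  𝓕 (⇑f) (Real.sqrt ((j : ℝ) + ε j)) * (η j x : ℂ)‖) ∧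
              HasSum (fun j : ℕ =>
                f (Real.sqrt ((j : ℝ) + ε j)) * (θ j x : ℂ) +
                  𝓕 (⇑f) (Real.sqrt ((j : ℝ) + ε j)) * (η j x : ℂ)) (f x) := by
  obtain ⟨δ, D, hδ, hD, key⟩ := exists_interpolation
  refine ⟨δ, hδ, fun e h0 he hs => ?_⟩
  have he' (k : ℕ) : |e k| ≤ 1 / 2 := abs_le.mpr ⟨(he k).1.le, (he k).2.le⟩
  obtain ⟨β, hβc, hβb, hβF, hβ⟩ := key 1 (.inl rfl) e h0 he' hs
  obtain ⟨κ, hκc, hκb, hκF, hκ⟩ := key (-1) (.inr rfl) e h0 he' hs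
  set p : ℕ → ℝ → ℂ := fun j x => 1 / 2 * (β j x + 1 * κ j x) with hp
  set q : ℕ → ℝ → ℂ := fun j x => 1 / 2 * (β j x + (-1) * κ j x) with hq
  have hpc (j : ℕ) : Continuous (p j) := by
    have := hβc j
    have := hκc j
    fun_prop
  have hqc (j : ℕ) : Continuous (q j) := by
    have := hβc j
    have := hκc j
    fun_prop
  have hβi (j : ℕ) := integrable_of_norm_le (hβc j) (hβb j)
  have hκi (j : ℕ) := integrable_of_norm_le (hκc j) (hκb j)
  have hpF (j : ℕ) (x : ℝ) : 𝓕 (p j) x = q j x := by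
    simp only [hp, hq]
    rw [fourier_const_mul_apply, fourier_add_mul_apply (hβi j) (hκi j), hβF, hκF]
    ring
  have hqF (j : ℕ) (x : ℝ) : 𝓕 (q j) x = p j x := by
    simp only [hp, hq]
    rw [fourier_const_mul_apply, fourier_add_mul_apply (hβi j) (hκi j), hβF, hκF]
    ring
  have hbound (c : ℂ) (hc : ‖c‖ = 1) (j : ℕ) (x : ℝ) :
      ‖1 / 2 * (β j x + c * κ j x)‖ ≤ D * (j + 1 : ℝ) ^ 12 / (1 + x ^ 2) ^ 5 := by
    have h1 := norm_add_le (β j x) (c * κ j x)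
    rw [norm_mul, hc] at h1
    rw [norm_mul, norm_div, norm_one, Complex.norm_ofNat]
    linarith [hβb j x, hκb j x]
  have hpb (j : ℕ) := hbound 1 (by simp) j
  have hqb (j : ℕ) := hbound (-1) (by simp) j
  refine ⟨fun j x => (p j x).re, fun j x => (q j x).re,
    fun j => ⟨Complex.continuous_re.comp (hpc j), Complex.continuous_re.comp (hqc j)⟩,
    ⟨12, 4 * (2 ^ 5 * D), by norm_num, by positivity, fun j x => ?_⟩, fun f hf him x => ?_⟩
  · have h1 := (Complex.abs_re_le_norm _).trans (hpb j x)
    have h2 := (Complex.abs_re_le_norm _).trans (hqb j x)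
    have h3 := norm_fourier_re_le (integrable_of_norm_le (hpc j) (hpb j))
      (fun y => by rw [hpF]; exact hqb j y) x
    have h4 := norm_fourier_re_le (integrable_of_norm_le (hqc j) (hqb j))
      (fun y => by rw [hqF]; exact hpb j y) x
    have h5 := div_one_add_sq_pow_le_rpow (by positivity : 0 ≤ D * (j + 1 : ℝ) ^ 12) x
    have h6 : (1 + (j : ℝ)) ^ (12 : ℝ) = (j + 1 : ℝ) ^ 12 := by
      rw [add_comm]
      norm_cast
    rw [h6]
    calc _ ≤ 4 * (D * (j + 1 : ℝ) ^ 12 / (1 + x ^ 2) ^ 5) := by linarith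
      _ ≤ 4 * (2 ^ 5 * (D * (j + 1 : ℝ) ^ 12) * (1 + |x|) ^ (-(10 : ℝ))) := by gcongr
      _ = _ := by ring
  · have hre {z : ℂ} (hz : z.im = 0) : z = z.re := Complex.ext rfl (by simpa using hz)
    have h1 := ((hβ f hf x).sub (hκ f hf x)).mul_left (1 / 2)
    have h2 := Complex.hasSum_ofReal.mpr (Complex.hasSum_re h1)
    have h3 : HasSum (fun j : ℕ => f (√(j + e j)) * ((p j x).re : ℂ) +
        𝓕 (⇑f) (√(j + e j)) * ((q j x).re : ℂ)) (f x) := by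
      have e1 : ((1 / 2 * (𝓕 (⇑f) x + 1 * f x - (𝓕 (⇑f) x + -1 * f x))).re : ℂ) = f x := by
        rw [show 1 / 2 * (𝓕 (⇑f) x + 1 * f x - (𝓕 (⇑f) x + -1 * f x)) = f x by ring]
        exact (hre (him x)).symm
      rw [e1] at h2
      refine (congrArg (HasSum · _) (funext fun j => ?_)).mp h2
      rw [hre (him √(j + e j)), hre (im_fourier_eq_zero hf him √(j + e j)), ← Complex.ofReal_mul,
        ← Complex.ofReal_mul, ← Complex.ofReal_add, ← Complex.re_ofReal_mul,
        ← Complex.re_ofReal_mul, ← Complex.add_re]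
      congr 2
      simp only [hp, hq]
      ring
    exact ⟨h3.summable.norm, h3⟩
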